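/- Let (A◊, φ◊, a◊₃) be a data set on H obeying KW (i)–(iii) with ∫_H (1+t²)|𝔛◊|² < ∞, let T ∈ (0, ∞], and let s ↦ g|_s, s ∈ [0, T), be a flow for (A◊, φ◊, a◊₃). Then the family extends to a smooth family on the closed interval [0, T] (when T = ∞ this means: the reparametrized family r ↦ g|_{−ln(1−r)}, r ∈ [0,1), extends to a smooth family of maps H → SL(2,ℂ) on [0,1]). Moreover, there exists κ > 1 such that for all s ∈ [0, T] and all (t,z) ∈ H, |g|_s(t,z)| < κ and |∇_{A◊}g|_s(t,z)| < κ/(μ_{(t,z)}^κ · t); and for every ε > 0 there exists κ_ε > 1 such that at every point (t,z) ∈ H with t < 1/κ_ε or t > κ_ε or t/|z| < 1/κ_ε one has |g|_s(t,z) − 𝕀| < ε and |∇_{A◊}g|_s(t,z)| < ε/(μ_{(t,z)}^κ · t) for all s ∈ [0, T]. -/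

import Mathlib

open MeasureTheory Matrix Filter Set
open scoped ENNReal NNReal Topology

noncomputable section

attribute [local instance] Matrix.normedAddCommGroup Matrix.normedSpace

/-- Points of `(0,∞) × ℝ²` live in `ℝ × ℝ × ℝ` with coordinates `(t, z₁, z₂)`. -/
abbrev P3 := ℝ × ℝ × ℝ

/-- 2×2 complex matrices. -/
abbrev M2 := Matrix (Fin 2) (Fin 2) ℂ

/-- The open half-space `H = (0,∞) × ℝ²`. -/
def Hsp : Set P3 := {p | 0 < p.1}

/-- The half-space minus the locus `z = 0`. -/
def Hstar : Set P3 := {p | 0 < p.1 ∧ p.2 ≠ 0}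

/-- The coordinate directions. -/
def et : P3 := (1, 0, 0)
def ez1 : P3 := (0, 1, 0)
def ez2 : P3 := (0, 0, 1)

/-- Commutator of matrices. -/
def mcomm (X Y : M2) : M2 := X * Y - Y * X

/-- `η* = -η†`, minus the conjugate transpose. -/
def mstar (X : M2) : M2 := -Xᴴ

/-- The norm `|M| = ((1/2) trace (M M†))^{1/2}`. -/
noncomputable def mnorm (X : M2) : ℝ := Real.sqrt ((Matrix.trace (X * Xᴴ)).re / 2)

/-- `⟨στ⟩ = -(1/2) trace (στ)`. -/
noncomputable def minner (X Y : M2) : ℂ := -(2:ℂ)⁻¹ * Matrix.trace (X * Y)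

/-- The real inner product of su(2)-valued matrices. -/
noncomputable def ipR (X Y : M2) : ℝ := (minner X Y).re

/-- Membership in su(2): traceless and anti-Hermitian. -/
def IsSU2 (X : M2) : Prop := Matrix.trace X = 0 ∧ Xᴴ = -X

/-- `|z|` for a point of the half-space. -/
noncomputable def znorm (p : P3) : ℝ := Real.sqrt (p.2.1^2 + p.2.2^2)

/-- `z = z₁ + i z₂` as a complex number. -/
noncomputable def zc (p : P3) : ℂ := (p.2.1 : ℂ) + Complex.I * (p.2.2 : ℂ)

/-- Euclidean distance on `ℝ³`. -/
noncomputable def dist3 (p q : P3) : ℝ :=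
  Real.sqrt ((p.1 - q.1)^2 + (p.2.1 - q.2.1)^2 + (p.2.2 - q.2.2)^2)

/-- Directional derivative of a matrix-valued function. -/
noncomputable def pd (v : P3) (f : P3 → M2) (p : P3) : M2 := fderiv ℝ f p v

/-- Directional derivative of a real-valued function. -/
noncomputable def pdR (v : P3) (f : P3 → ℝ) (p : P3) : ℝ := fderiv ℝ f p v

/-- The flat Laplacian `∂_t² + ∂_{z₁}² + ∂_{z₂}²` on real functions. -/
noncomputable def lap3 (f : P3 → ℝ) (p : P3) : ℝ :=
  pdR et (fun q => pdR et f q) p + pdR ez1 (fun q => pdR ez1 f q) p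
    + pdR ez2 (fun q => pdR ez2 f q) p

/-- Covariant derivative `∇_A f = ∂_v f + [A, f]` in direction `v`. -/
noncomputable def cd (A : P3 → M2) (v : P3) (f : P3 → M2) : P3 → M2 :=
  fun p => pd v f p + mcomm (A p) (f p)

/-- `a₁ = (1/2)(φ + φ*)`. -/
noncomputable def a1Of (phi : P3 → M2) (p : P3) : M2 := (2:ℂ)⁻¹ • (phi p + mstar (phi p))

/-- `a₂ = (i/2)(φ - φ*)`. -/
noncomputable def a2Of (phi : P3 → M2) (p : P3) : M2 :=
  (Complex.I * (2:ℂ)⁻¹) • (phi p - mstar (phi p))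

/-- Curvature component `E_{A_1} = ∂_t A₁ - ∂_{z₁} A_t + [A_t, A₁]`. -/
noncomputable def EA1Of (At A1 : P3 → M2) (p : P3) : M2 :=
  pd et A1 p - pd ez1 At p + mcomm (At p) (A1 p)

/-- Curvature component `E_{A_2} = ∂_t A₂ - ∂_{z₂} A_t + [A_t, A₂]`. -/
noncomputable def EA2Of (At A2 : P3 → M2) (p : P3) : M2 :=
  pd et A2 p - pd ez2 At p + mcomm (At p) (A2 p)

/-- Curvature component `B_{A_3} = ∂_{z₁} A₂ - ∂_{z₂} A₁ + [A₁, A₂]`. -/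
noncomputable def B3Of (A1 A2 : P3 → M2) (p : P3) : M2 :=
  pd ez1 A2 p - pd ez2 A1 p + mcomm (A1 p) (A2 p)

/-- `𝔛 = ∇_{A_t} a₃ - B_{A_3} - (i/2)[φ, φ*]`. -/
noncomputable def XOf (At A1 A2 a3 phi : P3 → M2) (p : P3) : M2 :=
  cd At et a3 p - B3Of A1 A2 p - (Complex.I * (2:ℂ)⁻¹) • mcomm (phi p) (mstar (phi p))

/-- The Kapustin-Witten equations (i), (ii), (iii) at a point. -/
def KW123At (At A1 A2 a3 phi : P3 → M2) (p : P3) : Prop :=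
  EA1Of At A1 p = cd A2 ez2 a3 p ∧
  EA2Of At A2 p = -(cd A1 ez1 a3 p) ∧
  cd A1 ez1 phi p + Complex.I • cd A2 ez2 phi p = 0 ∧
  cd At et phi p = Complex.I • mcomm (a3 p) (phi p)

/-- The Kapustin-Witten equation (iv) at a point. -/
def KW4At (At A1 A2 a3 phi : P3 → M2) (p : P3) : Prop :=
  cd At et a3 p = B3Of A1 A2 p + (Complex.I * (2:ℂ)⁻¹) • mcomm (phi p) (mstar (phi p))

/-- The operator `Δ_{(A,a)} u = -(∇²_t + ∇²₁ + ∇²₂) u + Σ_a [a_a, [u, a_a]]`. -/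
noncomputable def lapOf (At A1 A2 a3 phi u : P3 → M2) (p : P3) : M2 :=
  -(cd At et (cd At et u) p + cd A1 ez1 (cd A1 ez1 u) p + cd A2 ez2 (cd A2 ez2 u) p)
  + mcomm (a1Of phi p) (mcomm (u p) (a1Of phi p))
  + mcomm (a2Of phi p) (mcomm (u p) (a2Of phi p))
  + mcomm (a3 p) (mcomm (u p) (a3 p))

/-- An ℝ-invariant data set on an open set `U ⊆ H`: smooth su(2)-valued connection
components `A_t, A₁, A₂`, an su(2)-valued `a₃` and an sl(2,ℂ)-valued `φ`. -/
structure DataSet (U : Set P3) where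
  At : P3 → M2
  A1 : P3 → M2
  A2 : P3 → M2
  a3 : P3 → M2
  phi : P3 → M2
  smooth_At : ContDiffOn ℝ (⊤:ℕ∞) At U
  smooth_A1 : ContDiffOn ℝ (⊤:ℕ∞) A1 U
  smooth_A2 : ContDiffOn ℝ (⊤:ℕ∞) A2 U
  smooth_a3 : ContDiffOn ℝ (⊤:ℕ∞) a3 U
  smooth_phi : ContDiffOn ℝ (⊤:ℕ∞) phi U
  su2_At : ∀ p ∈ U, IsSU2 (At p)
  su2_A1 : ∀ p ∈ U, IsSU2 (A1 p)
  su2_A2 : ∀ p ∈ U, IsSU2 (A2 p)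
  su2_a3 : ∀ p ∈ U, IsSU2 (a3 p)
  sl2_phi : ∀ p ∈ U, Matrix.trace (phi p) = 0

namespace DataSet

variable {U : Set P3} (D : DataSet U)

noncomputable def a1 : P3 → M2 := a1Of D.phi
noncomputable def a2 : P3 → M2 := a2Of D.phi
noncomputable def X : P3 → M2 := XOf D.At D.A1 D.A2 D.a3 D.phi
noncomputable def lap (u : P3 → M2) : P3 → M2 := lapOf D.At D.A1 D.A2 D.a3 D.phi u

end DataSet

/-- The Kapustin-Witten equations (i)-(iii) on `U`. -/
def KW123 (U : Set P3) (D : DataSet U) : Prop :=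
  ∀ p ∈ U, KW123At D.At D.A1 D.A2 D.a3 D.phi p

/-- The Kapustin-Witten equation (iv) on `U`. -/
def KW4 (U : Set P3) (D : DataSet U) : Prop :=
  ∀ p ∈ U, KW4At D.At D.A1 D.A2 D.a3 D.phi p

/-- `|∇_A f|² = Σ_{i ∈ {t,1,2}} |∇_{A_i} f|²`. -/
noncomputable def covGradSqOf (At A1 A2 : P3 → M2) (f : P3 → M2) (p : P3) : ℝ :=
  (mnorm (cd At et f p))^2 + (mnorm (cd A1 ez1 f p))^2 + (mnorm (cd A2 ez2 f p))^2

/-- `|B_{A_3}|² + |E_{A_1}|² + |E_{A_2}|²`. -/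
noncomputable def curvSqOf (At A1 A2 : P3 → M2) (p : P3) : ℝ :=
  (mnorm (B3Of A1 A2 p))^2 + (mnorm (EA1Of At A1 p))^2 + (mnorm (EA2Of At A2 p))^2

/-- `|a| = (|a₁|² + |a₂|² + |a₃|²)^{1/2}`. -/
noncomputable def anormOf (a1 a2 a3 : P3 → M2) (p : P3) : ℝ :=
  Real.sqrt ((mnorm (a1 p))^2 + (mnorm (a2 p))^2 + (mnorm (a3 p))^2)

/-- `σ₁ = i·(first Pauli matrix)` and its siblings: a basis of su(2) with
`σ_a² = -𝕀`, `σ₁σ₂ = -σ₃`, `σ₂σ₃ = -σ₁`, `σ₃σ₁ = -σ₂`. -/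
def s1 : M2 := !![0, Complex.I; Complex.I, 0]
def s2 : M2 := !![0, 1; -1, 0]
def s3 : M2 := !![Complex.I, 0; 0, -Complex.I]

/-- `Θ = arcsinh(t/|z|)`. -/
noncomputable def Th (p : P3) : ℝ := Real.arsinh (p.1 / znorm p)

/-- The function `α_m`. -/
noncomputable def alphaM (m : ℕ) (p : P3) : ℝ :=
  -(1/(2*p.1)) * (((m:ℝ)+1) * Real.sinh (Th p) / Real.sinh (((m:ℝ)+1) * Th p))
    * (Real.cosh (((m:ℝ)+1) * Th p) / Real.cosh (Th p))

/-- The function `f_m`. -/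
noncomputable def fM (m : ℕ) (p : P3) : ℝ :=
  1 - (Real.sinh (Th p) * Real.cosh (((m:ℝ)+1) * Th p))
      / (Real.cosh (Th p) * Real.sinh (((m:ℝ)+1) * Th p))

/-- Model data: `A_t^{(m)} = 0`. -/
noncomputable def modelAt (_m : ℕ) : P3 → M2 := fun _ => 0

/-- Model data: `A₁^{(m)}`. -/
noncomputable def modelA1 (m : ℕ) (p : P3) : M2 :=
  ((-((((m:ℝ)+1))/2) * fM m p * (p.2.2 / (znorm p)^2) : ℝ) : ℂ) • s3

/-- Model data: `A₂^{(m)}`. -/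
noncomputable def modelA2 (m : ℕ) (p : P3) : M2 :=
  ((((((m:ℝ)+1))/2) * fM m p * (p.2.1 / (znorm p)^2) : ℝ) : ℂ) • s3

/-- Model data: `a₃^{(m)} = α_m σ₃`. -/
noncomputable def modela3 (m : ℕ) (p : P3) : M2 := ((alphaM m p : ℝ) : ℂ) • s3

/-- Model data: `φ^{(m)}`. -/
noncomputable def modelPhi (m : ℕ) (p : P3) : M2 :=
  (-(((2*p.1 : ℝ) : ℂ))⁻¹
    * (((((m:ℝ)+1) * Real.sinh (Th p) / Real.sinh (((m:ℝ)+1) * Th p)) : ℝ) : ℂ)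
    * (zc p / ((znorm p : ℝ) : ℂ))^m) • (s1 - Complex.I • s2)

/-- A smooth SU(2)-valued map on `U`. -/
def SU2Map (h : P3 → M2) (U : Set P3) : Prop :=
  ContDiffOn ℝ (⊤:ℕ∞) h U ∧ ∀ p ∈ U, (h p)ᴴ * h p = 1 ∧ (h p).det = 1

/-- Gauge action on a connection component: `A ↦ h A h⁻¹ - (∂_v h) h⁻¹`. -/
noncomputable def gAct (h : P3 → M2) (v : P3) (A : P3 → M2) (p : P3) : M2 :=
  h p * A p * (h p)⁻¹ - pd v h p * (h p)⁻¹

/-- Pointwise norm of the difference between the `h`-gauge transform of a data set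
and the model data set labelled by `m` (summing all six components). -/
noncomputable def gaugeDiff (h : P3 → M2) {U : Set P3} (D : DataSet U) (m : ℕ) (p : P3) : ℝ :=
  mnorm (gAct h et D.At p - modelAt m p) + mnorm (gAct h ez1 D.A1 p - modelA1 m p)
  + mnorm (gAct h ez2 D.A2 p - modelA2 m p)
  + mnorm (h p * D.a1 p * (h p)⁻¹ - a1Of (modelPhi m) p)
  + mnorm (h p * D.a2 p * (h p)⁻¹ - a2Of (modelPhi m) p)
  + mnorm (h p * D.a3 p * (h p)⁻¹ - modela3 m p)

/-- The asymptotic description (1.10) for the pair `(m, np)`:  gauge-asymptotic to the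
model `m + 2np` as `t → 0`, to the model `m` as `t → ∞` (with convergence of
`ln(|φ|/|φ^{(m)}|)`), and to the model `0` as `|z|/t → ∞` (via an `SU(2)/{±1}`-valued
gauge transformation, encoded by local smooth lifts). -/
def Described110 (D : DataSet Hsp) (m np : ℕ) : Prop :=
  ∃ g0 gi : P3 → M2, ∃ dgt : P3 → ℝ,
    SU2Map g0 (Hsp ∩ {q | q.1 < 1}) ∧
    SU2Map gi (Hsp ∩ {q | 1 < q.1}) ∧
    (∀ ε > (0:ℝ), ∃ δ : ℝ, 0 < δ ∧ δ ≤ 1 ∧ ∀ q ∈ Hsp, q.1 < δ →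
        q.1 * gaugeDiff g0 D (m + 2*np) q < ε) ∧
    (∀ ε > (0:ℝ), ∃ K : ℝ, 1 ≤ K ∧ ∀ q ∈ Hsp, K < q.1 →
        q.1 * gaugeDiff gi D m q
          + |Real.log (mnorm (D.phi q) / mnorm (modelPhi m q))| < ε) ∧
    (∀ q ∈ Hsp, q.1 < znorm q →
        ∃ V : Set P3, IsOpen V ∧ q ∈ V ∧ ∃ h : P3 → M2, SU2Map h (V ∩ Hsp) ∧
          ∀ q' ∈ V ∩ Hsp, q'.1 < znorm q' → dgt q' = gaugeDiff h D 0 q') ∧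
    (∀ ε > (0:ℝ), ∃ K : ℝ, 0 < K ∧ ∀ q ∈ Hsp, K * q.1 < znorm q → q.1 * dgt q < ε)

/-- Gauge equivalence of two data sets on `H` by a smooth SU(2)-valued map. -/
def GaugeEquiv (D D' : DataSet Hsp) : Prop :=
  ∃ h : P3 → M2, SU2Map h Hsp ∧ ∀ p ∈ Hsp,
    D'.At p = gAct h et D.At p ∧ D'.A1 p = gAct h ez1 D.A1 p ∧
    D'.A2 p = gAct h ez2 D.A2 p ∧
    D'.phi p = h p * D.phi p * (h p)⁻¹ ∧ D'.a3 p = h p * D.a3 p * (h p)⁻¹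

/-- Condition (1.9). -/
def Obeys19 (D : DataSet Hsp) : Prop :=
  (∃ C : ℝ, ∀ p ∈ Hsp, p.1 * anormOf D.a1 D.a2 D.a3 p ≤ C) ∧
  (∃ t0 > (0:ℝ), ∃ ε > (0:ℝ), ∃ r > (0:ℝ), ∀ p ∈ Hsp,
      p.1 < t0 → r * p.1 ≤ znorm p → ε < p.1 * anormOf D.a1 D.a2 D.a3 p) ∧
  (∃ C > (0:ℝ), ∀ R > (0:ℝ),
      (∫⁻ p in Hsp ∩ {q | R < znorm q}, ENNReal.ofReal (curvSqOf D.At D.A1 D.A2 p))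
        ≤ ENNReal.ofReal (C / R))

/-- `|f| → 0` as `t → 0` and as `t → ∞` (uniformly in `z`) and as `t/|z| → 0`. -/
def UAsymp (f : P3 → M2) : Prop :=
  (∀ ε > (0:ℝ), ∃ δ > (0:ℝ), ∀ p ∈ Hsp, p.1 < δ → mnorm (f p) < ε) ∧
  (∀ ε > (0:ℝ), ∃ K : ℝ, ∀ p ∈ Hsp, K < p.1 → mnorm (f p) < ε) ∧
  (∀ ε > (0:ℝ), ∃ δ > (0:ℝ), ∀ p ∈ Hsp, p.1 < δ * znorm p → mnorm (f p) < ε)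

/-- The parameter domain `[0, T)` of a flow. -/
def flowDom (T : ℝ≥0∞) : Set ℝ := {s : ℝ | 0 ≤ s ∧ ENNReal.ofReal s < T}

/-- A flow for the base data set `D` on `[0, T)`:  a smooth family `s ↦ g|_s` of
`SL(2,ℂ)`-valued maps with `g|₀ ≡ 𝕀` such that `u|_s = -i(∂_s g)g⁻¹` is su(2)-valued,
the associated data sets `Ds s` are obtained from `g|_s` by the complex gauge action,
`Δ_{(A|_s,a|_s)} u|_s = 𝔛|_s`, and `|u|_s|` decays as `t → 0`, `t → ∞`, `t/|z| → 0`. -/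
structure KWFlow (D : DataSet Hsp) (T : ℝ≥0∞) where
  g : ℝ → P3 → M2
  Ds : ℝ → DataSet Hsp
  u : ℝ → P3 → M2
  smooth_g : ContDiffOn ℝ (⊤:ℕ∞) (fun q : ℝ × P3 => g q.1 q.2) (flowDom T ×ˢ Hsp)
  g_zero : ∀ p ∈ Hsp, g 0 p = 1
  det_g : ∀ s ∈ flowDom T, ∀ p ∈ Hsp, (g s p).det = 1
  u_def : ∀ s ∈ flowDom T, ∀ p ∈ Hsp,
    u s p = (-Complex.I) • (deriv (fun s' => g s' p) s * (g s p)⁻¹)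
  su2_u : ∀ s ∈ flowDom T, ∀ p ∈ Hsp, IsSU2 (u s p)
  eq_t : ∀ s ∈ flowDom T, ∀ p ∈ Hsp,
    ((Ds s).At p - D.At p) - Complex.I • ((Ds s).a3 p - D.a3 p)
      = -(cd D.At et (g s) p * (g s p)⁻¹) + Complex.I • (mcomm (D.a3 p) (g s p) * (g s p)⁻¹)
  eq_z : ∀ s ∈ flowDom T, ∀ p ∈ Hsp,
    ((Ds s).A1 p - D.A1 p) + Complex.I • ((Ds s).A2 p - D.A2 p)
      = -((cd D.A1 ez1 (g s) p + Complex.I • cd D.A2 ez2 (g s) p) * (g s p)⁻¹)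
  eq_phi : ∀ s ∈ flowDom T, ∀ p ∈ Hsp, (Ds s).phi p = g s p * D.phi p * (g s p)⁻¹
  lap_eq : ∀ s ∈ flowDom T, ∀ p ∈ Hsp, (Ds s).lap (u s) p = (Ds s).X p
  asymp_u : ∀ s ∈ flowDom T, UAsymp (u s)

/-- `|∇_{A} a|²`, summing over all three covariant derivatives of all of `a₁,a₂,a₃`. -/
noncomputable def covaNormSq {U : Set P3} (D : DataSet U) (p : P3) : ℝ :=
  covGradSqOf D.At D.A1 D.A2 D.a1 p + covGradSqOf D.At D.A1 D.A2 D.a2 p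
    + covGradSqOf D.At D.A1 D.A2 D.a3 p

/-- `|a|² = Σ_a |a_a|²`. -/
noncomputable def anormSq {U : Set P3} (D : DataSet U) (p : P3) : ℝ :=
  (mnorm (D.a1 p))^2 + (mnorm (D.a2 p))^2 + (mnorm (D.a3 p))^2

/-- The function `q ↦ μ_q`: the largest `μ ∈ (0, min(1/t_q, 1/100)]` such that
`μ² t_q² (|B| + |E₁| + |E₂| + |∇_A a| + |a|²) ≤ 1` on the ball of radius `t_q/4`
centered at `q`. -/
noncomputable def mu (D : DataSet Hsp) (q : P3) : ℝ :=
  sSup {μ : ℝ | 0 < μ ∧ μ ≤ min (1/q.1) (1/100) ∧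
    ∀ p, dist3 p q < q.1/4 →
      μ^2 * q.1^2 * (mnorm (B3Of D.A1 D.A2 p) + mnorm (EA1Of D.At D.A1 p)
        + mnorm (EA2Of D.At D.A2 p) + Real.sqrt (covaNormSq D p) + anormSq D p) ≤ 1}

/-- The Dirichlet Green's function of the half-space Laplacian with pole at `q`. -/
noncomputable def Gf (q p : P3) : ℝ :=
  (4*Real.pi)⁻¹ * (Real.sqrt ((p.1 - q.1)^2 + (p.2.1 - q.2.1)^2 + (p.2.2 - q.2.2)^2))⁻¹
  - (4*Real.pi)⁻¹ * (Real.sqrt ((p.1 + q.1)^2 + (p.2.1 - q.2.1)^2 + (p.2.2 - q.2.2)^2))⁻¹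

/-- A family `g : [0,T) → (maps on H)` extends smoothly to the closed interval `[0,T]`;
when `T = ∞` this is in the reparametrized sense `r = 1 - e^{-s}`. -/
def ExtendsToClosed (T : ℝ≥0∞) (g : ℝ → P3 → M2) : Prop :=
  (T ≠ ⊤ → ∃ G : ℝ → P3 → M2,
     ContDiffOn ℝ (⊤:ℕ∞) (fun q : ℝ × P3 => G q.1 q.2) (Set.Icc 0 T.toReal ×ˢ Hsp) ∧
     ∀ s ∈ Set.Ico (0:ℝ) T.toReal, ∀ p ∈ Hsp, G s p = g s p) ∧
  (T = ⊤ → ∃ G : ℝ → P3 → M2,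
     ContDiffOn ℝ (⊤:ℕ∞) (fun q : ℝ × P3 => G q.1 q.2) (Set.Icc (0:ℝ) 1 ×ˢ Hsp) ∧
     ∀ r ∈ Set.Ico (0:ℝ) 1, ∀ p ∈ Hsp, G r p = g (-Real.log (1 - r)) p)

/-- A family `g : [0,∞) → (maps on H)` extends smoothly (in the reparametrized sense
`r = 1 - e^{-s}`) to `s = ∞` with limit `gi`. -/
def ExtendsToLimit (g : ℝ → P3 → M2) (gi : P3 → M2) : Prop :=
  ∃ G : ℝ → P3 → M2,
    ContDiffOn ℝ (⊤:ℕ∞) (fun q : ℝ × P3 => G q.1 q.2) (Set.Icc (0:ℝ) 1 ×ˢ Hsp) ∧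
    (∀ r ∈ Set.Ico (0:ℝ) 1, ∀ p ∈ Hsp, G r p = g (-Real.log (1 - r)) p) ∧
    (∀ p ∈ Hsp, G 1 p = gi p)

/-- `∫_H (1+t²)|𝔛|²` for a data set on `H`. -/
noncomputable def XnormSqInt (D : DataSet Hsp) : ℝ≥0∞ :=
  ∫⁻ p in Hsp, ENNReal.ofReal ((1 + p.1^2) * (mnorm (D.X p))^2)

/-- Convergence in the C^∞ topology on an open set `Ω`: all iterated derivatives
converge uniformly on every compact subset of `Ω`. -/
def CinftyTendsTo (Ω : Set P3) (f : ℕ → P3 → M2) (g : P3 → M2) : Prop :=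
  ∀ K : Set P3, K ⊆ Ω → IsCompact K → ∀ n : ℕ,
    Filter.Tendsto
      (fun k => sSup ((fun p => ‖iteratedFDeriv ℝ n (fun q => f k q - g q) p‖) '' K))
      Filter.atTop (nhds (0:ℝ))

/-- The hypotheses of Proposition 6.1 for a base data set `D` with constants `M, t0`. -/
def Prop61Hyp (D : DataSet Hsp) (M t0 : ℝ) : Prop :=
  KW123 Hsp D ∧
  XnormSqInt D < ⊤ ∧
  (∃ m np : ℕ, 1 ≤ np ∧ Described110 D m np) ∧
  (∃ μ0 > (0:ℝ), ∀ q ∈ Hsp, μ0 ≤ mu D q) ∧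
  0 < M ∧
  (∀ R > (1:ℝ),
    (∫⁻ p in Hsp ∩ {q | R < znorm q},
        ENNReal.ofReal (curvSqOf D.At D.A1 D.A2 p)) ≤ ENNReal.ofReal (M/R) ∧
    (∫⁻ p in Hsp ∩ {q | R < znorm q},
        ENNReal.ofReal ((mnorm (D.X p))^2)) ≤ ENNReal.ofReal (M/R)) ∧
  (0 < t0 ∧ t0 ≤ 1) ∧
  (∃ C : ℝ, ∀ t ∈ Set.Ioc (0:ℝ) t0,
      (∫⁻ z : ℝ × ℝ, ENNReal.ofReal ((mnorm (D.X (t, z)))^2)) ≤ ENNReal.ofReal C) ∧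
  (∀ t ∈ Set.Ioc (0:ℝ) t0, ∀ R > (1:ℝ),
      (∫⁻ z in {z : ℝ × ℝ | R < Real.sqrt (z.1^2 + z.2^2)},
          ENNReal.ofReal ((mnorm (D.X (t, z)))^2)) ≤ ENNReal.ofReal (M/R))

open ENNReal (ofReal ofReal_mul ofReal_le_ofReal ofReal_add ofReal_ne_top)
open Real (exp log norm_eq_abs norm_of_nonneg sq_sqrt exp_pos le_sqrt_of_sq_le)
open Metric (ball closedBall ball_subset_closedBall)
open Finset (sum_nonneg sum_le_sum sum_congr mul_sum sum_add_distrib single_le_sum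
  abs_sum_le_sum_abs sum_mul smul_sum)

section SmoothFunctions

/-- Sets on which one-sided smooth calculus behaves as on open sets. -/
class SmoothDomain {V : Type*} [NormedAddCommGroup V] [NormedSpace ℝ V] (Ω : Set V) : Prop where
  uniqueDiffOn : UniqueDiffOn ℝ Ω
  subset_closure_interior : Ω ⊆ closure (interior Ω)

variable {V : Type*} [NormedAddCommGroup V] [NormedSpace ℝ V] {Ω : Set V}
variable {F : Type*} [NormedAddCommGroup F] [NormedSpace ℝ F]
variable {G : Type*} [NormedAddCommGroup G] [NormedSpace ℝ G]
variable {K : Type*} [NormedAddCommGroup K] [NormedSpace ℝ K]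

theorem IsOpen.smoothDomain (h : IsOpen Ω) : SmoothDomain Ω :=
  ⟨h.uniqueDiffOn, by rw [h.interior_eq]; exact subset_closure⟩

/-- Functions that are smooth on `Ω` and vanish off `Ω`. -/
def Sm (Ω : Set V) (F : Type*) [NormedAddCommGroup F] [NormedSpace ℝ F] :
    Submodule ℝ (V → F) where
  carrier := {f | ContDiffOn ℝ (⊤ : ℕ∞) f Ω ∧ ∀ x ∉ Ω, f x = 0}
  add_mem' := fun ha hb => ⟨ha.1.add hb.1, fun x hx => by simp [ha.2 x hx, hb.2 x hx]⟩
  zero_mem' := ⟨contDiffOn_const, fun _ _ => rfl⟩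
  smul_mem' := fun c _ hf => ⟨contDiffOn_const.smul hf.1, fun x hx => by simp [hf.2 x hx]⟩

namespace Sm

/-- Restriction of a function smooth on `Ω`. -/
def ofContDiffOn (f : V → F) (hf : ContDiffOn ℝ (⊤ : ℕ∞) f Ω) : Sm Ω F :=
  ⟨Ω.indicator f, hf.congr fun _ hx => indicator_of_mem hx f,
    fun _ hx => indicator_of_notMem hx f⟩

theorem ofContDiffOn_apply {f : V → F} (hf : ContDiffOn ℝ (⊤ : ℕ∞) f Ω) {x : V} (hx : x ∈ Ω) :
    (ofContDiffOn f hf).1 x = f x := indicator_of_mem hx f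

theorem ext_on {f g : Sm Ω F} (h : ∀ x ∈ Ω, f.1 x = g.1 x) : f = g := by
  refine Subtype.ext (funext fun x => ?_)
  by_cases hx : x ∈ Ω
  · exact h x hx
  · rw [f.2.2 x hx, g.2.2 x hx]

@[simp] theorem add_apply (f g : Sm Ω F) (x : V) : (f + g).1 x = f.1 x + g.1 x := rfl
@[simp] theorem sub_apply (f g : Sm Ω F) (x : V) : (f - g).1 x = f.1 x - g.1 x := rfl
@[simp] theorem neg_apply (f : Sm Ω F) (x : V) : (-f).1 x = -f.1 x := rfl
@[simp] theorem zero_apply (x : V) : (0 : Sm Ω F).1 x = 0 := rfl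
@[simp] theorem smul_apply (c : ℝ) (f : Sm Ω F) (x : V) : (c • f).1 x = c • f.1 x := rfl
@[simp] theorem sum_apply {ι : Type*} (s : Finset ι) (f : ι → Sm Ω F) (x : V) :
    (∑ i ∈ s, f i).1 x = ∑ i ∈ s, (f i).1 x := by
  simp

theorem continuousOn (f : Sm Ω F) : ContinuousOn f.1 Ω := f.2.1.continuousOn

theorem differentiableOn (f : Sm Ω F) : DifferentiableOn ℝ f.1 Ω :=
  f.2.1.differentiableOn (by simp)

theorem hasFDerivWithinAt (f : Sm Ω F) {x : V} (hx : x ∈ Ω) :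
    HasFDerivWithinAt f.1 (fderivWithin ℝ f.1 Ω x) Ω x :=
  (Sm.differentiableOn f x hx).hasFDerivWithinAt

/-- Pointwise application of a continuous bilinear map. -/
def bil (B : F →L[ℝ] G →L[ℝ] K) (f : Sm Ω F) (g : Sm Ω G) : Sm Ω K :=
  ⟨fun x => B (f.1 x) (g.1 x),
    (B.contDiff.comp_contDiffOn f.2.1).clm_apply g.2.1, fun x hx => by simp [f.2.2 x hx]⟩

@[simp] theorem bil_apply (B : F →L[ℝ] G →L[ℝ] K) (f : Sm Ω F) (g : Sm Ω G) (x : V) :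
    (bil B f g).1 x = B (f.1 x) (g.1 x) := rfl

/-- Pointwise application of a continuous linear map. -/
def map (L : F →L[ℝ] G) : Sm Ω F →ₗ[ℝ] Sm Ω G where
  toFun f := ⟨fun x => L (f.1 x), L.contDiff.comp_contDiffOn f.2.1,
    fun x hx => by simp [f.2.2 x hx]⟩
  map_add' f g := Subtype.ext (funext fun x => by simp)
  map_smul' c f := Subtype.ext (funext fun x => by simp)

@[simp] theorem map_apply (L : F →L[ℝ] G) (f : Sm Ω F) (x : V) :
    (map L f).1 x = L (f.1 x) := rfl

/-- Functions that agree on a dense subset of `Ω` are equal. -/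
theorem ext_of_dense {s : Set V} (hs : Ω ⊆ closure (s ∩ Ω)) {f g : Sm Ω F}
    (h : ∀ x ∈ s ∩ Ω, f.1 x = g.1 x) : f = g := by
  refine ext_on fun x hx => ?_
  have hne : (𝓝[s ∩ Ω] x).NeBot := mem_closure_iff_nhdsWithin_neBot.1 (hs hx)
  have h1 : Tendsto f.1 (𝓝[s ∩ Ω] x) (𝓝 (f.1 x)) :=
    (Sm.continuousOn f x hx).mono_left (nhdsWithin_mono _ inter_subset_right)
  have h2 : Tendsto g.1 (𝓝[s ∩ Ω] x) (𝓝 (g.1 x)) :=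
    (Sm.continuousOn g x hx).mono_left (nhdsWithin_mono _ inter_subset_right)
  refine tendsto_nhds_unique (h1.congr' ?_) h2
  filter_upwards [self_mem_nhdsWithin] with y hy using h y hy

variable [hΩ : SmoothDomain Ω]

/-- Directional derivative. -/
def d (v : V) : Sm Ω F →ₗ[ℝ] Sm Ω F where
  toFun f := ofContDiffOn (fun x => fderivWithin ℝ f.1 Ω x v)
    ((f.2.1.fderivWithin hΩ.uniqueDiffOn (by simp)).clm_apply contDiffOn_const)
  map_add' f g := ext_on fun x hx => by
    simp only [ofContDiffOn_apply _ hx, add_apply]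
    rw [show (f + g).1 = f.1 + g.1 from rfl, fderivWithin_add (hΩ.uniqueDiffOn x hx)
      (Sm.differentiableOn f x hx) (Sm.differentiableOn g x hx)]
    rfl
  map_smul' c f := ext_on fun x hx => by
    simp only [ofContDiffOn_apply _ hx, smul_apply, RingHom.id_apply]
    rw [show (c • f).1 = c • f.1 from rfl, fderivWithin_const_smul (hΩ.uniqueDiffOn x hx)
      (Sm.differentiableOn f x hx)]
    rfl

theorem d_apply (v : V) (f : Sm Ω F) {x : V} (hx : x ∈ Ω) :
    (d v f).1 x = fderivWithin ℝ f.1 Ω x v :=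
  indicator_of_mem hx fun x => fderivWithin ℝ f.1 Ω x v

theorem d_apply_of_hasFDerivWithinAt (v : V) (f : Sm Ω F) {x : V} (hx : x ∈ Ω)
    {f' : V →L[ℝ] F} (h : HasFDerivWithinAt f.1 f' Ω x) : (d v f).1 x = f' v := by
  rw [d_apply v f hx, h.fderivWithin (hΩ.uniqueDiffOn x hx)]

theorem d_apply_of_isOpen (ho : IsOpen Ω) (v : V) (f : Sm Ω F) {x : V} (hx : x ∈ Ω) :
    (d v f).1 x = fderiv ℝ f.1 x v := by
  rw [d_apply v f hx, fderivWithin_of_isOpen ho hx]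

theorem d_ofContDiffOn (ho : IsOpen Ω) (v : V) {f : V → F} (hf : ContDiffOn ℝ (⊤ : ℕ∞) f Ω)
    {x : V} (hx : x ∈ Ω) : (d v (ofContDiffOn f hf)).1 x = fderiv ℝ f x v := by
  rw [d_apply_of_isOpen ho v _ hx]
  congr 1
  refine Filter.EventuallyEq.fderiv_eq ?_
  filter_upwards [ho.mem_nhds hx] with y hy using ofContDiffOn_apply hf hy

theorem d_zero_dir (f : Sm Ω F) : d (0 : V) f = 0 :=
  ext_on fun x hx => by rw [d_apply _ _ hx]; simp

theorem d_comm (v w : V) (f : Sm Ω F) : d v (d w f) = d w (d v f) := by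
  have key : ∀ (a b : V) (x : V), x ∈ Ω →
      (d a (d b f)).1 x = fderivWithin ℝ (fderivWithin ℝ f.1 Ω) Ω x a b := by
    intro a b x hx
    have hd : DifferentiableWithinAt ℝ (fderivWithin ℝ f.1 Ω) Ω x :=
      (f.2.1.fderivWithin (m := 1) hΩ.uniqueDiffOn (by norm_cast)).differentiableOn (by simp) x hx
    have h1 := hd.hasFDerivWithinAt.clm_apply (hasFDerivWithinAt_const b x Ω)
    have h2 : HasFDerivWithinAt (d b f).1 _ Ω x :=
      h1.congr (fun y hy => d_apply b f hy) (d_apply b f hx)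
    rw [d_apply_of_hasFDerivWithinAt a _ hx h2]
    simp
  refine ext_on fun x hx => ?_
  rw [key v w x hx, key w v x hx]
  exact (f.2.1 x hx).isSymmSndFDerivWithinAt (by simp; norm_cast) hΩ.uniqueDiffOn
    (hΩ.subset_closure_interior hx) hx v w

theorem d_bil (v : V) (B : F →L[ℝ] G →L[ℝ] K) (f : Sm Ω F) (g : Sm Ω G) :
    d v (bil B f g) = bil B (d v f) g + bil B f (d v g) := by
  refine ext_on fun x hx => ?_
  have h1 := B.hasFDerivAt.comp_hasFDerivWithinAt x (Sm.hasFDerivWithinAt f hx)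
  have h2 := h1.clm_apply (Sm.hasFDerivWithinAt g hx)
  rw [d_apply_of_hasFDerivWithinAt v (bil B f g) hx h2]
  simp [d_apply _ _ hx, add_comm]

theorem d_map (v : V) (L : F →L[ℝ] G) (f : Sm Ω F) : d v (map L f) = map L (d v f) := by
  refine ext_on fun x hx => ?_
  have h1 := L.hasFDerivAt.comp_hasFDerivWithinAt x (Sm.hasFDerivWithinAt f hx)
  rw [d_apply_of_hasFDerivWithinAt v (map L f) hx h1]
  simp [d_apply _ _ hx]

end Sm

end SmoothFunctions

section Slices

variable {F : Type*} [NormedAddCommGroup F] [NormedSpace ℝ F]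

theorem isOpen_Hsp : IsOpen Hsp := isOpen_lt continuous_const continuous_fst

instance : SmoothDomain Hsp := isOpen_Hsp.smoothDomain

/-- The parameter space `[0,R) × H`. -/
abbrev Cyl (R : ℝ) : Set (ℝ × P3) := Ico 0 R ×ˢ Hsp

theorem Cyl_subset_closure (R : ℝ) : Cyl R ⊆ closure ((Ioo 0 R ×ˢ Hsp) ∩ Cyl R) := by
  have h : (Ioo 0 R ×ˢ Hsp) ∩ Cyl R = Ioo 0 R ×ˢ Hsp :=
    inter_eq_left.2 (prod_mono Ioo_subset_Ico_self le_rfl)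
  rw [h, closure_prod_eq]
  rintro ⟨r, x⟩ ⟨hr, hx⟩
  refine ⟨?_, subset_closure hx⟩
  have hr' : r ∈ Ico 0 R := hr
  rw [closure_Ioo (hr'.1.trans_lt hr'.2).ne]
  exact ⟨hr'.1, hr'.2.le⟩

instance (R : ℝ) : SmoothDomain (Cyl R) where
  uniqueDiffOn := (uniqueDiffOn_Ico 0 R).prod isOpen_Hsp.uniqueDiffOn
  subset_closure_interior := by
    refine (Cyl_subset_closure R).trans (closure_mono ?_)
    refine interior_maximal inter_subset_right ?_
    have h : (Ioo 0 R ×ˢ Hsp) ∩ Cyl R = Ioo 0 R ×ˢ Hsp :=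
      inter_eq_left.2 (prod_mono Ioo_subset_Ico_self le_rfl)
    rw [h]
    exact isOpen_Ioo.prod isOpen_Hsp

namespace Sm

variable {R : ℝ}

theorem ext_Ioo {f g : Sm (Cyl R) F} (h : ∀ r ∈ Ioo 0 R, ∀ x ∈ Hsp, f.1 (r, x) = g.1 (r, x)) :
    f = g :=
  ext_of_dense (Cyl_subset_closure R) fun _ hq => h _ hq.1.1 _ hq.1.2

/-- Restriction to fixed parameter. -/
def slice (r : ℝ) : Sm (Cyl R) F →ₗ[ℝ] Sm Hsp F where
  toFun f := ⟨fun x => f.1 (r, x), by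
    by_cases hr : r ∈ Ico 0 R
    · exact f.2.1.comp (contDiff_const.prodMk contDiff_id).contDiffOn fun x hx => ⟨hr, hx⟩
    · have : (fun x => f.1 (r, x)) = fun _ => 0 :=
        funext fun x => f.2.2 _ fun h => hr h.1
      rw [this]; exact contDiffOn_const, fun x hx => f.2.2 _ fun h => hx h.2⟩
  map_add' f g := rfl
  map_smul' c f := rfl

@[simp] theorem slice_apply (r : ℝ) (f : Sm (Cyl R) F) (x : P3) : (slice r f).1 x = f.1 (r, x) :=
  rfl

theorem slice_of_notMem {r : ℝ} (hr : r ∉ Ico 0 R) (f : Sm (Cyl R) F) : slice r f = 0 :=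
  ext_on fun _ _ => f.2.2 _ fun h => hr h.1

theorem slice_d (r : ℝ) (w : P3) (f : Sm (Cyl R) F) :
    slice r (d ((0 : ℝ), w) f) = d w (slice r f) := by
  by_cases hr : r ∈ Ico 0 R
  · refine ext_on fun x hx => ?_
    have h0 : HasFDerivWithinAt (fun x : P3 => ((r, x) : ℝ × P3))
        ((0 : P3 →L[ℝ] ℝ).prod (ContinuousLinearMap.id ℝ P3)) Hsp x :=
      (hasFDerivWithinAt_const r x Hsp).prodMk (hasFDerivWithinAt_id x Hsp)
    have h1 := (Sm.hasFDerivWithinAt f (x := (r, x)) ⟨hr, hx⟩).comp x h0 fun y hy => ⟨hr, hy⟩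
    rw [d_apply_of_hasFDerivWithinAt w (slice r f) hx h1, slice_apply,
      d_apply _ _ (show (r, x) ∈ Cyl R from ⟨hr, hx⟩)]
    simp
  · rw [slice_of_notMem hr, slice_of_notMem hr, map_zero]

/-- Derivative in the parameter. -/
abbrev dr : Sm (Cyl R) F →ₗ[ℝ] Sm (Cyl R) F := d ((1 : ℝ), (0 : P3))

theorem hasDerivWithinAt_dr (f : Sm (Cyl R) F) {r : ℝ} (hr : r ∈ Ico 0 R) (x : P3) :
    HasDerivWithinAt (fun r => f.1 (r, x)) ((dr f).1 (r, x)) (Ico 0 R) r := by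
  by_cases hx : x ∈ Hsp
  · have h0 : HasDerivWithinAt (fun r : ℝ => ((r, x) : ℝ × P3)) ((1 : ℝ), (0 : P3)) (Ico 0 R) r :=
      (hasDerivWithinAt_id r _).prodMk (hasDerivWithinAt_const _ _ x)
    have h1 := (Sm.hasFDerivWithinAt f (x := (r, x)) ⟨hr, hx⟩).comp_hasDerivWithinAt r h0
      (t := Cyl R) fun y hy => ⟨hy, hx⟩
    rw [d_apply _ _ (show (r, x) ∈ Cyl R from ⟨hr, hx⟩)]
    exact h1
  · have h1 : ∀ r, f.1 (r, x) = 0 := fun r => f.2.2 _ fun h => hx h.2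
    have h2 : (dr f).1 (r, x) = 0 := (dr f).2.2 _ fun h => hx h.2
    simp only [h1, h2]
    exact hasDerivWithinAt_const _ _ _

theorem hasDerivWithinAt_dr_Ici (f : Sm (Cyl R) F) {r : ℝ} (hr : r ∈ Ico 0 R) (x : P3) :
    HasDerivWithinAt (fun r => f.1 (r, x)) ((dr f).1 (r, x)) (Ici r) r := by
  refine (Sm.hasDerivWithinAt_dr f hr x).mono_of_mem_nhdsWithin ?_
  exact mem_of_superset (Ico_mem_nhdsGE hr.2) (Ico_subset_Ico_left hr.1)

theorem continuousOn_param (f : Sm (Cyl R) F) (x : P3) :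
    ContinuousOn (fun r => f.1 (r, x)) (Ico 0 R) :=
  fun _ hr => (Sm.hasDerivWithinAt_dr f hr x).continuousWithinAt

/-- A function on `H` viewed as independent of the parameter. -/
def cst (R : ℝ) (f : Sm Hsp F) : Sm (Cyl R) F :=
  ofContDiffOn (fun q => f.1 q.2) (f.2.1.comp contDiff_snd.contDiffOn fun _ hq => hq.2)

theorem cst_apply (f : Sm Hsp F) {r : ℝ} (hr : r ∈ Ico 0 R) (x : P3) :
    (cst R f).1 (r, x) = f.1 x := by
  by_cases hx : x ∈ Hsp
  · exact ofContDiffOn_apply _ (show (r, x) ∈ Cyl R from ⟨hr, hx⟩)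
  · rw [f.2.2 x hx]; exact (cst R f).2.2 _ fun h => hx h.2

theorem slice_cst {r : ℝ} (hr : r ∈ Ico 0 R) (f : Sm Hsp F) : slice r (cst R f) = f :=
  ext_on fun x _ => cst_apply f hr x

theorem ext_slice {f g : Sm (Cyl R) F} (h : ∀ r ∈ Ico 0 R, slice r f = slice r g) : f = g :=
  ext_on fun q hq => by
    have := congrArg (fun s : Sm Hsp F => s.1 q.2) (h q.1 hq.1)
    simpa using this

theorem dr_cst (f : Sm Hsp F) : dr (cst R f) = 0 := by
  refine ext_on fun q hq => ?_
  have h1 := Sm.hasDerivWithinAt_dr (cst R f) hq.1 q.2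
  have h2 : HasDerivWithinAt (fun r => (cst R f).1 (r, q.2)) 0 (Ico 0 R) q.1 :=
    (hasDerivWithinAt_const q.1 (Ico 0 R) (f.1 q.2)).congr (fun r hr => cst_apply f hr q.2)
      (cst_apply f hq.1 q.2)
  exact (uniqueDiffOn_Ico 0 R q.1 hq.1).eq_deriv _ h1 h2

theorem d_cst (w : P3) (f : Sm Hsp F) : d ((0 : ℝ), w) (cst R f) = cst R (d w f) :=
  ext_slice fun r hr => by rw [slice_d, slice_cst hr, slice_cst hr]

end Sm

end Slices

section NewtonKernel

instance : (volume : Measure P3).IsAddHaarMeasure :=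
  have : (volume : Measure (ℝ × ℝ)).IsAddHaarMeasure :=
    Measure.prod.instIsAddHaarMeasure (volume : Measure ℝ) (volume : Measure ℝ)
  Measure.prod.instIsAddHaarMeasure (volume : Measure ℝ) (volume : Measure (ℝ × ℝ))

/-- Squared Euclidean norm. -/
def nsq (x : P3) : ℝ := x.1 ^ 2 + x.2.1 ^ 2 + x.2.2 ^ 2

/-- Coordinate directions. -/
def bvec : Fin 3 → P3 := ![et, ez1, ez2]

/-- Coordinates. -/
def coord (i : Fin 3) : P3 →L[ℝ] ℝ :=
  ![ContinuousLinearMap.fst ℝ ℝ (ℝ × ℝ),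
    (ContinuousLinearMap.fst ℝ ℝ ℝ).comp (ContinuousLinearMap.snd ℝ ℝ (ℝ × ℝ)),
    (ContinuousLinearMap.snd ℝ ℝ ℝ).comp (ContinuousLinearMap.snd ℝ ℝ (ℝ × ℝ))] i

theorem nsq_eq_sum (x : P3) : nsq x = ∑ i, coord i x ^ 2 := by
  simp [nsq, coord, Fin.sum_univ_three]

theorem coord_bvec (i : Fin 3) : coord i (bvec i) = 1 := by
  fin_cases i <;> simp [coord, bvec, et, ez1, ez2]

theorem sum_coord_smul_bvec (x : P3) : ∑ i, coord i x • bvec i = x := by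
  simp [Fin.sum_univ_three, coord, bvec, et, ez1, ez2]

theorem abs_coord_le (i : Fin 3) (x : P3) : |coord i x| ≤ ‖x‖ := by
  have h1 : |x.1| ≤ ‖x‖ := norm_fst_le x
  have h2 : ‖x.2‖ ≤ ‖x‖ := norm_snd_le x
  have h3 : |x.2.1| ≤ ‖x.2‖ := norm_fst_le x.2
  have h4 : |x.2.2| ≤ ‖x.2‖ := norm_snd_le x.2
  fin_cases i
  · exact h1
  · exact h3.trans h2
  · exact h4.trans h2

theorem abs_coord_le_sqrt (i : Fin 3) (x : P3) : |coord i x| ≤ √(nsq x) := by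
  rw [← Real.sqrt_sq_eq_abs]
  refine Real.sqrt_le_sqrt ?_
  rw [nsq_eq_sum]
  exact single_le_sum (f := fun i => coord i x ^ 2) (fun _ _ => sq_nonneg _)
    (Finset.mem_univ i)

theorem nsq_nonneg (x : P3) : 0 ≤ nsq x := by unfold nsq; positivity

theorem norm_sq_le_nsq (x : P3) : ‖x‖ ^ 2 ≤ nsq x := by
  have h : ‖x‖ ≤ √(nsq x) := by
    refine max_le (abs_coord_le_sqrt 0 x) (max_le (abs_coord_le_sqrt 1 x) (abs_coord_le_sqrt 2 x))
  calc ‖x‖ ^ 2 ≤ √(nsq x) ^ 2 := by gcongr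
    _ = nsq x := sq_sqrt (nsq_nonneg x)

theorem nsq_le (x : P3) : nsq x ≤ 3 * ‖x‖ ^ 2 := by
  rw [nsq_eq_sum]
  calc ∑ i, coord i x ^ 2 ≤ ∑ _i : Fin 3, ‖x‖ ^ 2 :=
        sum_le_sum fun i _ => sq_le_sq.2 (by simpa using abs_coord_le i x)
    _ = 3 * ‖x‖ ^ 2 := by simp

theorem nsq_smul (c : ℝ) (x : P3) : nsq (c • x) = c ^ 2 * nsq x := by
  simp [nsq]; ring

/-- The regularised distance. -/
def rdist (ε : ℝ) (x₀ x : P3) : ℝ := √(nsq (x - x₀) + ε ^ 2)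

theorem rdist_pos {ε : ℝ} (hε : 0 < ε) (x₀ x : P3) : 0 < rdist ε x₀ x :=
  Real.sqrt_pos.2 (by have := nsq_nonneg (x - x₀); positivity)

theorem rdist_sq (ε : ℝ) (x₀ x : P3) : rdist ε x₀ x ^ 2 = nsq (x - x₀) + ε ^ 2 :=
  sq_sqrt (by have := nsq_nonneg (x - x₀); positivity)

theorem contDiff_nsq : ContDiff ℝ (⊤ : ℕ∞) nsq := by unfold nsq; fun_prop

theorem contDiff_rdist {ε : ℝ} (hε : 0 < ε) (x₀ : P3) : ContDiff ℝ (⊤ : ℕ∞) (rdist ε x₀) := by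
  unfold rdist
  refine ContDiff.sqrt ((contDiff_nsq.comp (contDiff_id.sub contDiff_const)).add contDiff_const) ?_
  intro x
  have := nsq_nonneg (x - x₀)
  positivity

theorem contDiff_rdist_inv_pow {ε : ℝ} (hε : 0 < ε) (x₀ : P3) (n : ℕ) :
    ContDiff ℝ (⊤ : ℕ∞) fun x => (rdist ε x₀ x ^ n)⁻¹ :=
  ((contDiff_rdist hε x₀).pow n).inv fun x => (pow_pos (rdist_pos hε x₀ x) n).ne'

theorem continuous_rdist (ε : ℝ) (x₀ : P3) : Continuous (rdist ε x₀) :=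
  (((contDiff_nsq.continuous.comp (continuous_id.sub continuous_const))).add
    continuous_const).sqrt

theorem hasFDerivAt_coord_sub (j : Fin 3) (x₀ x : P3) :
    HasFDerivAt (fun y => coord j (y - x₀)) (coord j) x :=
  ((coord j).hasFDerivAt.comp x ((hasFDerivAt_id x).sub_const x₀)).congr_fderiv
    (ContinuousLinearMap.comp_id _)

theorem hasFDerivAt_nsq_sub (x₀ x : P3) :
    HasFDerivAt (fun y => nsq (y - x₀)) (∑ j, (2 * coord j (x - x₀)) • coord j) x := by
  have h : (fun y => nsq (y - x₀)) = fun y => ∑ j, coord j (y - x₀) ^ 2 :=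
    funext fun y => nsq_eq_sum _
  rw [h]
  refine HasFDerivAt.fun_sum fun j _ => ?_
  simpa using (hasFDerivAt_coord_sub j x₀ x).pow 2

theorem coord_bvec_of_ne {i j : Fin 3} (h : i ≠ j) : coord i (bvec j) = 0 := by
  fin_cases i <;> fin_cases j <;> simp_all [coord, bvec, et, ez1, ez2]

theorem fderiv_rdist_inv_pow {ε : ℝ} (hε : 0 < ε) (x₀ x : P3) (n : ℕ) (i : Fin 3) :
    fderiv ℝ (fun y => (rdist ε x₀ y ^ n)⁻¹) x (bvec i)
      = -(n * coord i (x - x₀) * (rdist ε x₀ x ^ (n + 2))⁻¹) := by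
  have hp := rdist_pos hε x₀ x
  have h1 : HasFDerivAt (rdist ε x₀) _ x :=
    ((hasFDerivAt_nsq_sub x₀ x).add_const (ε ^ 2)).sqrt (by
      have := nsq_nonneg (x - x₀); positivity)
  have h2 : HasDerivAt (fun s : ℝ => (s ^ n)⁻¹) (-(n * (rdist ε x₀ x ^ (n + 1))⁻¹))
      (rdist ε x₀ x) := by
    have := (hasDerivAt_pow n (rdist ε x₀ x)).inv (pow_pos hp n).ne'
    refine this.congr_deriv ?_
    rcases n with _ | n
    · simp
    · simp only [Nat.add_sub_cancel]
      field_simp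
      ring
  have h3 := h2.comp_hasFDerivAt x h1
  have h4 : (fun y => (rdist ε x₀ y ^ n)⁻¹) = (fun s : ℝ => (s ^ n)⁻¹) ∘ rdist ε x₀ := rfl
  rw [h4, h3.fderiv]
  have h5 : (∑ j, (2 * coord j (x - x₀)) • coord j) (bvec i) = 2 * coord i (x - x₀) := by
    rw [_root_.sum_apply, Finset.sum_eq_single i]
    · simp [coord_bvec]
    · intro j _ hj
      simp [coord_bvec_of_ne hj]
    · simp
  simp only [_root_.smul_apply, h5, smul_eq_mul]
  change -(n * (rdist ε x₀ x ^ (n + 1))⁻¹) * (1 / (2 * rdist ε x₀ x) * (2 * coord i (x - x₀))) = _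
  field_simp
  ring

variable {U : Set P3}

/-- The flat Laplacian. -/
def flap {F : Type*} [NormedAddCommGroup F] [NormedSpace ℝ F] [SmoothDomain U] :
    Sm U F →ₗ[ℝ] Sm U F :=
  ∑ i, (Sm.d (bvec i)).comp (Sm.d (bvec i))

theorem flap_eq {F : Type*} [NormedAddCommGroup F] [NormedSpace ℝ F] [SmoothDomain U]
    (f : Sm U F) : flap f = ∑ i, Sm.d (bvec i) (Sm.d (bvec i) f) := by
  simp [flap]

/-- `f` vanishes off `K`. -/
def VanishOff {V F : Type*} [Zero F] (K : Set V) (f : V → F) : Prop := ∀ x ∉ K, f x = 0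

section Compact

variable {F : Type*} [NormedAddCommGroup F] [NormedSpace ℝ F] {K : Set P3}

theorem Sm.contDiff_of_vanishOff (hU : IsOpen U) (hK : IsCompact K) (hKU : K ⊆ U) {f : Sm U F}
    (hf : VanishOff K f.1) : ContDiff ℝ (⊤ : ℕ∞) f.1 := by
  rw [contDiff_iff_contDiffAt]
  intro x
  by_cases hx : x ∈ U
  · exact f.2.1.contDiffAt (hU.mem_nhds hx)
  · have : f.1 =ᶠ[𝓝 x] fun _ => 0 := by
      filter_upwards [hK.isClosed.isOpen_compl.mem_nhds fun h => hx (hKU h)] with y hy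
        using hf y hy
    exact contDiffAt_const.congr_of_eventuallyEq this

theorem Sm.vanishOff_fderiv (hK : IsCompact K) {f : Sm U F} (hf : VanishOff K f.1) {x : P3}
    (hx : x ∉ K) : fderiv ℝ f.1 x = 0 := by
  have : f.1 =ᶠ[𝓝 x] fun _ => 0 := by
    filter_upwards [hK.isClosed.isOpen_compl.mem_nhds hx] with y hy using hf y hy
  rw [this.fderiv_eq]; simp

variable [SmoothDomain U]

theorem Sm.d_eq_fderiv (hU : IsOpen U) (hK : IsCompact K) (hKU : K ⊆ U) {f : Sm U F}
    (hf : VanishOff K f.1) (v x : P3) : (Sm.d v f).1 x = fderiv ℝ f.1 x v := by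
  by_cases hx : x ∈ U
  · exact Sm.d_apply_of_isOpen hU v f hx
  · rw [(Sm.d v f).2.2 x hx, Sm.vanishOff_fderiv hK hf fun h => hx (hKU h)]; rfl

theorem Sm.vanishOff_d (hU : IsOpen U) (hK : IsCompact K) (hKU : K ⊆ U) {f : Sm U F}
    (hf : VanishOff K f.1) (v : P3) : VanishOff K (Sm.d v f).1 := fun x hx => by
  rw [Sm.d_eq_fderiv hU hK hKU hf, Sm.vanishOff_fderiv hK hf hx]; rfl

omit [SmoothDomain U] in
theorem Sm.integrable_mul (hU : IsOpen U) (hK : IsCompact K) (hKU : K ⊆ U) {f : Sm U ℝ}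
    (hf : VanishOff K f.1) {k : P3 → ℝ} (hk : Continuous k) :
    Integrable fun x => f.1 x * k x := by
  refine Continuous.integrable_of_hasCompactSupport
    ((Sm.contDiff_of_vanishOff hU hK hKU hf).continuous.mul hk) ?_
  exact HasCompactSupport.intro hK fun x hx => by rw [hf x hx, zero_mul]

theorem Sm.integral_d_mul (hU : IsOpen U) (hK : IsCompact K) (hKU : K ⊆ U) {f : Sm U ℝ}
    (hf : VanishOff K f.1) {k : P3 → ℝ} (hk : ContDiff ℝ (⊤ : ℕ∞) k) (v : P3) :
    ∫ x, (Sm.d v f).1 x * k x = -∫ x, f.1 x * fderiv ℝ k x v := by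
  have hk' : Continuous fun x => fderiv ℝ k x v :=
    (hk.continuous_fderiv (by simp)).clm_apply continuous_const
  have h := integral_mul_fderiv_eq_neg_fderiv_mul_of_integrable (μ := volume) (f := f.1) (g := k)
    (v := v) ?_ (Sm.integrable_mul hU hK hKU hf hk') (Sm.integrable_mul hU hK hKU hf hk.continuous)
    (fun x _ => (Sm.contDiff_of_vanishOff hU hK hKU hf).differentiable (by simp) x)
    (fun x _ => hk.differentiable (by simp) x)
  · rw [h, neg_neg]
    exact integral_congr_ae (.of_forall fun x => by
      simp only [Sm.d_eq_fderiv hU hK hKU hf])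
  · refine (Sm.integrable_mul hU hK hKU (Sm.vanishOff_d hU hK hKU hf v) hk.continuous).congr
      (.of_forall fun x => by simp only [Sm.d_eq_fderiv hU hK hKU hf])

/-- The mass of the regularised Newton kernel. -/
def newtonMass : ℝ := ∫ y : P3, 3 * (√(nsq y + 1) ^ 5)⁻¹

theorem finrank_P3 : Module.finrank ℝ P3 = 3 := by simp

theorem integrable_newton : Integrable fun y : P3 => 3 * (√(nsq y + 1) ^ 5)⁻¹ := by
  refine Integrable.const_mul ?_ 3
  have h := integrable_rpow_neg_one_add_norm_sq (E := P3) (μ := volume) (r := 5)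
    (by rw [finrank_P3]; norm_num)
  refine h.mono' (Continuous.aestronglyMeasurable ?_) (.of_forall fun y => ?_)
  · refine Continuous.inv₀ ((contDiff_nsq.continuous.add continuous_const).sqrt.pow 5) fun y => ?_
    have := nsq_nonneg y
    positivity
  · have h0 := nsq_nonneg y
    have h1 := norm_sq_le_nsq y
    have h2 : √(nsq y + 1) ^ 5 = (nsq y + 1) ^ ((5 : ℝ) / 2) := by
      rw [Real.sqrt_eq_rpow, ← Real.rpow_natCast, ← Real.rpow_mul (by positivity)]; norm_num
    rw [norm_of_nonneg (by positivity), h2, neg_div, Real.rpow_neg (by positivity)]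
    rw [add_comm (nsq y)]
    gcongr

theorem newtonMass_pos : 0 < newtonMass := by
  unfold newtonMass
  rw [integral_pos_iff_support_of_nonneg (fun y => by have := nsq_nonneg y; positivity)
    integrable_newton]
  have : Function.support (fun y : P3 => 3 * (√(nsq y + 1) ^ 5)⁻¹) = univ := by
    refine eq_univ_of_forall fun y => ?_
    have := nsq_nonneg y
    exact (by positivity : (0 : ℝ) < 3 * (√(nsq y + 1) ^ 5)⁻¹).ne'
  rw [this]
  simp

theorem Sm.integral_flap_mul (hU : IsOpen U) (hK : IsCompact K) (hKU : K ⊆ U) {f : Sm U ℝ}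
    (hf : VanishOff K f.1) {ε : ℝ} (hε : 0 < ε) (x₀ : P3) :
    -∫ x, (flap f).1 x * (rdist ε x₀ x)⁻¹
      = ∫ x, f.1 x * (3 * ε ^ 2 * (rdist ε x₀ x ^ 5)⁻¹) := by
  have hd := fun v => Sm.vanishOff_d hU hK hKU hf v
  have hdd := fun v w => Sm.vanishOff_d hU hK hKU (hd v) w
  have hk1 : ContDiff ℝ (⊤ : ℕ∞) fun x => (rdist ε x₀ x)⁻¹ := by
    simpa using contDiff_rdist_inv_pow hε x₀ 1
  have hk3 := contDiff_rdist_inv_pow hε x₀ 3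
  have hk5 := contDiff_rdist_inv_pow hε x₀ 5
  have hco : ∀ i, ContDiff ℝ (⊤ : ℕ∞) fun x => coord i (x - x₀) := fun i =>
    (coord i).contDiff.comp (contDiff_id.sub contDiff_const)
  have e1 : ∀ x i, fderiv ℝ (fun x => (rdist ε x₀ x)⁻¹) x (bvec i)
      = -(coord i (x - x₀) * (rdist ε x₀ x ^ 3)⁻¹) := fun x i => by
    simpa using fderiv_rdist_inv_pow hε x₀ x 1 i
  have e2 : ∀ x i, fderiv ℝ (fun x => -(coord i (x - x₀) * (rdist ε x₀ x ^ 3)⁻¹)) x (bvec i)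
      = -((rdist ε x₀ x ^ 3)⁻¹ - 3 * coord i (x - x₀) ^ 2 * (rdist ε x₀ x ^ 5)⁻¹) := by
    intro x i
    have h1 := hasFDerivAt_coord_sub i x₀ x
    have h2 := ((hk3.differentiable (by simp)) x).hasFDerivAt
    rw [((h1.fun_mul h2).fun_neg).fderiv]
    simp only [_root_.neg_apply, _root_.add_apply,
      _root_.smul_apply, coord_bvec, fderiv_rdist_inv_pow hε x₀ x 3 i, smul_eq_mul]
    push_cast
    ring
  have hI : ∀ i, ∫ x, (Sm.d (bvec i) (Sm.d (bvec i) f)).1 x * (rdist ε x₀ x)⁻¹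
      = ∫ x, f.1 x * -((rdist ε x₀ x ^ 3)⁻¹ - 3 * coord i (x - x₀) ^ 2 * (rdist ε x₀ x ^ 5)⁻¹) := by
    intro i
    rw [Sm.integral_d_mul hU hK hKU (hd (bvec i)) hk1]
    simp only [e1]
    rw [Sm.integral_d_mul hU hK hKU hf ((hco i).mul hk3).neg, neg_neg]
    simp only [e2]
  have hint : ∀ i, Integrable fun x => f.1 x *
      -((rdist ε x₀ x ^ 3)⁻¹ - 3 * coord i (x - x₀) ^ 2 * (rdist ε x₀ x ^ 5)⁻¹) := fun i =>
    Sm.integrable_mul hU hK hKU hf (hk3.continuous.sub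
      ((continuous_const.mul ((hco i).continuous.pow 2)).mul hk5.continuous)).neg
  rw [flap_eq]
  simp only [Sm.sum_apply, sum_mul]
  rw [integral_finsetSum _ fun i _ => Sm.integrable_mul hU hK hKU (hdd _ _) hk1.continuous,
    sum_congr rfl fun i _ => hI i, ← integral_finsetSum _ fun i _ => hint i,
    ← integral_neg]
  refine integral_congr_ae (.of_forall fun x => ?_)
  simp only
  have hp := rdist_pos hε x₀ x
  have hs := rdist_sq ε x₀ x
  rw [nsq_eq_sum] at hs
  have h3 : (rdist ε x₀ x ^ 3)⁻¹ = rdist ε x₀ x ^ 2 * (rdist ε x₀ x ^ 5)⁻¹ := by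
    field_simp
  rw [← mul_sum, h3, hs]
  simp only [Fin.sum_univ_three]
  ring

theorem Sm.tendsto_integral_flap (hU : IsOpen U) (hK : IsCompact K) (hKU : K ⊆ U) {f : Sm U ℝ}
    (hf : VanishOff K f.1) (x₀ : P3) :
    Tendsto (fun ε => -∫ x, (flap f).1 x * (rdist ε x₀ x)⁻¹) (𝓝[>] 0)
      (𝓝 (newtonMass * f.1 x₀)) := by
  have hc := (Sm.contDiff_of_vanishOff hU hK hKU hf).continuous
  have key : ∀ ε : ℝ, 0 < ε → -∫ x, (flap f).1 x * (rdist ε x₀ x)⁻¹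
      = ∫ y, f.1 (x₀ + ε • y) * (3 * (√(nsq y + 1) ^ 5)⁻¹) := by
    intro ε hε
    rw [Sm.integral_flap_mul hU hK hKU hf hε,
      ← integral_add_left_eq_self _ x₀]
    have h := Measure.integral_comp_smul (volume : Measure P3)
      (fun x => f.1 (x₀ + x) * (3 * ε ^ 2 * (rdist ε x₀ (x₀ + x) ^ 5)⁻¹)) ε
    rw [finrank_P3, abs_of_pos (by positivity), smul_eq_mul,
      eq_inv_mul_iff_mul_eq₀ (by positivity : (ε ^ 3 : ℝ) ≠ 0)] at h
    rw [← h, ← integral_const_mul]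
    refine integral_congr_ae (.of_forall fun y => ?_)
    simp only
    have h1 : rdist ε x₀ (x₀ + ε • y) = ε * √(nsq y + 1) := by
      unfold rdist
      rw [add_sub_cancel_left, nsq_smul, ← mul_add_one, Real.sqrt_mul (sq_nonneg ε),
        Real.sqrt_sq hε.le]
    have h2 : 0 < √(nsq y + 1) := Real.sqrt_pos.2 (by have := nsq_nonneg y; positivity)
    rw [h1]
    field_simp
  obtain ⟨C, hC⟩ := hc.bounded_above_of_compact_support
    (HasCompactSupport.intro hK fun x hx => hf x hx)
  have hlim : Tendsto (fun ε : ℝ => ∫ y, f.1 (x₀ + ε • y) * (3 * (√(nsq y + 1) ^ 5)⁻¹)) (𝓝[>] 0)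
      (𝓝 (∫ y, f.1 x₀ * (3 * (√(nsq y + 1) ^ 5)⁻¹))) := by
    refine tendsto_integral_filter_of_dominated_convergence
      (fun y => C * (3 * (√(nsq y + 1) ^ 5)⁻¹)) ?_ ?_ (integrable_newton.const_mul C) ?_
    · refine .of_forall fun ε => ?_
      exact (hc.comp (by fun_prop)).aestronglyMeasurable.mul
        integrable_newton.aestronglyMeasurable
    · refine .of_forall fun ε => .of_forall fun y => ?_
      have := nsq_nonneg y
      rw [norm_mul, norm_of_nonneg (by positivity : 0 ≤ 3 * (√(nsq y + 1) ^ 5)⁻¹)]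
      gcongr
      exact hC _
    · refine .of_forall fun y => Tendsto.mul_const _ ?_
      have : Tendsto (fun ε : ℝ => x₀ + ε • y) (𝓝 0) (𝓝 (x₀ + (0 : ℝ) • y)) :=
        (continuous_const.add (continuous_id.smul continuous_const)).tendsto 0
      rw [zero_smul, add_zero] at this
      exact (hc.tendsto x₀).comp (this.mono_left nhdsWithin_le_nhds)
  rw [integral_const_mul, mul_comm] at hlim
  refine hlim.congr' ?_
  filter_upwards [self_mem_nhdsWithin] with ε hε using (key ε hε).symm

end Compact

end NewtonKernel

section Connection

/-- Three-dimensional Euclidean space, identified with `su(2)` by `toM`. -/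
abbrev E3 := EuclideanSpace ℝ (Fin 3)

/-- The Lie bracket of `su(2)` in coordinates. -/
def br : E3 →L[ℝ] E3 →L[ℝ] E3 :=
  LinearMap.toContinuousBilinearMap (LinearMap.mk₂ ℝ
    (fun a b : E3 => (!₂[-2 * (a 1 * b 2 - a 2 * b 1), -2 * (a 2 * b 0 - a 0 * b 2),
      -2 * (a 0 * b 1 - a 1 * b 0)] : E3))
    (fun a b c => by ext i; fin_cases i <;> simp <;> ring)
    (fun r a b => by ext i; fin_cases i <;> simp <;> ring)
    (fun a b c => by ext i; fin_cases i <;> simp <;> ring)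
    (fun r a b => by ext i; fin_cases i <;> simp <;> ring))

theorem br_apply (a b : E3) : br a b = !₂[-2 * (a 1 * b 2 - a 2 * b 1),
    -2 * (a 2 * b 0 - a 0 * b 2), -2 * (a 0 * b 1 - a 1 * b 0)] := rfl

theorem br_skew (a b : E3) : br a b = -br b a := by
  ext i; fin_cases i <;> simp [br_apply] <;> ring

theorem br_jacobi (a b c : E3) : br a (br b c) = br (br a b) c + br b (br a c) := by
  ext i; fin_cases i <;> simp [br_apply] <;> ring

theorem inner_br (a b c : E3) : inner ℝ (br a b) c = -inner ℝ b (br a c) := by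
  simp [br_apply, PiLp.inner_apply, Fin.sum_univ_three]; ring

theorem norm_br_le (a b : E3) : ‖br a b‖ ≤ 2 * ‖a‖ * ‖b‖ := by
  have h : ‖br a b‖ ^ 2 ≤ (2 * ‖a‖ * ‖b‖) ^ 2 := by
    rw [mul_pow, mul_pow, EuclideanSpace.norm_sq_eq, EuclideanSpace.norm_sq_eq,
      EuclideanSpace.norm_sq_eq]
    simp only [br_apply, Fin.sum_univ_three, norm_eq_abs, sq_abs]
    simp
    nlinarith [sq_nonneg (a 0 * b 0 + a 1 * b 1 + a 2 * b 2)]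
  exact le_of_sq_le_sq h (by positivity)

variable {V : Type*} [NormedAddCommGroup V] [NormedSpace ℝ V] {Ω : Set V}

/-- The pointwise Lie bracket. -/
def lb : Sm Ω E3 →ₗ[ℝ] Sm Ω E3 →ₗ[ℝ] Sm Ω E3 :=
  LinearMap.mk₂ ℝ (Sm.bil br)
    (fun a b c => Sm.ext_on fun x _ => by simp)
    (fun r a b => Sm.ext_on fun x _ => by simp)
    (fun a b c => Sm.ext_on fun x _ => by simp)
    (fun r a b => Sm.ext_on fun x _ => by simp)

/-- The pointwise inner product. -/
def ip : Sm Ω E3 →ₗ[ℝ] Sm Ω E3 →ₗ[ℝ] Sm Ω ℝ :=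
  LinearMap.mk₂ ℝ (Sm.bil (innerSL ℝ))
    (fun a b c => Sm.ext_on fun x _ => by simp)
    (fun r a b => Sm.ext_on fun x _ => by simp)
    (fun a b c => Sm.ext_on fun x _ => by simp)
    (fun r a b => Sm.ext_on fun x _ => by simp)

@[simp] theorem lb_apply (f g : Sm Ω E3) (x : V) : (lb f g).1 x = br (f.1 x) (g.1 x) := rfl

@[simp] theorem ip_apply (f g : Sm Ω E3) (x : V) : (ip f g).1 x = inner ℝ (f.1 x) (g.1 x) := rfl

theorem lb_skew (f g : Sm Ω E3) : lb f g = -lb g f :=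
  Sm.ext_on fun _ _ => br_skew _ _

theorem lb_jacobi (f g h : Sm Ω E3) : lb f (lb g h) = lb (lb f g) h + lb g (lb f h) :=
  Sm.ext_on fun _ _ => br_jacobi _ _ _

theorem ip_lb (f g h : Sm Ω E3) : ip (lb f g) h = -ip g (lb f h) :=
  Sm.ext_on fun _ _ => inner_br _ _ _

theorem ip_comm (f g : Sm Ω E3) : ip f g = ip g f :=
  Sm.ext_on fun x _ => by simp only [ip_apply, real_inner_comm]

variable [SmoothDomain Ω]

theorem d_lb (v : V) (f g : Sm Ω E3) : Sm.d v (lb f g) = lb (Sm.d v f) g + lb f (Sm.d v g) :=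
  Sm.d_bil v br f g

theorem d_ip' (v : V) (f g : Sm Ω E3) : Sm.d v (ip f g) = ip (Sm.d v f) g + ip f (Sm.d v g) :=
  Sm.d_bil v (innerSL ℝ) f g

/-- Covariant derivative along `e i` with connection coefficient `c i`. -/
def covD (e : Fin 6 → V) (c : Fin 6 → Sm Ω E3) (i : Fin 6) : Sm Ω E3 →ₗ[ℝ] Sm Ω E3 :=
  Sm.d (e i) + lb (c i)

/-- Curvature coefficients. -/
def curv (e : Fin 6 → V) (c : Fin 6 → Sm Ω E3) (i j : Fin 6) : Sm Ω E3 :=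
  Sm.d (e i) (c j) - Sm.d (e j) (c i) + lb (c i) (c j)

/-- The covariant Laplacian (a nonpositive operator). -/
def covL (e : Fin 6 → V) (c : Fin 6 → Sm Ω E3) : Sm Ω E3 →ₗ[ℝ] Sm Ω E3 :=
  ∑ i, (covD e c i).comp (covD e c i)

variable (e : Fin 6 → V) (c : Fin 6 → Sm Ω E3)

theorem covD_eq (i : Fin 6) (f : Sm Ω E3) : covD e c i f = Sm.d (e i) f + lb (c i) f := rfl

theorem covL_eq (f : Sm Ω E3) : covL e c f = ∑ i, covD e c i (covD e c i f) := by
  simp [covL]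

theorem covD_lb (i : Fin 6) (f g : Sm Ω E3) :
    covD e c i (lb f g) = lb (covD e c i f) g + lb f (covD e c i g) := by
  simp only [covD_eq, d_lb, map_add, LinearMap.add_apply]
  rw [lb_jacobi (c i) f g]
  abel

theorem d_ip (i : Fin 6) (f g : Sm Ω E3) :
    Sm.d (e i) (ip f g) = ip (covD e c i f) g + ip f (covD e c i g) := by
  simp only [covD_eq, d_ip', map_add, LinearMap.add_apply]
  rw [ip_lb (c i) f g]
  abel

theorem covD_comm (i j : Fin 6) (f : Sm Ω E3) :
    covD e c j (covD e c i f) = covD e c i (covD e c j f) + lb (curv e c j i) f := by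
  simp only [covD_eq, curv, d_lb, map_add, map_sub, LinearMap.add_apply, LinearMap.sub_apply,
    Sm.d_comm (e j) (e i)]
  rw [lb_jacobi (c j) (c i) f]
  abel

theorem covL_covD (i : Fin 6) (f : Sm Ω E3) :
    covL e c (covD e c i f) = covD e c i (covL e c f)
      + ∑ j, (lb (curv e c j i) (covD e c j f) + covD e c j (lb (curv e c j i) f)) := by
  simp only [covL_eq, map_sum, ← sum_add_distrib]
  refine sum_congr rfl fun j _ => ?_
  rw [covD_comm e c i j f, map_add, covD_comm e c i j (covD e c j f)]
  abel

theorem sum_d_d_ip (f : Sm Ω E3) :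
    ∑ i, Sm.d (e i) (Sm.d (e i) (ip f f))
      = (2 : ℝ) • (∑ i, ip (covD e c i f) (covD e c i f)) + (2 : ℝ) • ip f (covL e c f) := by
  rw [covL_eq, map_sum, ← smul_add, ← sum_add_distrib, smul_sum]
  refine sum_congr rfl fun i _ => ?_
  rw [d_ip e c i, map_add, d_ip e c i, d_ip e c i, ip_comm (covD e c i (covD e c i f)) f, two_smul]
  abel

/-- The squared norm of the full covariant derivative. -/
def gradSq (f : Sm Ω E3) : Sm Ω ℝ := ∑ i, ip (covD e c i f) (covD e c i f)

theorem gradSq_apply (f : Sm Ω E3) (x : V) :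
    (gradSq e c f).1 x = ∑ i, ‖(covD e c i f).1 x‖ ^ 2 := by
  simp [gradSq]

/-- The vector field whose divergence collects the uncontrolled terms of `Δ|∇f|²`. -/
def fluxY (f : Sm Ω E3) (j : Fin 6) : Sm Ω ℝ :=
  ip (covD e c j f) (covL e c f) + ∑ i, ip (covD e c i f) (lb (curv e c j i) f)

theorem sum_d_d_gradSq (f : Sm Ω E3) :
    ∑ j, Sm.d (e j) (Sm.d (e j) (gradSq e c f))
      = (2 : ℝ) • (∑ i, gradSq e c (covD e c i f)) + (2 : ℝ) • ∑ j, Sm.d (e j) (fluxY e c f j)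
        - (2 : ℝ) • ip (covL e c f) (covL e c f)
        + (2 : ℝ) • ∑ i, ∑ j, (ip (covD e c i f) (lb (curv e c j i) (covD e c j f))
            - ip (covD e c j (covD e c i f)) (lb (curv e c j i) f)) := by
  have h1 : ∑ j, Sm.d (e j) (Sm.d (e j) (gradSq e c f))
      = ∑ i, ∑ j, Sm.d (e j) (Sm.d (e j) (ip (covD e c i f) (covD e c i f))) := by
    simp only [gradSq, map_sum]
    exact Finset.sum_comm
  have h2 : ∑ i, ip (covD e c i f) (covL e c (covD e c i f))
      = ∑ j, Sm.d (e j) (fluxY e c f j) - ip (covL e c f) (covL e c f)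
        + ∑ i, ∑ j, (ip (covD e c i f) (lb (curv e c j i) (covD e c j f))
            - ip (covD e c j (covD e c i f)) (lb (curv e c j i) f)) := by
    have h3 : ∑ j, Sm.d (e j) (fluxY e c f j)
        = ip (covL e c f) (covL e c f) + ∑ i, (ip (covD e c i f) (covD e c i (covL e c f))
          + ∑ j, (ip (covD e c j (covD e c i f)) (lb (curv e c j i) f)
            + ip (covD e c i f) (covD e c j (lb (curv e c j i) f)))) := by
      have h4 : ip (covL e c f) (covL e c f)
          = ∑ i, ip (covD e c i (covD e c i f)) (covL e c f) := by
        have h5 : ∀ h, ip (covL e c f) h = ∑ i, ip (covD e c i (covD e c i f)) h := fun h => by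
          rw [covL_eq, map_sum, LinearMap.sum_apply]
        exact h5 _
      simp only [fluxY, map_add, map_sum, d_ip e c]
      rw [h4]
      simp only [sum_add_distrib]
      rw [Finset.sum_comm (f := fun i j => ip (covD e c i (covD e c j f)) (lb (curv e c i j) f)),
        Finset.sum_comm (f := fun i j => ip (covD e c j f) (covD e c i (lb (curv e c i j) f)))]
      abel
    rw [h3]
    simp only [covL_covD, map_add, map_sum, sum_add_distrib, Finset.sum_sub_distrib]
    abel
  rw [h1]
  simp only [sum_d_d_ip e c, sum_add_distrib, ← smul_sum, h2, gradSq]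
  rw [smul_add, smul_sub]
  abel

end Connection

section Cutoff

variable {V : Type*} [NormedAddCommGroup V] [NormedSpace ℝ V] {Ω : Set V}
variable {F : Type*} [NormedAddCommGroup F] [NormedSpace ℝ F]

/-- Pointwise multiplication by a scalar function. -/
def scal : Sm Ω ℝ →ₗ[ℝ] Sm Ω F →ₗ[ℝ] Sm Ω F :=
  LinearMap.mk₂ ℝ (Sm.bil (ContinuousLinearMap.lsmul ℝ ℝ))
    (fun a b c => Sm.ext_on fun x _ => by simp)
    (fun r a b => Sm.ext_on fun x _ => by simp [mul_smul])
    (fun a b c => Sm.ext_on fun x _ => by simp)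
    (fun r a b => Sm.ext_on fun x _ => by simp [smul_comm r])

@[simp] theorem scal_apply (f : Sm Ω ℝ) (g : Sm Ω F) (x : V) :
    (scal f g).1 x = f.1 x • g.1 x := rfl

theorem d_scal [SmoothDomain Ω] (v : V) (f : Sm Ω ℝ) (g : Sm Ω F) :
    Sm.d v (scal f g) = scal (Sm.d v f) g + scal f (Sm.d v g) :=
  Sm.d_bil v (ContinuousLinearMap.lsmul ℝ ℝ) f g

/-- The six directions: three coordinate vectors followed by three zeros. -/
def dir : Fin 6 → P3 := ![et, ez1, ez2, 0, 0, 0]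

theorem flap_eq_sum_dir (f : Sm Hsp F) : flap f = ∑ i, Sm.d (dir i) (Sm.d (dir i) f) := by
  rw [flap_eq, Fin.sum_univ_three, Fin.sum_univ_six]
  simp [dir, bvec, Sm.d_zero_dir]

theorem flap_scal (f : Sm Hsp ℝ) (g : Sm Hsp F) :
    flap (scal f g) = scal f (flap g) + (2 : ℝ) • (∑ i, scal (Sm.d (dir i) f) (Sm.d (dir i) g))
      + scal (flap f) g := by
  simp only [flap_eq_sum_dir, d_scal, map_add, map_sum, smul_sum, LinearMap.sum_apply,
    two_smul, ← sum_add_distrib]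
  refine sum_congr rfl fun i _ => ?_
  abel

theorem dir_eq_zero_or (i : Fin 6) : dir i = 0 ∨ ∃ j, dir i = bvec j := by
  fin_cases i
  · exact .inr ⟨0, rfl⟩
  · exact .inr ⟨1, rfl⟩
  · exact .inr ⟨2, rfl⟩
  all_goals exact .inl rfl

theorem norm_bvec_le (j : Fin 3) : ‖bvec j‖ ≤ 1 := by
  fin_cases j <;> simp [bvec, et, ez1, ez2]

theorem norm_dir_le (i : Fin 6) : ‖dir i‖ ≤ 1 := by
  rcases dir_eq_zero_or i with h | ⟨j, h⟩ <;> rw [h]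
  · simp
  · exact norm_bvec_le j

theorem fderiv_rescale {k : P3 → ℝ} (hk : Differentiable ℝ k) (a : ℝ) (x₀ x v : P3) :
    fderiv ℝ (fun x => k (a • (x - x₀))) x v = a * fderiv ℝ k (a • (x - x₀)) v := by
  have h1 : HasFDerivAt (fun x : P3 => a • (x - x₀)) (a • ContinuousLinearMap.id ℝ P3) x :=
    ((hasFDerivAt_id x).sub_const x₀).const_smul a
  have h2 := (hk (a • (x - x₀))).hasFDerivAt.comp x h1
  rw [show (fun x => k (a • (x - x₀))) = k ∘ fun x => a • (x - x₀) from rfl, h2.fderiv]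
  simp

/-- Smooth cutoff functions at every scale, with scale-invariant bounds. -/
theorem exists_cutoff : ∃ C : ℝ, 0 < C ∧ ∀ (x₀ : P3) (ρ : ℝ), 0 < ρ → ∃ ζ : Sm Hsp ℝ,
    (∀ x, 0 ≤ ζ.1 x ∧ ζ.1 x ≤ 1) ∧ (∀ x ∈ Hsp, ‖x - x₀‖ ≤ ρ → ζ.1 x = 1) ∧
    VanishOff (closedBall x₀ (2 * ρ)) ζ.1 ∧
    (∀ x i, ((Sm.d (dir i) ζ).1 x) ^ 2 ≤ C / ρ ^ 2 * ζ.1 x) ∧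
    (∀ x, |(flap ζ).1 x| ≤ C / ρ ^ 2) := by
  let b : ContDiffBump (0 : P3) := ⟨1, 2, by norm_num, by norm_num⟩
  have hb : ContDiff ℝ (⊤ : ℕ∞) b := b.contDiff
  have hbs : HasCompactSupport b := b.hasCompactSupport
  let η : P3 → ℝ := fun y => b y ^ 2
  have hη : ContDiff ℝ (⊤ : ℕ∞) η := hb.pow 2
  have hηd : ∀ v, ContDiff ℝ (⊤ : ℕ∞) fun y => fderiv ℝ η y v := fun v =>
    (hη.fderiv_right (by simp)).clm_apply contDiff_const
  have hηs : HasCompactSupport η :=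
    hbs.comp_left (g := fun t : ℝ => t ^ 2) (by simp)
  obtain ⟨C₁, hC₁⟩ := (hb.continuous_fderiv (by simp)).bounded_above_of_compact_support
    (hbs.fderiv ℝ)
  have hdds : ∀ v, HasCompactSupport fun y => fderiv ℝ (fun y => fderiv ℝ η y v) y v :=
    fun v => by
      have h1 : HasCompactSupport fun y => fderiv ℝ η y v :=
        (hηs.fderiv ℝ).comp_left (g := fun l : P3 →L[ℝ] ℝ => l v) (by simp)
      exact (h1.fderiv ℝ).comp_left (g := fun l : P3 →L[ℝ] ℝ => l v) (by simp)
  have hex : ∀ i, ∃ C, ∀ y, |fderiv ℝ (fun y => fderiv ℝ η y (dir i)) y (dir i)| ≤ C := fun i =>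
    (((hηd (dir i)).continuous_fderiv (by simp)).clm_apply
      continuous_const).bounded_above_of_compact_support (hdds _)
  choose C₂ hC₂ using hex
  have hC₁0 : 0 ≤ C₁ := (norm_nonneg _).trans (hC₁ 0)
  have hC₂0 : ∀ i, 0 ≤ C₂ i := fun i => (abs_nonneg _).trans (hC₂ i 0)
  have hη1 : ∀ y i, (fderiv ℝ η y (dir i)) ^ 2 ≤ 4 * C₁ ^ 2 * η y := by
    intro y i
    have h1 : fderiv ℝ η y = (2 * b y) • fderiv ℝ b y := by
      have := ((hb.differentiable (by simp) y).hasFDerivAt.pow 2).fderiv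
      simpa using this
    have h2 : |fderiv ℝ b y (dir i)| ≤ C₁ := by
      refine ((fderiv ℝ b y).le_opNorm _).trans ?_
      exact (mul_le_of_le_one_right (norm_nonneg _) (norm_dir_le i)).trans (hC₁ y)
    rw [h1, _root_.smul_apply, smul_eq_mul, mul_pow, mul_pow]
    have h3 : (fderiv ℝ b y (dir i)) ^ 2 ≤ C₁ ^ 2 := sq_le_sq.2 (by rwa [abs_of_nonneg hC₁0])
    have h4 : 0 ≤ b y ^ 2 := sq_nonneg _
    change 2 ^ 2 * b y ^ 2 * _ ≤ 4 * C₁ ^ 2 * b y ^ 2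
    nlinarith
  refine ⟨4 * C₁ ^ 2 + ∑ i, C₂ i + 1, by
    have := sum_nonneg fun i (_ : i ∈ Finset.univ) => hC₂0 i
    positivity, fun x₀ ρ hρ => ?_⟩
  have hS := sum_nonneg fun i (_ : i ∈ Finset.univ) => hC₂0 i
  have hsc : ∀ k : P3 → ℝ, ContDiff ℝ (⊤ : ℕ∞) k →
      ContDiffOn ℝ (⊤ : ℕ∞) (fun x => k (ρ⁻¹ • (x - x₀))) Hsp := fun k hk =>
    (hk.comp (by fun_prop : ContDiff ℝ (⊤ : ℕ∞) fun x : P3 => ρ⁻¹ • (x - x₀))).contDiffOn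
  let ζ : Sm Hsp ℝ := Sm.ofContDiffOn (fun x => η (ρ⁻¹ • (x - x₀))) (hsc η hη)
  have hζ : ∀ x ∈ Hsp, ζ.1 x = η (ρ⁻¹ • (x - x₀)) := fun x hx => Sm.ofContDiffOn_apply _ hx
  have hd1 : ∀ i, Sm.d (dir i) ζ = ρ⁻¹ • Sm.ofContDiffOn
      (fun x => fderiv ℝ η (ρ⁻¹ • (x - x₀)) (dir i)) (hsc _ (hηd _)) := fun i =>
    Sm.ext_on fun x hx => by
      rw [Sm.d_ofContDiffOn isOpen_Hsp _ _ hx, fderiv_rescale (hη.differentiable (by simp)),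
        Sm.smul_apply, Sm.ofContDiffOn_apply _ hx, smul_eq_mul]
  have hd2 : ∀ i x, x ∈ Hsp → (Sm.d (dir i) (Sm.d (dir i) ζ)).1 x
      = ρ⁻¹ * (ρ⁻¹ * fderiv ℝ (fun y => fderiv ℝ η y (dir i)) (ρ⁻¹ • (x - x₀)) (dir i)) := by
    intro i x hx
    rw [hd1 i, map_smul, Sm.smul_apply, Sm.d_ofContDiffOn isOpen_Hsp _ _ hx,
      fderiv_rescale ((hηd _).differentiable (by simp)), smul_eq_mul]
  have hnorm : ∀ x, ‖ρ⁻¹ • (x - x₀)‖ = ‖x - x₀‖ / ρ := fun x => by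
    rw [norm_smul, norm_inv, norm_of_nonneg hρ.le, inv_mul_eq_div]
  refine ⟨ζ, fun x => ?_, fun x hx hxρ => ?_, fun x hx => ?_, fun x i => ?_, fun x => ?_⟩
  · by_cases hx : x ∈ Hsp
    · rw [hζ x hx]
      exact ⟨sq_nonneg _, pow_le_one₀ b.nonneg b.le_one⟩
    · rw [ζ.2.2 x hx]; simp
  · rw [hζ x hx]
    have : b (ρ⁻¹ • (x - x₀)) = 1 := b.one_of_mem_closedBall (by
      rw [mem_closedBall_zero_iff, hnorm]; exact (div_le_one hρ).2 hxρ)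
    change b _ ^ 2 = 1
    rw [this, one_pow]
  · by_cases hx' : x ∈ Hsp
    · rw [hζ x hx']
      have : b (ρ⁻¹ • (x - x₀)) = 0 := b.zero_of_le_dist (by
        rw [dist_zero_right, hnorm, le_div_iff₀ hρ]
        rw [Metric.mem_closedBall, dist_eq_norm, not_le] at hx
        exact hx.le)
      change b _ ^ 2 = 0
      rw [this]; simp
    · exact ζ.2.2 x hx'
  · by_cases hx : x ∈ Hsp
    · rw [hd1 i, Sm.smul_apply, Sm.ofContDiffOn_apply _ hx, hζ x hx, smul_eq_mul, mul_pow, inv_pow,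
        div_mul_eq_mul_div, inv_mul_eq_div]
      gcongr
      refine (hη1 _ i).trans ?_
      have : 0 ≤ η (ρ⁻¹ • (x - x₀)) := sq_nonneg _
      gcongr
      linarith
    · rw [(Sm.d (dir i) ζ).2.2 x hx, ζ.2.2 x hx]; simp
  · by_cases hx : x ∈ Hsp
    · rw [flap_eq_sum_dir, Sm.sum_apply]
      calc |∑ i, (Sm.d (dir i) (Sm.d (dir i) ζ)).1 x|
          ≤ ∑ i, |(Sm.d (dir i) (Sm.d (dir i) ζ)).1 x| := abs_sum_le_sum_abs _ _
        _ ≤ ∑ i, C₂ i / ρ ^ 2 := sum_le_sum fun i _ => by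
            rw [hd2 i x hx, ← mul_assoc, abs_mul, abs_of_pos (by positivity : 0 < ρ⁻¹ * ρ⁻¹),
              div_eq_inv_mul, pow_two, mul_inv]
            gcongr
            exact hC₂ i _
        _ ≤ _ := by
            rw [← Finset.sum_div]
            gcongr
            nlinarith [sq_nonneg C₁]
    · rw [(flap ζ).2.2 x hx]; simp; positivity

end Cutoff

section GradientEstimate

/-- The inverse square kernel truncated to a ball (of the sup norm). -/
def trunc (x₀ : P3) (ρ : ℝ) (x : P3) : ℝ := (Iic ρ).indicator (fun y => (y ^ 2)⁻¹) ‖x - x₀‖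

theorem trunc_of_le {x₀ x : P3} {ρ : ℝ} (h : ‖x - x₀‖ ≤ ρ) :
    trunc x₀ ρ x = (‖x - x₀‖ ^ 2)⁻¹ :=
  indicator_of_mem (s := Iic ρ) h _

theorem trunc_nonneg (x₀ : P3) (ρ : ℝ) (x : P3) : 0 ≤ trunc x₀ ρ x :=
  indicator_nonneg (fun _ _ => by positivity) _

theorem eqOn_trunc_radial (ρ : ℝ) : EqOn (fun y : ℝ => y ^ (Module.finrank ℝ P3 - 1) •
      (Iic ρ).indicator (fun y => (y ^ 2)⁻¹) y) ((Iic ρ).indicator fun _ => 1) (Ioi 0) := by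
  intro y hy
  have hy' : (0 : ℝ) < y := hy
  rw [finrank_P3]
  by_cases h : y ∈ Iic ρ
  · simp only [indicator_of_mem h, smul_eq_mul]
    norm_num
    field_simp
  · simp [indicator_of_notMem h]

theorem integrable_trunc (x₀ : P3) (ρ : ℝ) : Integrable (trunc x₀ ρ) := by
  refine Integrable.comp_sub_right (f := fun x : P3 => (Iic ρ).indicator (fun y => (y ^ 2)⁻¹) ‖x‖)
    ?_ x₀
  rw [integrable_fun_norm_addHaar (volume : Measure P3)
    (f := (Iic ρ).indicator (fun y => (y ^ 2)⁻¹)),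
    integrableOn_congr_fun (eqOn_trunc_radial ρ) measurableSet_Ioi,
    integrableOn_indicator_iff measurableSet_Iic, Iic_inter_Ioi]
  exact integrableOn_const (by simp)

theorem exists_integral_trunc : ∃ C : ℝ, 0 < C ∧ ∀ (x₀ : P3) (ρ : ℝ), 0 ≤ ρ →
    ∫ x, trunc x₀ ρ x ≤ C * ρ := by
  refine ⟨3 * volume.real (ball (0 : P3) 1) + 1, by positivity, fun x₀ ρ hρ => ?_⟩
  have h : ∫ x, trunc x₀ ρ x = ∫ x : P3, (Iic ρ).indicator (fun y => (y ^ 2)⁻¹) ‖x‖ :=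
    integral_sub_right_eq_self (fun x : P3 => (Iic ρ).indicator (fun y => (y ^ 2)⁻¹) ‖x‖) x₀
  rw [h, integral_fun_norm_addHaar (volume : Measure P3)
    (f := (Iic ρ).indicator (fun y => (y ^ 2)⁻¹)), setIntegral_congr_fun measurableSet_Ioi
    (eqOn_trunc_radial ρ), setIntegral_indicator measurableSet_Iic, Ioi_inter_Iic, finrank_P3]
  simp [hρ]
  nlinarith

theorem abs_fderiv_rdist_inv_le {ε : ℝ} (hε : 0 < ε) (x₀ x : P3) (i : Fin 6) :
    |fderiv ℝ (fun y => (rdist ε x₀ y)⁻¹) x (dir i)| ≤ (rdist ε x₀ x ^ 2)⁻¹ := by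
  have hp := rdist_pos hε x₀ x
  rcases dir_eq_zero_or i with h | ⟨j, h⟩ <;> rw [h]
  · simp; positivity
  · have h1 := fderiv_rdist_inv_pow hε x₀ x 1 j
    simp only [pow_one] at h1
    rw [h1, abs_neg, abs_mul, abs_of_pos (by positivity : 0 < (rdist ε x₀ x ^ (1 + 2))⁻¹)]
    have h2 : |coord j (x - x₀)| ≤ rdist ε x₀ x :=
      (abs_coord_le_sqrt j _).trans (Real.sqrt_le_sqrt (by nlinarith))
    push_cast
    rw [one_mul]
    calc |coord j (x - x₀)| * (rdist ε x₀ x ^ (1 + 2))⁻¹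
        ≤ rdist ε x₀ x * (rdist ε x₀ x ^ (1 + 2))⁻¹ := by gcongr
      _ = _ := by field_simp

theorem norm_sub_le_rdist (ε : ℝ) (x₀ x : P3) : ‖x - x₀‖ ≤ rdist ε x₀ x :=
  le_sqrt_of_sq_le ((norm_sq_le_nsq _).trans (by nlinarith))

/-- A pointwise bound on a divergence-form representation of `Δφ` controls the value of `φ` at
the centre of a ball. -/
theorem value_le_of_flap_ge : ∃ C : ℝ, 0 < C ∧ ∀ (x₀ : P3) (ρ B B' : ℝ) (φ : Sm Hsp ℝ)
    (Y : Fin 6 → Sm Hsp ℝ), 0 < ρ → 0 ≤ B → 0 ≤ B' → closedBall x₀ ρ ⊆ Hsp →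
    VanishOff (closedBall x₀ ρ) φ.1 → (∀ j, VanishOff (closedBall x₀ ρ) (Y j).1) →
    (∀ x ∈ closedBall x₀ ρ, -B ≤ (flap φ).1 x - ∑ j, (Sm.d (dir j) (Y j)).1 x) →
    (∀ x ∈ closedBall x₀ ρ, ∀ j, |(Y j).1 x| ≤ B') →
    φ.1 x₀ ≤ C * (ρ ^ 2 * B + ρ * B') := by
  obtain ⟨C, hC, hCi⟩ := exists_integral_trunc
  have hm := newtonMass_pos
  refine ⟨6 * C / newtonMass, by positivity, fun x₀ ρ B B' φ Y hρ hB hB' hsub hφ hY h1 h2 => ?_⟩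
  have hK := isCompact_closedBall x₀ ρ
  have hdd : VanishOff (closedBall x₀ ρ) (flap φ).1 := by
    intro x hx
    rw [flap_eq, Sm.sum_apply]
    exact Finset.sum_eq_zero fun i _ =>
      Sm.vanishOff_d isOpen_Hsp hK hsub (Sm.vanishOff_d isOpen_Hsp hK hsub hφ _) _ x hx
  have hdY : ∀ j, VanishOff (closedBall x₀ ρ) (Sm.d (dir j) (Y j)).1 := fun j =>
    Sm.vanishOff_d isOpen_Hsp hK hsub (hY j) _
  have key : ∀ ε : ℝ, 0 < ε → -∫ x, (flap φ).1 x * (rdist ε x₀ x)⁻¹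
      ≤ (ρ * B + 6 * B') * (C * ρ) := by
    intro ε hε
    have hk : ContDiff ℝ (⊤ : ℕ∞) fun x => (rdist ε x₀ x)⁻¹ := by
      simpa using contDiff_rdist_inv_pow hε x₀ 1
    have hk' : ∀ j, Continuous fun x => fderiv ℝ (fun x => (rdist ε x₀ x)⁻¹) x (dir j) :=
      fun j => (hk.continuous_fderiv (by simp)).clm_apply continuous_const
    have i1 := Sm.integrable_mul isOpen_Hsp hK hsub hdd hk.continuous
    have i2 := fun j => Sm.integrable_mul isOpen_Hsp hK hsub (hdY j) hk.continuous
    have i3 := fun j => Sm.integrable_mul isOpen_Hsp hK hsub (hY j) (hk' j)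
    have e1 : -∫ x, (flap φ).1 x * (rdist ε x₀ x)⁻¹
        = ∫ x, ((-((flap φ).1 x - ∑ j, (Sm.d (dir j) (Y j)).1 x) * (rdist ε x₀ x)⁻¹)
          + ∑ j, (Y j).1 x * fderiv ℝ (fun x => (rdist ε x₀ x)⁻¹) x (dir j)) := by
      have e2 : ∫ x, ∑ j, (Sm.d (dir j) (Y j)).1 x * (rdist ε x₀ x)⁻¹
          = -∫ x, ∑ j, (Y j).1 x * fderiv ℝ (fun x => (rdist ε x₀ x)⁻¹) x (dir j) := by
        rw [integral_finsetSum _ fun j _ => i2 j, integral_finsetSum _ fun j _ => i3 j,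
          ← Finset.sum_neg_distrib]
        exact sum_congr rfl fun j _ =>
          Sm.integral_d_mul isOpen_Hsp hK hsub (hY j) hk (dir j)
      have i2s := integrable_finsetSum Finset.univ fun j (_ : j ∈ Finset.univ) => i2 j
      have i3s := integrable_finsetSum Finset.univ fun j (_ : j ∈ Finset.univ) => i3 j
      have e3 : ∀ x, -((flap φ).1 x - ∑ j, (Sm.d (dir j) (Y j)).1 x) * (rdist ε x₀ x)⁻¹
          = -((flap φ).1 x * (rdist ε x₀ x)⁻¹)
            + ∑ j, (Sm.d (dir j) (Y j)).1 x * (rdist ε x₀ x)⁻¹ := fun x => by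
        rw [← sum_mul]; ring
      simp only [e3]
      have i4 : Integrable fun x => -((flap φ).1 x * (rdist ε x₀ x)⁻¹)
          + ∑ j, (Sm.d (dir j) (Y j)).1 x * (rdist ε x₀ x)⁻¹ := i1.neg.add i2s
      have i5 : Integrable fun x => -((flap φ).1 x * (rdist ε x₀ x)⁻¹) := i1.neg
      rw [integral_add i4 i3s, integral_add i5 i2s, integral_neg, e2]
      ring
    have i6 : Integrable fun x =>
        (-((flap φ).1 x - ∑ j, (Sm.d (dir j) (Y j)).1 x) * (rdist ε x₀ x)⁻¹)
          + ∑ j, (Y j).1 x * fderiv ℝ (fun x => (rdist ε x₀ x)⁻¹) x (dir j) := by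
      have i2s := integrable_finsetSum Finset.univ fun j (_ : j ∈ Finset.univ) => i2 j
      have i3s := integrable_finsetSum Finset.univ fun j (_ : j ∈ Finset.univ) => i3 j
      refine ((i1.neg.add i2s).add i3s).congr (.of_forall fun x => ?_)
      simp only [Pi.add_apply, Pi.neg_apply]
      rw [← sum_mul]; ring
    have hne : ∀ᵐ x : P3, x ≠ x₀ := by
      rw [ae_iff]; simp
    rw [e1]
    calc _ ≤ ∫ x, (ρ * B + 6 * B') * trunc x₀ ρ x := by
          refine integral_mono_ae i6 ((integrable_trunc x₀ ρ).const_mul _) ?_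
          filter_upwards [hne] with x hx
          have hpos : 0 < ‖x - x₀‖ := norm_pos_iff.2 (sub_ne_zero.2 hx)
          have hrd := norm_sub_le_rdist ε x₀ x
          by_cases hxb : x ∈ closedBall x₀ ρ
          · have hxρ : ‖x - x₀‖ ≤ ρ := by rwa [← dist_eq_norm]
            rw [trunc_of_le hxρ, add_mul]
            refine add_le_add ?_ ?_
            · have h4 : (rdist ε x₀ x)⁻¹ ≤ ρ * (‖x - x₀‖ ^ 2)⁻¹ := by
                calc (rdist ε x₀ x)⁻¹ ≤ ‖x - x₀‖⁻¹ := by gcongr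
                  _ = ‖x - x₀‖ * (‖x - x₀‖ ^ 2)⁻¹ := by field_simp
                  _ ≤ _ := by gcongr
              calc _ ≤ B * (rdist ε x₀ x)⁻¹ := by
                    have := h1 x hxb
                    have := rdist_pos hε x₀ x
                    gcongr
                    linarith
                _ ≤ B * (ρ * (‖x - x₀‖ ^ 2)⁻¹) := by gcongr
                _ = _ := by ring
            · calc _ ≤ ∑ _j : Fin 6, B' * (‖x - x₀‖ ^ 2)⁻¹ := sum_le_sum fun j _ => by
                    refine (le_abs_self _).trans ?_
                    rw [abs_mul]
                    refine mul_le_mul (h2 x hxb j)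
                      ((abs_fderiv_rdist_inv_le hε x₀ x j).trans ?_) (abs_nonneg _) hB'
                    gcongr
                _ = _ := by simp; ring
          · have h0 : ∀ j, (Y j).1 x = 0 := fun j => hY j x hxb
            have h0' : ∀ j, (Sm.d (dir j) (Y j)).1 x = 0 := fun j => hdY j x hxb
            simp only [h0, h0', hdd x hxb]
            have := trunc_nonneg x₀ ρ x
            simp
            positivity
      _ = (ρ * B + 6 * B') * ∫ x, trunc x₀ ρ x := integral_const_mul _ _
      _ ≤ _ := by gcongr; exact hCi x₀ ρ hρ.le
  have hlim := Sm.tendsto_integral_flap isOpen_Hsp hK hsub hφ x₀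
  have h3 : newtonMass * φ.1 x₀ ≤ (ρ * B + 6 * B') * (C * ρ) :=
    le_of_tendsto hlim (by filter_upwards [self_mem_nhdsWithin] with ε hε using key ε hε)
  rw [div_mul_eq_mul_div, le_div_iff₀ hm, mul_comm]
  refine h3.trans ?_
  have : 0 ≤ C * (ρ ^ 2 * B) := by positivity
  nlinarith

end GradientEstimate

section GradientEstimate

theorem cross_term_le {z ζ a p q s : ℝ} (hz : z ^ 2 ≤ a * ζ) (hζ : 0 ≤ ζ) (ha : 0 ≤ a)
    (hs : |s| ≤ |p| * |q|) : |4 * z * s| ≤ ζ / 2 * q ^ 2 + 8 * a * p ^ 2 := by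
  refine abs_le_of_sq_le_sq ?_ (by positivity)
  have h1 : s ^ 2 ≤ p ^ 2 * q ^ 2 := by
    have := mul_self_le_mul_self (abs_nonneg _) hs
    rw [abs_mul_abs_self] at this
    nlinarith [abs_mul_abs_self p, abs_mul_abs_self q]
  calc (4 * z * s) ^ 2 = 16 * (z ^ 2 * s ^ 2) := by ring
    _ ≤ 16 * (a * ζ * (p ^ 2 * q ^ 2)) := by gcongr
    _ ≤ _ := by nlinarith [sq_nonneg (ζ / 2 * q ^ 2 - 8 * a * p ^ 2)]

variable (c : Fin 6 → Sm Hsp E3) (f : Sm Hsp E3)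

theorem flap_ip_self : flap (ip f f) = (2 : ℝ) • gradSq dir c f + (2 : ℝ) • ip f (covL dir c f) := by
  rw [flap_eq_sum_dir, sum_d_d_ip dir c f]; rfl

theorem d_gradSq (i : Fin 6) (x : P3) : (Sm.d (dir i) (gradSq dir c f)).1 x
    = ∑ k, 2 * inner ℝ ((covD dir c k f).1 x) ((covD dir c i (covD dir c k f)).1 x) := by
  rw [gradSq, map_sum, Sm.sum_apply]
  refine sum_congr rfl fun k _ => ?_
  rw [d_ip dir c, Sm.add_apply, ip_apply, ip_apply, real_inner_comm, two_mul]

theorem d_ip_self (i : Fin 6) (x : P3) : (Sm.d (dir i) (ip f f)).1 x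
    = 2 * inner ℝ (f.1 x) ((covD dir c i f).1 x) := by
  rw [d_ip dir c, Sm.add_apply, ip_apply, ip_apply, real_inner_comm, two_mul]

theorem abs_fluxY_le {x : P3} {F₀ H P Fc : ℝ} (hP0 : 0 ≤ P) (hFc0 : 0 ≤ Fc)
    (hf : ‖f.1 x‖ ≤ F₀) (hh : ‖(covL dir c f).1 x‖ ≤ H) (hP : ∀ i, ‖(covD dir c i f).1 x‖ ≤ P)
    (hF : ∀ i j, ‖(curv dir c i j).1 x‖ ≤ Fc) (j : Fin 6) :
    |(fluxY dir c f j).1 x| ≤ 12 * (P * (H + Fc * F₀)) := by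
  rw [fluxY, Sm.add_apply, Sm.sum_apply]
  have hF0 : 0 ≤ F₀ := (norm_nonneg _).trans hf
  have hH0 : 0 ≤ H := (norm_nonneg _).trans hh
  have h1 : |inner ℝ ((covD dir c j f).1 x) ((covL dir c f).1 x)| ≤ P * H :=
    (abs_real_inner_le_norm _ _).trans (mul_le_mul (hP j) hh (norm_nonneg _) hP0)
  have h2 : |∑ i, inner ℝ ((covD dir c i f).1 x) (br ((curv dir c j i).1 x) (f.1 x))|
      ≤ ∑ _i : Fin 6, P * (2 * Fc * F₀) := by
    refine (abs_sum_le_sum_abs _ _).trans (sum_le_sum fun i _ => ?_)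
    refine (abs_real_inner_le_norm _ _).trans (mul_le_mul (hP i) ?_ (norm_nonneg _) hP0)
    refine (norm_br_le _ _).trans ?_
    gcongr
    exact hF j i
  simp only [Finset.sum_const, Finset.card_univ, Fintype.card_fin, nsmul_eq_mul] at h2
  refine (abs_add_le _ _).trans ((add_le_add h1 h2).trans ?_)
  have := mul_nonneg hP0 hH0
  push_cast
  nlinarith

set_option maxHeartbeats 1000000 in
/-- Bochner inequality for the localised energy density. -/
theorem flap_cutoff_gradSq_ge (ζ : Sm Hsp ℝ) {x : P3} {a F₀ H P Fc : ℝ} (ha : 0 ≤ a)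
    (hP0 : 0 ≤ P) (hFc0 : 0 ≤ Fc) (hζ : 0 ≤ ζ.1 x ∧ ζ.1 x ≤ 1)
    (hz : ∀ i, ((Sm.d (dir i) ζ).1 x) ^ 2 ≤ a * ζ.1 x) (hfl : |(flap ζ).1 x| ≤ a)
    (hf : ‖f.1 x‖ ≤ F₀) (hh : ‖(covL dir c f).1 x‖ ≤ H) (hP : ∀ i, ‖(covD dir c i f).1 x‖ ≤ P)
    (hF : ∀ i j, ‖(curv dir c i j).1 x‖ ≤ Fc) :
    -(49 * a * (gradSq dir c f).1 x + 2 * H ^ 2 + 144 * Fc * P ^ 2 + 288 * Fc ^ 2 * F₀ ^ 2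
        + 144 * √a * (P * (H + Fc * F₀)))
      ≤ (flap (scal ζ (gradSq dir c f))).1 x
        - ∑ j, (Sm.d (dir j) ((2 : ℝ) • scal ζ (fluxY dir c f j))).1 x := by
  have hF0 : 0 ≤ F₀ := (norm_nonneg _).trans hf
  have hH0 : 0 ≤ H := (norm_nonneg _).trans hh
  obtain ⟨S, hS⟩ : ∃ S, S = (gradSq dir c f).1 x := ⟨_, rfl⟩
  obtain ⟨Q, hQ⟩ : ∃ Q, Q = ∑ i, (gradSq dir c (covD dir c i f)).1 x := ⟨_, rfl⟩
  rw [← hS]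
  have hSe : S = ∑ i, ‖(covD dir c i f).1 x‖ ^ 2 := hS.trans (gradSq_apply _ _ _ _)
  have hQe : Q = ∑ i, ∑ j, ‖(covD dir c j (covD dir c i f)).1 x‖ ^ 2 :=
    hQ.trans (sum_congr rfl fun i _ => gradSq_apply _ _ _ _)
  have hS0 : 0 ≤ S := hSe ▸ sum_nonneg fun _ _ => sq_nonneg _
  have hQ0 : 0 ≤ Q := hQe ▸ sum_nonneg fun _ _ => sum_nonneg fun _ _ => sq_nonneg _
  have e1 : (flap (scal ζ (gradSq dir c f))).1 x
      = ζ.1 x * (flap (gradSq dir c f)).1 x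
        + 2 * (∑ i, (Sm.d (dir i) ζ).1 x * (Sm.d (dir i) (gradSq dir c f)).1 x)
        + (flap ζ).1 x * S := by
    rw [flap_scal, hS]
    simp only [Sm.add_apply, Sm.smul_apply, Sm.sum_apply, scal_apply, smul_eq_mul]
  have e2 : (flap (gradSq dir c f)).1 x
      = 2 * Q + 2 * (∑ j, (Sm.d (dir j) (fluxY dir c f j)).1 x)
        - 2 * ‖(covL dir c f).1 x‖ ^ 2
        + 2 * ∑ i, ∑ j, (inner ℝ ((covD dir c i f).1 x)
              (br ((curv dir c j i).1 x) ((covD dir c j f).1 x))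
            - inner ℝ ((covD dir c j (covD dir c i f)).1 x)
              (br ((curv dir c j i).1 x) (f.1 x))) := by
    rw [flap_eq_sum_dir, sum_d_d_gradSq]; simp [hQ]
  have e3 : ∑ j, (Sm.d (dir j) ((2 : ℝ) • scal ζ (fluxY dir c f j))).1 x
      = 2 * (∑ j, (Sm.d (dir j) ζ).1 x * (fluxY dir c f j).1 x)
        + 2 * (ζ.1 x * ∑ j, (Sm.d (dir j) (fluxY dir c f j)).1 x) := by
    simp only [map_smul, d_scal, Sm.smul_apply, Sm.add_apply, scal_apply, smul_eq_mul,
      mul_sum, ← sum_add_distrib, mul_add]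
  have b1 : -(ζ.1 x / 2 * Q + 48 * a * S)
      ≤ 2 * ∑ i, (Sm.d (dir i) ζ).1 x * (Sm.d (dir i) (gradSq dir c f)).1 x := by
    have : |2 * ∑ i, (Sm.d (dir i) ζ).1 x * (Sm.d (dir i) (gradSq dir c f)).1 x|
        ≤ ∑ i, ∑ k, (ζ.1 x / 2 * ‖(covD dir c i (covD dir c k f)).1 x‖ ^ 2
          + 8 * a * ‖(covD dir c k f).1 x‖ ^ 2) := by
      rw [mul_sum]
      refine (abs_sum_le_sum_abs _ _).trans (sum_le_sum fun i _ => ?_)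
      rw [d_gradSq, mul_sum, mul_sum]
      refine (abs_sum_le_sum_abs _ _).trans (sum_le_sum fun k _ => ?_)
      have := cross_term_le (hz i) hζ.1 ha (p := ‖(covD dir c k f).1 x‖)
        (q := ‖(covD dir c i (covD dir c k f)).1 x‖)
        (s := inner ℝ ((covD dir c k f).1 x) ((covD dir c i (covD dir c k f)).1 x))
        (by simpa using abs_real_inner_le_norm _ _)
      refine le_trans (le_of_eq ?_) this
      congr 1; ring
    have h2 := neg_le_of_abs_le this
    refine le_trans (le_of_eq ?_) h2
    simp only [sum_add_distrib, ← mul_sum]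
    rw [Finset.sum_comm, ← hQe, ← hSe]
    simp; ring
  have b2 : |(flap ζ).1 x * S| ≤ a * S := by
    rw [abs_mul, abs_of_nonneg hS0]; gcongr
  have b3 : |∑ i, ∑ j, (inner ℝ ((covD dir c i f).1 x)
              (br ((curv dir c j i).1 x) ((covD dir c j f).1 x))
            - inner ℝ ((covD dir c j (covD dir c i f)).1 x)
              (br ((curv dir c j i).1 x) (f.1 x)))|
      ≤ 72 * Fc * P ^ 2 + Q / 4 + 144 * Fc ^ 2 * F₀ ^ 2 := by
    have : ∀ i j : Fin 6, |inner ℝ ((covD dir c i f).1 x)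
              (br ((curv dir c j i).1 x) ((covD dir c j f).1 x))
            - inner ℝ ((covD dir c j (covD dir c i f)).1 x)
              (br ((curv dir c j i).1 x) (f.1 x))|
        ≤ 2 * Fc * P ^ 2 + (‖(covD dir c j (covD dir c i f)).1 x‖ ^ 2 / 4
          + 4 * Fc ^ 2 * F₀ ^ 2) := by
      intro i j
      refine (abs_sub _ _).trans (add_le_add ?_ ?_)
      · refine (abs_real_inner_le_norm _ _).trans ?_
        calc _ ≤ P * (2 * Fc * P) := by
              refine mul_le_mul (hP i) ((norm_br_le _ _).trans ?_) (norm_nonneg _) hP0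
              gcongr
              · exact hF j i
              · exact hP j
          _ = _ := by ring
      · refine (abs_real_inner_le_norm _ _).trans ?_
        calc _ ≤ ‖(covD dir c j (covD dir c i f)).1 x‖ * (2 * Fc * F₀) := by
              gcongr
              refine (norm_br_le _ _).trans ?_
              gcongr
              exact hF j i
          _ ≤ _ := by
              nlinarith [sq_nonneg (‖(covD dir c j (covD dir c i f)).1 x‖ / 2 - 2 * Fc * F₀)]
    refine (abs_sum_le_sum_abs _ _).trans ((sum_le_sum fun i _ =>
      (abs_sum_le_sum_abs _ _).trans (sum_le_sum fun j _ => this i j)).trans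
      (le_of_eq ?_))
    simp only [sum_add_distrib, ← Finset.sum_div]
    rw [← hQe]
    simp; ring
  have b4 : |2 * ∑ j, (Sm.d (dir j) ζ).1 x * (fluxY dir c f j).1 x|
      ≤ 144 * √a * (P * (H + Fc * F₀)) := by
    rw [mul_sum]
    calc _ ≤ ∑ _j : Fin 6, 2 * (√a * (12 * (P * (H + Fc * F₀)))) := by
          refine (abs_sum_le_sum_abs _ _).trans (sum_le_sum fun j _ => ?_)
          rw [abs_mul, abs_mul, abs_two]
          gcongr
          · refine Real.abs_le_sqrt ((hz j).trans ?_)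
            exact mul_le_of_le_one_right ha hζ.2
          · exact abs_fluxY_le c f hP0 hFc0 hf hh hP hF j
      _ = _ := by simp; ring
  have b5 : ‖(covL dir c f).1 x‖ ^ 2 ≤ H ^ 2 := by gcongr
  rw [e1, e2, e3]
  have b2' := neg_le_of_abs_le b2
  have b3' := neg_le_of_abs_le b3
  have b4' := le_of_abs_le b4
  have b6 : -(2 * H ^ 2 + 144 * Fc * P ^ 2 + 288 * Fc ^ 2 * F₀ ^ 2) + ζ.1 x * (3 / 2 * Q) ≤
      ζ.1 x * (2 * Q - 2 * ‖(covL dir c f).1 x‖ ^ 2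
        + 2 * ∑ i, ∑ j, (inner ℝ ((covD dir c i f).1 x)
              (br ((curv dir c j i).1 x) ((covD dir c j f).1 x))
            - inner ℝ ((covD dir c j (covD dir c i f)).1 x)
              (br ((curv dir c j i).1 x) (f.1 x)))) := by
    set W := ∑ i, ∑ j, (inner ℝ ((covD dir c i f).1 x)
              (br ((curv dir c j i).1 x) ((covD dir c j f).1 x))
            - inner ℝ ((covD dir c j (covD dir c i f)).1 x)
              (br ((curv dir c j i).1 x) (f.1 x)))
    have hR : 0 ≤ 2 * H ^ 2 + 144 * Fc * P ^ 2 + 288 * Fc ^ 2 * F₀ ^ 2 := by positivity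
    have h1 : 3 / 2 * Q - (2 * H ^ 2 + 144 * Fc * P ^ 2 + 288 * Fc ^ 2 * F₀ ^ 2)
        ≤ 2 * Q - 2 * ‖(covL dir c f).1 x‖ ^ 2 + 2 * W := by linarith
    have h2 := mul_le_mul_of_nonneg_left h1 hζ.1
    nlinarith [mul_le_of_le_one_left hR hζ.2]
  have b7 : 0 ≤ ζ.1 x * Q := mul_nonneg hζ.1 hQ0
  nlinarith

theorem flap_cutoff_normSq_ge (ω : Sm Hsp ℝ) {x : P3} {a F₀ H : ℝ} (ha : 0 ≤ a)
    (hω : 0 ≤ ω.1 x ∧ ω.1 x ≤ 1)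
    (hz : ∀ i, ((Sm.d (dir i) ω).1 x) ^ 2 ≤ a * ω.1 x) (hfl : |(flap ω).1 x| ≤ a)
    (hf : ‖f.1 x‖ ≤ F₀) (hh : ‖(covL dir c f).1 x‖ ≤ H) :
    ω.1 x * (gradSq dir c f).1 x - (2 * (F₀ * H) + 49 * a * F₀ ^ 2)
      ≤ (flap (scal ω (ip f f))).1 x := by
  have hF0 : 0 ≤ F₀ := (norm_nonneg _).trans hf
  have hH0 : 0 ≤ H := (norm_nonneg _).trans hh
  set S := (gradSq dir c f).1 x with hS
  have hSe : S = ∑ i, ‖(covD dir c i f).1 x‖ ^ 2 := gradSq_apply _ _ _ _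
  have hS0 : 0 ≤ S := hSe ▸ sum_nonneg fun _ _ => sq_nonneg _
  have e1 : (flap (scal ω (ip f f))).1 x
      = ω.1 x * (2 * S + 2 * inner ℝ (f.1 x) ((covL dir c f).1 x))
        + 2 * (∑ i, (Sm.d (dir i) ω).1 x * (Sm.d (dir i) (ip f f)).1 x)
        + (flap ω).1 x * ‖f.1 x‖ ^ 2 := by
    rw [flap_scal, flap_ip_self c]; simp [hS]; ring
  have b1 : |2 * ∑ i, (Sm.d (dir i) ω).1 x * (Sm.d (dir i) (ip f f)).1 x|
      ≤ ω.1 x / 2 * S + 48 * a * F₀ ^ 2 := by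
    rw [mul_sum]
    calc _ ≤ ∑ i, (ω.1 x / 2 * ‖(covD dir c i f).1 x‖ ^ 2 + 8 * a * F₀ ^ 2) := by
          refine (abs_sum_le_sum_abs _ _).trans (sum_le_sum fun i _ => ?_)
          have := cross_term_le (hz i) hω.1 ha (p := F₀) (q := ‖(covD dir c i f).1 x‖)
            (s := inner ℝ (f.1 x) ((covD dir c i f).1 x)) (by
              rw [abs_of_nonneg hF0, abs_norm]
              exact (abs_real_inner_le_norm _ _).trans (by gcongr))
          refine le_trans (le_of_eq ?_) this
          rw [d_ip_self c]
          congr 1; ring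
      _ = _ := by
          rw [sum_add_distrib, ← mul_sum, ← hSe]; simp; ring
  have b2 : |(flap ω).1 x * ‖f.1 x‖ ^ 2| ≤ a * F₀ ^ 2 := by
    rw [abs_mul, abs_of_nonneg (sq_nonneg ‖f.1 x‖)]; gcongr
  have b3 : |inner ℝ (f.1 x) ((covL dir c f).1 x)| ≤ F₀ * H :=
    (abs_real_inner_le_norm _ _).trans (mul_le_mul hf hh (norm_nonneg _) hF0)
  have b4 : |ω.1 x * inner ℝ (f.1 x) ((covL dir c f).1 x)| ≤ F₀ * H := by
    rw [abs_mul, abs_of_nonneg hω.1]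
    exact (mul_le_of_le_one_left (abs_nonneg _) hω.2).trans b3
  rw [e1]
  have := neg_le_of_abs_le b1
  have := neg_le_of_abs_le b2
  have := neg_le_of_abs_le b4
  have b7 : 0 ≤ ω.1 x * S := mul_nonneg hω.1 hS0
  nlinarith

set_option maxHeartbeats 1000000 in
/-- Interior gradient estimate for the covariant Laplacian. -/
theorem gradient_estimate : ∃ K : ℝ, 0 < K ∧ ∀ (c : Fin 6 → Sm Hsp E3) (f : Sm Hsp E3) (x₀ : P3)
    (ρ F₀ H P Fc : ℝ), 0 < ρ → 0 ≤ P → 0 ≤ Fc → closedBall x₀ (4 * ρ) ⊆ Hsp →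
    (∀ x ∈ closedBall x₀ (4 * ρ), ‖f.1 x‖ ≤ F₀ ∧ ‖(covL dir c f).1 x‖ ≤ H ∧
      (∀ i, ‖(covD dir c i f).1 x‖ ≤ P) ∧ ∀ i j, ‖(curv dir c i j).1 x‖ ≤ Fc) →
    (gradSq dir c f).1 x₀ ≤ K * (F₀ ^ 2 / ρ ^ 2 + F₀ * H
      + ρ ^ 2 * (H ^ 2 + Fc ^ 2 * F₀ ^ 2 + Fc * P ^ 2) + ρ * (P * (H + Fc * F₀))) := by
  obtain ⟨C, hC, hcut⟩ := exists_cutoff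
  obtain ⟨C', hC', hval⟩ := value_le_of_flap_ge
  refine ⟨C' * (16 * (49 * C * (2 + 49 * C) + 288 + 144 * √C) + 96),
    by positivity, fun c f x₀ ρ F₀ H P Fc hρ hP0 hFc0 hsub hb => ?_⟩
  obtain ⟨ζ, hζ, hζ1, hζ0, hζd, hζl⟩ := hcut x₀ ρ hρ
  obtain ⟨ω, hω, hω1, hω0, hωd, hωl⟩ := hcut x₀ (2 * ρ) (by positivity)
  have hx₀ : x₀ ∈ closedBall x₀ (4 * ρ) := Metric.mem_closedBall_self (by positivity)
  have hF0 : 0 ≤ F₀ := (norm_nonneg _).trans (hb x₀ hx₀).1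
  have hH0 : 0 ≤ H := (norm_nonneg _).trans (hb x₀ hx₀).2.1
  have h22 : 2 * (2 * ρ) = 4 * ρ := by ring
  rw [h22] at hω0
  have hsub2 : closedBall x₀ (2 * ρ) ⊆ closedBall x₀ (4 * ρ) :=
    Metric.closedBall_subset_closedBall (by linarith)
  have hζ0' : VanishOff (closedBall x₀ (4 * ρ)) ζ.1 := fun x hx => hζ0 x fun h => hx (hsub2 h)
  set a := C / ρ ^ 2 with ha
  have ha0 : 0 ≤ a := by positivity
  let φ : Sm Hsp ℝ := scal ζ (gradSq dir c f) + (49 * a) • scal ω (ip f f)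
  let Y : Fin 6 → Sm Hsp ℝ := fun j => (2 : ℝ) • scal ζ (fluxY dir c f j)
  have ha2 : C / (2 * ρ) ^ 2 ≤ a := by
    rw [ha]; gcongr; linarith
  set B := 2 * H ^ 2 + 144 * Fc * P ^ 2 + 288 * Fc ^ 2 * F₀ ^ 2 + 144 * √a * (P * (H + Fc * F₀))
    + 49 * a * (2 * (F₀ * H) + 49 * a * F₀ ^ 2) with hB
  have hval' := hval x₀ (4 * ρ) B (24 * (P * (H + Fc * F₀))) φ Y (by positivity) (by positivity)
    (by positivity) hsub
    (fun x hx => by simp [φ, hζ0' x hx, hω0 x hx])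
    (fun j x hx => by simp [Y, hζ0' x hx])
    (fun x hx => by
      obtain ⟨h1, h2, h3, h4⟩ := hb x hx
      have hg1 := flap_cutoff_gradSq_ge c f ζ ha0 hP0 hFc0 (hζ x) (hζd x) (hζl x) h1 h2 h3 h4
      have hg2 := flap_cutoff_normSq_ge c f ω ha0 (hω x)
        (fun i => (hωd x i).trans (mul_le_mul_of_nonneg_right ha2 (hω x).1))
        ((hωl x).trans ha2) h1 h2
      have hS0 : 0 ≤ (gradSq dir c f).1 x := by rw [gradSq_apply]; positivity
      have hφ : (flap φ).1 x = (flap (scal ζ (gradSq dir c f))).1 x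
          + 49 * a * (flap (scal ω (ip f f))).1 x := by
        simp [φ]
      rw [hφ]
      by_cases hx2 : x ∈ closedBall x₀ (2 * ρ)
      · have hω' : ω.1 x = 1 := hω1 x (hsub hx) (by rwa [← dist_eq_norm])
        rw [hω', one_mul] at hg2
        have := mul_le_mul_of_nonneg_left hg2 (by positivity : 0 ≤ 49 * a)
        simp only [Y]
        linarith
      · have hK := isCompact_closedBall x₀ (2 * ρ)
        have v1 : (flap (scal ζ (gradSq dir c f))).1 x = 0 := by
          rw [flap_eq, Sm.sum_apply]
          refine Finset.sum_eq_zero fun i _ => Sm.vanishOff_d isOpen_Hsp hK (hsub2.trans hsub)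
            (Sm.vanishOff_d isOpen_Hsp hK (hsub2.trans hsub) (fun y hy => ?_) _) _ x hx2
          simp [hζ0 y hy]
        have v2 : ∀ j, (Sm.d (dir j) (Y j)).1 x = 0 := fun j =>
          Sm.vanishOff_d isOpen_Hsp hK (hsub2.trans hsub)
            (fun y hy => by simp [Y, hζ0 y hy]) _ x hx2
        simp only [v1, v2]
        have h5 : -(2 * (F₀ * H) + 49 * a * F₀ ^ 2) ≤ (flap (scal ω (ip f f))).1 x := by
          have := mul_nonneg (hω x).1 hS0
          linarith
        have := mul_le_mul_of_nonneg_left h5 (by positivity : 0 ≤ 49 * a)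
        have : 0 ≤ 2 * H ^ 2 + 144 * Fc * P ^ 2 + 288 * Fc ^ 2 * F₀ ^ 2
          + 144 * √a * (P * (H + Fc * F₀)) := by positivity
        simp only [Finset.sum_const_zero]
        linarith)
    (fun x hx j => by
      obtain ⟨h1, h2, h3, h4⟩ := hb x hx
      have := abs_fluxY_le c f hP0 hFc0 h1 h2 h3 h4 j
      simp only [Y, Sm.smul_apply, scal_apply, smul_eq_mul]
      rw [abs_mul, abs_mul, abs_two, abs_of_nonneg (hζ x).1]
      have h6 := mul_le_of_le_one_left (abs_nonneg ((fluxY dir c f j).1 x)) (hζ x).2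
      linarith)
  have hφ0 : (gradSq dir c f).1 x₀ ≤ φ.1 x₀ := by
    have h1 : ζ.1 x₀ = 1 := hζ1 x₀ (hsub hx₀) (by simp [hρ.le])
    simp only [φ, Sm.add_apply, scal_apply, Sm.smul_apply, h1, ip_apply, smul_eq_mul, one_mul]
    have := (hω x₀).1
    have : 0 ≤ inner ℝ (f.1 x₀) (f.1 x₀) := real_inner_self_nonneg
    have : 0 ≤ 49 * a * (ω.1 x₀ * inner ℝ (f.1 x₀) (f.1 x₀)) := by positivity
    linarith
  refine (hφ0.trans hval').trans ?_
  rw [mul_assoc C' (16 * (49 * C * (2 + 49 * C) + 288 + 144 * √C) + 96)]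
  refine mul_le_mul_of_nonneg_left ?_ hC'.le
  have hsa : √a = √C / ρ := by rw [ha, Real.sqrt_div hC.le, Real.sqrt_sq hρ.le]
  have e : (4 * ρ) ^ 2 * B + 4 * ρ * (24 * (P * (H + Fc * F₀)))
      = 16 * (49 * C * (2 * (F₀ * H) + 49 * C * (F₀ ^ 2 / ρ ^ 2)))
        + 16 * (ρ ^ 2 * (2 * H ^ 2 + 288 * (Fc ^ 2 * F₀ ^ 2) + 144 * (Fc * P ^ 2)))
        + (16 * 144 * √C + 96) * (ρ * (P * (H + Fc * F₀))) := by
    rw [hB, hsa, ha]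
    field_simp
    ring
  rw [e]
  have t1 : 0 ≤ F₀ ^ 2 / ρ ^ 2 := by positivity
  have t2 : 0 ≤ F₀ * H := by positivity
  have t3 : 0 ≤ ρ ^ 2 * H ^ 2 := by positivity
  have t4 : 0 ≤ ρ ^ 2 * (Fc ^ 2 * F₀ ^ 2) := by positivity
  have t5 : 0 ≤ ρ ^ 2 * (Fc * P ^ 2) := by positivity
  have t6 : 0 ≤ ρ * (P * (H + Fc * F₀)) := by positivity
  set k := 49 * C * (2 + 49 * C) + 288 + 144 * √C
  have hs0 : 0 ≤ √C := Real.sqrt_nonneg C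
  have hCC : 0 ≤ C * C := by positivity
  have k1 : 49 * C * (49 * C) ≤ k := by simp only [k]; linarith
  have k2 : 49 * C * 2 ≤ k := by simp only [k]; linarith
  have k3 : 288 ≤ k := by simp only [k]; linarith
  have k4 : 144 * √C ≤ k := by simp only [k]; linarith
  clear_value k
  clear hb hval hval' hcut hφ0
  nlinarith [mul_le_mul_of_nonneg_right k1 t1, mul_le_mul_of_nonneg_right k2 t2,
    mul_le_mul_of_nonneg_right k3 t3, mul_le_mul_of_nonneg_right k3 t4,
    mul_le_mul_of_nonneg_right k3 t5, mul_le_mul_of_nonneg_right k4 t6]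

end GradientEstimate

section SoftPositivePart

/-- A smooth convex approximation to the positive part. -/
def softPos (x : ℝ) : ℝ := ∫ y in (0 : ℝ)..x, Real.smoothTransition (y - 1)

theorem hasDerivAt_softPos (x : ℝ) : HasDerivAt softPos (Real.smoothTransition (x - 1)) x := by
  have h : Continuous fun y : ℝ => Real.smoothTransition (y - 1) :=
    Real.smoothTransition.continuous.comp (continuous_id.sub continuous_const)
  exact intervalIntegral.integral_hasDerivAt_right (h.intervalIntegrable _ _)
    (h.stronglyMeasurableAtFilter _ _) h.continuousAt

theorem deriv_softPos : deriv softPos = fun x => Real.smoothTransition (x - 1) :=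
  funext fun x => (hasDerivAt_softPos x).deriv

theorem contDiff_softPos : ContDiff ℝ (⊤ : ℕ∞) softPos := by
  rw [contDiff_infty_iff_deriv, deriv_softPos]
  exact ⟨fun x => (hasDerivAt_softPos x).differentiableAt,
    Real.smoothTransition.contDiff.comp (contDiff_id.sub contDiff_const)⟩

theorem monotone_softPos : Monotone softPos :=
  monotone_of_deriv_nonneg (fun x => (hasDerivAt_softPos x).differentiableAt) fun x => by
    rw [deriv_softPos]; exact Real.smoothTransition.nonneg _

theorem softPos_of_nonneg_of_le_one {x : ℝ} (h0 : 0 ≤ x) (h : x ≤ 1) : softPos x = 0 := by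
  rw [softPos, intervalIntegral.integral_congr (g := fun _ => (0 : ℝ))]
  · simp
  · intro y hy
    rw [uIcc_of_le h0] at hy
    exact Real.smoothTransition.zero_of_nonpos (by linarith [hy.2])

theorem softPos_zero : softPos 0 = 0 := softPos_of_nonneg_of_le_one le_rfl zero_le_one

theorem softPos_nonneg {x : ℝ} (h : 0 ≤ x) : 0 ≤ softPos x :=
  softPos_zero ▸ monotone_softPos h

theorem softPos_le {x : ℝ} (h : 0 ≤ x) : softPos x ≤ x := by
  have h1 : Antitone fun y => softPos y - y :=
    antitone_of_deriv_nonpos (fun y => (hasDerivAt_softPos y).differentiableAt.sub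
      differentiableAt_id) fun y => by
        have := ((hasDerivAt_softPos y).sub (hasDerivAt_id y)).deriv
        change deriv (softPos - id) y ≤ 0
        rw [this]
        linarith [Real.smoothTransition.le_one (y - 1)]
  have := h1 h
  simp only [softPos_zero] at this
  linarith

theorem sub_two_le_softPos {x : ℝ} (h : 0 ≤ x) : x - 2 ≤ softPos x := by
  rcases le_total x 2 with h2 | h2
  · linarith [softPos_nonneg h]
  have hd : ∀ y ∈ Ici (2 : ℝ), 0 ≤ deriv (fun y => softPos y - y) y := fun y hy => by
    have := ((hasDerivAt_softPos y).sub (hasDerivAt_id y)).deriv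
    change 0 ≤ deriv (softPos - id) y
    rw [this, Real.smoothTransition.one_of_one_le (by linarith [mem_Ici.1 hy])]
    simp
  have h1 : MonotoneOn (fun y => softPos y - y) (Ici 2) :=
    monotoneOn_of_deriv_nonneg (convex_Ici 2)
      (fun y _ => ((hasDerivAt_softPos y).differentiableAt.sub
        differentiableAt_id).continuousAt.continuousWithinAt)
      (fun y _ => ((hasDerivAt_softPos y).differentiableAt.sub
        differentiableAt_id).differentiableWithinAt) fun y hy => hd y (interior_subset hy)
  have := h1 (mem_Ici.2 le_rfl) (mem_Ici.2 h2) h2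
  simp only at this
  linarith [softPos_nonneg (zero_le_two (α := ℝ))]

/-- `softPos` rescaled to vanish on `[0, ε]`. -/
def softPosAt (ε x : ℝ) : ℝ := ε * softPos (x / ε)

theorem contDiff_softPosAt (ε : ℝ) : ContDiff ℝ (⊤ : ℕ∞) (softPosAt ε) :=
  contDiff_const.mul (contDiff_softPos.comp (contDiff_id.div_const ε))

theorem deriv_softPosAt {ε : ℝ} (hε : 0 < ε) :
    deriv (softPosAt ε) = fun x => Real.smoothTransition (x / ε - 1) := funext fun x => by
  have := ((hasDerivAt_softPos (x / ε)).comp x ((hasDerivAt_id x).div_const ε)).const_mul ε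
  have h2 : HasDerivAt (softPosAt ε) (ε * (Real.smoothTransition (x / ε - 1) * (1 / ε))) x := this
  rw [h2.deriv, mul_comm, mul_assoc, one_div, inv_mul_cancel₀ hε.ne', mul_one]

theorem monotone_deriv_softPosAt {ε : ℝ} (hε : 0 < ε) : Monotone (deriv (softPosAt ε)) := by
  rw [deriv_softPosAt hε]
  intro x y h
  exact Real.smoothTransition.monotone (by gcongr)

theorem softPosAt_of_le {ε x : ℝ} (hε : 0 < ε) (h0 : 0 ≤ x) (h : x ≤ ε) : softPosAt ε x = 0 := by
  rw [softPosAt, softPos_of_nonneg_of_le_one (by positivity) ((div_le_one hε).2 h), mul_zero]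

theorem softPosAt_nonneg {ε x : ℝ} (hε : 0 < ε) (h0 : 0 ≤ x) : 0 ≤ softPosAt ε x :=
  mul_nonneg hε.le (softPos_nonneg (by positivity))

theorem sub_le_softPosAt {ε x : ℝ} (hε : 0 < ε) (h0 : 0 ≤ x) : x - 2 * ε ≤ softPosAt ε x := by
  have h := mul_le_mul_of_nonneg_left (sub_two_le_softPos (x := x / ε) (by positivity)) hε.le
  refine le_trans (le_of_eq ?_) h
  field_simp

theorem softPosAt_le {ε x : ℝ} (hε : 0 < ε) (h0 : 0 ≤ x) : softPosAt ε x ≤ x := by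
  have h := mul_le_mul_of_nonneg_left (softPos_le (x := x / ε) (by positivity)) hε.le
  rwa [mul_div_cancel₀ _ hε.ne'] at h

end SoftPositivePart

section PostComposition

variable {V : Type*} [NormedAddCommGroup V] [NormedSpace ℝ V] {Ω : Set V}

/-- Composition of a scalar function with a smooth function of one variable. -/
def Sm.post (θ : ℝ → ℝ) (hθ : ContDiff ℝ (⊤ : ℕ∞) θ) (f : Sm Ω ℝ) : Sm Ω ℝ :=
  Sm.ofContDiffOn (fun x => θ (f.1 x)) (hθ.comp_contDiffOn f.2.1)

theorem Sm.post_apply {θ : ℝ → ℝ} (hθ : ContDiff ℝ (⊤ : ℕ∞) θ) (f : Sm Ω ℝ) {x : V} (hx : x ∈ Ω) :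
    (Sm.post θ hθ f).1 x = θ (f.1 x) := Sm.ofContDiffOn_apply _ hx

theorem Sm.d_post [SmoothDomain Ω] (v : V) {θ : ℝ → ℝ} (hθ : ContDiff ℝ (⊤ : ℕ∞) θ)
    (f : Sm Ω ℝ) : Sm.d v (Sm.post θ hθ f)
      = scal (Sm.post (deriv θ) (contDiff_infty_iff_deriv.1 hθ).2 f) (Sm.d v f) :=
  Sm.ext_on fun x hx => by
    have h1 := (Sm.hasFDerivWithinAt f hx)
    have h2 := (contDiff_infty_iff_deriv.1 hθ).1 (f.1 x) |>.hasDerivAt.comp_hasFDerivWithinAt x h1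
    have h3 : HasFDerivWithinAt (Sm.post θ hθ f).1 (deriv θ (f.1 x) • fderivWithin ℝ f.1 Ω x) Ω x :=
      h2.congr (fun y hy => Sm.post_apply hθ f hy) (Sm.post_apply hθ f hx)
    rw [Sm.d_apply_of_hasFDerivWithinAt _ _ hx h3, scal_apply, Sm.post_apply _ _ hx,
      Sm.d_apply_of_hasFDerivWithinAt _ _ hx h1]
    simp

theorem flap_post_ge {θ : ℝ → ℝ} (hθ : ContDiff ℝ (⊤ : ℕ∞) θ) (hm : Monotone (deriv θ))
    (f : Sm Hsp ℝ) {x : P3} (hx : x ∈ Hsp) :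
    deriv θ (f.1 x) * (flap f).1 x ≤ (flap (Sm.post θ hθ f)).1 x := by
  have : (flap (Sm.post θ hθ f)).1 x = deriv θ (f.1 x) * (flap f).1 x
      + ∑ i, deriv (deriv θ) (f.1 x) * ((Sm.d (bvec i) f).1 x) ^ 2 := by
    simp only [flap_eq, Sm.sum_apply, Sm.d_post, d_scal, Sm.add_apply, scal_apply,
      Sm.post_apply _ _ hx, smul_eq_mul, sum_add_distrib, mul_sum]
    rw [add_comm]
    congr 1
    exact sum_congr rfl fun i _ => by ring
  rw [this]
  have h0 : 0 ≤ deriv (deriv θ) (f.1 x) := hm.deriv_nonneg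
  have : 0 ≤ ∑ i, deriv (deriv θ) (f.1 x) * ((Sm.d (bvec i) f).1 x) ^ 2 :=
    sum_nonneg fun i _ => by positivity
  linarith

end PostComposition

section Ends

/-- `φ → 0` as `t → 0`, as `t → ∞` and as `t / |z| → 0`. -/
def EndsLt (φ : P3 → ℝ) (ε : ℝ) : Prop :=
  (∃ δ > (0 : ℝ), ∀ p ∈ Hsp, p.1 < δ → φ p < ε) ∧ (∃ K : ℝ, ∀ p ∈ Hsp, K < p.1 → φ p < ε) ∧
    ∃ δ > (0 : ℝ), ∀ p ∈ Hsp, p.1 < δ * znorm p → φ p < ε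

theorem EndsLt.exists_compact {φ : P3 → ℝ} {ε : ℝ} (h : EndsLt φ ε) :
    ∃ K ⊆ Hsp, IsCompact K ∧ ∀ p ∈ Hsp, p ∉ K → φ p < ε := by
  obtain ⟨⟨δ, hδ, h1⟩, ⟨M, h2⟩, η, hη, h3⟩ := h
  refine ⟨{p | δ ≤ p.1 ∧ p.1 ≤ M ∧ η * znorm p ≤ p.1}, fun p hp => hδ.trans_le hp.1, ?_, ?_⟩
  · have hz : Continuous znorm := by unfold znorm; fun_prop
    refine Metric.isCompact_of_isClosed_isBounded ?_ ?_
    · exact (isClosed_le continuous_const continuous_fst).inter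
        ((isClosed_le continuous_fst continuous_const).inter
          (isClosed_le (continuous_const.mul hz) continuous_fst))
    · refine (Metric.isBounded_closedBall (x := (0 : P3)) (r := M + M / η)).subset ?_
      rintro p ⟨hp1, hp2, hp3⟩
      have hp0 : 0 < p.1 := hδ.trans_le hp1
      have hM : 0 < M := hp0.trans_le hp2
      have hzp : znorm p ≤ M / η := by rw [le_div_iff₀ hη]; linarith
      have h1 : |p.2.1| ≤ znorm p := Real.abs_le_sqrt (by nlinarith [sq_nonneg p.2.2])
      have h2 : |p.2.2| ≤ znorm p := Real.abs_le_sqrt (by nlinarith [sq_nonneg p.2.1])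
      have hd : 0 < M / η := by positivity
      rw [mem_closedBall_zero_iff, Prod.norm_def, Prod.norm_def]
      refine max_le ?_ (max_le ?_ ?_)
      · rw [norm_eq_abs, abs_of_pos hp0]; linarith
      · rw [norm_eq_abs]; linarith
      · rw [norm_eq_abs]; linarith
  · intro p hp hpK
    by_contra hn
    refine hpK ⟨?_, ?_, ?_⟩
    · by_contra hc; exact hn (h1 p hp (not_le.1 hc))
    · by_contra hc; exact hn (h2 p hp (not_le.1 hc))
    · by_contra hc; exact hn (h3 p hp (not_le.1 hc))

theorem EndsLt.mono {φ ψ : P3 → ℝ} {ε ε' : ℝ} (h : EndsLt φ ε)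
    (hψ : ∀ p ∈ Hsp, φ p < ε → ψ p < ε') : EndsLt ψ ε' := by
  obtain ⟨⟨δ, hδ, h1⟩, ⟨M, h2⟩, η, hη, h3⟩ := h
  exact ⟨⟨δ, hδ, fun p hp hh => hψ p hp (h1 p hp hh)⟩, ⟨M, fun p hp hh => hψ p hp (h2 p hp hh)⟩,
    η, hη, fun p hp hh => hψ p hp (h3 p hp hh)⟩

theorem EndsLt.and {φ ψ χ : P3 → ℝ} {a b ε : ℝ} (h : EndsLt φ a) (h' : EndsLt ψ b)
    (hψ : ∀ p ∈ Hsp, φ p < a → ψ p < b → χ p < ε) : EndsLt χ ε := by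
  obtain ⟨⟨δ, hδ, h1⟩, ⟨M, h2⟩, η, hη, h3⟩ := h
  obtain ⟨⟨δ', hδ', h1'⟩, ⟨M', h2'⟩, η', hη', h3'⟩ := h'
  refine ⟨⟨min δ δ', lt_min hδ hδ', fun p hp hh => hψ p hp (h1 p hp (hh.trans_le (min_le_left _ _)))
    (h1' p hp (hh.trans_le (min_le_right _ _)))⟩, ⟨max M M', fun p hp hh =>
      hψ p hp (h2 p hp ((le_max_left _ _).trans_lt hh)) (h2' p hp ((le_max_right _ _).trans_lt hh))⟩,
    min η η', lt_min hη hη', fun p hp hh => ?_⟩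
  have hz : 0 ≤ znorm p := Real.sqrt_nonneg _
  exact hψ p hp (h3 p hp (hh.trans_le (by gcongr; exact min_le_left _ _)))
    (h3' p hp (hh.trans_le (by gcongr; exact min_le_right _ _)))

/-- `φ` tends to zero at every end of the half-space. -/
def EndsZero (φ : P3 → ℝ) : Prop := ∀ ε > 0, EndsLt φ ε

theorem EndsZero.exists_bound {φ : P3 → ℝ} (h : EndsZero φ) (hc : ContinuousOn φ Hsp) :
    ∃ M, ∀ p ∈ Hsp, φ p ≤ M := by
  obtain ⟨K, hK, hKc, hb⟩ := (h 1 one_pos).exists_compact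
  obtain ⟨M, hM⟩ := hKc.bddAbove_image (hc.mono hK)
  refine ⟨max M 1, fun p hp => ?_⟩
  by_cases hpK : p ∈ K
  · exact (hM (mem_image_of_mem _ hpK)).trans (le_max_left _ _)
  · exact (hb p hp hpK).le.trans (le_max_right _ _)

end Ends

section Barrier

/-- The coordinate functions. -/
def coordSm (i : Fin 3) : Sm Hsp ℝ := Sm.ofContDiffOn (coord i) (coord i).contDiff.contDiffOn

/-- The negative powers of `√(1 + |x|²)`. -/
def bracketInv (n : ℕ) : Sm Hsp ℝ :=
  Sm.ofContDiffOn (fun x => (rdist 1 0 x ^ n)⁻¹) (contDiff_rdist_inv_pow one_pos 0 n).contDiffOn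

theorem coordSm_apply (i : Fin 3) {x : P3} (hx : x ∈ Hsp) : (coordSm i).1 x = coord i x :=
  Sm.ofContDiffOn_apply _ hx

theorem bracketInv_apply (n : ℕ) {x : P3} (hx : x ∈ Hsp) :
    (bracketInv n).1 x = (rdist 1 0 x ^ n)⁻¹ :=
  Sm.ofContDiffOn_apply _ hx

theorem d_coordSm (i j : Fin 3) {x : P3} (hx : x ∈ Hsp) :
    (Sm.d (bvec i) (coordSm j)).1 x = if i = j then 1 else 0 := by
  rw [coordSm, Sm.d_ofContDiffOn isOpen_Hsp _ _ hx, ContinuousLinearMap.fderiv]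
  split_ifs with h
  · rw [h, coord_bvec]
  · exact coord_bvec_of_ne fun h' => h h'.symm

theorem d_d_coordSm (i j : Fin 3) : Sm.d (bvec i) (Sm.d (bvec i) (coordSm j)) = 0 := by
  have : Sm.d (bvec i) (coordSm j)
      = Sm.ofContDiffOn (fun _ => if i = j then (1 : ℝ) else 0) contDiffOn_const :=
    Sm.ext_on fun x hx => by rw [d_coordSm i j hx, Sm.ofContDiffOn_apply _ hx]
  rw [this]
  refine Sm.ext_on fun x hx => ?_
  rw [Sm.d_ofContDiffOn isOpen_Hsp _ _ hx]
  simp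

theorem d_bracketInv (i : Fin 3) (n : ℕ) :
    Sm.d (bvec i) (bracketInv n) = (-(n : ℝ)) • scal (coordSm i) (bracketInv (n + 2)) :=
  Sm.ext_on fun x hx => by
    rw [bracketInv, Sm.d_ofContDiffOn isOpen_Hsp _ _ hx, fderiv_rdist_inv_pow one_pos,
      Sm.smul_apply, scal_apply, coordSm_apply i hx, bracketInv_apply _ hx]
    simp; ring

/-- A positive superharmonic function tending to zero at the ends. -/
def barrier : Sm Hsp ℝ := scal (coordSm 0) (bracketInv 3)

theorem barrier_apply {x : P3} (hx : x ∈ Hsp) : barrier.1 x = x.1 * (rdist 1 0 x ^ 3)⁻¹ := by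
  rw [barrier, scal_apply, coordSm_apply 0 hx, bracketInv_apply 3 hx]; rfl

theorem barrier_pos {x : P3} (hx : x ∈ Hsp) : 0 < barrier.1 x := by
  rw [barrier_apply hx]
  have := rdist_pos one_pos 0 x
  have : 0 < x.1 := hx
  positivity

theorem flap_barrier {x : P3} (hx : x ∈ Hsp) :
    (flap barrier).1 x = -(15 * (x.1 * (rdist 1 0 x ^ 7)⁻¹)) := by
  have h : ∀ i, (Sm.d (bvec i) (Sm.d (bvec i) barrier)).1 x
      = 2 * ((if i = 0 then 1 else 0) * (-3 * (coord i x * (rdist 1 0 x ^ 5)⁻¹)))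
        + x.1 * (-3 * ((rdist 1 0 x ^ 5)⁻¹ + coord i x * (-5 * (coord i x *
          (rdist 1 0 x ^ 7)⁻¹)))) := by
    intro i
    simp only [barrier, d_scal, d_bracketInv, map_add, map_smul, Sm.add_apply, Sm.smul_apply,
      scal_apply, d_d_coordSm, Sm.zero_apply, d_coordSm i _ hx, bracketInv_apply _ hx,
      coordSm_apply _ hx, smul_eq_mul]
    have : coord 0 x = x.1 := rfl
    rw [this]
    simp only [if_true]
    push_cast
    ring
  rw [flap_eq, Sm.sum_apply, sum_congr rfl fun i _ => h i]
  have h0 := rdist_pos one_pos 0 x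
  have h1 := rdist_sq 1 0 x
  rw [sub_zero, nsq_eq_sum, Fin.sum_univ_three] at h1
  have e : (rdist 1 0 x ^ 5)⁻¹ = rdist 1 0 x ^ 2 * (rdist 1 0 x ^ 7)⁻¹ := by
    field_simp
  rw [Fin.sum_univ_three, e, h1]
  have : coord 0 x = x.1 := rfl
  simp [this]
  ring

theorem endsZero_barrier : EndsZero barrier.1 := by
  have key : ∀ x ∈ Hsp, 1 ≤ rdist 1 0 x ∧ x.1 ≤ rdist 1 0 x ∧ znorm x ≤ rdist 1 0 x := by
    intro x hx
    refine ⟨?_, ?_, ?_⟩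
    · exact Real.one_le_sqrt.2 (by have := nsq_nonneg (x - 0); linarith)
    · refine le_sqrt_of_sq_le ?_
      simp only [sub_zero, nsq]; nlinarith [sq_nonneg x.2.1, sq_nonneg x.2.2]
    · refine Real.sqrt_le_sqrt ?_
      simp only [sub_zero, nsq]; nlinarith [sq_nonneg x.1]
  intro ε hε
  refine ⟨⟨ε, hε, fun x hx h => ?_⟩, ⟨1 / ε, fun x hx h => ?_⟩, ε, hε, fun x hx h => ?_⟩
  all_goals
    obtain ⟨h1, h2, h3⟩ := key x hx
    have h0 : 0 < x.1 := hx
    set ρ := rdist 1 0 x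
    rw [barrier_apply hx, ← div_eq_mul_inv, div_lt_iff₀ (by positivity)]
  · have : 1 ≤ ρ ^ 3 := one_le_pow₀ h1
    nlinarith
  · have h4 : 1 < ε * x.1 := by rwa [div_lt_iff₀ hε, mul_comm] at h
    have h5 : ε * x.1 * x.1 ≤ ε * ρ ^ 3 := by
      have : x.1 * x.1 ≤ ρ ^ 3 := by nlinarith [mul_le_mul h2 h2 h0.le (by linarith)]
      nlinarith
    nlinarith
  · have h4 : ρ ≤ ρ ^ 3 := by nlinarith [mul_le_mul h1 h1 zero_le_one (by linarith)]
    have : ε * znorm x ≤ ε * ρ ^ 3 := by gcongr; exact h3.trans h4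
    linarith

end Barrier

section GreenFunction

/-- Reflection in the boundary plane. -/
def reflect (q : P3) : P3 := (-q.1, q.2)

theorem reflect_notMem {q : P3} (hq : q ∈ Hsp) : reflect q ∉ Hsp := by
  have : 0 < q.1 := hq
  simp only [reflect, Hsp, mem_ofPred_eq]
  linarith

/-- The regularised Green function of the half-space. -/
def greenReg (η : ℝ) (q p : P3) : ℝ := (rdist η q p)⁻¹ - (rdist η (reflect q) p)⁻¹

theorem nsq_sub_reflect (q p : P3) : nsq (p - reflect q) = nsq (p - q) + 4 * p.1 * q.1 := by
  simp only [nsq, reflect, Prod.fst_sub, Prod.snd_sub]; ring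

theorem rdist_le_reflect {q p : P3} (hq : q ∈ Hsp) (hp : p ∈ Hsp) (η : ℝ) :
    rdist η q p ≤ rdist η (reflect q) p := by
  have h1 : 0 < q.1 := hq
  have h2 : 0 < p.1 := hp
  refine Real.sqrt_le_sqrt ?_
  rw [nsq_sub_reflect]
  have := mul_pos h2 h1
  linarith

theorem greenReg_nonneg {q p : P3} (hq : q ∈ Hsp) (hp : p ∈ Hsp) {η : ℝ} (hη : 0 < η) :
    0 ≤ greenReg η q p :=
  sub_nonneg.2 (inv_anti₀ (rdist_pos hη q p) (rdist_le_reflect hq hp η))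

theorem rdist_zero_pos {q p : P3} (h : p ≠ q) : 0 < rdist 0 q p := by
  have : 0 < ‖p - q‖ := norm_pos_iff.2 (sub_ne_zero.2 h)
  exact this.trans_le (norm_sub_le_rdist 0 q p)

theorem rdist_mono {η η' : ℝ} (h0 : 0 ≤ η) (h : η ≤ η') (q p : P3) :
    rdist η q p ≤ rdist η' q p :=
  Real.sqrt_le_sqrt (by gcongr)

theorem greenReg_eq {q p : P3} {η : ℝ} (h : 0 < rdist η q p) (h' : 0 < rdist η (reflect q) p) :
    greenReg η q p = 4 * p.1 * q.1 /
      (rdist η q p * rdist η (reflect q) p * (rdist η q p + rdist η (reflect q) p)) := by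
  have e : rdist η (reflect q) p ^ 2 - rdist η q p ^ 2 = 4 * p.1 * q.1 := by
    rw [rdist_sq, rdist_sq, nsq_sub_reflect]; ring
  rw [greenReg, ← e]
  field_simp
  ring

theorem greenReg_le {q p : P3} (hq : q ∈ Hsp) (hp : p ∈ Hsp) (h : p ≠ q) {η : ℝ} (hη : 0 < η) :
    greenReg η q p ≤ greenReg 0 q p := by
  have a0 := rdist_zero_pos h
  have b0 := a0.trans_le (rdist_le_reflect hq hp 0)
  rw [greenReg_eq (rdist_pos hη _ _) (rdist_pos hη _ _), greenReg_eq a0 b0]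
  have h1 : 0 < q.1 := hq
  have h2 : 0 < p.1 := hp
  have := rdist_mono le_rfl hη.le q p
  have := rdist_mono le_rfl hη.le (reflect q) p
  have := rdist_pos hη q p
  have := rdist_pos hη (reflect q) p
  gcongr

theorem tendsto_greenReg {q p : P3} (hq : q ∈ Hsp) (hp : p ∈ Hsp) (h : p ≠ q) :
    Tendsto (fun η => greenReg η q p) (𝓝 0) (𝓝 (greenReg 0 q p)) := by
  have a0 := rdist_zero_pos h
  have b0 := a0.trans_le (rdist_le_reflect hq hp 0)
  have hc : ∀ x₀ x : P3, Continuous fun η => rdist η x₀ x := fun x₀ x => by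
    unfold rdist; fun_prop
  exact ((hc q p).tendsto 0 |>.inv₀ a0.ne').sub ((hc (reflect q) p).tendsto 0 |>.inv₀ b0.ne')

theorem continuous_greenReg {η : ℝ} (hη : 0 < η) (q : P3) : Continuous (greenReg η q) :=
  ((continuous_rdist η q).inv₀ fun p => (rdist_pos hη q p).ne').sub
    ((continuous_rdist η _).inv₀ fun p => (rdist_pos hη _ p).ne')

theorem measurable_greenReg (η : ℝ) (q : P3) : Measurable (greenReg η q) :=
  (continuous_rdist η q).measurable.inv.sub (continuous_rdist η _).measurable.inv

/-- The Green potential of a nonnegative density on the half-space. -/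
def greenPot (h : P3 → ℝ≥0∞) (q : P3) : ℝ≥0∞ :=
  ∫⁻ p in Hsp, h p * ofReal (greenReg 0 q p)

theorem greenPot_mono {h k : P3 → ℝ≥0∞} (hk : ∀ p ∈ Hsp, h p ≤ k p) (q : P3) :
    greenPot h q ≤ greenPot k q :=
  setLIntegral_mono' isOpen_Hsp.measurableSet fun p hp => mul_le_mul_left (hk p hp) _

theorem greenPot_add {h k : P3 → ℝ≥0∞} (hh : AEMeasurable h (volume.restrict Hsp)) (q : P3) :
    greenPot (fun p => h p + k p) q = greenPot h q + greenPot k q := by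
  simp only [greenPot, add_mul]
  exact lintegral_add_left' (hh.mul (measurable_greenReg 0 q).ennreal_ofReal.aemeasurable) _

theorem greenPot_const_mul {h : P3 → ℝ≥0∞} (hh : AEMeasurable h (volume.restrict Hsp))
    (c : ℝ≥0∞) (q : P3) : greenPot (fun p => c * h p) q = c * greenPot h q := by
  simp only [greenPot, mul_assoc]
  exact lintegral_const_mul'' _ (hh.mul (measurable_greenReg 0 q).ennreal_ofReal.aemeasurable)

theorem greenReg_zero_le (q p : P3) : greenReg 0 q p ≤ ‖p - q‖⁻¹ := by
  rcases eq_or_ne p q with rfl | h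
  · have : 0 ≤ (rdist 0 (reflect p) p)⁻¹ := inv_nonneg.2 (Real.sqrt_nonneg _)
    simp only [greenReg, rdist, sub_self] at *
    simp [nsq] at *
  have h1 : 0 ≤ (rdist 0 (reflect q) p)⁻¹ := inv_nonneg.2 (Real.sqrt_nonneg _)
  have h2 := inv_anti₀ (norm_pos_iff.2 (sub_ne_zero.2 h)) (norm_sub_le_rdist 0 q p)
  rw [greenReg]; linarith

theorem norm_inv_le_trunc (q p : P3) : ‖p - q‖⁻¹ ≤ trunc q 1 p + 1 := by
  rcases le_total ‖p - q‖ 1 with h | h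
  · rw [trunc_of_le h]
    rcases (norm_nonneg (p - q)).eq_or_lt with h0 | h0
    · rw [← h0]; simp
    · have : ‖p - q‖⁻¹ ≤ (‖p - q‖ ^ 2)⁻¹ := inv_anti₀ (by positivity) (by nlinarith)
      linarith
  · have := trunc_nonneg q 1 p
    have := inv_le_one_of_one_le₀ h
    linarith

theorem greenPot_barrier_lt_top (q : P3) :
    greenPot (fun p => ofReal (15 * (p.1 * (rdist 1 0 p ^ 7)⁻¹))) q < ⊤ := by
  have hi : Integrable fun p : P3 => 15 * trunc q 1 p + 5 * (3 * (√(nsq p + 1) ^ 5)⁻¹) :=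
    ((integrable_trunc q 1).const_mul 15).add (integrable_newton.const_mul 5)
  refine lt_of_le_of_lt ?_ (hi.restrict (s := Hsp)).lintegral_lt_top
  refine setLIntegral_mono' isOpen_Hsp.measurableSet fun p hp => ?_
  have h0 : 0 < p.1 := hp
  have hρ := rdist_pos one_pos 0 p
  rw [← ofReal_mul (by positivity)]
  refine ofReal_le_ofReal ?_
  have e : √(nsq p + 1) = rdist 1 0 p := by simp [rdist]
  rw [e]
  have h1 : 1 ≤ rdist 1 0 p := Real.one_le_sqrt.2 (by have := nsq_nonneg (p - 0); linarith)
  have h2 : p.1 ≤ rdist 1 0 p := by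
    refine le_sqrt_of_sq_le ?_
    simp only [sub_zero, nsq]; nlinarith [sq_nonneg p.2.1, sq_nonneg p.2.2]
  set ρ := rdist 1 0 p
  have h3 : p.1 * (ρ ^ 7)⁻¹ ≤ (ρ ^ 5)⁻¹ := by
    rw [← div_eq_mul_inv, div_le_iff₀ (by positivity)]
    have : (ρ ^ 5)⁻¹ * ρ ^ 7 = ρ ^ 2 := by field_simp
    rw [this]; nlinarith
  have h4 : (ρ ^ 5)⁻¹ ≤ 1 := inv_le_one_of_one_le₀ (one_le_pow₀ h1)
  have h5 := (greenReg_zero_le q p).trans (norm_inv_le_trunc q p)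
  have h6 : 0 ≤ p.1 * (ρ ^ 7)⁻¹ := by positivity
  have h7 := trunc_nonneg q 1 p
  calc 15 * (p.1 * (ρ ^ 7)⁻¹) * greenReg 0 q p ≤ 15 * (p.1 * (ρ ^ 7)⁻¹) * (trunc q 1 p + 1) := by
        gcongr
    _ ≤ _ := by nlinarith

end GreenFunction

section GreenEnergy

theorem integrable_of_continuousOn_of_vanishOff {K : Set P3} (hK : IsCompact K) {f : P3 → ℝ}
    (hf : ContinuousOn f K) (h0 : VanishOff K f) : Integrable f :=
  (integrableOn_iff_integrable_of_support_subset fun x hx => by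
    by_contra h; exact hx (h0 x h)).1 (hf.integrableOn_compact hK)

theorem ofReal_add_ofReal_le {x y z : ℝ} (hy : 0 ≤ y) (hz : 0 ≤ z) (h : x + y ≤ z) :
    ofReal x + ofReal y ≤ ofReal z + ofReal (-x) := by
  rcases le_total 0 x with hx | hx
  · rw [← ofReal_add hx hy, ENNReal.ofReal_of_nonpos (neg_nonpos.2 hx), add_zero]
    exact ofReal_le_ofReal h
  · rw [ENNReal.ofReal_of_nonpos hx, zero_add, ← ofReal_add hz (neg_nonneg.2 hx)]
    exact ofReal_le_ofReal (by linarith)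

variable (c : Fin 6 → Sm Hsp E3) (f : Sm Hsp E3)

theorem gradSq_nonneg (p : P3) : 0 ≤ (gradSq dir c f).1 p := by
  rw [gradSq_apply]; exact sum_nonneg fun _ _ => sq_nonneg _

/-- Testing the Bochner identity for a truncation of `|f|² + δ·barrier` against the regularised
Green function. -/
theorem green_energy_reg (hf : EndsZero fun p => ‖f.1 p‖) {q : P3} (hq : q ∈ Hsp) {ε δ : ℝ}
    (hε : 0 < ε) (hδ : 0 < δ) :
    ∃ x : ℝ → ℝ, Tendsto x (𝓝[>] 0)
        (𝓝 (newtonMass * softPosAt ε (‖f.1 q‖ ^ 2 + δ * barrier.1 q))) ∧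
      ∀ η > 0, ofReal (x η)
        + ∫⁻ p in Hsp, ofReal (Real.smoothTransition
            ((‖f.1 p‖ ^ 2 + δ * barrier.1 p) / ε - 1) * (2 * (gradSq dir c f).1 p)
              * greenReg η q p)
        ≤ greenPot (fun p => ofReal (2 * (‖f.1 p‖ * ‖(covL dir c f).1 p‖)
            + δ * (15 * (p.1 * (rdist 1 0 p ^ 7)⁻¹)))) q + ofReal (-x η) := by
  set φ : Sm Hsp ℝ := ip f f + δ • barrier with hφ
  have hφp : ∀ p, φ.1 p = ‖f.1 p‖ ^ 2 + δ * barrier.1 p := fun p => by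
    simp [hφ]
  have hb0 : ∀ p, 0 ≤ barrier.1 p := fun p => by
    by_cases hp : p ∈ Hsp
    · exact (barrier_pos hp).le
    · rw [barrier.2.2 p hp]
  have hφ0 : ∀ p, 0 ≤ φ.1 p := fun p => by
    rw [hφp]; have := hb0 p; positivity
  have hends : EndsLt φ.1 ε := by
    refine EndsLt.and (hf (√(ε / 2)) (by positivity)) (endsZero_barrier (ε / (2 * δ)) (by positivity))
      fun p hp h1 h2 => ?_
    rw [hφp]
    have h3 : ‖f.1 p‖ ^ 2 < ε / 2 := by
      have := pow_lt_pow_left₀ h1 (norm_nonneg _) two_ne_zero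
      rwa [sq_sqrt (by positivity)] at this
    have h4 : δ * barrier.1 p < δ * (ε / (2 * δ)) := by gcongr
    have h5 : δ * (ε / (2 * δ)) = ε / 2 := by field_simp
    linarith
  obtain ⟨K, hKH, hK, hKb⟩ := hends.exists_compact
  have hoff : ∀ p ∉ K, φ.1 p ≤ ε := fun p hp => by
    by_cases hpH : p ∈ Hsp
    · exact (hKb p hpH hp).le
    · rw [φ.2.2 p hpH]; exact hε.le
  set ψ := Sm.post (softPosAt ε) (contDiff_softPosAt ε) φ with hψ
  have hψK : VanishOff K ψ.1 := fun p hp => by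
    by_cases hpH : p ∈ Hsp
    · rw [hψ, Sm.post_apply _ _ hpH, softPosAt_of_le hε (hφ0 p) (hoff p hp)]
    · exact ψ.2.2 p hpH
  set w : P3 → ℝ := fun p => Real.smoothTransition (φ.1 p / ε - 1) with hw
  have hw0 : ∀ p, 0 ≤ w p := fun p => Real.smoothTransition.nonneg _
  have hw1 : ∀ p, w p ≤ 1 := fun p => Real.smoothTransition.le_one _
  have hwK : ∀ p ∉ K, w p = 0 := fun p hp => Real.smoothTransition.zero_of_nonpos (by
    have := (div_le_one hε).2 (hoff p hp); linarith)
  have hwc : ContinuousOn w Hsp := Real.smoothTransition.continuous.comp_continuousOn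
    (((Sm.continuousOn φ).div_const ε).sub continuousOn_const)
  have hfl : ∀ p ∈ Hsp, -(flap ψ).1 p + w p * (2 * (gradSq dir c f).1 p)
      ≤ w p * (2 * (‖f.1 p‖ * ‖(covL dir c f).1 p‖) + δ * (15 * (p.1 * (rdist 1 0 p ^ 7)⁻¹))) := by
    intro p hp
    have h1 := flap_post_ge (contDiff_softPosAt ε) (monotone_deriv_softPosAt hε) φ hp
    rw [deriv_softPosAt hε] at h1
    have h2 : (flap φ).1 p = 2 * (gradSq dir c f).1 p + 2 * inner ℝ (f.1 p) ((covL dir c f).1 p)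
        - δ * (15 * (p.1 * (rdist 1 0 p ^ 7)⁻¹)) := by
      rw [hφ, map_add, map_smul, flap_ip_self c]
      simp only [Sm.add_apply, Sm.smul_apply, flap_barrier hp, ip_apply, smul_eq_mul]
      ring
    have h3 := neg_le_of_abs_le (abs_real_inner_le_norm (f.1 p) ((covL dir c f).1 p))
    rw [h2] at h1
    have h4 := mul_le_mul_of_nonneg_left h3 (hw0 p)
    change w p * _ ≤ _ at h1
    linarith
  refine ⟨fun η => -∫ p, (flap ψ).1 p * greenReg η q p, ?_, fun η hη => ?_⟩
  · have h1 := Sm.tendsto_integral_flap isOpen_Hsp hK hKH hψK q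
    have h2 := Sm.tendsto_integral_flap isOpen_Hsp hK hKH hψK (reflect q)
    rw [ψ.2.2 _ (reflect_notMem hq), mul_zero] at h2
    have h3 := h1.sub h2
    rw [sub_zero, hψ, Sm.post_apply _ _ hq, hφp] at h3
    refine h3.congr' ?_
    filter_upwards [self_mem_nhdsWithin] with η hη
    have i : ∀ x₀, Integrable fun p => (flap ψ).1 p * (rdist η x₀ p)⁻¹ := fun x₀ => by
      refine Sm.integrable_mul isOpen_Hsp hK hKH (fun p hp => ?_)
        ((continuous_rdist η x₀).inv₀ fun p => (rdist_pos hη x₀ p).ne')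
      rw [flap_eq, Sm.sum_apply]
      exact Finset.sum_eq_zero fun i _ => Sm.vanishOff_d isOpen_Hsp hK hKH
        (Sm.vanishOff_d isOpen_Hsp hK hKH hψK _) _ p hp
    simp only [greenReg, mul_sub]
    rw [integral_sub (i q) (i _)]
    ring
  · have hflK : VanishOff K (flap ψ).1 := fun p hp => by
      rw [flap_eq, Sm.sum_apply]
      exact Finset.sum_eq_zero fun i _ => Sm.vanishOff_d isOpen_Hsp hK hKH
        (Sm.vanishOff_d isOpen_Hsp hK hKH hψK _) _ p hp
    have hgc := continuous_greenReg hη q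
    have i1 : Integrable fun p => (flap ψ).1 p * greenReg η q p :=
      Sm.integrable_mul isOpen_Hsp hK hKH hflK hgc
    have i2 : Integrable fun p => w p * (2 * (gradSq dir c f).1 p) * greenReg η q p := by
      refine integrable_of_continuousOn_of_vanishOff hK ?_ fun p hp => by simp [hwK p hp]
      exact ((hwc.mul (continuousOn_const.mul (Sm.continuousOn _))).mul hgc.continuousOn).mono hKH
    have i3 : Integrable fun p => w p * (2 * (‖f.1 p‖ * ‖(covL dir c f).1 p‖)
        + δ * (15 * (p.1 * (rdist 1 0 p ^ 7)⁻¹))) * greenReg η q p := by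
      refine integrable_of_continuousOn_of_vanishOff hK ?_ fun p hp => by simp [hwK p hp]
      refine ContinuousOn.mono (s := Hsp) ?_ hKH
      refine (hwc.mul ((continuousOn_const.mul ((Sm.continuousOn f).norm.mul
        (Sm.continuousOn (covL dir c f)).norm)).add ?_)).mul hgc.continuousOn
      exact (continuous_const.mul (continuous_const.mul (continuous_fst.mul
        (contDiff_rdist_inv_pow one_pos 0 7).continuous))).continuousOn
    have hN : ∀ p ∈ Hsp, 0 ≤ greenReg η q p := fun p hp => greenReg_nonneg hq hp hη
    have hsum : (-∫ p, (flap ψ).1 p * greenReg η q p)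
        + ∫ p in Hsp, w p * (2 * (gradSq dir c f).1 p) * greenReg η q p
        ≤ ∫ p in Hsp, w p * (2 * (‖f.1 p‖ * ‖(covL dir c f).1 p‖)
        + δ * (15 * (p.1 * (rdist 1 0 p ^ 7)⁻¹))) * greenReg η q p := by
      have e : ∫ p, (flap ψ).1 p * greenReg η q p
          = ∫ p in Hsp, (flap ψ).1 p * greenReg η q p :=
        (setIntegral_eq_integral_of_forall_compl_eq_zero fun p hp => by
          rw [(flap ψ).2.2 p hp, zero_mul]).symm
      have i1n : Integrable (fun p => -((flap ψ).1 p * greenReg η q p)) (volume.restrict Hsp) :=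
        i1.restrict.neg
      rw [e, ← integral_neg, ← integral_add i1n i2.restrict]
      refine setIntegral_mono_on (i1n.add i2.restrict) i3.restrict
        isOpen_Hsp.measurableSet fun p hp => ?_
      have := mul_le_mul_of_nonneg_right (hfl p hp) (hN p hp)
      linarith
    have n2 : ∀ p ∈ Hsp, 0 ≤ w p * (2 * (gradSq dir c f).1 p) * greenReg η q p := fun p hp =>
      mul_nonneg (mul_nonneg (hw0 p) (mul_nonneg zero_le_two (gradSq_nonneg c f p))) (hN p hp)
    have n4 : ∀ p ∈ Hsp, 0 ≤ 2 * (‖f.1 p‖ * ‖(covL dir c f).1 p‖)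
        + δ * (15 * (p.1 * (rdist 1 0 p ^ 7)⁻¹)) := fun p hp => by
      have : 0 < p.1 := hp
      have := rdist_pos one_pos 0 p
      positivity
    have n3 : ∀ p ∈ Hsp, 0 ≤ w p * (2 * (‖f.1 p‖ * ‖(covL dir c f).1 p‖)
        + δ * (15 * (p.1 * (rdist 1 0 p ^ 7)⁻¹))) * greenReg η q p := fun p hp =>
      mul_nonneg (mul_nonneg (hw0 p) (n4 p hp)) (hN p hp)
    have aux := ofReal_add_ofReal_le (setIntegral_nonneg isOpen_Hsp.measurableSet n2)
      (setIntegral_nonneg isOpen_Hsp.measurableSet n3) hsum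
    have ae2 := (ae_restrict_iff' (μ := volume) isOpen_Hsp.measurableSet).2 (.of_forall n2)
    have ae3 := (ae_restrict_iff' (μ := volume) isOpen_Hsp.measurableSet).2 (.of_forall n3)
    rw [ofReal_integral_eq_lintegral_ofReal i2.restrict ae2,
      ofReal_integral_eq_lintegral_ofReal i3.restrict ae3] at aux
    simp only [hw, hφp] at aux ⊢
    refine aux.trans (add_le_add_left ?_ _)
    have hne : ∀ᵐ p : P3 ∂volume, p ≠ q := by
      rw [ae_iff]; simp
    refine lintegral_mono_ae ?_
    filter_upwards [ae_restrict_of_ae hne, ae_restrict_mem isOpen_Hsp.measurableSet] with p hp hpH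
    rw [← ofReal_mul (n4 p hpH)]
    refine ofReal_le_ofReal ?_
    exact mul_le_mul (mul_le_of_le_one_left (n4 p hpH) (Real.smoothTransition.le_one _))
      (greenReg_le hq hpH hp hη) (hN p hpH) (n4 p hpH)

theorem add_lintegral_le_of_tendsto {α : Type*} [MeasurableSpace α] {μ : Measure α}
    {F : ℕ → α → ℝ≥0∞} {G : α → ℝ≥0∞} {x b : ℕ → ℝ≥0∞} {L B : ℝ≥0∞}
    (hF : ∀ n, AEMeasurable (F n) μ) (hG : ∀ᵐ p ∂μ, Tendsto (fun n => F n p) atTop (𝓝 (G p)))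
    (hx : Tendsto x atTop (𝓝 L)) (hL : L ≠ ⊤) (hb : Tendsto b atTop (𝓝 B))
    (h : ∀ n, x n + ∫⁻ p, F n p ∂μ ≤ b n) : L + ∫⁻ p, G p ∂μ ≤ B := by
  have h1 : ∫⁻ p, G p ∂μ ≤ liminf (fun n => ∫⁻ p, F n p ∂μ) atTop := by
    refine le_trans (lintegral_mono_ae ?_) (lintegral_liminf_le' hF)
    filter_upwards [hG] with p hp
    exact hp.liminf_eq.ge
  have h2 : ∀ᶠ n in atTop, ∫⁻ p, F n p ∂μ ≤ b n - x n := by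
    filter_upwards [hx.eventually_lt_const (lt_top_iff_ne_top.2 hL)] with n hn
    exact ENNReal.le_sub_of_add_le_left hn.ne (h n)
  have h3 : Tendsto (fun n => b n - x n) atTop (𝓝 (B - L)) := ENNReal.Tendsto.sub hb hx (.inr hL)
  have h4 : ∫⁻ p, G p ∂μ ≤ B - L := h1.trans ((liminf_le_liminf h2).trans h3.liminf_eq.le)
  have h5 : L ≤ B := le_of_tendsto_of_tendsto' hx hb fun n => le_self_add.trans (h n)
  calc L + ∫⁻ p, G p ∂μ ≤ L + (B - L) := by gcongr
    _ = B := add_tsub_cancel_of_le h5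

theorem green_energy_trunc (hf : EndsZero fun p => ‖f.1 p‖) {q : P3} (hq : q ∈ Hsp) {ε δ : ℝ}
    (hε : 0 < ε) (hδ : 0 < δ) :
    ofReal (newtonMass * softPosAt ε (‖f.1 q‖ ^ 2 + δ * barrier.1 q))
        + ∫⁻ p in Hsp, ofReal (Real.smoothTransition
            ((‖f.1 p‖ ^ 2 + δ * barrier.1 p) / ε - 1) * (2 * (gradSq dir c f).1 p)
              * greenReg 0 q p)
        ≤ greenPot (fun p => ofReal (2 * (‖f.1 p‖ * ‖(covL dir c f).1 p‖)
            + δ * (15 * (p.1 * (rdist 1 0 p ^ 7)⁻¹)))) q := by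
  obtain ⟨x, hx, hle⟩ := green_energy_reg c f hf hq hε hδ
  set l := newtonMass * softPosAt ε (‖f.1 q‖ ^ 2 + δ * barrier.1 q)
  have hl : 0 ≤ l := mul_nonneg newtonMass_pos.le (softPosAt_nonneg hε (by
    have := barrier_pos hq; positivity))
  have hseq : Tendsto (fun n : ℕ => 1 / ((n : ℝ) + 1)) atTop (𝓝[>] 0) :=
    tendsto_nhdsWithin_iff.2 ⟨tendsto_one_div_add_atTop_nhds_zero_nat,
      .of_forall fun n => by simp only [mem_Ioi]; positivity⟩
  have hx' := hx.comp hseq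
  refine add_lintegral_le_of_tendsto
    (F := fun (n : ℕ) p => ofReal (Real.smoothTransition
            ((‖f.1 p‖ ^ 2 + δ * barrier.1 p) / ε - 1) * (2 * (gradSq dir c f).1 p)
              * greenReg (1 / ((n : ℝ) + 1)) q p))
    (fun n => ?_) ?_ (ENNReal.tendsto_ofReal hx') ofReal_ne_top
    (b := fun n : ℕ => greenPot (fun p => ofReal (2 * (‖f.1 p‖ * ‖(covL dir c f).1 p‖)
            + δ * (15 * (p.1 * (rdist 1 0 p ^ 7)⁻¹)))) q
              + ofReal (-x (1 / ((n : ℝ) + 1)))) ?_ fun n => hle _ (by positivity)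
  · refine (ContinuousOn.aemeasurable ?_ isOpen_Hsp.measurableSet).ennreal_ofReal
    refine ContinuousOn.mul (ContinuousOn.mul ?_ (continuousOn_const.mul (Sm.continuousOn _)))
      (continuous_greenReg (by positivity) q).continuousOn
    exact Real.smoothTransition.continuous.comp_continuousOn (((((Sm.continuousOn f).norm.pow 2).add
      (continuousOn_const.mul (Sm.continuousOn barrier))).div_const ε).sub continuousOn_const)
  · have hne : ∀ᵐ p : P3 ∂volume, p ≠ q := by
      rw [ae_iff]; simp
    filter_upwards [ae_restrict_of_ae hne, ae_restrict_mem isOpen_Hsp.measurableSet] with p hp hpH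
    exact ENNReal.tendsto_ofReal (((tendsto_greenReg hq hpH hp).comp
      tendsto_one_div_add_atTop_nhds_zero_nat).const_mul _)
  · have h1 := ENNReal.tendsto_ofReal hx'.neg
    rw [ENNReal.ofReal_of_nonpos (neg_nonpos.2 hl)] at h1
    simpa using h1.const_add (greenPot (fun p => ofReal (2 * (‖f.1 p‖ *
      ‖(covL dir c f).1 p‖) + δ * (15 * (p.1 * (rdist 1 0 p ^ 7)⁻¹)))) q)

/-- The energy inequality: the Green potential of `|∇f|²` is controlled by that of `|f||Lf|`. -/
theorem green_energy (hf : EndsZero fun p => ‖f.1 p‖) {q : P3} (hq : q ∈ Hsp) :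
    ofReal (newtonMass * ‖f.1 q‖ ^ 2)
        + greenPot (fun p => ofReal (2 * (gradSq dir c f).1 p)) q
      ≤ greenPot (fun p => ofReal (2 * (‖f.1 p‖ * ‖(covL dir c f).1 p‖))) q := by
  set a : ℕ → ℝ := fun n => 1 / ((n : ℝ) + 1) with ha
  have ha0 : ∀ n, 0 < a n := fun n => by simp only [ha]; positivity
  have ha1 : Tendsto a atTop (𝓝 0) := tendsto_one_div_add_atTop_nhds_zero_nat
  set B := greenPot (fun p => ofReal (15 * (p.1 * (rdist 1 0 p ^ 7)⁻¹))) q with hB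
  have key := fun n => green_energy_trunc c f hf hq (pow_pos (ha0 n) 2) (ha0 n)
  have hsplit : ∀ n, greenPot (fun p => ofReal (2 * (‖f.1 p‖ * ‖(covL dir c f).1 p‖)
            + a n * (15 * (p.1 * (rdist 1 0 p ^ 7)⁻¹)))) q
      ≤ greenPot (fun p => ofReal (2 * (‖f.1 p‖ * ‖(covL dir c f).1 p‖))) q
        + ofReal (a n) * B := by
    intro n
    have m1 : Measurable fun p : P3 => ofReal (15 * (p.1 * (rdist 1 0 p ^ 7)⁻¹)) :=
      (measurable_const.mul (measurable_fst.mul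
        (contDiff_rdist_inv_pow one_pos 0 7).continuous.measurable)).ennreal_ofReal
    have m2 : AEMeasurable (fun p => ofReal (2 * (‖f.1 p‖ * ‖(covL dir c f).1 p‖)))
        (volume.restrict Hsp) :=
      (ContinuousOn.aemeasurable (continuousOn_const.mul ((Sm.continuousOn f).norm.mul
        (Sm.continuousOn (covL dir c f)).norm)) isOpen_Hsp.measurableSet).ennreal_ofReal
    rw [hB, ← greenPot_const_mul m1.aemeasurable, ← greenPot_add m2]
    refine greenPot_mono (fun p hp => ?_) q
    have : 0 < p.1 := hp
    have := rdist_pos one_pos 0 p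
    rw [← ofReal_mul (ha0 n).le, ← ofReal_add (by positivity)
      (mul_nonneg (ha0 n).le (by positivity))]
  refine add_lintegral_le_of_tendsto
    (F := fun (n : ℕ) p => ofReal (Real.smoothTransition
            ((‖f.1 p‖ ^ 2 + a n * barrier.1 p) / a n ^ 2 - 1) * (2 * (gradSq dir c f).1 p)
              * greenReg 0 q p))
    (x := fun n => ofReal (newtonMass * softPosAt (a n ^ 2)
      (‖f.1 q‖ ^ 2 + a n * barrier.1 q)))
    (b := fun n => greenPot (fun p => ofReal (2 * (‖f.1 p‖ * ‖(covL dir c f).1 p‖))) q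
        + ofReal (a n) * B) (fun n => ?_) ?_ ?_ ofReal_ne_top ?_
    fun n => (key n).trans (hsplit n)
  · refine AEMeasurable.ennreal_ofReal (AEMeasurable.mul ?_ (measurable_greenReg 0 q).aemeasurable)
    refine ContinuousOn.aemeasurable (ContinuousOn.mul ?_ (continuousOn_const.mul
      (Sm.continuousOn _))) isOpen_Hsp.measurableSet
    exact Real.smoothTransition.continuous.comp_continuousOn (((((Sm.continuousOn f).norm.pow 2).add
      (continuousOn_const.mul (Sm.continuousOn barrier))).div_const _).sub continuousOn_const)
  · filter_upwards [ae_restrict_mem isOpen_Hsp.measurableSet] with p hp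
    have hb := barrier_pos hp
    have hev : ∀ᶠ n in atTop, a n < barrier.1 p / 2 :=
      ha1.eventually_lt_const (by positivity)
    refine tendsto_const_nhds.congr' ?_
    filter_upwards [hev] with n hn
    rw [Real.smoothTransition.one_of_one_le, one_mul,
      ofReal_mul (mul_nonneg zero_le_two (gradSq_nonneg c f p))]
    rw [le_sub_iff_add_le, le_div_iff₀ (pow_pos (ha0 n) 2)]
    nlinarith [ha0 n, sq_nonneg ‖f.1 p‖]
  · refine ENNReal.tendsto_ofReal (Tendsto.const_mul _ ?_)
    have hb := barrier_pos hq
    have up : Tendsto (fun n => ‖f.1 q‖ ^ 2 + a n * barrier.1 q) atTop (𝓝 (‖f.1 q‖ ^ 2)) := by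
      simpa using (ha1.mul_const (barrier.1 q)).const_add (‖f.1 q‖ ^ 2)
    have lo : Tendsto (fun n => ‖f.1 q‖ ^ 2 + a n * barrier.1 q - 2 * a n ^ 2) atTop
        (𝓝 (‖f.1 q‖ ^ 2)) := by
      simpa using up.sub ((ha1.pow 2).const_mul 2)
    refine tendsto_of_tendsto_of_tendsto_of_le_of_le lo up (fun n => ?_) fun n => ?_
    · have := ha0 n
      exact sub_le_softPosAt (pow_pos (ha0 n) 2) (by positivity)
    · have := ha0 n
      exact softPosAt_le (pow_pos (ha0 n) 2) (by positivity)
  · have h1 := ENNReal.Tendsto.mul_const (ENNReal.tendsto_ofReal ha1)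
      (.inr (greenPot_barrier_lt_top q).ne)
    rw [ENNReal.ofReal_zero, zero_mul] at h1
    have h2 := h1.const_add
      (greenPot (fun p => ofReal (2 * (‖f.1 p‖ * ‖(covL dir c f).1 p‖))) q)
    rw [add_zero] at h2
    exact h2

end GreenEnergy

section GreenPotential

theorem integral_add_inv_sq {t : ℝ} (ht : 0 < t) :
    IntegrableOn (fun y : ℝ => ((y + t) ^ 2)⁻¹) (Ioi 0) ∧
      ∫ y in Ioi (0 : ℝ), ((y + t) ^ 2)⁻¹ = 1 / t := by
  have hd : ∀ y ∈ Ici (0 : ℝ), HasDerivAt (fun y => -(y + t)⁻¹) (((y + t) ^ 2)⁻¹) y := by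
    intro y hy
    have h0 : y + t ≠ 0 := by have : (0 : ℝ) ≤ y := hy; positivity
    have := (((hasDerivAt_id y).add_const t).inv h0).neg
    refine this.congr_deriv ?_
    simp only [id]
    ring
  have hl : Tendsto (fun y : ℝ => -(y + t)⁻¹) atTop (𝓝 0) := by
    simpa using (tendsto_inv_atTop_zero.comp (tendsto_atTop_add_const_right atTop t tendsto_id)).neg
  have hi := integrableOn_Ioi_deriv_of_nonneg' hd (fun y _ => by positivity) hl
  refine ⟨hi, ?_⟩
  rw [integral_Ioi_of_hasDerivAt_of_tendsto' hd hi hl]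
  simp

theorem exists_lintegral_radial_le : ∃ C : ℝ, 0 < C ∧ ∀ (q : P3) (t : ℝ), 0 < t →
    ∫⁻ p : P3, ofReal ((‖p - q‖ ^ 2 * (‖p - q‖ + t) ^ 2)⁻¹) ≤ ofReal (C / t) := by
  refine ⟨3 * volume.real (ball (0 : P3) 1) + 1, by positivity, fun q t ht => ?_⟩
  have hE : EqOn (fun y : ℝ => y ^ (Module.finrank ℝ P3 - 1) • (y ^ 2 * (y + t) ^ 2)⁻¹)
      (fun y => ((y + t) ^ 2)⁻¹) (Ioi 0) := by
    intro y hy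
    have hy' : (0 : ℝ) < y := hy
    rw [finrank_P3]
    norm_num
    field_simp
  have hi : Integrable fun p : P3 => (‖p‖ ^ 2 * (‖p‖ + t) ^ 2)⁻¹ := by
    rw [integrable_fun_norm_addHaar (volume : Measure P3) (f := fun y => (y ^ 2 * (y + t) ^ 2)⁻¹),
      integrableOn_congr_fun hE measurableSet_Ioi]
    exact (integral_add_inv_sq ht).1
  rw [lintegral_sub_right_eq_self
    (fun p : P3 => ofReal ((‖p‖ ^ 2 * (‖p‖ + t) ^ 2)⁻¹)) q,
    ← ofReal_integral_eq_lintegral_ofReal hi (.of_forall fun p => by positivity),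
    integral_fun_norm_addHaar (volume : Measure P3) (f := fun y => (y ^ 2 * (y + t) ^ 2)⁻¹),
    setIntegral_congr_fun measurableSet_Ioi hE, (integral_add_inv_sq ht).2, finrank_P3]
  refine ofReal_le_ofReal ?_
  simp only [nsmul_eq_mul, smul_eq_mul]
  rw [div_eq_mul_one_div (3 * volume.real (ball (0 : P3) 1) + 1) t]
  have : 0 < 1 / t := by positivity
  push_cast
  linarith

theorem greenReg_zero_bounds {q p : P3} (hq : q ∈ Hsp) (hp : p ∈ Hsp) (h : p ≠ q) :
    0 ≤ greenReg 0 q p ∧ greenReg 0 q p * (‖p - q‖ * (‖p - q‖ + q.1)) ≤ 8 * q.1 ∧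
      greenReg 0 q p * (‖p - q‖ * (‖p - q‖ + q.1)) ≤ 8 * p.1 := by
  have hn : 0 < ‖p - q‖ := norm_pos_iff.2 (sub_ne_zero.2 h)
  have hq1 : 0 < q.1 := hq
  have hp1 : 0 < p.1 := hp
  have a1 := norm_sub_le_rdist 0 q p
  have a0 : 0 < rdist 0 q p := hn.trans_le a1
  have ab := rdist_le_reflect hq hp 0
  have b0 : 0 < rdist 0 (reflect q) p := a0.trans_le ab
  have b1 : p.1 + q.1 ≤ rdist 0 (reflect q) p := by
    have := (le_abs_self _).trans ((norm_fst_le (p - reflect q)).trans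
      (norm_sub_le_rdist 0 (reflect q) p))
    simpa [reflect] using this
  rw [greenReg_eq a0 b0]
  generalize rdist 0 q p = a at *
  generalize rdist 0 (reflect q) p = b at *
  generalize ‖p - q‖ = n at *
  have h1 : n * (n + q.1) ≤ a * (2 * b) := by gcongr; linarith
  have h2 : 4 * p.1 * q.1 * (n * (n + q.1)) ≤ 4 * p.1 * q.1 * (a * (2 * b)) := by gcongr
  rw [div_mul_eq_mul_div, div_le_iff₀ (by positivity), div_le_iff₀ (by positivity)]
  refine ⟨by positivity, ?_, ?_⟩
  · have h3 : 8 * q.1 * (a * b) * p.1 ≤ 8 * q.1 * (a * b) * (a + b) := by gcongr; linarith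
    linarith
  · have h3 : 8 * p.1 * (a * b) * q.1 ≤ 8 * p.1 * (a * b) * (a + b) := by gcongr; linarith
    linarith

theorem greenReg_sq_le {q p : P3} (hq : q ∈ Hsp) (hp : p ∈ Hsp) (h : p ≠ q) :
    greenReg 0 q p ^ 2 ≤ (1 + p.1 ^ 2) *
      (64 * min (q.1 ^ 2) 1 * (‖p - q‖ ^ 2 * (‖p - q‖ + q.1) ^ 2)⁻¹) := by
  obtain ⟨h0, h1, h2⟩ := greenReg_zero_bounds hq hp h
  have hn : 0 < ‖p - q‖ := norm_pos_iff.2 (sub_ne_zero.2 h)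
  have hq1 : 0 < q.1 := hq
  have hp1 : 0 < p.1 := hp
  set w := ‖p - q‖ * (‖p - q‖ + q.1) with hw
  have hw0 : 0 < w := by positivity
  have e : ‖p - q‖ ^ 2 * (‖p - q‖ + q.1) ^ 2 = w ^ 2 := by rw [hw]; ring
  rw [e, ← mul_assoc, ← div_eq_mul_inv, le_div_iff₀ (by positivity), ← mul_pow]
  have i1 : (greenReg 0 q p * w) ^ 2 ≤ (8 * q.1) ^ 2 := by gcongr
  have i2 : (greenReg 0 q p * w) ^ 2 ≤ (8 * p.1) ^ 2 := by gcongr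
  rcases le_total (q.1 ^ 2) 1 with hm | hm
  · rw [min_eq_left hm]; nlinarith [mul_pos (pow_pos hp1 2) (pow_pos hq1 2)]
  · rw [min_eq_right hm]; nlinarith

/-- Weighted Cauchy–Schwarz bound for Green potentials. -/
theorem exists_greenPot_le : ∃ C : ℝ, 0 < C ∧ ∀ (x : P3 → ℝ), (∀ p, 0 ≤ x p) →
    ∀ q ∈ Hsp, ∀ l : ℝ, 0 < l → greenPot (fun p => ofReal (x p)) q ≤
      ofReal l * (∫⁻ p in Hsp, ofReal ((1 + p.1 ^ 2) * x p ^ 2))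
        + ofReal (C * min q.1 (1 / q.1) / l) := by
  obtain ⟨C, hC, hb⟩ := exists_lintegral_radial_le
  refine ⟨16 * C, by positivity, fun x hx q hq l hl => ?_⟩
  have hq1 : 0 < q.1 := hq
  set w : P3 → ℝ := fun p => (‖p - q‖ ^ 2 * (‖p - q‖ + q.1) ^ 2)⁻¹
  have hwm : Measurable fun p => ofReal (w p) := by
    refine Measurable.ennreal_ofReal (Measurable.inv ?_)
    fun_prop
  set m := 16 * min (q.1 ^ 2) 1 / l
  have hm : 0 ≤ m := by positivity
  have hne : ∀ᵐ p : P3 ∂volume, p ≠ q := by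
    rw [ae_iff]; simp
  have step : greenPot (fun p => ofReal (x p)) q ≤ ∫⁻ p in Hsp,
      (ofReal l * ofReal ((1 + p.1 ^ 2) * x p ^ 2)
        + ofReal m * ofReal (w p)) := by
    refine lintegral_mono_ae ?_
    filter_upwards [ae_restrict_of_ae hne, ae_restrict_mem isOpen_Hsp.measurableSet] with p hp hpH
    have hw0 : 0 ≤ w p := by positivity
    rw [← ofReal_mul (hx p), ← ofReal_mul hl.le, ← ofReal_mul hm,
      ← ofReal_add (by positivity) (by positivity)]
    refine ofReal_le_ofReal ?_
    have h1 := greenReg_sq_le hq hpH hp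
    change _ ≤ (1 + p.1 ^ 2) * (64 * min (q.1 ^ 2) 1 * w p) at h1
    have h2 : 4 * l * m = 64 * min (q.1 ^ 2) 1 := by simp only [m]; field_simp; ring
    rw [← h2] at h1
    have hs : 0 < 1 + p.1 ^ 2 := by positivity
    set G := greenReg 0 q p
    have h3 : 0 ≤ (2 * l * (1 + p.1 ^ 2) * x p - G) ^ 2 := sq_nonneg _
    have h4 : 0 ≤ 4 * l * (1 + p.1 ^ 2) * (l * ((1 + p.1 ^ 2) * x p ^ 2) + m * w p - x p * G) := by
      nlinarith
    have h5 := (mul_nonneg_iff_of_pos_left (by positivity : 0 < 4 * l * (1 + p.1 ^ 2))).1 h4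
    linarith
  refine step.trans ?_
  rw [lintegral_add_right _ (hwm.const_mul _), lintegral_const_mul' _ _ ofReal_ne_top]
  gcongr
  rw [lintegral_const_mul _ hwm]
  refine (mul_le_mul_right (setLIntegral_le_lintegral _ _) _).trans
    ((mul_le_mul_right (hb q q.1 hq) _).trans ?_)
  rw [← ofReal_mul hm]
  refine ofReal_le_ofReal (le_of_eq ?_)
  have : min q.1 (1 / q.1) = min (q.1 ^ 2) 1 / q.1 := by
    rw [← min_div_div_right hq1.le]; congr 1; field_simp
  rw [this]
  simp only [m]
  field_simp

theorem exists_lintegral_tail_lt {x : P3 → ℝ} (hx : AEMeasurable x (volume.restrict Hsp))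
    (hN : ∫⁻ p in Hsp, ofReal ((1 + p.1 ^ 2) * x p ^ 2) < ⊤) {ε : ℝ≥0∞} (hε : 0 < ε) :
    ∃ n : ℕ, ∫⁻ p in Hsp, ofReal ((1 + p.1 ^ 2) *
      ((closedBall (0 : P3) n)ᶜ.indicator x p) ^ 2) < ε := by
  have h := tendsto_lintegral_of_dominated_convergence' (μ := volume.restrict Hsp)
    (F := fun (n : ℕ) p => ofReal ((1 + p.1 ^ 2) *
      ((closedBall (0 : P3) n)ᶜ.indicator x p) ^ 2)) (f := fun _ => 0)
    (fun p => ofReal ((1 + p.1 ^ 2) * x p ^ 2)) (fun n => ?_) (fun n => ?_) hN.ne ?_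
  · rw [lintegral_zero] at h
    exact (h.eventually_lt_const hε).exists
  · exact (AEMeasurable.mul (by fun_prop) ((hx.indicator
      Metric.isClosed_closedBall.measurableSet.compl).pow_const 2)).ennreal_ofReal
  · refine .of_forall fun p => ofReal_le_ofReal ?_
    by_cases hp : p ∈ (closedBall (0 : P3) n)ᶜ
    · simp only [indicator_of_mem hp]; exact le_rfl
    · simp only [indicator_of_notMem hp, ne_eq, OfNat.ofNat_ne_zero, not_false_eq_true, zero_pow,
        mul_zero]
      positivity
  · refine .of_forall fun p => tendsto_const_nhds.congr' ?_
    filter_upwards [eventually_ge_atTop ⌈‖p‖⌉₊] with n hn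
    have : p ∉ (closedBall (0 : P3) n)ᶜ := by
      simpa using Nat.ceil_le.1 hn
    simp [indicator_of_notMem this]

theorem znorm_le_norm (p : P3) : znorm p ≤ 2 * ‖p‖ := by
  refine Real.sqrt_le_iff.2 ⟨by positivity, ?_⟩
  have h1 : |p.2.1| ≤ ‖p‖ := (norm_fst_le p.2).trans (norm_snd_le p)
  have h2 : |p.2.2| ≤ ‖p‖ := (norm_snd_le p.2).trans (norm_snd_le p)
  nlinarith [sq_abs p.2.1, sq_abs p.2.2, abs_nonneg p.2.1, abs_nonneg p.2.2,
    pow_le_pow_left₀ (abs_nonneg p.2.1) h1 2, pow_le_pow_left₀ (abs_nonneg p.2.2) h2 2]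

theorem EndsLt.of_norm {φ : P3 → ℝ} {ε δ ρ : ℝ} (hδ : 0 < δ)
    (h1 : ∀ p ∈ Hsp, p.1 < δ → φ p < ε) (h2 : ∀ p ∈ Hsp, ρ ≤ ‖p‖ → φ p < ε) : EndsLt φ ε := by
  refine ⟨⟨δ, hδ, h1⟩, ⟨ρ, fun p hp h => h2 p hp ?_⟩, δ / (2 * (|ρ| + 1)), by positivity,
    fun p hp h => ?_⟩
  · exact h.le.trans ((le_abs_self _).trans (norm_fst_le p))
  · rcases lt_or_ge p.1 δ with h3 | h3
    · exact h1 p hp h3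
    · refine h2 p hp ?_
      have h4 : δ < δ / (2 * (|ρ| + 1)) * (2 * ‖p‖) :=
        (h3.trans_lt h).trans_le (by gcongr; exact znorm_le_norm p)
      have h5 : δ / (2 * (|ρ| + 1)) * (2 * ‖p‖) = δ * (‖p‖ / (|ρ| + 1)) := by field_simp
      rw [h5] at h4
      have h6 : 1 < ‖p‖ / (|ρ| + 1) := by nlinarith
      rw [lt_div_iff₀ (by positivity)] at h6
      linarith [le_abs_self ρ]

theorem greenPot_bounded_endsZero {x : P3 → ℝ} (hx0 : ∀ p, 0 ≤ x p)
    (hx : AEMeasurable x (volume.restrict Hsp))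
    (hN : ∫⁻ p in Hsp, ofReal ((1 + p.1 ^ 2) * x p ^ 2) < ⊤) :
    (∃ M : ℝ, 0 < M ∧ ∀ q ∈ Hsp, greenPot (fun p => ofReal (x p)) q ≤ ofReal M) ∧
      EndsZero fun q => (greenPot (fun p => ofReal (x p)) q).toReal := by
  obtain ⟨C, hC, hb⟩ := exists_greenPot_le
  set N := ∫⁻ p in Hsp, ofReal ((1 + p.1 ^ 2) * x p ^ 2) with hNdef
  have hk : ∀ q ∈ Hsp, min q.1 (1 / q.1) ≤ 1 := fun q hq => by
    rcases le_total q.1 1 with h | h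
    · exact (min_le_left _ _).trans h
    · exact (min_le_right _ _).trans ((div_le_one (by linarith)).2 h)
  refine ⟨⟨N.toReal + C + 1, by positivity, fun q hq => ?_⟩, fun ε hε => ?_⟩
  · refine (hb x hx0 q hq 1 one_pos).trans ?_
    rw [ENNReal.ofReal_one, one_mul, div_one]
    calc N + ofReal (C * min q.1 (1 / q.1)) ≤ ofReal N.toReal + ofReal C := by
          rw [ENNReal.ofReal_toReal hN.ne]
          gcongr
          exact mul_le_of_le_one_right hC.le (hk q hq)
      _ = ofReal (N.toReal + C) := (ofReal_add ENNReal.toReal_nonneg hC.le).symm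
      _ ≤ _ := ofReal_le_ofReal (by linarith)
  · have hred : ∀ q, greenPot (fun p => ofReal (x p)) q < ofReal ε →
        (greenPot (fun p => ofReal (x p)) q).toReal < ε := fun q h =>
      (ENNReal.toReal_lt_of_lt_ofReal h)
    obtain ⟨l, hl, hlN⟩ : ∃ l : ℝ, 0 < l ∧ l * N.toReal < ε / 2 := by
      refine ⟨ε / (2 * (N.toReal + 1)), by positivity, ?_⟩
      rw [div_mul_eq_mul_div, div_lt_div_iff₀ (by positivity) (by positivity)]
      nlinarith
    obtain ⟨n, hn⟩ := exists_lintegral_tail_lt hx hN (ε := ofReal (ε ^ 2 / (16 * C)))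
      (by rw [ENNReal.ofReal_pos]; positivity)
    set x₁ := (closedBall (0 : P3) n).indicator x with hx₁
    set x₂ := (closedBall (0 : P3) n)ᶜ.indicator x with hx₂
    have x1n : ∀ p, 0 ≤ x₁ p := fun p => indicator_nonneg (fun p _ => hx0 p) p
    have x2n : ∀ p, 0 ≤ x₂ p := fun p => indicator_nonneg (fun p _ => hx0 p) p
    set I := ∫⁻ p in Hsp, ofReal (x₁ p) with hI
    have hIfin : I < ⊤ := by
      have h1 : I ≤ ∫⁻ p in Hsp, (ofReal ((1 + p.1 ^ 2) * x p ^ 2)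
          + (closedBall (0 : P3) n).indicator 1 p) := by
        refine lintegral_mono fun p => ?_
        by_cases hp : p ∈ closedBall (0 : P3) n
        · simp only [hx₁, indicator_of_mem hp, Pi.one_apply]
          rw [← ENNReal.ofReal_one, ← ofReal_add (by positivity) zero_le_one]
          refine ofReal_le_ofReal ?_
          nlinarith [mul_nonneg (sq_nonneg p.1) (sq_nonneg (x p)), sq_nonneg (x p - 1)]
        · simp [hx₁, indicator_of_notMem hp]
      refine h1.trans_lt ?_
      rw [lintegral_add_right _ (measurable_one.indicator Metric.isClosed_closedBall.measurableSet)]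
      refine ENNReal.add_lt_top.2 ⟨hN, (setLIntegral_le_lintegral _ _).trans_lt ?_⟩
      rw [lintegral_indicator_one Metric.isClosed_closedBall.measurableSet]
      exact (isCompact_closedBall _ _).measure_lt_top
    refine EndsLt.of_norm (δ := l * ε / (2 * C)) (ρ := 2 * n + 1 + 4 * I.toReal / ε) (by positivity)
      (fun q hq hqd => hred q ?_) fun q hq hqn => hred q ?_
    · refine (hb x hx0 q hq l hl).trans_lt ?_
      rw [← hNdef, ← ENNReal.ofReal_toReal hN.ne, ← ofReal_mul hl.le,
        ← ofReal_add (by positivity) (by have : 0 < q.1 := hq; positivity),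
        ENNReal.ofReal_lt_ofReal_iff hε]
      have h1 : C * min q.1 (1 / q.1) / l < ε / 2 := by
        rw [div_lt_iff₀ hl]
        have := min_le_left q.1 (1 / q.1)
        rw [lt_div_iff₀ (by positivity)] at hqd
        nlinarith
      linarith
    · have hsplit : greenPot (fun p => ofReal (x p)) q
          ≤ greenPot (fun p => ofReal (x₁ p)) q
            + greenPot (fun p => ofReal (x₂ p)) q := by
        rw [← greenPot_add (hx.indicator Metric.isClosed_closedBall.measurableSet).ennreal_ofReal]
        refine greenPot_mono (fun p _ => ?_) q
        rw [← ofReal_add (x1n p) (x2n p)]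
        refine ofReal_le_ofReal (le_of_eq ?_)
        exact (congrFun (indicator_self_add_compl (closedBall (0 : P3) n) x) p).symm
      have g2 : greenPot (fun p => ofReal (x₂ p)) q ≤ ofReal (ε / 2) := by
        refine (hb x₂ x2n q hq (4 * C / ε) (by positivity)).trans ?_
        refine (add_le_add (mul_le_mul_right hn.le _) le_rfl).trans ?_
        rw [← ofReal_mul (by positivity),
          ← ofReal_add (by positivity) (by have : 0 < q.1 := hq; positivity)]
        refine ofReal_le_ofReal ?_
        have h1 : 4 * C / ε * (ε ^ 2 / (16 * C)) = ε / 4 := by field_simp; norm_num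
        have h2 : C * min q.1 (1 / q.1) / (4 * C / ε) = ε / 4 * min q.1 (1 / q.1) := by
          field_simp
        rw [h1, h2]
        nlinarith [hk q hq]
      have hqpos : 0 < ‖q‖ := by
        have : 0 ≤ 4 * I.toReal / ε := by positivity
        have : (0 : ℝ) ≤ n := Nat.cast_nonneg n
        linarith
      have g1 : greenPot (fun p => ofReal (x₁ p)) q ≤ ofReal (2 / ‖q‖) * I := by
        rw [hI, ← lintegral_const_mul' _ _ ofReal_ne_top]
        refine lintegral_mono fun p => ?_
        rw [mul_comm]
        by_cases hp : p ∈ closedBall (0 : P3) n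
        · refine mul_le_mul_left (ofReal_le_ofReal ?_) _
          refine (greenReg_zero_le q p).trans ?_
          have h1 : ‖p‖ ≤ n := by simpa using hp
          have h2 : ‖q‖ ≤ ‖p - q‖ + ‖p‖ := by
            have := norm_sub_le p (p - q)
            rw [sub_sub_cancel] at this; linarith
          have h3 : 0 ≤ 4 * I.toReal / ε := by positivity
          rw [inv_eq_one_div, div_le_div_iff₀ (by linarith) hqpos]
          linarith
        · simp [hx₁, indicator_of_notMem hp]
      have g3 : ofReal (2 / ‖q‖) * I < ofReal (ε / 2) := by
        rw [← ENNReal.ofReal_toReal hIfin.ne, ← ofReal_mul (by positivity),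
          ENNReal.ofReal_lt_ofReal_iff (by positivity), div_mul_eq_mul_div, div_lt_iff₀ hqpos]
        have h1 : ε / 2 * (4 * I.toReal / ε) = 2 * I.toReal := by field_simp; norm_num
        have h2 : (0 : ℝ) ≤ n := Nat.cast_nonneg n
        nlinarith
      calc _ ≤ _ := hsplit
        _ < ofReal (ε / 2) + ofReal (ε / 2) :=
            ENNReal.add_lt_add_of_lt_of_le (g2.trans_lt ENNReal.ofReal_lt_top).ne (g1.trans_lt g3) g2
        _ = _ := by rw [← ofReal_add (by positivity) (by positivity), add_halves]

/-- If the Green potential of `|Lf|` is at most `B·W`, then `f` and the potential of its energy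
density are controlled by `B` and `W`. -/
theorem green_bounds (c : Fin 6 → Sm Hsp E3) (f : Sm Hsp E3) (hf : EndsZero fun p => ‖f.1 p‖)
    {W : P3 → ℝ} {B Wm : ℝ} (hB : 0 ≤ B) (hW0 : ∀ q, 0 ≤ W q) (hW : ∀ q ∈ Hsp, W q ≤ Wm)
    (h : ∀ q ∈ Hsp, greenPot (fun p => ofReal ‖(covL dir c f).1 p‖) q
      ≤ ofReal (B * W q)) :
    (∀ q, ‖f.1 q‖ ≤ 2 * B * Wm / newtonMass) ∧
    (∀ q ∈ Hsp, newtonMass * ‖f.1 q‖ ^ 2 ≤ 2 * (2 * B * Wm / newtonMass) * (B * W q)) ∧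
    ∀ q ∈ Hsp, greenPot (fun p => ofReal ((gradSq dir c f).1 p)) q
      ≤ ofReal (2 * B * Wm / newtonMass * (B * W q)) := by
  have hm := newtonMass_pos
  have e0 : (1, 0, 0) ∈ Hsp := show (0 : ℝ) < 1 from one_pos
  have hWm : 0 ≤ Wm := (hW0 _).trans (hW _ e0)
  have main : ∀ M : ℝ, 0 ≤ M → (∀ q ∈ Hsp, ‖f.1 q‖ ≤ M) → ∀ q ∈ Hsp,
      ofReal (newtonMass * ‖f.1 q‖ ^ 2)
        + greenPot (fun p => ofReal (2 * (gradSq dir c f).1 p)) q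
        ≤ ofReal (2 * M * (B * W q)) := by
    intro M hM hfM q hq
    refine (green_energy c f hf hq).trans ?_
    rw [ofReal_mul (by positivity)]
    refine le_trans ?_ (mul_le_mul_right (h q hq) _)
    rw [← greenPot_const_mul ((Sm.continuousOn (covL dir c f)).norm.aemeasurable
      isOpen_Hsp.measurableSet).ennreal_ofReal]
    refine greenPot_mono (fun p hp => ?_) q
    rw [← ofReal_mul (by positivity), mul_assoc]
    refine ofReal_le_ofReal ?_
    gcongr
    exact hfM p hp
  have hsq : ∀ M : ℝ, 0 ≤ M → (∀ q ∈ Hsp, ‖f.1 q‖ ≤ M) → ∀ q ∈ Hsp,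
      newtonMass * ‖f.1 q‖ ^ 2 ≤ 2 * M * (B * W q) := fun M hM hfM q hq =>
    (ENNReal.ofReal_le_ofReal_iff (by have := hW0 q; positivity)).1
      (le_self_add.trans (main M hM hfM q hq))
  obtain ⟨M₀, hM₀⟩ := hf.exists_bound (Sm.continuousOn f).norm
  have hbdd : BddAbove ((fun q => ‖f.1 q‖) '' Hsp) := ⟨M₀, by rintro _ ⟨q, hq, rfl⟩; exact hM₀ q hq⟩
  have hne : ((fun q => ‖f.1 q‖) '' Hsp).Nonempty := ⟨_, mem_image_of_mem _ e0⟩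
  set M := sSup ((fun q => ‖f.1 q‖) '' Hsp) with hMdef
  have hfM : ∀ q ∈ Hsp, ‖f.1 q‖ ≤ M := fun q hq => le_csSup hbdd (mem_image_of_mem _ hq)
  have hM0 : 0 ≤ M := (norm_nonneg _).trans (hfM _ e0)
  have hMle : M ≤ 2 * B * Wm / newtonMass := by
    rw [le_div_iff₀ hm]
    by_contra hcon
    push Not at hcon
    have hMpos : 0 < M := by
      rcases hM0.eq_or_lt with h0 | h0
      · rw [← h0, zero_mul] at hcon
        exact absurd hcon (not_lt.2 (by positivity))
      · exact h0
    have hall : ∀ q ∈ Hsp, ‖f.1 q‖ ≤ √(2 * M * (B * Wm) / newtonMass) := fun q hq => by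
      refine le_sqrt_of_sq_le ((le_div_iff₀ hm).2 ?_)
      have := hsq M hM0 hfM q hq
      have h2 : 2 * M * (B * W q) ≤ 2 * M * (B * Wm) := by gcongr; exact hW q hq
      linarith
    have h1 : M ≤ √(2 * M * (B * Wm) / newtonMass) :=
      csSup_le hne (by rintro _ ⟨q, hq, rfl⟩; exact hall q hq)
    have h2 := (Real.le_sqrt hM0 (by positivity)).1 h1
    rw [le_div_iff₀ hm] at h2
    nlinarith
  have hM1 : 0 ≤ 2 * B * Wm / newtonMass := hM0.trans hMle
  have hfM' : ∀ q ∈ Hsp, ‖f.1 q‖ ≤ 2 * B * Wm / newtonMass := fun q hq => (hfM q hq).trans hMle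
  refine ⟨fun q => ?_, hsq _ hM1 hfM', fun q hq => ?_⟩
  · by_cases hq : q ∈ Hsp
    · exact hfM' q hq
    · rw [f.2.2 q hq, norm_zero]; exact hM1
  · have h1 := le_add_self.trans (main _ hM1 hfM' q hq)
    have h2 : (fun p => ofReal (2 * (gradSq dir c f).1 p))
        = fun p => 2 * ofReal ((gradSq dir c f).1 p) := by
      funext p
      rw [ofReal_mul zero_le_two, ENNReal.ofReal_ofNat]
    rw [h2, greenPot_const_mul ((Sm.continuousOn (gradSq dir c f)).aemeasurable
      isOpen_Hsp.measurableSet).ennreal_ofReal, mul_assoc, ofReal_mul zero_le_two,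
      ENNReal.ofReal_ofNat] at h1
    exact (ENNReal.mul_le_mul_iff_right two_ne_zero ENNReal.ofNat_ne_top).1 h1

end GreenPotential

section FlowSystem

/-- The six spatial directions on the cylinder. -/
def cdir (i : Fin 6) : ℝ × P3 := ((0 : ℝ), dir i)

/-- The reparametrised flow in coordinates: `c` collects the connection and Higgs coefficients,
`v` generates the flow, `X` is the initial defect and `Y` the defect at parameter `r`. -/
structure FlowSystem (R : ℝ) where
  pos : 0 < R
  le_one : R ≤ 1
  c : Fin 6 → Sm (Cyl R) E3
  v : Sm (Cyl R) E3
  X : Sm Hsp E3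
  Y : Sm (Cyl R) E3
  J : Fin 6 → Fin 6 → ℝ
  abs_J_le : ∀ i j, |J i j| ≤ 1
  dr_c : ∀ i, Sm.dr (c i) = ∑ j, J i j • covD cdir c j v
  covL_v : covL cdir c v = -Sm.cst R X
  dr_Y : Sm.dr Y = -Sm.cst R X
  norm_Y_le : ∀ r p, ‖Y.1 (r, p)‖ ≤ ‖X.1 p‖
  div_dr_c : ∑ i, covD cdir c i (Sm.dr (c i)) = -lb Y v
  ends_v : ∀ r ∈ Ioo 0 R, EndsZero fun p => ‖v.1 (r, p)‖
  energy : ∫⁻ p in Hsp, ofReal ((1 + p.1 ^ 2) * ‖X.1 p‖ ^ 2) < ⊤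

variable {R : ℝ}

theorem dr_covD (c : Fin 6 → Sm (Cyl R) E3) (i : Fin 6) (f : Sm (Cyl R) E3) :
    Sm.dr (covD cdir c i f) = covD cdir c i (Sm.dr f) + lb (Sm.dr (c i)) f := by
  simp only [covD_eq, map_add, d_lb, Sm.d_comm ((1 : ℝ), (0 : P3)) (cdir i)]
  abel

theorem dr_covL (c : Fin 6 → Sm (Cyl R) E3) (f : Sm (Cyl R) E3) :
    Sm.dr (covL cdir c f) = covL cdir c (Sm.dr f)
      + (2 : ℝ) • (∑ i, lb (Sm.dr (c i)) (covD cdir c i f))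
      + lb (∑ i, covD cdir c i (Sm.dr (c i))) f := by
  simp only [covL_eq, map_sum, smul_sum, LinearMap.sum_apply, ← sum_add_distrib]
  refine sum_congr rfl fun i _ => ?_
  rw [dr_covD, dr_covD, map_add, covD_lb, two_smul]
  abel

theorem slice_lb (r : ℝ) (f g : Sm (Cyl R) E3) :
    Sm.slice r (lb f g) = lb (Sm.slice r f) (Sm.slice r g) := rfl

theorem slice_covD (r : ℝ) (c : Fin 6 → Sm (Cyl R) E3) (i : Fin 6) (f : Sm (Cyl R) E3) :
    Sm.slice r (covD cdir c i f) = covD dir (fun i => Sm.slice r (c i)) i (Sm.slice r f) := by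
  rw [covD_eq, covD_eq, map_add, slice_lb, cdir, Sm.slice_d]

theorem slice_covL (r : ℝ) (c : Fin 6 → Sm (Cyl R) E3) (f : Sm (Cyl R) E3) :
    Sm.slice r (covL cdir c f) = covL dir (fun i => Sm.slice r (c i)) (Sm.slice r f) := by
  simp only [covL_eq, map_sum, slice_covD]

namespace FlowSystem

variable (S : FlowSystem R)

/-- The parameter derivatives of the generator. -/
def vd (k : ℕ) : Sm (Cyl R) E3 := Sm.dr^[k] S.v

theorem vd_zero : S.vd 0 = S.v := rfl

theorem dr_vd (k : ℕ) : Sm.dr (S.vd k) = S.vd (k + 1) :=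
  (Function.iterate_succ_apply' _ _ _).symm

/-- `S.Term d k f`: `f` is a polynomial of weight `d` in `v_j`, `∇v_j` (`j < k`), `X` and `Y`. -/
inductive Term : ℕ → ℕ → Sm (Cyl R) E3 → Prop
  | vd {k j : ℕ} (h : j < k) : Term 0 k (S.vd j)
  | grad {k j : ℕ} (h : j < k) (i : Fin 6) : Term 1 k (covD cdir S.c i (S.vd j))
  | X (k : ℕ) : Term 2 k (Sm.cst R S.X)
  | Y (k : ℕ) : Term 2 k S.Y
  | lb {d d' k : ℕ} {f g : Sm (Cyl R) E3} (hf : Term d k f) (hg : Term d' k g) :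
      Term (d + d') k (lb f g)
  | add {d k : ℕ} {f g : Sm (Cyl R) E3} (hf : Term d k f) (hg : Term d k g) : Term d k (f + g)
  | smul {d k : ℕ} {f : Sm (Cyl R) E3} (a : ℝ) (hf : Term d k f) : Term d k (a • f)

variable {S}

theorem Term.neg {d k : ℕ} {f : Sm (Cyl R) E3} (h : S.Term d k f) : S.Term d k (-f) := by
  have e : -f = (-1 : ℝ) • f := by module
  rw [e]
  exact h.smul (-1)

theorem Term.sum {d k : ℕ} {f : Fin 6 → Sm (Cyl R) E3} (h : ∀ i, S.Term d k (f i)) :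
    S.Term d k (∑ i, f i) := by
  rw [Fin.sum_univ_six]
  exact (((((h 0).add (h 1)).add (h 2)).add (h 3)).add (h 4)).add (h 5)

theorem Term.mono {d k l : ℕ} (hkl : k ≤ l) {f : Sm (Cyl R) E3} (h : S.Term d k f) :
    S.Term d l f := by
  induction h with
  | vd h => exact .vd (h.trans_le hkl)
  | grad h i => exact .grad (h.trans_le hkl) i
  | X => exact .X l
  | Y => exact .Y l
  | lb _ _ h h' => exact (h hkl).lb (h' hkl)
  | add _ _ h h' => exact (h hkl).add (h' hkl)
  | smul a _ h => exact (h hkl).smul a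

theorem Term.dr_c {k : ℕ} (hk : 0 < k) (i : Fin 6) : S.Term 1 k (Sm.dr (S.c i)) := by
  rw [S.dr_c]
  exact .sum fun j => (Term.grad hk j).smul _

theorem Term.dr {d k : ℕ} {f : Sm (Cyl R) E3} (h : S.Term d k f) :
    S.Term d (k + 1) (Sm.dr f) := by
  induction h with
  | vd h => rw [S.dr_vd]; exact .vd (by omega)
  | @grad k j h i =>
    rw [dr_covD, S.dr_vd]
    exact (Term.grad (by omega) i).add ((Term.dr_c (Nat.succ_pos k) i).lb
      (Term.vd (Nat.lt_succ_of_lt h)))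
  | X k => rw [Sm.dr_cst, ← zero_smul ℝ (Sm.cst R S.X)]; exact (Term.X _).smul 0
  | Y k => rw [S.dr_Y]; exact (Term.X _).neg
  | @lb _ _ k _ _ hf hg h h' =>
    rw [d_lb]
    exact (h.lb (hg.mono k.le_succ)).add ((hf.mono k.le_succ).lb h')
  | add _ _ h h' => rw [map_add]; exact h.add h'
  | smul a _ h => rw [map_smul]; exact h.smul a

theorem Term.covL_vd (k : ℕ) : S.Term 2 k (covL cdir S.c (S.vd k)) := by
  induction k with
  | zero => rw [vd_zero, S.covL_v]; exact (Term.X 0).neg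
  | succ k ih =>
    have h : covL cdir S.c (S.vd (k + 1)) = Sm.dr (covL cdir S.c (S.vd k))
        + (-(2 : ℝ)) • (∑ i, _root_.lb (Sm.dr (S.c i)) (covD cdir S.c i (S.vd k)))
        + _root_.lb (_root_.lb S.Y S.v) (S.vd k) := by
      rw [dr_covL, S.div_dr_c, S.dr_vd, map_neg, LinearMap.neg_apply]
      module
    rw [h]
    refine (ih.dr.add (Term.smul _ (.sum fun i => ?_))).add ?_
    · exact (Term.dr_c k.succ_pos i).lb (Term.grad k.lt_succ_self i)
    · exact ((Term.Y _).lb (Term.vd (j := 0) k.succ_pos)).lb (Term.vd k.lt_succ_self)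

variable (S)

/-- The weight-two size of the generators of `Term _ k`. -/
def weight (k : ℕ) (x : ℝ × P3) : ℝ :=
  (∑ j ∈ Finset.range k, (gradSq cdir S.c (S.vd j)).1 x) + ‖S.X.1 x.2‖

theorem weight_nonneg (k : ℕ) (x : ℝ × P3) : 0 ≤ S.weight k x :=
  add_nonneg (sum_nonneg fun j _ => by
    rw [gradSq_apply]; exact sum_nonneg fun _ _ => sq_nonneg _) (norm_nonneg _)

variable {S}

theorem norm_grad_sq_le_weight {k j : ℕ} (h : j < k) (i : Fin 6) (x : ℝ × P3) :
    ‖(covD cdir S.c i (S.vd j)).1 x‖ ^ 2 ≤ S.weight k x := by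
  have h1 : ‖(covD cdir S.c i (S.vd j)).1 x‖ ^ 2 ≤ (gradSq cdir S.c (S.vd j)).1 x := by
    rw [gradSq_apply]
    exact single_le_sum (f := fun i => ‖(covD cdir S.c i (S.vd j)).1 x‖ ^ 2)
      (fun i _ => sq_nonneg _) (Finset.mem_univ i)
  have h2 : (gradSq cdir S.c (S.vd j)).1 x
      ≤ ∑ j ∈ Finset.range k, (gradSq cdir S.c (S.vd j)).1 x :=
    single_le_sum (f := fun j => (gradSq cdir S.c (S.vd j)).1 x) (fun j _ => by
      rw [gradSq_apply]; exact sum_nonneg fun _ _ => sq_nonneg _) (Finset.mem_range.2 h)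
  exact h1.trans (h2.trans (le_add_of_nonneg_right (norm_nonneg _)))

theorem norm_cst_le (f : Sm Hsp E3) (x : ℝ × P3) : ‖(Sm.cst R f).1 x‖ ≤ ‖f.1 x.2‖ := by
  by_cases hx : x ∈ Cyl R
  · exact (congrArg norm (Sm.cst_apply f hx.1 x.2)).le
  · rw [(Sm.cst R f).2.2 x hx, norm_zero]; exact norm_nonneg _

theorem Term.exists_bound {d k : ℕ} {f : Sm (Cyl R) E3} (h : S.Term d k f)
    (hb : ∀ j < k, ∃ C, ∀ x, ‖(S.vd j).1 x‖ ≤ C) :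
    ∃ C, 0 ≤ C ∧ ∀ x, ‖f.1 x‖ ≤ C * √(S.weight k x) ^ d := by
  induction h with
  | vd h =>
    obtain ⟨C, hC⟩ := hb _ h
    exact ⟨C, (norm_nonneg _).trans (hC 0), fun x => by simpa using hC x⟩
  | grad h i =>
    refine ⟨1, zero_le_one, fun x => ?_⟩
    rw [one_mul, pow_one]
    exact le_sqrt_of_sq_le (norm_grad_sq_le_weight h i x)
  | X k =>
    refine ⟨1, zero_le_one, fun x => ?_⟩
    rw [one_mul, sq_sqrt (S.weight_nonneg k x)]
    exact (norm_cst_le _ x).trans (le_add_of_nonneg_left (sum_nonneg fun j _ => by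
      rw [gradSq_apply]; exact sum_nonneg fun _ _ => sq_nonneg _))
  | Y k =>
    refine ⟨1, zero_le_one, fun x => ?_⟩
    rw [one_mul, sq_sqrt (S.weight_nonneg k x)]
    exact (S.norm_Y_le x.1 x.2).trans (le_add_of_nonneg_left (sum_nonneg fun j _ => by
      rw [gradSq_apply]; exact sum_nonneg fun _ _ => sq_nonneg _))
  | @lb d d' k f g _ _ h h' =>
    obtain ⟨C, hC0, hC⟩ := h hb
    obtain ⟨C', hC0', hC'⟩ := h' hb
    refine ⟨2 * C * C', by positivity, fun x => (norm_br_le _ _).trans ?_⟩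
    calc 2 * ‖f.1 x‖ * ‖g.1 x‖ ≤ 2 * (C * √(S.weight k x) ^ d) * (C' * √(S.weight k x) ^ d') := by
          gcongr
          · exact hC x
          · exact hC' x
      _ = _ := by rw [pow_add]; ring
  | @add d k f g _ _ h h' =>
    obtain ⟨C, hC0, hC⟩ := h hb
    obtain ⟨C', hC0', hC'⟩ := h' hb
    refine ⟨C + C', by positivity, fun x => (norm_add_le _ _).trans ?_⟩
    rw [add_mul]
    exact add_le_add (hC x) (hC' x)
  | @smul d k f a _ h =>
    obtain ⟨C, hC0, hC⟩ := h hb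
    refine ⟨|a| * C, by positivity, fun x => ?_⟩
    rw [Sm.smul_apply, norm_smul, mul_assoc, norm_eq_abs]
    exact mul_le_mul_of_nonneg_left (hC x) (abs_nonneg a)

end FlowSystem

end FlowSystem

section ParameterIntegrals

variable {R : ℝ} {F : Type*} [NormedAddCommGroup F] [NormedSpace ℝ F] [CompleteSpace F]

namespace Sm

theorem norm_sub_le_integral (φ : Sm (Cyl R) F) {r r' : ℝ} (hr : 0 ≤ r) (h : r ≤ r') (hr' : r' < R)
    (p : P3) : ‖φ.1 (r', p) - φ.1 (r, p)‖ ≤ ∫ ρ in r..r', ‖(dr φ).1 (ρ, p)‖ := by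
  have hsub : Icc r r' ⊆ Ico 0 R := fun ρ hρ => ⟨hr.trans hρ.1, hρ.2.trans_lt hr'⟩
  have hc : ContinuousOn (fun ρ => (dr φ).1 (ρ, p)) (uIcc r r') := by
    rw [uIcc_of_le h]; exact (Sm.continuousOn_param (dr φ) p).mono hsub
  rw [← intervalIntegral.integral_eq_sub_of_hasDeriv_right_of_le h
    ((Sm.continuousOn_param φ p).mono hsub)
    (fun ρ hρ => (Sm.hasDerivWithinAt_dr_Ici φ (hsub (Ioo_subset_Icc_self hρ)) p).mono
      Ioi_subset_Ici_self) hc.intervalIntegrable]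
  exact intervalIntegral.norm_integral_le_integral_norm h

theorem norm_sub_sq_le_integral (φ : Sm (Cyl R) F) {r r' : ℝ} (hr : 0 ≤ r) (h : r ≤ r')
    (hr' : r' < R) (p : P3) :
    ‖φ.1 (r', p) - φ.1 (r, p)‖ ^ 2 ≤ (r' - r) * ∫ ρ in r..r', ‖(dr φ).1 (ρ, p)‖ ^ 2 := by
  rcases h.eq_or_lt with rfl | hlt
  · simp
  have hsub : uIcc r r' ⊆ Ico 0 R := by
    rw [uIcc_of_le h]; exact fun ρ hρ => ⟨hr.trans hρ.1, hρ.2.trans_lt hr'⟩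
  have hc : ContinuousOn (fun ρ => ‖(dr φ).1 (ρ, p)‖) (uIcc r r') :=
    ((Sm.continuousOn_param (dr φ) p).mono hsub).norm
  set I := ∫ ρ in r..r', ‖(dr φ).1 (ρ, p)‖ with hI
  have h1 := norm_sub_le_integral φ hr h hr' p
  have h2 : 0 ≤ ∫ ρ in r..r', (‖(dr φ).1 (ρ, p)‖ - I / (r' - r)) ^ 2 :=
    intervalIntegral.integral_nonneg h fun _ _ => sq_nonneg _
  have e : ∀ ρ, (‖(dr φ).1 (ρ, p)‖ - I / (r' - r)) ^ 2
      = ‖(dr φ).1 (ρ, p)‖ ^ 2 - (2 * (I / (r' - r))) * ‖(dr φ).1 (ρ, p)‖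
        + (I / (r' - r)) ^ 2 := fun ρ => by ring
  simp only [e] at h2
  have i1 : IntervalIntegrable (fun ρ => ‖(dr φ).1 (ρ, p)‖ ^ 2) volume r r' :=
    (hc.pow 2).intervalIntegrable
  have i2 := (hc.intervalIntegrable (μ := volume)).const_mul (2 * (I / (r' - r)))
  rw [intervalIntegral.integral_add (i1.sub i2) intervalIntegrable_const,
    intervalIntegral.integral_sub i1 i2, intervalIntegral.integral_const_mul, ← hI,
    intervalIntegral.integral_const, smul_eq_mul] at h2
  have hpos : 0 < r' - r := sub_pos.2 hlt
  have h3 : 0 ≤ (r' - r) * ((∫ ρ in r..r', ‖(dr φ).1 (ρ, p)‖ ^ 2)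
      - 2 * (I / (r' - r)) * I + (r' - r) * (I / (r' - r)) ^ 2) := mul_nonneg hpos.le h2
  have e2 : (r' - r) * ((∫ ρ in r..r', ‖(dr φ).1 (ρ, p)‖ ^ 2)
      - 2 * (I / (r' - r)) * I + (r' - r) * (I / (r' - r)) ^ 2)
      = (r' - r) * (∫ ρ in r..r', ‖(dr φ).1 (ρ, p)‖ ^ 2) - I ^ 2 := by
    field_simp; ring
  rw [e2] at h3
  have := pow_le_pow_left₀ (norm_nonneg _) h1 2
  linarith

theorem ofReal_integral_param {w : ℝ × P3 → ℝ} (hw : ContinuousOn w (Cyl R)) (hw0 : ∀ x, 0 ≤ w x)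
    {r r' : ℝ} (hr : 0 ≤ r) (h : r ≤ r') (hr' : r' < R) {p : P3} (hp : p ∈ Hsp) :
    ofReal (∫ ρ in r..r', w (ρ, p)) = ∫⁻ ρ in Ioc r r', ofReal (w (ρ, p)) := by
  have hc : ContinuousOn (fun ρ => w (ρ, p)) (uIcc r r') := by
    rw [uIcc_of_le h]
    exact hw.comp (by fun_prop) fun ρ hρ => ⟨⟨hr.trans hρ.1, hρ.2.trans_lt hr'⟩, hp⟩
  rw [intervalIntegral.integral_of_le h, ofReal_integral_eq_lintegral_ofReal
    ((intervalIntegrable_iff_integrableOn_Ioc_of_le h).1 hc.intervalIntegrable)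
    (.of_forall fun _ => hw0 _)]

end Sm

theorem greenPot_param_integral_le {w : ℝ × P3 → ℝ} (hw : ContinuousOn w (Cyl R)) {r r' : ℝ}
    (hr : 0 ≤ r) (hr' : r' < R) {q : P3} {K : ℝ≥0∞}
    (hK : ∀ ρ ∈ Icc r r', greenPot (fun p => ofReal (w (ρ, p))) q ≤ K) :
    greenPot (fun p => ∫⁻ ρ in Ioc r r', ofReal (w (ρ, p))) q
      ≤ ofReal (r' - r) * K := by
  have h1 : greenPot (fun p => ∫⁻ ρ in Ioc r r', ofReal (w (ρ, p))) q
      = ∫⁻ p in Hsp, ∫⁻ ρ in Ioc r r', ofReal (w (ρ, p)) *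
        ofReal (greenReg 0 q p) := by
    refine lintegral_congr fun p => ?_
    rw [lintegral_mul_const' _ _ ofReal_ne_top]
  rw [h1, lintegral_lintegral_swap]
  · refine (setLIntegral_mono' measurableSet_Ioc fun ρ hρ => hK ρ (Ioc_subset_Icc_self hρ)).trans ?_
    rw [setLIntegral_const, Real.volume_Ioc, mul_comm]
  · refine AEMeasurable.mul ?_ ((measurable_greenReg 0 q).comp measurable_fst).ennreal_ofReal.aemeasurable
    rw [Measure.prod_restrict]
    refine (ContinuousOn.aemeasurable ?_
      (isOpen_Hsp.measurableSet.prod measurableSet_Ioc)).ennreal_ofReal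
    exact hw.comp (f := fun x : P3 × ℝ => (x.2, x.1)) (by fun_prop) fun x hx =>
      ⟨⟨hr.trans hx.2.1.le, hx.2.2.trans_lt hr'⟩, hx.1⟩

end ParameterIntegrals

namespace FlowSystem

variable {R : ℝ} (S : FlowSystem R)

/-- The Green potential of the initial defect. -/
def W (q : P3) : ℝ := (greenPot (fun p => ofReal ‖S.X.1 p‖) q).toReal

theorem W_nonneg (q : P3) : 0 ≤ S.W q := ENNReal.toReal_nonneg

theorem aemeasurable_norm_X : AEMeasurable (fun p => ‖S.X.1 p‖) (volume.restrict Hsp) :=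
  (Sm.continuousOn S.X).norm.aemeasurable isOpen_Hsp.measurableSet

theorem exists_W_le : ∃ M : ℝ, 0 < M ∧ ∀ q ∈ Hsp, S.W q ≤ M := by
  obtain ⟨⟨M, hM, h⟩, -⟩ := greenPot_bounded_endsZero (fun p => norm_nonneg (S.X.1 p))
    S.aemeasurable_norm_X S.energy
  exact ⟨M, hM, fun q hq => ENNReal.toReal_le_of_le_ofReal hM.le (h q hq)⟩

theorem greenPot_X {q : P3} (hq : q ∈ Hsp) :
    greenPot (fun p => ofReal ‖S.X.1 p‖) q = ofReal (S.W q) := by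
  obtain ⟨⟨M, hM, h⟩, -⟩ := greenPot_bounded_endsZero (fun p => norm_nonneg (S.X.1 p))
    S.aemeasurable_norm_X S.energy
  exact (ENNReal.ofReal_toReal ((h q hq).trans_lt ENNReal.ofReal_lt_top).ne).symm

theorem endsZero_W : EndsZero S.W :=
  (greenPot_bounded_endsZero (fun p => norm_nonneg (S.X.1 p)) S.aemeasurable_norm_X S.energy).2

theorem endsZero_of_sq_le {f : P3 → E3} {C : ℝ} (h : ∀ q ∈ Hsp, ‖f q‖ ^ 2 ≤ C * S.W q) :
    EndsZero fun q => ‖f q‖ := by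
  intro ε hε
  refine (S.endsZero_W (ε ^ 2 / (|C| + 1)) (by positivity)).mono fun q hq hlt => ?_
  rw [lt_div_iff₀ (by positivity)] at hlt
  have h1 := h q hq
  have h2 := S.W_nonneg q
  have h3 : ‖f q‖ ^ 2 < ε ^ 2 := by nlinarith [le_abs_self C]
  exact lt_of_pow_lt_pow_left₀ 2 hε.le h3

/-- Uniform control of the `k`-th parameter derivative of the generator. -/
def Controlled (k : ℕ) : Prop := ∃ C, 0 ≤ C ∧ (∀ x, ‖(S.vd k).1 x‖ ≤ C) ∧
  ∀ r ∈ Ico 0 R, ∀ q ∈ Hsp, ‖(S.vd k).1 (r, q)‖ ^ 2 ≤ C * S.W q ∧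
    greenPot (fun p => ofReal ((gradSq cdir S.c (S.vd k)).1 (r, p))) q
      ≤ ofReal (C * S.W q)

theorem continuousOn_weight (k : ℕ) : ContinuousOn (S.weight k) (Cyl R) := by
  refine ContinuousOn.add (continuousOn_finsetSum _ fun j _ => Sm.continuousOn _) ?_
  exact ((Sm.continuousOn S.X).comp continuousOn_snd fun x hx => hx.2).norm

variable {S}

theorem exists_greenPot_weight_le {k : ℕ} (h : ∀ j < k, S.Controlled j) :
    ∃ C, 0 ≤ C ∧ ∀ r ∈ Ico 0 R, ∀ q ∈ Hsp,
      greenPot (fun p => ofReal (S.weight k (r, p))) q ≤ ofReal (C * S.W q) := by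
  induction k with
  | zero =>
    refine ⟨1, zero_le_one, fun r _ q hq => ?_⟩
    simp only [weight, Finset.range_zero, Finset.sum_empty, zero_add, one_mul]
    exact (S.greenPot_X hq).le
  | succ k ih =>
    obtain ⟨C, hC0, hC⟩ := ih fun j hj => h j (hj.trans k.lt_succ_self)
    obtain ⟨C', hC0', -, hC'⟩ := h k k.lt_succ_self
    refine ⟨C + C', by positivity, fun r hr q hq => ?_⟩
    have e : ∀ p, S.weight (k + 1) (r, p)
        = (gradSq cdir S.c (S.vd k)).1 (r, p) + S.weight k (r, p) := fun p => by
      simp only [weight, Finset.sum_range_succ]; ring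
    have n : ∀ p, 0 ≤ (gradSq cdir S.c (S.vd k)).1 (r, p) := fun p => by
      rw [gradSq_apply]; exact sum_nonneg fun _ _ => sq_nonneg _
    have m : ContinuousOn (fun p => (gradSq cdir S.c (S.vd k)).1 (r, p)) Hsp :=
      Sm.continuousOn (Sm.slice r (gradSq cdir S.c (S.vd k)))
    simp only [e, ofReal_add (n _) (S.weight_nonneg k _)]
    rw [greenPot_add (m.aemeasurable isOpen_Hsp.measurableSet).ennreal_ofReal, add_mul,
      add_comm (C * _), ofReal_add (mul_nonneg hC0' (S.W_nonneg q))
      (mul_nonneg hC0 (S.W_nonneg q))]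
    exact add_le_add (hC' r hr q hq).2 (hC r hr q hq)

theorem slice_gradSq (r : ℝ) (f : Sm (Cyl R) E3) :
    Sm.slice r (gradSq cdir S.c f) = gradSq dir (fun i => Sm.slice r (S.c i)) (Sm.slice r f) :=
  Sm.ext_on fun p _ => by
    simp only [Sm.slice_apply, gradSq_apply, ← slice_covD]

theorem controlled_of_ends {k : ℕ} (h : ∀ j < k, S.Controlled j)
    (he : ∀ r ∈ Ioo 0 R, EndsZero fun p => ‖(S.vd k).1 (r, p)‖) : S.Controlled k := by
  obtain ⟨B, hB0, hB⟩ := (Term.covL_vd (S := S) k).exists_bound fun j hj =>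
    let ⟨C, _, hC, _⟩ := h j hj; ⟨C, hC⟩
  obtain ⟨C, hC0, hC⟩ := exists_greenPot_weight_le h
  obtain ⟨M, hM, hWM⟩ := S.exists_W_le
  have hm := newtonMass_pos
  set a := 2 * (B * C) * M / newtonMass with ha
  have green := fun r (hr : r ∈ Ico 0 R) (he : EndsZero fun p => ‖(S.vd k).1 (r, p)‖) =>
    green_bounds (fun i => Sm.slice r (S.c i))
    (Sm.slice r (S.vd k)) he (mul_nonneg hB0 hC0) S.W_nonneg hWM (fun q hq => by
      rw [← slice_covL, mul_assoc, ofReal_mul hB0]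
      refine le_trans ?_ (mul_le_mul_right (hC r hr q hq) _)
      have m : ContinuousOn (fun p => S.weight k (r, p)) Hsp :=
        (S.continuousOn_weight k).comp (by fun_prop) fun p hp => ⟨hr, hp⟩
      rw [← greenPot_const_mul (m.aemeasurable isOpen_Hsp.measurableSet).ennreal_ofReal]
      refine greenPot_mono (fun p _ => ?_) q
      rw [← ofReal_mul hB0]
      refine ofReal_le_ofReal ?_
      have := hB (r, p)
      rwa [sq_sqrt (S.weight_nonneg k _)] at this)
  have ends_zero : EndsZero fun p => ‖(S.vd k).1 (0, p)‖ := by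
    refine S.endsZero_of_sq_le (C := 2 * a * (B * C) / newtonMass) fun q hq => ?_
    have ht := ((Sm.continuousOn_param (S.vd k) q 0 ⟨le_rfl, S.pos⟩).mono
      Ioo_subset_Ico_self).norm.pow 2
    have : (𝓝[Ioo 0 R] (0 : ℝ)).NeBot := left_nhdsWithin_Ioo_neBot S.pos
    refine le_of_tendsto ht (eventually_mem_nhdsWithin.mono fun r hr => ?_)
    have h4 := (green r ⟨hr.1.le, hr.2⟩ (he r hr)).2.1 q hq
    rw [Sm.slice_apply, ← ha] at h4
    change ‖(S.vd k).1 (r, q)‖ ^ 2 ≤ _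
    rw [div_mul_eq_mul_div, le_div_iff₀ hm]
    linarith
  have key := fun r (hr : r ∈ Ico 0 R) => green r hr (by
    rcases hr.1.eq_or_lt with h0 | h0
    · rw [← h0]; exact ends_zero
    · exact he r ⟨h0, hr.2⟩)
  refine ⟨a + a * (B * C) + 2 * a * (B * C) / newtonMass, by positivity, fun x => ?_,
    fun r hr q hq => ?_⟩
  · have hx : ‖(S.vd k).1 x‖ ≤ a := by
      by_cases hx : x.1 ∈ Ico 0 R
      · exact (key x.1 hx).1 x.2
      · rw [(S.vd k).2.2 x fun h => hx h.1, norm_zero]; positivity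
    have : 0 ≤ a * (B * C) + 2 * a * (B * C) / newtonMass := by positivity
    linarith
  · obtain ⟨-, h2, h3⟩ := key r hr
    have hW0 := S.W_nonneg q
    constructor
    · have h4 := h2 q hq
      rw [Sm.slice_apply] at h4
      have h5 : ‖(S.vd k).1 (r, q)‖ ^ 2 ≤ 2 * a * (B * C) / newtonMass * S.W q := by
        rw [div_mul_eq_mul_div, le_div_iff₀ hm]; linarith
      have : 0 ≤ (a + a * (B * C)) * S.W q := by positivity
      linarith
    · refine le_trans (le_of_eq ?_) ((h3 q hq).trans (ofReal_le_ofReal ?_))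
      · rw [← slice_gradSq]; rfl
      · have : 0 ≤ (a + 2 * a * (B * C) / newtonMass) * S.W q := by positivity
        linarith

end FlowSystem

namespace FlowSystem

variable {R : ℝ} (S : FlowSystem R)

/-- The Green potential of `w` is at most `C` times that of the initial defect. -/
def GreenLe (w : P3 → ℝ) (C : ℝ) : Prop :=
  ∀ q ∈ Hsp, greenPot (fun p => ofReal (w p)) q ≤ ofReal (C * S.W q)

variable {S}

theorem GreenLe.mono {w w' : P3 → ℝ} {C : ℝ} (h : S.GreenLe w C) (hw : ∀ p ∈ Hsp, w' p ≤ w p) :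
    S.GreenLe w' C := fun q hq =>
  (greenPot_mono (fun p hp => ofReal_le_ofReal (hw p hp)) q).trans (h q hq)

theorem GreenLe.mono_const {w : P3 → ℝ} {C C' : ℝ} (h : S.GreenLe w C) (hC : C ≤ C') :
    S.GreenLe w C' := fun q hq =>
  (h q hq).trans (ofReal_le_ofReal (mul_le_mul_of_nonneg_right hC (S.W_nonneg q)))

theorem GreenLe.add {w w' : P3 → ℝ} {C C' : ℝ} (h : S.GreenLe w C) (h' : S.GreenLe w' C')
    (hw : ContinuousOn w Hsp) (hC : 0 ≤ C) (hC' : 0 ≤ C') :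
    S.GreenLe (fun p => w p + w' p) (C + C') := fun q hq => by
  rw [add_mul, ofReal_add (mul_nonneg hC (S.W_nonneg q)) (mul_nonneg hC' (S.W_nonneg q))]
  refine le_trans ?_ (add_le_add (h q hq) (h' q hq))
  rw [← greenPot_add (hw.aemeasurable isOpen_Hsp.measurableSet).ennreal_ofReal]
  exact greenPot_mono (fun p _ => ENNReal.ofReal_add_le) q

theorem GreenLe.const_mul {w : P3 → ℝ} {C a : ℝ} (h : S.GreenLe w C) (ha : 0 ≤ a) :
    S.GreenLe (fun p => a * w p) (a * C) := fun q hq => by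
  simp only [greenPot, ofReal_mul ha, mul_assoc]
  rw [lintegral_const_mul' _ _ ofReal_ne_top]
  exact mul_le_mul_right (h q hq) _

theorem GreenLe.integral {w : ℝ × P3 → ℝ} (hw : ContinuousOn w (Cyl R)) (hw0 : ∀ x, 0 ≤ w x)
    {r r' C : ℝ} (hr : 0 ≤ r) (h : r ≤ r') (hr' : r' < R)
    (hC : ∀ ρ ∈ Icc r r', S.GreenLe (fun p => w (ρ, p)) C) :
    S.GreenLe (fun p => ∫ ρ in r..r', w (ρ, p)) ((r' - r) * C) := fun q hq => by
  rw [mul_assoc, ofReal_mul (sub_nonneg.2 h)]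
  refine (greenPot_mono (fun p hp => ?_) q).trans
    (greenPot_param_integral_le hw hr hr' fun ρ hρ => hC ρ hρ q hq)
  rw [Sm.ofReal_integral_param hw hw0 hr h hr' hp]

theorem GreenLe.sum {ι : Type*} (s : Finset ι) {w : ι → P3 → ℝ} {C : ℝ}
    (h : ∀ i, S.GreenLe (w i) C) (hw : ∀ i, ContinuousOn (w i) Hsp) (hC : 0 ≤ C) :
    S.GreenLe (fun p => ∑ i ∈ s, w i p) (s.card * C) := by
  classical
  induction s using Finset.induction_on with
  | empty =>
    intro q hq
    simp [greenPot]
  | insert a s ha ih =>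
    simp only [Finset.sum_insert ha, Finset.card_insert_of_notMem ha]
    refine ((h a).add ih (hw a) hC (by positivity)).mono_const (le_of_eq ?_)
    push_cast; ring

set_option maxHeartbeats 1000000 in
theorem norm_vd_succ_sq_le {k : ℕ} (h : ∀ j ≤ k, S.Controlled j) :
    ∃ C, ∀ r ∈ Ico 0 R, ∀ q ∈ Hsp, ‖(S.vd (k + 1)).1 (r, q)‖ ^ 2 ≤ C * S.W q := by
  have hbd : ∀ j < k + 1, ∃ C, ∀ x, ‖(S.vd j).1 x‖ ≤ C := fun j hj =>
    let ⟨C, _, hC, _⟩ := h j (Nat.lt_succ_iff.1 hj); ⟨C, hC⟩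
  obtain ⟨B₁, hB₁0, hB₁⟩ := (Term.covL_vd (S := S) k).dr.exists_bound hbd
  choose B₂ hB₂0 hB₂ using fun i => (Term.dr_c (S := S) k.succ_pos i).exists_bound hbd
  obtain ⟨C₃, hC₃0, hC₃⟩ := exists_greenPot_weight_le (k := k + 1) fun j hj =>
    h j (Nat.lt_succ_iff.1 hj)
  obtain ⟨Ck, hCk0, hCk, hCk'⟩ := h k le_rfl
  obtain ⟨C0, hC00, hC0, -⟩ := h 0 (Nat.zero_le k)
  obtain ⟨M, hM, hWM⟩ := S.exists_W_le
  have hm := newtonMass_pos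
  obtain ⟨w, hw⟩ : ∃ w, w = S.weight (k + 1) := ⟨_, rfl⟩
  have hwc : ContinuousOn w (Cyl R) := hw ▸ S.continuousOn_weight _
  have hw0 : ∀ x, 0 ≤ w x := hw ▸ S.weight_nonneg _
  have hwg : ∀ r ∈ Ico 0 R, S.GreenLe (fun p => w (r, p)) C₃ := by
    intro r hr q hq; rw [hw]; exact hC₃ r hr q hq
  have hwr : ∀ r ∈ Ico 0 R, ContinuousOn (fun p => w (r, p)) Hsp := fun r hr =>
    hwc.comp (by fun_prop) fun p hp => ⟨hr, hp⟩
  rw [← hw] at hB₁ hB₂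
  obtain ⟨B, hBdef⟩ : ∃ B, B = ∑ i, B₂ i := ⟨_, rfl⟩
  have hB0 : 0 ≤ B := hBdef ▸ sum_nonneg fun i _ => hB₂0 i
  have hċ : ∀ i x, ‖(Sm.dr (S.c i)).1 x‖ ^ 2 ≤ B ^ 2 * w x := by
    intro i x
    have h1 : B₂ i ≤ B := hBdef ▸ single_le_sum (fun i _ => hB₂0 i) (Finset.mem_univ i)
    calc ‖(Sm.dr (S.c i)).1 x‖ ^ 2 ≤ (B₂ i * √(w x) ^ 1) ^ 2 :=
          pow_le_pow_left₀ (norm_nonneg _) (hB₂ i x) 2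
      _ = B₂ i ^ 2 * w x := by rw [pow_one, mul_pow, sq_sqrt (hw0 x)]
      _ ≤ _ := by gcongr; exacts [hw0 x, hB₂0 i]
  obtain ⟨E, hE⟩ : ∃ E, E = 4 * Ck ^ 2 * B ^ 2 := ⟨_, rfl⟩
  have hE0 : 0 ≤ E := by rw [hE]; positivity
  obtain ⟨K, hK⟩ : ∃ K, K = B₁ * C₃ + (6 * (2 * (B ^ 2 * C₃) + 2 * (2 * C₃ + 2 * (E * C₃)))
      + 4 * C0 * Ck * C₃) := ⟨_, rfl⟩
  have hK0 : 0 ≤ K := by rw [hK]; positivity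
  refine ⟨2 * (2 * K * M / newtonMass) * K / newtonMass, fun r hr q hq => ?_⟩
  have key : ∀ r' ∈ Ioo r R,
      ‖(r' - r)⁻¹ • ((S.vd k).1 (r', q) - (S.vd k).1 (r, q))‖ ^ 2
        ≤ 2 * (2 * K * M / newtonMass) * K / newtonMass * S.W q := by
    intro r' hr'
    have hr'2 : r' ∈ Ico 0 R := ⟨hr.1.trans hr'.1.le, hr'.2⟩
    have hpos : 0 < r' - r := sub_pos.2 hr'.1
    obtain ⟨G, hG⟩ : ∃ G, G = Sm.cst R (Sm.slice r' (S.vd k)) := ⟨_, rfl⟩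
    have hGs : ∀ ρ ∈ Ico 0 R, Sm.slice ρ G = Sm.slice r' (S.vd k) := fun ρ hρ => by
      rw [hG, Sm.slice_cst hρ]
    have hdrG : Sm.dr G = 0 := by rw [hG, Sm.dr_cst]
    have hGb : ∀ x, ‖G.1 x‖ ≤ Ck := fun x => by
      rw [hG]; exact (norm_cst_le _ x).trans (hCk _)
    have hdDG : ∀ i, Sm.dr (covD cdir S.c i G) = lb (Sm.dr (S.c i)) G := fun i => by
      rw [dr_covD, hdrG, map_zero, zero_add]
    have hDG : ∀ i, ∀ ρ ∈ Icc r r',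
        S.GreenLe (fun p => ‖(covD cdir S.c i G).1 (ρ, p)‖ ^ 2) (2 * C₃ + 2 * (E * C₃)) := by
      intro i ρ hρ
      have hρ0 := hr.1.trans hρ.1
      have g2 : S.GreenLe (fun p => ∫ s in ρ..r', E * w (s, p)) ((r' - ρ) * (E * C₃)) :=
        GreenLe.integral (w := fun x => E * w x) (continuousOn_const.mul hwc)
          (fun x => mul_nonneg hE0 (hw0 x)) hρ0 hρ.2 hr'.2 fun s hs =>
          (hwg s ⟨hρ0.trans hs.1, hs.2.trans_lt hr'.2⟩).const_mul hE0
      have hle1 : r' - ρ ≤ 1 := by linarith [S.le_one, hr'.2]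
      have g3 := g2.mono_const (C' := E * C₃)
        (mul_le_of_le_one_left (by positivity) hle1)
      have g4 : S.GreenLe (fun p => 2 * (w (r', p) + ∫ s in ρ..r', E * w (s, p)))
          (2 * (C₃ + E * C₃)) :=
        ((hwg r' hr'2).add g3 (hwr r' hr'2) hC₃0 (by positivity)).const_mul zero_le_two
      refine (g4.mono_const (le_of_eq (by ring))).mono fun p hp => ?_
      have e1 : (covD cdir S.c i G).1 (r', p) = (covD cdir S.c i (S.vd k)).1 (r', p) := by
        rw [← Sm.slice_apply, ← Sm.slice_apply, slice_covD, slice_covD, hGs r' hr'2]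
      have e2 := Sm.norm_sub_sq_le_integral (covD cdir S.c i G) hρ0 hρ.2 hr'.2 p
      have hcont : ∀ {φ : ℝ × P3 → ℝ}, ContinuousOn φ (Cyl R) →
          IntervalIntegrable (fun s => φ (s, p)) volume ρ r' := fun hφ =>
        ContinuousOn.intervalIntegrable (by
          rw [uIcc_of_le hρ.2]
          exact hφ.comp (by fun_prop) fun s hs => ⟨⟨hρ0.trans hs.1, hs.2.trans_lt hr'.2⟩, hp⟩)
      have e3 : (∫ s in ρ..r', ‖(Sm.dr (covD cdir S.c i G)).1 (s, p)‖ ^ 2)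
          ≤ ∫ s in ρ..r', E * w (s, p) := by
        refine intervalIntegral.integral_mono_on hρ.2
          (hcont (φ := fun x => ‖(Sm.dr (covD cdir S.c i G)).1 x‖ ^ 2)
            ((Sm.continuousOn _).norm.pow 2))
          (hcont (φ := fun x => E * w x) (continuousOn_const.mul hwc)) fun s _ => ?_
        rw [hdDG]
        calc ‖(lb (Sm.dr (S.c i)) G).1 (s, p)‖ ^ 2
            ≤ (2 * ‖(Sm.dr (S.c i)).1 (s, p)‖ * Ck) ^ 2 := by
              refine pow_le_pow_left₀ (norm_nonneg _) ((norm_br_le _ _).trans ?_) 2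
              gcongr
              exact hGb _
          _ = 4 * Ck ^ 2 * ‖(Sm.dr (S.c i)).1 (s, p)‖ ^ 2 := by ring
          _ ≤ 4 * Ck ^ 2 * (B ^ 2 * w (s, p)) := by gcongr; exact hċ i _
          _ = _ := by rw [hE]; ring
      have e4 : ‖(covD cdir S.c i G).1 (r', p)‖ ^ 2 ≤ w (r', p) := by
        rw [e1, hw]; exact norm_grad_sq_le_weight k.lt_succ_self i _
      have e5 : 0 ≤ ∫ s in ρ..r', ‖(Sm.dr (covD cdir S.c i G)).1 (s, p)‖ ^ 2 :=
        intervalIntegral.integral_nonneg hρ.2 fun _ _ => sq_nonneg _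
      have e6 : ‖(covD cdir S.c i G).1 (ρ, p)‖
          ≤ ‖(covD cdir S.c i G).1 (r', p)‖
            + ‖(covD cdir S.c i G).1 (r', p) - (covD cdir S.c i G).1 (ρ, p)‖ := by
        have := norm_sub_le ((covD cdir S.c i G).1 (r', p))
          ((covD cdir S.c i G).1 (r', p) - (covD cdir S.c i G).1 (ρ, p))
        rwa [sub_sub_cancel] at this
      have e7 : ‖(covD cdir S.c i G).1 (r', p) - (covD cdir S.c i G).1 (ρ, p)‖ ^ 2
          ≤ ∫ s in ρ..r', E * w (s, p) :=
        (e2.trans (mul_le_of_le_one_left e5 hle1)).trans e3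
      have e8 := pow_le_pow_left₀ (norm_nonneg _) e6 2
      nlinarith [sq_nonneg (‖(covD cdir S.c i G).1 (r', p)‖
        - ‖(covD cdir S.c i G).1 (r', p) - (covD cdir S.c i G).1 (ρ, p)‖)]
    obtain ⟨f, hf⟩ : ∃ f, f = (r' - r)⁻¹ • (Sm.slice r' (S.vd k) - Sm.slice r (S.vd k)) :=
      ⟨_, rfl⟩
    have hends : EndsZero fun p => ‖f.1 p‖ := by
      refine S.endsZero_of_sq_le (C := ((r' - r)⁻¹) ^ 2 * (4 * Ck)) fun p hp => ?_
      have a1 := (hCk' r' hr'2 p hp).1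
      have a2 := (hCk' r hr p hp).1
      rw [hf, Sm.smul_apply, norm_smul, mul_pow, norm_inv, norm_of_nonneg hpos.le, mul_assoc]
      refine mul_le_mul_of_nonneg_left ?_ (sq_nonneg _)
      rw [Sm.sub_apply, Sm.slice_apply, Sm.slice_apply]
      have := pow_le_pow_left₀ (norm_nonneg _)
        (norm_sub_le ((S.vd k).1 (r', p)) ((S.vd k).1 (r, p))) 2
      nlinarith [sq_nonneg (‖(S.vd k).1 (r', p)‖ - ‖(S.vd k).1 (r, p)‖)]
    have hL : covL dir (fun i => Sm.slice r (S.c i)) f = (r' - r)⁻¹ •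
        ((Sm.slice r' (covL cdir S.c (S.vd k)) - Sm.slice r (covL cdir S.c (S.vd k)))
          - (Sm.slice r' (covL cdir S.c G) - Sm.slice r (covL cdir S.c G))) := by
      have e1 : Sm.slice r' (covL cdir S.c G) = Sm.slice r' (covL cdir S.c (S.vd k)) := by
        rw [slice_covL, slice_covL, hGs r' hr'2]
      rw [e1, hf, map_smul, map_sub, slice_covL r, slice_covL r, hGs r hr]
      congr 1; abel
    have hdrLG : ∀ x, ‖(Sm.dr (covL cdir S.c G)).1 x‖
        ≤ (∑ i, (2 * (B ^ 2 * w x) + 2 * ‖(covD cdir S.c i G).1 x‖ ^ 2)) + 4 * C0 * Ck * w x := by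
      intro x
      rw [dr_covL, hdrG, map_zero, zero_add, S.div_dr_c, Sm.add_apply]
      refine (norm_add_le _ _).trans (add_le_add ?_ ?_)
      · rw [smul_sum, Sm.sum_apply]
        refine (norm_sum_le _ _).trans (sum_le_sum fun i _ => ?_)
        rw [Sm.smul_apply, norm_smul, Real.norm_two]
        have a1 := norm_br_le ((Sm.dr (S.c i)).1 x) ((covD cdir S.c i G).1 x)
        have a2 := hċ i x
        rw [lb_apply]
        nlinarith [sq_nonneg (‖(Sm.dr (S.c i)).1 x‖ - ‖(covD cdir S.c i G).1 x‖)]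
      · have a1 := norm_br_le ((-lb S.Y S.v).1 x) (G.1 x)
        have a2 := norm_br_le (S.Y.1 x) (S.v.1 x)
        have a3 : ‖S.Y.1 x‖ ≤ w x := (S.norm_Y_le x.1 x.2).trans (by
          rw [hw]
          exact le_add_of_nonneg_left (sum_nonneg fun j _ => by
            rw [gradSq_apply]; exact sum_nonneg fun _ _ => sq_nonneg _))
        rw [lb_apply]
        rw [Sm.neg_apply, norm_neg, lb_apply] at a1
        calc _ ≤ _ := a1
          _ ≤ 2 * (2 * w x * C0) * Ck := by
              refine mul_le_mul (mul_le_mul_of_nonneg_left (a2.trans ?_) zero_le_two) (hGb x)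
                (norm_nonneg _) ?_
              · exact mul_le_mul (mul_le_mul_of_nonneg_left a3 zero_le_two) (hC0 x)
                  (norm_nonneg _) (mul_nonneg zero_le_two (hw0 x))
              · have := hw0 x; positivity
          _ = _ := by ring
    obtain ⟨ω, hω⟩ : ∃ ω : ℝ × P3 → ℝ, ω = fun x => B₁ * w x
        + ((∑ i, (2 * (B ^ 2 * w x) + 2 * ‖(covD cdir S.c i G).1 x‖ ^ 2)) + 4 * C0 * Ck * w x) :=
      ⟨_, rfl⟩
    have hDc : ∀ i, ContinuousOn (fun x => ‖(covD cdir S.c i G).1 x‖ ^ 2) (Cyl R) := fun i =>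
      (Sm.continuousOn _).norm.pow 2
    have hsc : ∀ i, ContinuousOn (fun x => 2 * (B ^ 2 * w x)
        + 2 * ‖(covD cdir S.c i G).1 x‖ ^ 2) (Cyl R) := fun i =>
      (continuousOn_const.mul (continuousOn_const.mul hwc)).add (continuousOn_const.mul (hDc i))
    have hsumc := continuousOn_finsetSum Finset.univ fun i _ => hsc i
    have hωc : ContinuousOn ω (Cyl R) := by
      rw [hω]
      exact (continuousOn_const.mul hwc).add (hsumc.add (continuousOn_const.mul hwc))
    have hω0 : ∀ x, 0 ≤ ω x := fun x => by
      rw [hω]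
      have := hw0 x
      refine add_nonneg (by positivity) (add_nonneg (sum_nonneg fun i _ => ?_)
        (by positivity))
      positivity
    have hsl : ∀ ρ ∈ Icc r r', ∀ {φ : ℝ × P3 → ℝ}, ContinuousOn φ (Cyl R) →
        ContinuousOn (fun p => φ (ρ, p)) Hsp := fun ρ hρ φ hφ =>
      hφ.comp (by fun_prop) fun p hp => ⟨⟨hr.1.trans hρ.1, hρ.2.trans_lt hr'.2⟩, hp⟩
    have hωg : ∀ ρ ∈ Icc r r', S.GreenLe (fun p => ω (ρ, p)) K := by
      intro ρ hρ
      have hρ2 : ρ ∈ Ico 0 R := ⟨hr.1.trans hρ.1, hρ.2.trans_lt hr'.2⟩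
      have b1 := (hwg ρ hρ2).const_mul hB₁0
      have b2 := (hwg ρ hρ2).const_mul (a := 4 * C0 * Ck) (by positivity)
      have b3 : ∀ i, S.GreenLe (fun p => 2 * (B ^ 2 * w (ρ, p))
          + 2 * ‖(covD cdir S.c i G).1 (ρ, p)‖ ^ 2)
          (2 * (B ^ 2 * C₃) + 2 * (2 * C₃ + 2 * (E * C₃))) := fun i =>
        (((hwg ρ hρ2).const_mul (sq_nonneg B)).const_mul zero_le_two).add
          ((hDG i ρ hρ).const_mul zero_le_two)
          (hsl ρ hρ (continuousOn_const.mul (continuousOn_const.mul hwc)))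
          (by positivity) (by positivity)
      have b4 := GreenLe.sum Finset.univ b3 (fun i => hsl ρ hρ (hsc i)) (by positivity)
      have b5 := b1.add (b4.add b2 (hsl ρ hρ hsumc) (by positivity) (by positivity))
        (hsl ρ hρ (continuousOn_const.mul hwc)) (by positivity) (by positivity)
      rw [hω, hK]
      refine b5.mono_const (le_of_eq ?_)
      simp
    have hfin : S.GreenLe (fun p => ‖(covL dir (fun i => Sm.slice r (S.c i)) f).1 p‖) K := by
      have c1 := GreenLe.integral hωc hω0 hr.1 hr'.1.le hr'.2 hωg
      intro q hq
      have c2 := c1 q hq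
      rw [mul_assoc, ofReal_mul hpos.le] at c2
      have c3 : greenPot (fun p => ofReal
            ‖(covL dir (fun i => Sm.slice r (S.c i)) f).1 p‖) q
          ≤ ofReal (r' - r)⁻¹
            * greenPot (fun p => ofReal (∫ ρ in r..r', ω (ρ, p))) q := by
        rw [greenPot, greenPot, ← lintegral_const_mul' _ _ ofReal_ne_top]
        refine setLIntegral_mono' isOpen_Hsp.measurableSet fun p hp => ?_
        rw [← mul_assoc, ← ofReal_mul (inv_nonneg.2 hpos.le)]
        refine mul_le_mul_left (ofReal_le_ofReal ?_) _
        rw [hL, Sm.smul_apply, norm_smul, norm_inv, norm_of_nonneg hpos.le]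
        refine mul_le_mul_of_nonneg_left ?_ (inv_nonneg.2 hpos.le)
        rw [Sm.sub_apply, Sm.sub_apply, Sm.sub_apply]
        simp only [Sm.slice_apply]
        have hcont : ∀ {φ : ℝ × P3 → ℝ}, ContinuousOn φ (Cyl R) →
            IntervalIntegrable (fun s => φ (s, p)) volume r r' := fun hφ =>
          ContinuousOn.intervalIntegrable (by
            rw [uIcc_of_le hr'.1.le]
            exact hφ.comp (by fun_prop) fun s hs =>
              ⟨⟨hr.1.trans hs.1, hs.2.trans_lt hr'.2⟩, hp⟩)
        have i1 := hcont (φ := fun x => ‖(Sm.dr (covL cdir S.c (S.vd k))).1 x‖)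
          (Sm.continuousOn _).norm
        have i2 := hcont (φ := fun x => ‖(Sm.dr (covL cdir S.c G)).1 x‖) (Sm.continuousOn _).norm
        calc _ ≤ _ := norm_sub_le _ _
          _ ≤ _ := add_le_add
              (Sm.norm_sub_le_integral (covL cdir S.c (S.vd k)) hr.1 hr'.1.le hr'.2 p)
              (Sm.norm_sub_le_integral (covL cdir S.c G) hr.1 hr'.1.le hr'.2 p)
          _ = _ := (intervalIntegral.integral_add i1 i2).symm
          _ ≤ _ := intervalIntegral.integral_mono_on hr'.1.le (i1.add i2) (hcont hωc)
              fun s _ => by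
                rw [hω]
                have := hB₁ (s, p)
                rw [sq_sqrt (hw0 _)] at this
                exact add_le_add this (hdrLG _)
      refine c3.trans ((mul_le_mul_right c2 _).trans (le_of_eq ?_))
      rw [← mul_assoc, ← ofReal_mul (inv_nonneg.2 hpos.le), inv_mul_cancel₀ hpos.ne',
        ENNReal.ofReal_one, one_mul]
    have hfq := (green_bounds _ f hends hK0 S.W_nonneg hWM hfin).2.1 q hq
    rw [div_mul_eq_mul_div, le_div_iff₀ hm]
    have : f.1 q = (r' - r)⁻¹ • ((S.vd k).1 (r', q) - (S.vd k).1 (r, q)) := by rw [hf]; rfl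
    rw [← this]
    linarith
  have hlim := hasDerivWithinAt_iff_tendsto_slope.1 (Sm.hasDerivWithinAt_dr_Ici (S.vd k) hr q)
  rw [S.dr_vd, Ici_sdiff_left] at hlim
  refine le_of_tendsto (hlim.norm.pow 2) ?_
  filter_upwards [Ioo_mem_nhdsGT hr.2] with r' hr'
  exact key r' hr'

theorem controlled (S : FlowSystem R) (k : ℕ) : S.Controlled k := by
  induction k using Nat.strong_induction_on with
  | _ k ih =>
    refine controlled_of_ends ih fun r hr => ?_
    rcases k with _ | k
    · exact S.ends_v r hr
    · obtain ⟨C, hC⟩ := norm_vd_succ_sq_le fun j hj => ih j (Nat.lt_succ_of_le hj)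
      exact S.endsZero_of_sq_le fun q hq => hC r ⟨hr.1.le, hr.2⟩ q hq

end FlowSystem

section Absorption

theorem le_of_sq_le_absorb {B N p θ : ℝ} (hB : 1 ≤ B) (hN : 0 ≤ N) (hθ : θ = 1 / (16 * B))
    (h : p ^ 2 ≤ B * (N ^ 2 / θ ^ 2 + N * (N + p) + θ ^ 2 * (N + p) ^ 2 + θ * (p * (N + p)))) :
    p ≤ 25 * B ^ 2 * N := by
  have hB0 : 0 < B := by linarith
  have h1 : B * (N ^ 2 / θ ^ 2) = 256 * B ^ 3 * N ^ 2 := by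
    rw [hθ]; field_simp; ring
  have h2 : B * (θ ^ 2 * (N + p) ^ 2) = (N + p) ^ 2 / (256 * B) := by
    rw [hθ]; field_simp; ring
  have h3 : B * (θ * (p * (N + p))) = p * (N + p) / 16 := by
    rw [hθ]; field_simp
  have h4 : (N + p) ^ 2 / (256 * B) ≤ (N + p) ^ 2 / 256 :=
    div_le_div_of_nonneg_left (sq_nonneg _) (by norm_num) (by linarith)
  have h5 : p ^ 2 ≤ 256 * B ^ 3 * N ^ 2 + B * (N * (N + p)) + (N + p) ^ 2 / 256
      + p * (N + p) / 16 := by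
    calc p ^ 2 ≤ _ := h
      _ = 256 * B ^ 3 * N ^ 2 + B * (N * (N + p)) + (N + p) ^ 2 / (256 * B)
          + p * (N + p) / 16 := by rw [← h1, ← h2, ← h3]; ring
      _ ≤ _ := by linarith
  have h6 : p ^ 2 ≤ (25 * B ^ 2 * N) ^ 2 := by
    have hB3 : B ^ 3 ≤ B ^ 4 := pow_le_pow_right₀ hB (by norm_num)
    have hB2 : B ^ 2 ≤ B ^ 4 := pow_le_pow_right₀ hB (by norm_num)
    have hB1 : B ≤ B ^ 4 := le_self_pow₀ hB (by norm_num)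
    have hB4 : (1 : ℝ) ≤ B ^ 4 := one_le_pow₀ hB
    have q1 : B * N * p ≤ 2 * B ^ 2 * N ^ 2 + p ^ 2 / 8 := by
      nlinarith [sq_nonneg (4 * B * N - p)]
    have q2 : N * p ≤ 2 * N ^ 2 + p ^ 2 / 8 := by nlinarith [sq_nonneg (4 * N - p)]
    have hN2 := sq_nonneg N
    have r1 := mul_le_mul_of_nonneg_right hB3 hN2
    have r2 := mul_le_mul_of_nonneg_right hB2 hN2
    have r3 := mul_le_mul_of_nonneg_right hB1 hN2
    have r4 := mul_le_mul_of_nonneg_right hB4 hN2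
    have e : (25 * B ^ 2 * N) ^ 2 = 625 * (B ^ 4 * N ^ 2) := by ring
    rw [e]
    nlinarith
  exact le_of_sq_le_sq h6 (by positivity)

theorem Sm.norm_le_exp {R : ℝ} {F : Type*} [NormedAddCommGroup F] [NormedSpace ℝ F]
    [CompleteSpace F] (φ : Sm (Cyl R) F) {σ a b κ : ℝ} (hσ : σ ∈ Ico 0 R) (p : P3) (hκ : 0 < κ)
    (ha : ‖φ.1 (0, p)‖ ≤ a) (hb0 : 0 ≤ b)
    (hb : ∀ τ ∈ Icc 0 σ, ‖(Sm.dr φ).1 (τ, p)‖ ≤ b * exp (κ * τ)) :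
    ‖φ.1 (σ, p)‖ ≤ a + b * exp (κ * σ) / κ := by
  have h1 := Sm.norm_sub_le_integral φ le_rfl hσ.1 hσ.2 p
  have hc : ContinuousOn (fun ρ => ‖(Sm.dr φ).1 (ρ, p)‖) (uIcc 0 σ) := by
    rw [uIcc_of_le hσ.1]
    exact ((Sm.continuousOn_param (Sm.dr φ) p).mono
      fun ρ hρ => ⟨hρ.1, hρ.2.trans_lt hσ.2⟩).norm
  have hd : ∀ τ ∈ uIcc 0 σ,
      HasDerivAt (fun τ => b * exp (κ * τ) / κ) (b * exp (κ * τ)) τ := fun τ _ => by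
    have := ((((hasDerivAt_id τ).const_mul κ).exp).const_mul b).div_const κ
    exact this.congr_deriv (by rw [mul_one, id, ← mul_assoc, mul_div_cancel_right₀ _ hκ.ne'])
  have hi : IntervalIntegrable (fun τ => b * exp (κ * τ)) volume 0 σ :=
    (by fun_prop : Continuous fun τ => b * exp (κ * τ)).intervalIntegrable _ _
  have h2 := intervalIntegral.integral_mono_on hσ.1 hc.intervalIntegrable hi hb
  rw [intervalIntegral.integral_eq_sub_of_hasDerivAt hd hi] at h2
  have h3 : ‖φ.1 (σ, p)‖ ≤ ‖φ.1 (0, p)‖ + ‖φ.1 (σ, p) - φ.1 (0, p)‖ := by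
    simpa using norm_add_le (φ.1 (0, p)) (φ.1 (σ, p) - φ.1 (0, p))
  have h4 : 0 ≤ b * exp (κ * 0) / κ := by positivity
  linarith

variable {R : ℝ} {α β : Type*} [Fintype α] [Fintype β]

/-- The sum of the norms of a finite family. -/
def normSum (y : β → Sm (Cyl R) E3) (x : ℝ × P3) : ℝ := ∑ b, ‖(y b).1 x‖

/-- The sum of the norms of the covariant derivatives of a finite family, for a connection that
does not depend on the parameter. -/
def gradSum (c : Fin 6 → Sm Hsp E3) (f : α → Sm (Cyl R) E3) (x : ℝ × P3) : ℝ :=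
  ∑ a, ∑ i, ‖(covD cdir (fun j => Sm.cst R (c j)) i (f a)).1 x‖

theorem normSum_nonneg (y : β → Sm (Cyl R) E3) (x : ℝ × P3) : 0 ≤ normSum y x :=
  sum_nonneg fun _ _ => norm_nonneg _

theorem gradSum_nonneg (c : Fin 6 → Sm Hsp E3) (f : α → Sm (Cyl R) E3) (x : ℝ × P3) :
    0 ≤ gradSum c f x :=
  sum_nonneg fun _ _ => sum_nonneg fun _ _ => norm_nonneg _

theorem norm_le_normSum (y : β → Sm (Cyl R) E3) (b : β) (x : ℝ × P3) :
    ‖(y b).1 x‖ ≤ normSum y x :=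
  single_le_sum (f := fun b => ‖(y b).1 x‖) (fun _ _ => norm_nonneg _) (Finset.mem_univ b)

theorem norm_le_gradSum (c : Fin 6 → Sm Hsp E3) (f : α → Sm (Cyl R) E3) (a : α) (i : Fin 6)
    (x : ℝ × P3) : ‖(covD cdir (fun j => Sm.cst R (c j)) i (f a)).1 x‖ ≤ gradSum c f x :=
  (single_le_sum (f := fun i => ‖(covD cdir (fun j => Sm.cst R (c j)) i (f a)).1 x‖)
    (fun _ _ => norm_nonneg _) (Finset.mem_univ i)).trans
  (single_le_sum
    (f := fun a => ∑ i, ‖(covD cdir (fun j => Sm.cst R (c j)) i (f a)).1 x‖)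
    (fun _ _ => sum_nonneg fun _ _ => norm_nonneg _) (Finset.mem_univ a))

/-- The depth of a point in a ball. -/
def depth (q : P3) (ρ : ℝ) (x : P3) : ℝ := ρ - ‖x - q‖

/-- The structural inequalities of a coupled elliptic-evolution system on a ball. -/
structure AbsorbSystem (c : Fin 6 → Sm Hsp E3) (f : α → Sm (Cyl R) E3) (y : β → Sm (Cyl R) E3)
    (z : Sm (Cyl R) E3) (q : P3) (ρ A : ℝ) : Prop where
  pos : 0 < ρ
  le_one : R ≤ 1
  sub : closedBall q ρ ⊆ Hsp
  curv_le : ∀ x ∈ ball q ρ, ∀ i j, ‖(curv dir c i j).1 x‖ ≤ A / ρ ^ 2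
  f_le : ∀ a, ∀ r ∈ Ico 0 R, ∀ x ∈ ball q ρ, ‖(f a).1 (r, x)‖ ≤ A
  lap_le : ∀ a, ∀ r ∈ Ico 0 R, ∀ x ∈ ball q ρ,
    ‖(covL cdir (fun j => Sm.cst R (c j)) (f a)).1 (r, x)‖
      ≤ A * ((1 / depth q ρ x + normSum y (r, x))
        * (1 / depth q ρ x + gradSum c f (r, x) + normSum y (r, x)) + ‖z.1 (r, x)‖)
  dr_y_le : ∀ b, ∀ r ∈ Ico 0 R, ∀ x ∈ ball q ρ,
    ‖(Sm.dr (y b)).1 (r, x)‖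
      ≤ A * (1 / depth q ρ x + gradSum c f (r, x) + normSum y (r, x))
  dr_z_le : ∀ r ∈ Ico 0 R, ∀ x ∈ ball q ρ,
    ‖(Sm.dr z).1 (r, x)‖ ≤ A * ((1 / depth q ρ x + normSum y (r, x))
      * (1 / depth q ρ x + gradSum c f (r, x) + normSum y (r, x)))
  y_zero_le : ∀ b, ∀ x ∈ ball q ρ, ‖(y b).1 (0, x)‖ ≤ A / depth q ρ x
  z_zero_le : ∀ x ∈ ball q ρ, ‖z.1 (0, x)‖ ≤ A / depth q ρ x ^ 2

theorem depth_pos {q x : P3} {ρ : ℝ} (hx : x ∈ ball q ρ) : 0 < depth q ρ x := by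
  rw [mem_ball_iff_norm] at hx
  exact sub_pos.2 hx

theorem depth_le {q x : P3} {ρ : ℝ} : depth q ρ x ≤ ρ := sub_le_self _ (norm_nonneg _)

theorem half_depth_le {q x x' : P3} {ρ e : ℝ} (hx : x' ∈ closedBall x e)
    (he : e ≤ depth q ρ x / 2) : depth q ρ x / 2 ≤ depth q ρ x' := by
  rw [mem_closedBall_iff_norm] at hx
  have : ‖x' - q‖ ≤ ‖x' - x‖ + ‖x - q‖ := norm_sub_le_norm_sub_add_norm_sub _ _ _
  unfold depth at *
  linarith

theorem continuous_depth (q : P3) (ρ : ℝ) : Continuous (depth q ρ) := by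
  unfold depth; fun_prop

theorem continuousOn_normSum (y : β → Sm (Cyl R) E3) : ContinuousOn (normSum y) (Cyl R) :=
  continuousOn_finsetSum _ fun _ _ => (Sm.continuousOn _).norm

theorem continuousOn_gradSum (c : Fin 6 → Sm Hsp E3) (f : α → Sm (Cyl R) E3) :
    ContinuousOn (gradSum c f) (Cyl R) :=
  continuousOn_finsetSum _ fun _ _ => continuousOn_finsetSum _ fun _ _ => (Sm.continuousOn _).norm

theorem gradient_bound_core {K A N p d E θ ρ s H g : ℝ} (hK : 0 < K) (hA : 1 ≤ A) (hN : 1 ≤ N)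
    (hp : 0 ≤ p) (hd : 0 < d) (hE : 1 ≤ E) (hθ : 0 < θ) (hs : s = N + p)
    (hH : H = 12 * A ^ 2 * (N * s) * E ^ 2 / d ^ 2) (hρ : ρ = θ * d / (N * E))
    (hg : g ≤ K * (A ^ 2 / ρ ^ 2 + A * H
      + ρ ^ 2 * (H ^ 2 + (A / d ^ 2) ^ 2 * A ^ 2 + A / d ^ 2 * (2 * p * E / d) ^ 2)
      + ρ * (2 * p * E / d * (H + A / d ^ 2 * A)))) :
    g * (d ^ 2 / E ^ 2) ≤ K * (149 * A ^ 4)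
      * (N ^ 2 / θ ^ 2 + N * s + θ ^ 2 * s ^ 2 + θ * (p * s)) := by
  have hA0 : 0 < A := by linarith
  have hN0 : 0 < N := by linarith
  have hE0 : 0 < E := by linarith
  have hs0 : 0 < s := by linarith
  have hNs : N ≤ s := by linarith
  have hps : p ≤ s := by linarith
  have hA2 : A ^ 2 ≤ A ^ 4 := pow_le_pow_right₀ hA (by norm_num)
  have hA3 : A ^ 3 ≤ A ^ 4 := pow_le_pow_right₀ hA (by norm_num)
  have hA1 : A ≤ A ^ 4 := le_self_pow₀ hA (by norm_num)
  have hinv : 1 / N ≤ 1 := by rw [div_le_one hN0]; exact hN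
  have hinvE : 1 / E ≤ 1 := by rw [div_le_one hE0]; exact hE
  have e : (A ^ 2 / ρ ^ 2 + A * H
      + ρ ^ 2 * (H ^ 2 + (A / d ^ 2) ^ 2 * A ^ 2 + A / d ^ 2 * (2 * p * E / d) ^ 2)
      + ρ * (2 * p * E / d * (H + A / d ^ 2 * A))) * (d ^ 2 / E ^ 2)
      = A ^ 2 * (N ^ 2 / θ ^ 2) + 12 * A ^ 3 * (N * s) + 144 * A ^ 4 * (θ ^ 2 * s ^ 2)
        + A ^ 4 * (θ ^ 2 * ((1 / N) ^ 2 * (1 / E) ^ 4)) + 4 * A * (θ ^ 2 * (p ^ 2 * ((1 / N) ^ 2 * (1 / E) ^ 2)))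
        + 24 * A ^ 2 * (θ * (p * s)) + 2 * A ^ 2 * (θ * (p * (1 / N * (1 / E) ^ 2))) := by
    rw [hρ, hH]; field_simp; ring
  have h1 : (1 / N) ^ 2 * (1 / E) ^ 4 ≤ s ^ 2 := by
    have : (1 / N) ^ 2 * (1 / E) ^ 4 ≤ 1 ^ 2 * 1 ^ 4 := by gcongr
    have : 1 ≤ s ^ 2 := one_le_pow₀ (by linarith)
    linarith
  have h2 : p ^ 2 * ((1 / N) ^ 2 * (1 / E) ^ 2) ≤ s ^ 2 := by
    have : p ^ 2 * ((1 / N) ^ 2 * (1 / E) ^ 2) ≤ s ^ 2 * (1 ^ 2 * 1 ^ 2) := by gcongr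
    linarith
  have h3 : p * (1 / N * (1 / E) ^ 2) ≤ p * s := by
    refine mul_le_mul_of_nonneg_left ?_ hp
    have : 1 / N * (1 / E) ^ 2 ≤ 1 * 1 ^ 2 := by gcongr
    linarith
  have hE2 : 0 ≤ d ^ 2 / E ^ 2 := by positivity
  calc g * (d ^ 2 / E ^ 2) ≤ _ := mul_le_mul_of_nonneg_right hg hE2
    _ = K * (A ^ 2 * (N ^ 2 / θ ^ 2) + 12 * A ^ 3 * (N * s) + 144 * A ^ 4 * (θ ^ 2 * s ^ 2)
        + A ^ 4 * (θ ^ 2 * ((1 / N) ^ 2 * (1 / E) ^ 4)) + 4 * A * (θ ^ 2 * (p ^ 2 * ((1 / N) ^ 2 * (1 / E) ^ 2)))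
        + 24 * A ^ 2 * (θ * (p * s)) + 2 * A ^ 2 * (θ * (p * (1 / N * (1 / E) ^ 2)))) := by
        rw [mul_assoc, e]
    _ ≤ K * (A ^ 4 * (N ^ 2 / θ ^ 2) + 12 * A ^ 4 * (N * s) + 144 * A ^ 4 * (θ ^ 2 * s ^ 2)
        + A ^ 4 * (θ ^ 2 * s ^ 2) + 4 * A ^ 4 * (θ ^ 2 * s ^ 2)
        + 24 * A ^ 4 * (θ * (p * s)) + 2 * A ^ 4 * (θ * (p * s))) := by gcongr
    _ ≤ _ := by
        rw [mul_assoc K]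
        refine mul_le_mul_of_nonneg_left ?_ hK.le
        have : 0 ≤ A ^ 4 * (N ^ 2 / θ ^ 2) := by positivity
        have : 0 ≤ A ^ 4 * (N * s) := by positivity
        have : 0 ≤ A ^ 4 * (θ * (p * s)) := by positivity
        linarith

end Absorption

section Absorption


set_option maxHeartbeats 1000000 in
theorem AbsorbSystem.exists_bound (α β : Type*) [Fintype α] [Fintype β] (A : ℝ) (hA : 1 ≤ A) :
    ∃ C : ℝ, 0 ≤ C ∧ ∀ {R : ℝ} (c : Fin 6 → Sm Hsp E3) (f : α → Sm (Cyl R) E3)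
      (y : β → Sm (Cyl R) E3) (z : Sm (Cyl R) E3) (q : P3) (ρ : ℝ), AbsorbSystem c f y z q ρ A →
      ∀ r ∈ Ico 0 R, ∀ x ∈ ball q ρ,
        depth q ρ x * gradSum c f (r, x) ≤ C ∧ depth q ρ x * normSum y (r, x) ≤ C ∧
          depth q ρ x ^ 2 * ‖z.1 (r, x)‖ ≤ C := by
  obtain ⟨K, hK, hgrad⟩ := gradient_estimate
  have hA0 : 0 < A := by linarith
  obtain ⟨n, hn⟩ : ∃ n : ℝ, n = 6 * (Fintype.card α : ℝ) := ⟨_, rfl⟩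
  have hn0 : 0 ≤ n := by rw [hn]; positivity
  obtain ⟨nb, hnb⟩ : ∃ nb : ℝ, nb = (Fintype.card β : ℝ) := ⟨_, rfl⟩
  have hnb0 : 0 ≤ nb := by rw [hnb]; positivity
  obtain ⟨B, hB⟩ : ∃ B, B = n ^ 2 * (K * (149 * A ^ 4)) + 1 := ⟨_, rfl⟩
  have hB1 : 1 ≤ B := by rw [hB]; exact le_add_of_nonneg_left (by positivity)
  obtain ⟨θ, hθ⟩ : ∃ θ, θ = 1 / (16 * B) := ⟨_, rfl⟩
  have hθ0 : 0 < θ := by rw [hθ]; positivity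
  have hθ1 : θ ≤ 1 / 16 := by
    rw [hθ]; exact one_div_le_one_div_of_le (by norm_num) (by linarith)
  obtain ⟨Λ, hΛ⟩ : ∃ Λ, Λ = 2 * (nb * A * (1 + 25 * B ^ 2)) + 1 := ⟨_, rfl⟩
  have hΛ1 : 1 ≤ Λ := by rw [hΛ]; exact le_add_of_nonneg_left (by positivity)
  have hΛ0 : 0 < Λ := by linarith
  obtain ⟨N₀, hN₀⟩ : ∃ N₀, N₀ = 2 * (1 + nb * A) := ⟨_, rfl⟩
  have hN₀0 : 0 ≤ N₀ := by rw [hN₀]; positivity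
  obtain ⟨eΛ, heΛ⟩ : ∃ e, e = exp Λ := ⟨_, rfl⟩
  have heΛ1 : 1 ≤ eΛ := by rw [heΛ]; exact Real.one_le_exp hΛ0.le
  obtain ⟨s₀, hs₀⟩ : ∃ s₀, s₀ = N₀ + 25 * B ^ 2 * N₀ := ⟨_, rfl⟩
  have hs₀0 : 0 ≤ s₀ := by rw [hs₀]; positivity
  refine ⟨s₀ * eΛ + 2 * A * (N₀ * s₀) * eΛ ^ 2, by positivity,
    fun {R} c f y z q ρ S r₁ hr₁ x₁ hx₁ => ?_⟩
  have hsub1 : ∀ {σ}, σ ∈ Icc 0 r₁ → σ ∈ Ico 0 R := fun hσ => ⟨hσ.1, hσ.2.trans_lt hr₁.2⟩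
  have hcomp : IsCompact (Icc 0 r₁ ×ˢ closedBall q ρ) :=
    isCompact_Icc.prod (isCompact_closedBall q ρ)
  have hKsub : Icc 0 r₁ ×ˢ closedBall q ρ ⊆ Cyl R := fun x hx =>
    ⟨hsub1 hx.1, S.sub hx.2⟩
  have hne : (Icc 0 r₁ ×ˢ closedBall q ρ).Nonempty :=
    ⟨(0, q), ⟨le_rfl, hr₁.1⟩, Metric.mem_closedBall_self S.pos.le⟩
  have hcd : Continuous fun x : ℝ × P3 => depth q ρ x.2 := (continuous_depth q ρ).comp continuous_snd
  have hce : Continuous fun x : ℝ × P3 => exp (-(Λ * x.1)) := by fun_prop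
  obtain ⟨xN, hxN, hNmax⟩ := hcomp.exists_isMaxOn
    (f := fun x => exp (-(Λ * x.1)) * (1 + depth q ρ x.2 * normSum y x)) hne
    (hce.continuousOn.mul (continuousOn_const.add
      (hcd.continuousOn.mul ((continuousOn_normSum y).mono hKsub))))
  obtain ⟨xp, hxp, hpmax⟩ := hcomp.exists_isMaxOn
    (f := fun x => exp (-(Λ * x.1)) * (depth q ρ x.2 * gradSum c f x)) hne
    (hce.continuousOn.mul
      (hcd.continuousOn.mul ((continuousOn_gradSum c f).mono hKsub)))
  obtain ⟨N, hNd⟩ : ∃ N, N = exp (-(Λ * xN.1)) * (1 + depth q ρ xN.2 * normSum y xN) :=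
    ⟨_, rfl⟩
  obtain ⟨p, hpd⟩ : ∃ p, p = exp (-(Λ * xp.1)) * (depth q ρ xp.2 * gradSum c f xp) :=
    ⟨_, rfl⟩
  have hdn : ∀ {x}, x ∈ closedBall q ρ → 0 ≤ depth q ρ x := fun hx =>
    sub_nonneg.2 (mem_closedBall_iff_norm.1 hx)
  have hp0 : 0 ≤ p := by
    rw [hpd]
    exact mul_nonneg (exp_pos _).le (mul_nonneg (hdn hxp.2) (gradSum_nonneg c f _))
  have hNle : ∀ σ ∈ Icc 0 r₁, ∀ x ∈ closedBall q ρ,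
      1 + depth q ρ x * normSum y (σ, x) ≤ N * exp (Λ * σ) := by
    intro σ hσ x hx
    have h1 : exp (-(Λ * σ)) * (1 + depth q ρ x * normSum y (σ, x)) ≤ N := by
      rw [hNd]; exact hNmax (mk_mem_prod hσ hx)
    rwa [Real.exp_neg, inv_mul_le_iff₀ (exp_pos _), mul_comm (exp _)] at h1
  have hple : ∀ σ ∈ Icc 0 r₁, ∀ x ∈ closedBall q ρ,
      depth q ρ x * gradSum c f (σ, x) ≤ p * exp (Λ * σ) := by
    intro σ hσ x hx
    have h1 : exp (-(Λ * σ)) * (depth q ρ x * gradSum c f (σ, x)) ≤ p := by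
      rw [hpd]; exact hpmax (mk_mem_prod hσ hx)
    rwa [Real.exp_neg, inv_mul_le_iff₀ (exp_pos _), mul_comm (exp _)] at h1
  have hN1 : 1 ≤ N := by
    have h1 := hNle 0 ⟨le_rfl, hr₁.1⟩ q (Metric.mem_closedBall_self S.pos.le)
    rw [mul_zero, Real.exp_zero, mul_one] at h1
    have := mul_nonneg (hdn (Metric.mem_closedBall_self (x := q) S.pos.le)) (normSum_nonneg y (0, q))
    linarith
  obtain ⟨s, hs⟩ : ∃ s, s = N + p := ⟨_, rfl⟩
  have hNs : N ≤ s := by linarith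
  have hs0 : 0 < s := by linarith
  -- pointwise bounds in terms of the maxima
  have hY : ∀ σ ∈ Icc 0 r₁, ∀ x ∈ ball q ρ,
      1 / depth q ρ x + normSum y (σ, x) ≤ N * exp (Λ * σ) / depth q ρ x := by
    intro σ hσ x hx
    have hd := depth_pos hx
    have := hNle σ hσ x (ball_subset_closedBall hx)
    rw [div_add' _ _ _ hd.ne', div_le_div_iff_of_pos_right hd]
    linarith
  have hPY : ∀ σ ∈ Icc 0 r₁, ∀ x ∈ ball q ρ,
      1 / depth q ρ x + gradSum c f (σ, x) + normSum y (σ, x)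
        ≤ s * exp (Λ * σ) / depth q ρ x := by
    intro σ hσ x hx
    have hd := depth_pos hx
    have h1 := hY σ hσ x hx
    have h2 := hple σ hσ x (ball_subset_closedBall hx)
    have h3 : gradSum c f (σ, x) ≤ p * exp (Λ * σ) / depth q ρ x := by
      rw [le_div_iff₀ hd]; linarith
    have : s * exp (Λ * σ) / depth q ρ x = N * exp (Λ * σ) / depth q ρ x
        + p * exp (Λ * σ) / depth q ρ x := by rw [hs]; ring
    linarith
  have hprod : ∀ σ ∈ Icc 0 r₁, ∀ x ∈ ball q ρ,
      (1 / depth q ρ x + normSum y (σ, x))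
        * (1 / depth q ρ x + gradSum c f (σ, x) + normSum y (σ, x))
        ≤ N * s * exp (Λ * σ) ^ 2 / depth q ρ x ^ 2 := by
    intro σ hσ x hx
    have hd := depth_pos hx
    have hE := exp_pos (Λ * σ)
    calc _ ≤ (N * exp (Λ * σ) / depth q ρ x) * (s * exp (Λ * σ) / depth q ρ x) := by
          refine mul_le_mul (hY σ hσ x hx) (hPY σ hσ x hx) ?_ (by positivity)
          have := normSum_nonneg y (σ, x)
          have := gradSum_nonneg c f (σ, x)
          positivity
      _ = _ := by ring
  have hz : ∀ σ ∈ Icc 0 r₁, ∀ x ∈ ball q ρ,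
      ‖z.1 (σ, x)‖ ≤ 2 * A * (N * s) * exp (Λ * σ) ^ 2 / depth q ρ x ^ 2 := by
    intro σ hσ x hx
    have hd := depth_pos hx
    have hE : 1 ≤ exp (Λ * σ) := Real.one_le_exp (mul_nonneg hΛ0.le hσ.1)
    have h1 := Sm.norm_le_exp z (κ := 2 * Λ) (b := A * (N * s) / depth q ρ x ^ 2) (hsub1 hσ) x
      (by positivity) (S.z_zero_le x hx) (by positivity) (fun τ hτ => by
        have hτ1 : τ ∈ Icc 0 r₁ := ⟨hτ.1, hτ.2.trans hσ.2⟩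
        refine (S.dr_z_le τ (hsub1 hτ1) x hx).trans ?_
        have := mul_le_mul_of_nonneg_left (hprod τ hτ1 x hx) hA0.le
        refine this.trans (le_of_eq ?_)
        rw [← Real.exp_nat_mul]
        push_cast
        rw [mul_assoc 2 Λ τ]; ring)
    have h2 : exp (2 * Λ * σ) = exp (Λ * σ) ^ 2 := by
      rw [← Real.exp_nat_mul]; push_cast; rw [mul_assoc]
    rw [h2] at h1
    have h3 : A * (N * s) / depth q ρ x ^ 2 * exp (Λ * σ) ^ 2 / (2 * Λ)
        ≤ A * (N * s) / depth q ρ x ^ 2 * exp (Λ * σ) ^ 2 :=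
      div_le_self (by positivity) (by linarith)
    have h4 : A / depth q ρ x ^ 2 ≤ A * (N * s) / depth q ρ x ^ 2 * exp (Λ * σ) ^ 2 := by
      rw [div_mul_eq_mul_div, div_le_div_iff_of_pos_right (by positivity), mul_assoc]
      refine le_mul_of_one_le_right hA0.le ?_
      have : 1 ≤ s := by linarith
      exact one_le_mul_of_one_le_of_one_le (one_le_mul_of_one_le_of_one_le hN1 this)
        (one_le_pow₀ hE)
    have : 2 * A * (N * s) * exp (Λ * σ) ^ 2 / depth q ρ x ^ 2
        = 2 * (A * (N * s) / depth q ρ x ^ 2 * exp (Λ * σ) ^ 2) := by ring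
    linarith
  -- the gradient estimate
  have hpN : p ≤ 25 * B ^ 2 * N := by
    refine le_of_sq_le_absorb hB1 (by linarith) hθ ?_
    rw [← hs]
    obtain ⟨Sg, hSg⟩ : ∃ Sg, Sg = N ^ 2 / θ ^ 2 + N * s + θ ^ 2 * s ^ 2 + θ * (p * s) := ⟨_, rfl⟩
    have hSg0 : 0 ≤ Sg := by rw [hSg]; positivity
    rw [← hSg]
    rcases (hdn hxp.2).eq_or_lt with h0 | hd
    · have : p = 0 := by rw [hpd, ← h0]; ring
      rw [this]
      have : 0 ≤ B * Sg := mul_nonneg (by linarith) hSg0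
      simpa using this
    have hxb : xp.2 ∈ ball q ρ := mem_ball_iff_norm.2 (sub_pos.1 hd)
    obtain ⟨d, hdd⟩ : ∃ d, d = depth q ρ xp.2 := ⟨_, rfl⟩
    obtain ⟨E, hE⟩ : ∃ E, E = exp (Λ * xp.1) := ⟨_, rfl⟩
    have hE1 : 1 ≤ E := by rw [hE]; exact Real.one_le_exp (mul_nonneg hΛ0.le hxp.1.1)
    rw [← hdd] at hd
    obtain ⟨ρ', hρ'⟩ : ∃ ρ', ρ' = θ * d / (N * E) := ⟨_, rfl⟩
    obtain ⟨H, hH⟩ : ∃ H, H = 12 * A ^ 2 * (N * s) * E ^ 2 / d ^ 2 := ⟨_, rfl⟩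
    have hρ'0 : 0 < ρ' := by rw [hρ']; positivity
    have hρ'1 : 4 * ρ' ≤ d / 2 := by
      have : ρ' ≤ θ * d := by
        rw [hρ']
        exact div_le_self (by positivity) (one_le_mul_of_one_le_of_one_le hN1 hE1)
      nlinarith
    have hball : ∀ x ∈ closedBall xp.2 (4 * ρ'),
        x ∈ ball q ρ ∧ d / 2 ≤ depth q ρ x := by
      intro x hx
      have h1 : d / 2 ≤ depth q ρ x := by
        rw [hdd]; exact half_depth_le hx (by rw [← hdd]; exact hρ'1)
      refine ⟨mem_ball_iff_norm.2 (sub_pos.1 (lt_of_lt_of_le (by positivity) h1)), h1⟩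
    have hdρ : d ≤ ρ := by rw [hdd]; exact depth_le
    have hg : ∀ a i, ‖(covD cdir (fun j => Sm.cst R (c j)) i (f a)).1 xp‖ * (d / E)
        ≤ √(K * (149 * A ^ 4) * Sg) := by
      intro a i
      have h1 := hgrad c (Sm.slice xp.1 (f a)) xp.2 ρ' A H (2 * p * E / d) (A / d ^ 2) hρ'0
        (by positivity) (by positivity)
        (fun x hx => S.sub (ball_subset_closedBall (hball x hx).1))
        (fun x hx => by
          obtain ⟨hxq, hxd⟩ := hball x hx
          have hx0 := depth_pos hxq
          have es : ∀ i, Sm.slice xp.1 (Sm.cst R (c i)) = c i := fun i =>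
            Sm.slice_cst (hsub1 hxp.1) _
          have eD : ∀ i, (covD dir c i (Sm.slice xp.1 (f a))).1 x
              = (covD cdir (fun j => Sm.cst R (c j)) i (f a)).1 (xp.1, x) := fun i => by
            rw [← Sm.slice_apply, slice_covD]; simp only [es]
          have eL : (covL dir c (Sm.slice xp.1 (f a))).1 x
              = (covL cdir (fun j => Sm.cst R (c j)) (f a)).1 (xp.1, x) := by
            rw [← Sm.slice_apply, slice_covL]; simp only [es]
          have hinv2 : ∀ {a : ℝ}, 0 ≤ a → a / depth q ρ x ^ 2 ≤ 4 * a / d ^ 2 := fun {a} ha => by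
            rw [div_le_div_iff₀ (by positivity) (by positivity)]
            have : d ^ 2 ≤ 4 * depth q ρ x ^ 2 := by nlinarith
            nlinarith
          refine ⟨S.f_le a xp.1 (hsub1 hxp.1) x hxq, ?_, fun i => ?_, fun i j => ?_⟩
          · rw [eL]
            refine (S.lap_le a xp.1 (hsub1 hxp.1) x hxq).trans ?_
            have a1 := hprod xp.1 hxp.1 x hxq
            have a2 := hz xp.1 hxp.1 x hxq
            rw [← hE] at a1 a2
            have a3 : N * s * E ^ 2 / depth q ρ x ^ 2 + 2 * A * (N * s) * E ^ 2 / depth q ρ x ^ 2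
                ≤ 3 * A * (N * s) * E ^ 2 / depth q ρ x ^ 2 := by
              rw [← add_div, div_le_div_iff_of_pos_right (by positivity)]
              have : 0 ≤ N * s * E ^ 2 := by positivity
              nlinarith
            have a4 := hinv2 (a := 3 * A * (N * s) * E ^ 2) (by positivity)
            calc _ ≤ A * (4 * (3 * A * (N * s) * E ^ 2) / d ^ 2) :=
                  mul_le_mul_of_nonneg_left (by linarith) hA0.le
              _ = H := by rw [hH]; ring
          · rw [eD]
            refine (norm_le_gradSum c f a i _).trans ?_
            have a1 := hple xp.1 hxp.1 x (ball_subset_closedBall hxq)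
            rw [← hE] at a1
            rw [le_div_iff₀ hd]
            have a2 := gradSum_nonneg c f (xp.1, x)
            nlinarith
          · refine (S.curv_le x hxq i j).trans ?_
            exact div_le_div_of_nonneg_left hA0.le (by positivity)
              (pow_le_pow_left₀ hd.le hdρ 2))
      have h2 := gradient_bound_core hK hA hN1 hp0 hd hE1 hθ0 hs hH hρ' h1
      rw [← hSg] at h2
      refine le_sqrt_of_sq_le (le_trans ?_ h2)
      rw [mul_pow, div_pow]
      refine mul_le_mul_of_nonneg_right ?_ (by positivity)
      have es : ∀ i, Sm.slice xp.1 (Sm.cst R (c i)) = c i := fun i =>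
        Sm.slice_cst (hsub1 hxp.1) _
      have eD : (covD dir c i (Sm.slice xp.1 (f a))).1 xp.2
          = (covD cdir (fun j => Sm.cst R (c j)) i (f a)).1 xp := by
        rw [← Prod.mk.eta (p := xp), ← Sm.slice_apply, slice_covD]; simp only [es]
      rw [← eD, gradSq_apply]
      exact single_le_sum
        (f := fun i => ‖(covD dir c i (Sm.slice xp.1 (f a))).1 xp.2‖ ^ 2)
        (fun i _ => sq_nonneg _) (Finset.mem_univ i)
    have h3 : p ≤ n * √(K * (149 * A ^ 4) * Sg) := by
      have e1 : p = ∑ a, ∑ i, ‖(covD cdir (fun j => Sm.cst R (c j)) i (f a)).1 xp‖ * (d / E) := by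
        simp only [← sum_mul]
        rw [hpd, ← hdd, Real.exp_neg, ← hE, gradSum]; ring
      rw [e1, hn]
      refine (sum_le_sum fun a _ => sum_le_sum fun i _ => hg a i).trans (le_of_eq ?_)
      simp only [Finset.sum_const, Finset.card_univ, Fintype.card_fin, nsmul_eq_mul]
      push_cast; ring
    have h4 := pow_le_pow_left₀ hp0 h3 2
    rw [mul_pow, sq_sqrt (by positivity)] at h4
    have : B * Sg = n ^ 2 * (K * (149 * A ^ 4) * Sg) + Sg := by rw [hB]; ring
    linarith
  -- closing the loop for the evolving quantities
  have hNN : N ≤ N₀ := by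
    have h1 : ∀ b, exp (-(Λ * xN.1)) * (depth q ρ xN.2 * ‖(y b).1 xN‖) ≤ A + A * s / Λ := by
      intro b
      rcases (hdn hxN.2).eq_or_lt with h0 | hd
      · rw [← h0, zero_mul, mul_zero]; positivity
      have hxb : xN.2 ∈ ball q ρ := mem_ball_iff_norm.2 (sub_pos.1 hd)
      have h2 := Sm.norm_le_exp (y b) (κ := Λ) (b := A * s / depth q ρ xN.2) (hsub1 hxN.1) xN.2
        hΛ0 (S.y_zero_le b xN.2 hxb) (by positivity) (fun τ hτ => by
          have hτ1 : τ ∈ Icc 0 r₁ := ⟨hτ.1, hτ.2.trans hxN.1.2⟩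
          refine (S.dr_y_le b τ (hsub1 hτ1) xN.2 hxb).trans ?_
          refine (mul_le_mul_of_nonneg_left (hPY τ hτ1 xN.2 hxb) hA0.le).trans (le_of_eq ?_)
          ring)
      rw [Prod.mk.eta] at h2
      have hE1 : 1 ≤ exp (Λ * xN.1) := Real.one_le_exp (mul_nonneg hΛ0.le hxN.1.1)
      rw [Real.exp_neg, inv_mul_le_iff₀ (by positivity)]
      calc depth q ρ xN.2 * ‖(y b).1 xN‖ ≤ depth q ρ xN.2 * (A / depth q ρ xN.2
            + A * s / depth q ρ xN.2 * exp (Λ * xN.1) / Λ) :=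
            mul_le_mul_of_nonneg_left h2 hd.le
        _ = A + exp (Λ * xN.1) * (A * s / Λ) := by field_simp
        _ ≤ exp (Λ * xN.1) * A + exp (Λ * xN.1) * (A * s / Λ) := by
            gcongr; exact le_mul_of_one_le_left hA0.le hE1
        _ = _ := by ring
    have h3 : N ≤ 1 + nb * (A + A * s / Λ) := by
      have e1 : N = exp (-(Λ * xN.1))
          + ∑ b, exp (-(Λ * xN.1)) * (depth q ρ xN.2 * ‖(y b).1 xN‖) := by
        rw [← mul_sum, ← mul_sum, hNd, normSum]; ring
      have e2 : exp (-(Λ * xN.1)) ≤ 1 :=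
        Real.exp_le_one_iff.2 (neg_nonpos.2 (mul_nonneg hΛ0.le hxN.1.1))
      have e3 := sum_le_sum fun b (_ : b ∈ Finset.univ) => h1 b
      rw [Finset.sum_const, Finset.card_univ, nsmul_eq_mul, ← hnb] at e3
      rw [e1]; exact add_le_add e2 e3
    have h4 : s ≤ (1 + 25 * B ^ 2) * N := by rw [hs]; linarith
    have h5 : nb * (A * s / Λ) ≤ N / 2 := by
      rw [← mul_div_assoc, div_le_iff₀ hΛ0]
      have e1 : nb * (A * s) ≤ nb * (A * ((1 + 25 * B ^ 2) * N)) := by gcongr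
      have e2 : N / 2 * Λ = nb * (A * ((1 + 25 * B ^ 2) * N)) + N / 2 := by rw [hΛ]; ring
      linarith
    rw [hN₀]; linarith
  have hss : s ≤ s₀ := by
    rw [hs, hs₀]
    have : 25 * B ^ 2 * N ≤ 25 * B ^ 2 * N₀ := by gcongr
    linarith
  have hr : r₁ ∈ Icc 0 r₁ := ⟨hr₁.1, le_rfl⟩
  have hE : exp (Λ * r₁) ≤ eΛ := by
    rw [heΛ]
    refine Real.exp_le_exp.2 (mul_le_of_le_one_right hΛ0.le ?_)
    linarith [hr₁.2, S.le_one]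
  have hEp := exp_pos (Λ * r₁)
  have hd := depth_pos hx₁
  have f1 := hple r₁ hr x₁ (ball_subset_closedBall hx₁)
  have f2 := hNle r₁ hr x₁ (ball_subset_closedBall hx₁)
  have f3 := hz r₁ hr x₁ hx₁
  have f4 : p * exp (Λ * r₁) ≤ s₀ * eΛ :=
    mul_le_mul (by linarith) hE hEp.le hs₀0
  have f5 : N * exp (Λ * r₁) ≤ s₀ * eΛ :=
    mul_le_mul (by linarith) hE hEp.le hs₀0
  have f6 : 2 * A * (N * s) * exp (Λ * r₁) ^ 2 ≤ 2 * A * (N₀ * s₀) * eΛ ^ 2 := by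
    gcongr
  have f7 : 0 ≤ 2 * A * (N₀ * s₀) * eΛ ^ 2 := by positivity
  have f8 : 0 ≤ s₀ * eΛ := by positivity
  refine ⟨by linarith, by linarith, ?_⟩
  rw [le_div_iff₀ (by positivity)] at f3
  linarith

end Absorption

namespace FlowSystem

variable {R : ℝ} (S : FlowSystem R) (c₀ : Fin 6 → Sm Hsp E3)

/-- The difference between the flowing connection and a background connection. -/
def diff (i : Fin 6) : Sm (Cyl R) E3 := S.c i - Sm.cst R (c₀ i)

/-- The divergence of the difference with the background connection. -/
def divDiff : Sm (Cyl R) E3 := ∑ i, covD cdir (fun j => Sm.cst R (c₀ j)) i (S.diff c₀ i)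

theorem covD_eq_background (i : Fin 6) (f : Sm (Cyl R) E3) :
    covD cdir S.c i f = covD cdir (fun j => Sm.cst R (c₀ j)) i f + lb (S.diff c₀ i) f := by
  simp only [covD_eq, diff, map_sub, LinearMap.sub_apply]
  abel

theorem covL_eq_background (f : Sm (Cyl R) E3) :
    covL cdir S.c f = covL cdir (fun j => Sm.cst R (c₀ j)) f + lb (S.divDiff c₀) f
      + (2 : ℝ) • (∑ i, lb (S.diff c₀ i) (covD cdir (fun j => Sm.cst R (c₀ j)) i f))
      + ∑ i, lb (S.diff c₀ i) (lb (S.diff c₀ i) f) := by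
  simp only [covL_eq, divDiff, map_sum, smul_sum, LinearMap.sum_apply,
    ← sum_add_distrib]
  refine sum_congr rfl fun i _ => ?_
  rw [S.covD_eq_background c₀, S.covD_eq_background c₀ i f, map_add, map_add, covD_lb, two_smul]
  abel

theorem dr_diff (i : Fin 6) : Sm.dr (S.diff c₀ i) = Sm.dr (S.c i) := by
  rw [diff, map_sub, Sm.dr_cst, sub_zero]

theorem dr_divDiff : Sm.dr (S.divDiff c₀)
    = -lb S.Y S.v - ∑ i, lb (S.diff c₀ i) (Sm.dr (S.c i)) := by
  rw [← S.div_dr_c, divDiff, map_sum, ← Finset.sum_sub_distrib]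
  refine sum_congr rfl fun i _ => ?_
  rw [dr_covD, Sm.dr_cst, map_zero, LinearMap.zero_apply, add_zero, dr_diff,
    S.covD_eq_background c₀, add_sub_cancel_right]

theorem norm_dr_c_le (c₀ : Fin 6 → Sm Hsp E3) (i : Fin 6) {x : ℝ × P3} {V : ℝ}
    (hv : ‖S.v.1 x‖ ≤ V) :
    ‖(Sm.dr (S.c i)).1 x‖ ≤ gradSum c₀ (fun _ : Unit => S.v) x
      + 2 * V * normSum (S.diff c₀) x := by
  rw [S.dr_c, Sm.sum_apply]
  refine (norm_sum_le _ _).trans ?_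
  have h1 : ∀ j, ‖(S.J i j • covD cdir S.c j S.v).1 x‖
      ≤ ‖(covD cdir (fun j => Sm.cst R (c₀ j)) j S.v).1 x‖
        + 2 * V * ‖(S.diff c₀ j).1 x‖ := by
    intro j
    rw [Sm.smul_apply, norm_smul, norm_eq_abs]
    refine (mul_le_of_le_one_left (norm_nonneg _) (S.abs_J_le i j)).trans ?_
    rw [S.covD_eq_background c₀, Sm.add_apply]
    refine (norm_add_le _ _).trans (add_le_add le_rfl ?_)
    refine (norm_br_le _ _).trans ?_
    nlinarith [norm_nonneg ((S.diff c₀ j).1 x)]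
  refine (sum_le_sum fun j _ => h1 j).trans (le_of_eq ?_)
  rw [sum_add_distrib, ← mul_sum]
  simp [gradSum, normSum]

theorem absorbSystem {q : P3} {ρ A : ℝ} (hA : 1 ≤ A) (hρ : 0 < ρ)
    (hsub : closedBall q ρ ⊆ Hsp)
    (hcurv : ∀ x ∈ ball q ρ, ∀ i j, ‖(curv dir c₀ i j).1 x‖ ≤ A / ρ ^ 2)
    (hv : ∀ x, ‖S.v.1 x‖ ≤ A) (hX : ∀ x ∈ ball q ρ, ‖S.X.1 x‖ ≤ A / ρ ^ 2)
    (hb : ∀ i, ∀ x ∈ ball q ρ, ‖(S.diff c₀ i).1 (0, x)‖ ≤ A / ρ)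
    (hβ : ∀ x ∈ ball q ρ, ‖(S.divDiff c₀).1 (0, x)‖ ≤ A / ρ ^ 2) :
    AbsorbSystem c₀ (fun _ : Unit => S.v) (S.diff c₀) (S.divDiff c₀) q ρ (10 * A ^ 2) := by
  have hA0 : 0 < A := by linarith
  have hAA : A ≤ 10 * A ^ 2 := by nlinarith
  have hdinv : ∀ {x}, x ∈ ball q ρ → A / ρ ^ 2 ≤ A / depth q ρ x ^ 2 := fun hx =>
    div_le_div_of_nonneg_left hA0.le (pow_pos (depth_pos hx) 2)
      (pow_le_pow_left₀ (depth_pos hx).le depth_le 2)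
  have hXd : ∀ {x}, x ∈ ball q ρ → ‖S.X.1 x‖ ≤ A * (1 / depth q ρ x) ^ 2 := fun {x} hx => by
    refine ((hX x hx).trans (hdinv hx)).trans (le_of_eq ?_)
    rw [one_div, inv_pow, div_eq_mul_inv]
  refine ⟨hρ, S.le_one, hsub, fun x hx i j => ?_, fun _ r _ x _ => (hv _).trans hAA,
    fun _ r hr x hx => ?_, fun i r hr x hx => ?_, fun r hr x hx => ?_, fun i x hx => ?_,
    fun x hx => ?_⟩
  · refine (hcurv x hx i j).trans ?_
    gcongr
  · obtain ⟨δ, hδ⟩ : ∃ δ, δ = 1 / depth q ρ x := ⟨_, rfl⟩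
    have hδ0 : 0 < δ := by rw [hδ]; exact one_div_pos.2 (depth_pos hx)
    have h1 := S.covL_eq_background c₀ S.v
    rw [S.covL_v] at h1
    have h2 : covL cdir (fun j => Sm.cst R (c₀ j)) S.v = -Sm.cst R S.X - lb (S.divDiff c₀) S.v
      - (2 : ℝ) • (∑ i, lb (S.diff c₀ i) (covD cdir (fun j => Sm.cst R (c₀ j)) i S.v))
      - ∑ i, lb (S.diff c₀ i) (lb (S.diff c₀ i) S.v) := by rw [h1]; abel
    rw [h2, Sm.sub_apply, Sm.sub_apply, Sm.sub_apply, Sm.smul_apply, Sm.sum_apply, Sm.sum_apply,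
      Sm.neg_apply, ← hδ]
    have hP0 := gradSum_nonneg c₀ (fun _ : Unit => S.v) (r, x)
    have hY0 := normSum_nonneg (S.diff c₀) (r, x)
    obtain ⟨P, hP⟩ : ∃ P, P = gradSum c₀ (fun _ : Unit => S.v) (r, x) := ⟨_, rfl⟩
    obtain ⟨Y, hY⟩ : ∃ Y, Y = normSum (S.diff c₀) (r, x) := ⟨_, rfl⟩
    have b1 : ‖-(Sm.cst R S.X).1 (r, x)‖ ≤ A * δ ^ 2 := by
      rw [norm_neg, hδ]; exact (norm_cst_le _ _).trans (hXd hx)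
    have b2 : ‖(lb (S.divDiff c₀) S.v).1 (r, x)‖ ≤ 2 * A * ‖(S.divDiff c₀).1 (r, x)‖ := by
      refine (norm_br_le _ _).trans ?_
      nlinarith [norm_nonneg ((S.divDiff c₀).1 (r, x)), hv (r, x)]
    have b3 : ‖(2 : ℝ) • ∑ i, (lb (S.diff c₀ i)
        (covD cdir (fun j => Sm.cst R (c₀ j)) i S.v)).1 (r, x)‖ ≤ 4 * (Y * P) := by
      rw [norm_smul, Real.norm_two, hY, normSum, sum_mul]
      have : ‖∑ i, (lb (S.diff c₀ i) (covD cdir (fun j => Sm.cst R (c₀ j)) i S.v)).1 (r, x)‖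
          ≤ ∑ i, 2 * (‖(S.diff c₀ i).1 (r, x)‖ * P) := by
        refine (norm_sum_le _ _).trans (sum_le_sum fun i _ => (norm_br_le _ _).trans ?_)
        have := norm_le_gradSum c₀ (fun _ : Unit => S.v) () i (r, x)
        rw [← hP] at this
        nlinarith [norm_nonneg ((S.diff c₀ i).1 (r, x))]
      rw [← mul_sum] at this
      linarith
    have b4 : ‖∑ i, (lb (S.diff c₀ i) (lb (S.diff c₀ i) S.v)).1 (r, x)‖ ≤ 4 * A * (Y * Y) := by
      refine (norm_sum_le _ _).trans ?_
      have : ∀ i, ‖(lb (S.diff c₀ i) (lb (S.diff c₀ i) S.v)).1 (r, x)‖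
          ≤ 4 * A * (‖(S.diff c₀ i).1 (r, x)‖ * Y) := fun i => by
        refine (norm_br_le _ _).trans ?_
        have a1 := norm_br_le ((S.diff c₀ i).1 (r, x)) (S.v.1 (r, x))
        have a2 := norm_le_normSum (S.diff c₀) i (r, x)
        rw [← hY] at a2
        have a3 := norm_nonneg ((S.diff c₀ i).1 (r, x))
        calc _ ≤ 2 * ‖(S.diff c₀ i).1 (r, x)‖ * (2 * Y * A) :=
              mul_le_mul_of_nonneg_left (a1.trans (mul_le_mul (by linarith) (hv _)
                (norm_nonneg _) (by linarith))) (by positivity)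
          _ = _ := by ring
      refine (sum_le_sum fun i _ => this i).trans (le_of_eq ?_)
      rw [← mul_sum, ← sum_mul, hY, normSum]
    rw [← hP] at hP0 ⊢
    rw [← hY] at hY0 ⊢
    have hZ0 := norm_nonneg ((S.divDiff c₀).1 (r, x))
    calc _ ≤ A * δ ^ 2 + 2 * A * ‖(S.divDiff c₀).1 (r, x)‖ + 4 * (Y * P) + 4 * A * (Y * Y) :=
          (norm_sub_le _ _).trans (add_le_add ((norm_sub_le _ _).trans
            (add_le_add ((norm_sub_le _ _).trans (add_le_add b1 b2)) b3)) b4)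
      _ ≤ _ := by
          have := mul_le_mul_of_nonneg_right hAA (sq_nonneg δ)
          have := mul_le_mul_of_nonneg_right (by nlinarith : 2 * A ≤ 10 * A ^ 2) hZ0
          have := mul_le_mul_of_nonneg_right (by nlinarith : 4 ≤ 10 * A ^ 2) (mul_nonneg hY0 hP0)
          have := mul_le_mul_of_nonneg_right (by nlinarith : 4 * A ≤ 10 * A ^ 2)
            (mul_nonneg hY0 hY0)
          have : 0 ≤ 10 * A ^ 2 * (δ * P + 2 * (δ * Y)) := by positivity
          linarith
  · rw [dr_diff]
    refine (S.norm_dr_c_le c₀ i (hv _)).trans ?_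
    have hP0 := gradSum_nonneg c₀ (fun _ : Unit => S.v) (r, x)
    have hY0 := normSum_nonneg (S.diff c₀) (r, x)
    have hδ0 : 0 < 1 / depth q ρ x := one_div_pos.2 (depth_pos hx)
    have e1 : 1 ≤ 10 * A ^ 2 := by nlinarith
    have e2 : 2 * A ≤ 10 * A ^ 2 := by nlinarith
    have := mul_le_mul_of_nonneg_right e1 hP0
    have := mul_le_mul_of_nonneg_right e2 hY0
    have : 0 ≤ 10 * A ^ 2 * (1 / depth q ρ x) := by positivity
    linarith
  · have hP0 := gradSum_nonneg c₀ (fun _ : Unit => S.v) (r, x)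
    have hY0 := normSum_nonneg (S.diff c₀) (r, x)
    obtain ⟨P, hP⟩ : ∃ P, P = gradSum c₀ (fun _ : Unit => S.v) (r, x) := ⟨_, rfl⟩
    obtain ⟨Y, hY⟩ : ∃ Y, Y = normSum (S.diff c₀) (r, x) := ⟨_, rfl⟩
    obtain ⟨δ, hδ⟩ : ∃ δ, δ = 1 / depth q ρ x := ⟨_, rfl⟩
    have hδ0 : 0 < δ := by rw [hδ]; exact one_div_pos.2 (depth_pos hx)
    rw [dr_divDiff, Sm.sub_apply, Sm.neg_apply, Sm.sum_apply]
    have b1 : ‖-(lb S.Y S.v).1 (r, x)‖ ≤ 2 * A ^ 2 * δ ^ 2 := by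
      rw [norm_neg]
      refine (norm_br_le _ _).trans ?_
      have a1 := (S.norm_Y_le r x).trans (hXd hx)
      rw [← hδ] at a1
      calc _ ≤ 2 * (A * δ ^ 2) * A := mul_le_mul (by linarith) (hv _) (norm_nonneg _)
            (by positivity)
        _ = _ := by ring
    have b2 : ‖∑ i, (lb (S.diff c₀ i) (Sm.dr (S.c i))).1 (r, x)‖ ≤ 2 * (Y * (P + 2 * A * Y)) := by
      refine (norm_sum_le _ _).trans ?_
      have : ∀ i, ‖(lb (S.diff c₀ i) (Sm.dr (S.c i))).1 (r, x)‖
          ≤ 2 * (‖(S.diff c₀ i).1 (r, x)‖ * (P + 2 * A * Y)) := fun i => by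
        refine (norm_br_le _ _).trans ?_
        have a1 := S.norm_dr_c_le c₀ i (hv (r, x))
        rw [← hP, ← hY] at a1
        rw [← mul_assoc]
        exact mul_le_mul_of_nonneg_left a1 (by positivity)
      refine (sum_le_sum fun i _ => this i).trans (le_of_eq ?_)
      rw [← mul_sum, ← sum_mul, hY, normSum]
    rw [← hP] at hP0 ⊢
    rw [← hY] at hY0 ⊢
    rw [← hδ]
    calc _ ≤ 2 * A ^ 2 * δ ^ 2 + 2 * (Y * (P + 2 * A * Y)) :=
          (norm_sub_le _ _).trans (add_le_add b1 b2)
      _ ≤ _ := by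
          have := mul_le_mul_of_nonneg_right (by nlinarith : 2 * A ^ 2 ≤ 10 * A ^ 2) (sq_nonneg δ)
          have := mul_le_mul_of_nonneg_right (by nlinarith : 2 ≤ 10 * A ^ 2) (mul_nonneg hY0 hP0)
          have := mul_le_mul_of_nonneg_right (by nlinarith : 4 * A ≤ 10 * A ^ 2)
            (mul_nonneg hY0 hY0)
          have : 0 ≤ 10 * A ^ 2 * (δ * P + 2 * (δ * Y)) := by positivity
          linarith
  · refine (hb i x hx).trans ?_
    have := depth_pos hx
    have := depth_le (q := q) (ρ := ρ) (x := x)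
    gcongr
  · refine ((hβ x hx).trans (hdinv hx)).trans ?_
    have := depth_pos hx
    gcongr

end FlowSystem

section LocalBounds

variable {R : ℝ}
variable {F : Type*} [NormedAddCommGroup F] [NormedSpace ℝ F]
variable {G : Type*} [NormedAddCommGroup G] [NormedSpace ℝ G]
variable {K : Type*} [NormedAddCommGroup K] [NormedSpace ℝ K]

/-- `f` is bounded by a multiple of `w`, locally in space and uniformly in the parameter. -/
def LocLe (w : ℝ × P3 → ℝ) (f : Sm (Cyl R) F) : Prop :=
  ∀ q ∈ Hsp, ∃ C, 0 ≤ C ∧ ∀ᶠ x in 𝓝 q, ∀ r, ‖f.1 (r, x)‖ ≤ C * w (r, x)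

/-- `f` is bounded, locally in space and uniformly in the parameter. -/
abbrev LocBdd (f : Sm (Cyl R) F) : Prop := LocLe (fun _ => 1) f

variable {w : ℝ × P3 → ℝ}

theorem LocLe.add {f g : Sm (Cyl R) F} (hf : LocLe w f) (hg : LocLe w g) : LocLe w (f + g) := by
  intro q hq
  obtain ⟨C, hC, h⟩ := hf q hq
  obtain ⟨C', hC', h'⟩ := hg q hq
  refine ⟨C + C', add_nonneg hC hC', ?_⟩
  filter_upwards [h, h'] with x hx hx' r
  rw [add_mul]
  exact (norm_add_le _ _).trans (add_le_add (hx r) (hx' r))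

theorem LocLe.smul (a : ℝ) {f : Sm (Cyl R) F} (hf : LocLe w f) : LocLe w (a • f) := by
  intro q hq
  obtain ⟨C, hC, h⟩ := hf q hq
  refine ⟨|a| * C, mul_nonneg (abs_nonneg _) hC, ?_⟩
  filter_upwards [h] with x hx r
  rw [Sm.smul_apply, norm_smul, norm_eq_abs, mul_assoc]
  exact mul_le_mul_of_nonneg_left (hx r) (abs_nonneg _)

theorem LocLe.neg {f : Sm (Cyl R) F} (hf : LocLe w f) : LocLe w (-f) := by
  have e : -f = (-1 : ℝ) • f := by module
  rw [e]
  exact hf.smul (-1)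

theorem LocLe.sub {f g : Sm (Cyl R) F} (hf : LocLe w f) (hg : LocLe w g) : LocLe w (f - g) := by
  rw [sub_eq_add_neg]
  exact hf.add hg.neg

theorem LocLe.zero : LocLe w (0 : Sm (Cyl R) F) :=
  fun _ _ => ⟨0, le_rfl, .of_forall fun x r => by simp⟩

theorem LocLe.sum {ι : Type*} (s : Finset ι) {f : ι → Sm (Cyl R) F} (h : ∀ i, LocLe w (f i)) :
    LocLe w (∑ i ∈ s, f i) := by
  classical
  induction s using Finset.induction_on with
  | empty => rw [Finset.sum_empty]; exact LocLe.zero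
  | insert a s ha ih => rw [Finset.sum_insert ha]; exact (h a).add ih

theorem LocLe.mono {w' : ℝ × P3 → ℝ} (hw : ∀ x, w x ≤ w' x) {f : Sm (Cyl R) F}
    (hf : LocLe w f) : LocLe w' f := by
  intro q hq
  obtain ⟨C, hC, h⟩ := hf q hq
  refine ⟨C, hC, ?_⟩
  filter_upwards [h] with x hx r
  exact (hx r).trans (mul_le_mul_of_nonneg_left (hw _) hC)

theorem LocLe.of_norm_le {f : Sm (Cyl R) F} (h : ∀ x, ‖f.1 x‖ ≤ w x) : LocLe w f :=
  fun _ _ => ⟨1, zero_le_one, .of_forall fun x r => by rw [one_mul]; exact h _⟩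

theorem LocLe.bil (B : F →L[ℝ] G →L[ℝ] K) {f : Sm (Cyl R) F} {g : Sm (Cyl R) G}
    (hf : LocBdd f) (hg : LocLe w g) : LocLe w (Sm.bil B f g) := by
  intro q hq
  obtain ⟨C, hC, h⟩ := hf q hq
  obtain ⟨C', hC', h'⟩ := hg q hq
  refine ⟨‖B‖ * C * C', by positivity, ?_⟩
  filter_upwards [h, h'] with x hx hx' r
  rw [Sm.bil_apply, mul_assoc _ C']
  refine (B.le_opNorm₂ _ _).trans ?_
  have := hx r
  rw [mul_one] at this
  exact mul_le_mul (mul_le_mul_of_nonneg_left this B.opNorm_nonneg) (hx' r) (norm_nonneg _)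
    (by positivity)

theorem LocLe.bil_right (B : F →L[ℝ] G →L[ℝ] K) {f : Sm (Cyl R) F} {g : Sm (Cyl R) G}
    (hf : LocLe w f) (hg : LocBdd g) : LocLe w (Sm.bil B f g) :=
  LocLe.bil B.flip hg hf

theorem LocLe.lb {f g : Sm (Cyl R) E3} (hf : LocBdd f) (hg : LocLe w g) : LocLe w (lb f g) :=
  LocLe.bil br hf hg

theorem LocLe.lb_right {f g : Sm (Cyl R) E3} (hf : LocLe w f) (hg : LocBdd g) :
    LocLe w (_root_.lb f g) :=
  LocLe.bil_right br hf hg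

theorem LocBdd.of_bound {f : Sm (Cyl R) F} {C : ℝ} (h : ∀ x, ‖f.1 x‖ ≤ C) : LocBdd f :=
  fun _ _ => ⟨C, (norm_nonneg _).trans (h 0), .of_forall fun x r => by rw [mul_one]; exact h _⟩

theorem Sm.eventually_norm_le (f : Sm Hsp F) {q : P3} (hq : q ∈ Hsp) :
    ∀ᶠ x in 𝓝 q, ‖f.1 x‖ ≤ ‖f.1 q‖ + 1 := by
  have h := ((Sm.continuousOn f).continuousAt (isOpen_Hsp.mem_nhds hq)).norm
  filter_upwards [h.eventually (eventually_lt_nhds (lt_add_one _))] with x hx using hx.le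

theorem LocBdd.cst (f : Sm Hsp F) : LocBdd (Sm.cst R f) := by
  intro q hq
  refine ⟨‖f.1 q‖ + 1, by positivity, ?_⟩
  filter_upwards [Sm.eventually_norm_le f hq] with x hx r
  rw [mul_one]
  by_cases hr : r ∈ Ico 0 R
  · rwa [Sm.cst_apply f hr]
  · rw [(Sm.cst R f).2.2 _ fun h => hr h.1, norm_zero]; positivity

theorem Sm.cst_zero : Sm.cst R (0 : Sm Hsp F) = 0 :=
  Sm.ext_slice fun r hr => by rw [Sm.slice_cst hr, map_zero]

theorem covD_cst_zero (i : Fin 6) (f : Sm (Cyl R) E3) :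
    covD cdir (fun j => Sm.cst R ((0 : Fin 6 → Sm Hsp E3) j)) i f = Sm.d (cdir i) f := by
  rw [covD_eq, Pi.zero_apply, Sm.cst_zero, map_zero, LinearMap.zero_apply, add_zero]

/-- The flat Laplacian on the slices of the cylinder. -/
def lap (f : Sm (Cyl R) E3) : Sm (Cyl R) E3 := ∑ i, Sm.d (cdir i) (Sm.d (cdir i) f)

theorem covL_cst_zero (f : Sm (Cyl R) E3) :
    covL cdir (fun j => Sm.cst R ((0 : Fin 6 → Sm Hsp E3) j)) f = lap f := by
  rw [covL_eq, lap]
  exact sum_congr rfl fun i _ => by rw [covD_cst_zero, covD_cst_zero]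

theorem norm_d_le_gradSum {α : Type*} [Fintype α] (f : α → Sm (Cyl R) E3) (a : α) (i : Fin 6)
    (x : ℝ × P3) : ‖(Sm.d (cdir i) (f a)).1 x‖ ≤ gradSum 0 f x := by
  have := norm_le_gradSum 0 f a i x
  rwa [covD_cst_zero] at this

theorem curv_zero (i j : Fin 6) : curv dir (0 : Fin 6 → Sm Hsp E3) i j = 0 := by
  simp [curv]

theorem exists_ball_of_eventually {q : P3} (hq : q ∈ Hsp) {P : P3 → Prop}
    (h : ∀ᶠ x in 𝓝 q, P x) :
    ∃ ρ, 0 < ρ ∧ ρ ≤ 1 ∧ closedBall q ρ ⊆ Hsp ∧ ∀ x ∈ ball q ρ, P x := by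
  obtain ⟨ε, hε, h1⟩ := Metric.eventually_nhds_iff_ball.1 (h.and (isOpen_Hsp.mem_nhds hq))
  refine ⟨min (ε / 2) 1, by positivity, min_le_right _ _, fun x hx => (h1 x ?_).2,
    fun x hx => (h1 x ?_).1⟩
  · exact Metric.closedBall_subset_ball ((min_le_left _ _).trans_lt (half_lt_self hε)) hx
  · exact Metric.ball_subset_ball ((min_le_left _ _).trans (half_le_self hε.le)) hx

theorem AbsorbSystem.locBdd_at {α β : Type*} [Fintype α] [Fintype β] {f : α → Sm (Cyl R) E3}
    {y : β → Sm (Cyl R) E3} {z : Sm (Cyl R) E3} {q : P3} {ρ A : ℝ} (hA : 1 ≤ A)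
    (h : AbsorbSystem 0 f y z q ρ A) :
    ∃ C, 0 ≤ C ∧ ∀ᶠ x in 𝓝 q, ∀ r, (∀ a i, ‖(Sm.d (cdir i) (f a)).1 (r, x)‖ ≤ C * 1)
      ∧ (∀ b, ‖(y b).1 (r, x)‖ ≤ C * 1) ∧ ‖z.1 (r, x)‖ ≤ C * 1 := by
  obtain ⟨C, hC, hb⟩ := AbsorbSystem.exists_bound α β A hA
  have hρ := h.pos
  refine ⟨2 * C / ρ + 4 * C / ρ ^ 2, by positivity, ?_⟩
  filter_upwards [Metric.ball_mem_nhds q (half_pos hρ)] with x hx r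
  by_cases hr : r ∈ Ico 0 R
  · have hx' : x ∈ ball q ρ := Metric.ball_subset_ball (half_le_self hρ.le) hx
    obtain ⟨h1, h2, h3⟩ := hb 0 f y z q ρ h r hr x hx'
    have hd : ρ / 2 ≤ depth q ρ x := by
      rw [mem_ball_iff_norm] at hx
      unfold depth
      linarith
    have e1 : 0 ≤ 2 * C / ρ := by positivity
    have e2 : 0 ≤ 4 * C / ρ ^ 2 := by positivity
    have key : ∀ s, 0 ≤ s → depth q ρ x * s ≤ C → s ≤ 2 * C / ρ := fun s hs hsC => by
      rw [le_div_iff₀ hρ]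
      have := mul_le_mul_of_nonneg_right hd hs
      linarith
    rw [mul_one]
    refine ⟨fun a i => ?_, fun b => ?_, ?_⟩
    · exact (norm_d_le_gradSum f a i _).trans
        ((key _ (gradSum_nonneg _ _ _) h1).trans (le_add_of_nonneg_right e2))
    · exact (norm_le_normSum y b _).trans
        ((key _ (normSum_nonneg _ _) h2).trans (le_add_of_nonneg_right e2))
    · refine le_trans ?_ (le_add_of_nonneg_left e1)
      rw [le_div_iff₀ (pow_pos hρ 2)]
      have := mul_le_mul_of_nonneg_right (pow_le_pow_left₀ (half_pos hρ).le hd 2)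
        (norm_nonneg (z.1 (r, x)))
      linarith
  · have h0 : ∀ g : Sm (Cyl R) E3, ‖g.1 (r, x)‖ = 0 := fun g => by
      rw [g.2.2 _ fun h => hr h.1, norm_zero]
    have : 0 ≤ (2 * C / ρ + 4 * C / ρ ^ 2) * 1 := by positivity
    exact ⟨fun _ _ => by rwa [h0], fun _ => by rwa [h0], by rwa [h0]⟩

/-- Interior estimate for systems with locally bounded coefficients, linear in the highest
derivatives. -/
theorem locBdd_of_locLe (hR : R ≤ 1) {α β : Type*} [Fintype α] [Fintype β]
    {f : α → Sm (Cyl R) E3} {y : β → Sm (Cyl R) E3} (hf : ∀ a, LocBdd (f a))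
    (hlap : ∀ a, LocLe (fun x => 1 + gradSum 0 f x + normSum y x) (lap (f a)))
    (hy : ∀ b, LocLe (fun x => 1 + gradSum 0 f x + normSum y x) (Sm.dr (y b))) :
    (∀ a i, LocBdd (Sm.d (cdir i) (f a))) ∧ ∀ b, LocBdd (y b) := by
  have key : ∀ q ∈ Hsp, ∃ C, 0 ≤ C ∧ ∀ᶠ x in 𝓝 q, ∀ r,
      (∀ a i, ‖(Sm.d (cdir i) (f a)).1 (r, x)‖ ≤ C * 1) ∧ (∀ b, ‖(y b).1 (r, x)‖ ≤ C * 1)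
        ∧ ‖(0 : Sm (Cyl R) E3).1 (r, x)‖ ≤ C * 1 := by
    intro q hq
    choose C₁ hC₁ h₁ using fun a => hf a q hq
    choose C₂ hC₂ h₂ using fun a => hlap a q hq
    choose C₃ hC₃ h₃ using fun b => hy b q hq
    have h₄ := fun b => Sm.eventually_norm_le (Sm.slice 0 (y b)) hq
    obtain ⟨A, hA⟩ : ∃ A, A = 1 + ∑ a, C₁ a + ∑ a, C₂ a + ∑ b, C₃ b
        + ∑ b, (‖(Sm.slice 0 (y b)).1 q‖ + 1) := ⟨_, rfl⟩
    have s₁ : 0 ≤ ∑ a, C₁ a := sum_nonneg fun a _ => hC₁ a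
    have s₂ : 0 ≤ ∑ a, C₂ a := sum_nonneg fun a _ => hC₂ a
    have s₃ : 0 ≤ ∑ b, C₃ b := sum_nonneg fun b _ => hC₃ b
    have s₄ : 0 ≤ ∑ b, (‖(Sm.slice 0 (y b)).1 q‖ + 1) :=
      sum_nonneg fun b _ => add_nonneg (norm_nonneg _) zero_le_one
    have a₁ : ∀ a, C₁ a ≤ A := fun a => by
      have := single_le_sum (fun a _ => hC₁ a) (Finset.mem_univ a)
      linarith
    have a₂ : ∀ a, C₂ a ≤ A := fun a => by
      have := single_le_sum (fun a _ => hC₂ a) (Finset.mem_univ a)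
      linarith
    have a₃ : ∀ b, C₃ b ≤ A := fun b => by
      have := single_le_sum (fun b _ => hC₃ b) (Finset.mem_univ b)
      linarith
    have a₄ : ∀ b, ‖(Sm.slice 0 (y b)).1 q‖ + 1 ≤ A := fun b => by
      have := single_le_sum (f := fun b => ‖(Sm.slice 0 (y b)).1 q‖ + 1)
        (fun b _ => add_nonneg (norm_nonneg _) zero_le_one) (Finset.mem_univ b)
      linarith
    have hA1 : 1 ≤ A := by linarith
    have hA0 : 0 ≤ A := by linarith
    obtain ⟨ρ, hρ, hρ1, hsub, hall⟩ := exists_ball_of_eventually hq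
      ((((eventually_all.2 h₁).and (eventually_all.2 h₂)).and (eventually_all.2 h₃)).and
        (eventually_all.2 h₄))
    have hone : ∀ {x}, x ∈ ball q ρ → 1 ≤ 1 / depth q ρ x := fun hx => by
      rw [le_div_iff₀ (depth_pos hx), one_mul]
      exact depth_le.trans hρ1
    refine AbsorbSystem.locBdd_at hA1 (q := q) (ρ := ρ) ⟨hρ, hR, hsub, ?_, ?_, ?_, ?_, ?_, ?_, ?_⟩
    · intro x _ i j
      rw [curv_zero, Sm.zero_apply, norm_zero]
      positivity
    · intro a r _ x hx
      have := (hall x hx).1.1.1 a r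
      rw [mul_one] at this
      exact this.trans (a₁ a)
    · intro a r _ x hx
      rw [covL_cst_zero, Sm.zero_apply, norm_zero, add_zero]
      refine ((hall x hx).1.1.2 a r).trans ?_
      have hP := gradSum_nonneg 0 f (r, x)
      have hY := normSum_nonneg y (r, x)
      have h1 := hone hx
      refine mul_le_mul (a₂ a) ?_ (by linarith) hA0
      nlinarith
    · intro b r _ x hx
      refine ((hall x hx).1.2 b r).trans ?_
      have hP := gradSum_nonneg 0 f (r, x)
      have hY := normSum_nonneg y (r, x)
      have h1 := hone hx
      exact mul_le_mul (a₃ b) (by linarith) (by linarith) hA0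
    · intro r _ x hx
      rw [map_zero, Sm.zero_apply, norm_zero]
      have hP := gradSum_nonneg 0 f (r, x)
      have hY := normSum_nonneg y (r, x)
      have h1 := hone hx
      have : 0 ≤ 1 / depth q ρ x := by linarith
      positivity
    · intro b x hx
      refine ((hall x hx).2 b).trans ((a₄ b).trans ?_)
      rw [div_eq_mul_one_div]
      exact le_mul_of_one_le_right hA0 (hone hx)
    · intro x hx
      rw [Sm.zero_apply, norm_zero]
      have := depth_pos hx
      positivity
  refine ⟨fun a i q hq => ?_, fun b q hq => ?_⟩
  · obtain ⟨C, hC, h⟩ := key q hq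
    exact ⟨C, hC, h.mono fun x hx r => (hx r).1 a i⟩
  · obtain ⟨C, hC, h⟩ := key q hq
    exact ⟨C, hC, h.mono fun x hx r => (hx r).2.1 b⟩

variable {ι : Type*}

/-- All derivatives of order at most `n` in the directions `e` are locally bounded. -/
def LocBddN (e : ι → ℝ × P3) : ℕ → Sm (Cyl R) F → Prop
  | 0, f => LocBdd f
  | n + 1, f => LocBdd f ∧ ∀ i, LocBddN e n (Sm.d (e i) f)

variable {e : ι → ℝ × P3} {n : ℕ}

theorem LocBddN.locBdd {f : Sm (Cyl R) F} (h : LocBddN e n f) : LocBdd f := by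
  cases n with
  | zero => exact h
  | succ n => exact h.1

theorem LocBddN.of_succ {f : Sm (Cyl R) F} (h : LocBddN e (n + 1) f) : LocBddN e n f := by
  induction n generalizing f with
  | zero => exact h.1
  | succ n ih => exact ⟨h.1, fun i => ih (h.2 i)⟩

theorem LocBddN.add {f g : Sm (Cyl R) F} (hf : LocBddN e n f) (hg : LocBddN e n g) :
    LocBddN e n (f + g) := by
  induction n generalizing f g with
  | zero => exact hf.locBdd.add hg.locBdd
  | succ n ih =>
    refine ⟨hf.1.add hg.1, fun i => ?_⟩
    rw [map_add]
    exact ih (hf.2 i) (hg.2 i)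

theorem LocBddN.bil (B : F →L[ℝ] G →L[ℝ] K) {f : Sm (Cyl R) F} {g : Sm (Cyl R) G}
    (hf : LocBddN e n f) (hg : LocBddN e n g) : LocBddN e n (Sm.bil B f g) := by
  induction n generalizing f g with
  | zero => exact LocLe.bil B hf.locBdd hg.locBdd
  | succ n ih =>
    refine ⟨LocLe.bil B hf.1 hg.1, fun i => ?_⟩
    rw [Sm.d_bil]
    exact (ih (hf.2 i) hg.of_succ).add (ih hf.of_succ (hg.2 i))

variable {α β : Type*}

/-- Polynomials in `f`, its first spatial derivatives and `y`, with parameter-independent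
coefficients. -/
inductive Pol (f : α → Sm (Cyl R) E3) (y : β → Sm (Cyl R) E3) : Sm (Cyl R) E3 → Prop
  | cst (g : Sm Hsp E3) : Pol f y (Sm.cst R g)
  | base (a : α) : Pol f y (f a)
  | grad (a : α) (i : Fin 6) : Pol f y (Sm.d (cdir i) (f a))
  | aux (b : β) : Pol f y (y b)
  | lb {g h : Sm (Cyl R) E3} (hg : Pol f y g) (hh : Pol f y h) : Pol f y (lb g h)
  | add {g h : Sm (Cyl R) E3} (hg : Pol f y g) (hh : Pol f y h) : Pol f y (g + h)
  | smul (a : ℝ) {g : Sm (Cyl R) E3} (hg : Pol f y g) : Pol f y (a • g)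

/-- A family together with its spatial derivatives. -/
def prolong (f : α → Sm (Cyl R) E3) (k : Option (Fin 6) × α) : Sm (Cyl R) E3 :=
  k.1.elim (f k.2) fun i => Sm.d (cdir i) (f k.2)

variable {f : α → Sm (Cyl R) E3} {y : β → Sm (Cyl R) E3} {g h : Sm (Cyl R) E3}

theorem Pol.neg (hg : Pol f y g) : Pol f y (-g) := by
  have e : -g = (-1 : ℝ) • g := by module
  rw [e]
  exact hg.smul (-1)

theorem Pol.sub (hg : Pol f y g) (hh : Pol f y h) : Pol f y (g - h) := by
  rw [sub_eq_add_neg]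
  exact hg.add hh.neg

theorem Pol.sum {g : Fin 6 → Sm (Cyl R) E3} (hg : ∀ i, Pol f y (g i)) : Pol f y (∑ i, g i) := by
  rw [Fin.sum_univ_six]
  exact (((((hg 0).add (hg 1)).add (hg 2)).add (hg 3)).add (hg 4)).add (hg 5)

theorem Pol.prolong (hg : Pol f y g) : Pol (prolong f) (prolong y) g := by
  induction hg with
  | cst g => exact .cst g
  | base a => exact .base (f := _root_.prolong f) (none, a)
  | grad a i => exact .base (f := _root_.prolong f) (some i, a)
  | aux b => exact .aux (y := _root_.prolong y) (none, b)
  | lb _ _ h h' => exact h.lb h'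
  | add _ _ h h' => exact h.add h'
  | smul a _ h => exact h.smul a

theorem Pol.d (hg : Pol f y g) (j : Fin 6) :
    Pol (_root_.prolong f) (_root_.prolong y) (Sm.d (cdir j) g) := by
  induction hg with
  | cst g => rw [cdir, Sm.d_cst]; exact .cst _
  | base a => exact .base (f := _root_.prolong f) (some j, a)
  | grad a i => exact .grad (f := _root_.prolong f) (some i, a) j
  | aux b => exact .aux (y := _root_.prolong y) (some j, b)
  | lb hg hh h h' => rw [d_lb]; exact (h.lb hh.prolong).add (hg.prolong.lb h')
  | add _ _ h h' => rw [map_add]; exact h.add h'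
  | smul a _ h => rw [map_smul]; exact h.smul a

/-- An elliptic-evolution system with polynomial structure and locally bounded unknowns. -/
structure PolSystem (f : α → Sm (Cyl R) E3) (y : β → Sm (Cyl R) E3) : Prop where
  lap_f : ∀ a, Pol f y (lap (f a))
  dr_y : ∀ b, Pol f y (Sm.dr (y b))
  locBdd_f : ∀ a, LocBdd (f a)
  locBdd_df : ∀ a i, LocBdd (Sm.d (cdir i) (f a))
  locBdd_y : ∀ b, LocBdd (y b)

theorem Pol.locBdd (hs : PolSystem f y) (hg : Pol f y g) : LocBdd g := by
  induction hg with
  | cst g => exact .cst g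
  | base a => exact hs.locBdd_f a
  | grad a i => exact hs.locBdd_df a i
  | aux b => exact hs.locBdd_y b
  | lb _ _ h h' => exact LocLe.lb h h'
  | add _ _ h h' => exact h.add h'
  | smul a _ h => exact h.smul a

theorem Pol.locLe_d (hs : PolSystem f y) (hg : Pol f y g) (j : Fin 6) {w : ℝ × P3 → ℝ}
    (hw1 : ∀ x, 1 ≤ w x)
    (hwf : ∀ i j a, LocLe w (Sm.d (cdir j) (Sm.d (cdir i) (f a))))
    (hwy : ∀ j b, LocLe w (Sm.d (cdir j) (y b))) : LocLe w (Sm.d (cdir j) g) := by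
  induction hg with
  | cst g =>
    rw [cdir, Sm.d_cst]
    exact LocLe.mono hw1 (LocBdd.cst _)
  | base a => exact (hs.locBdd_df a j).mono hw1
  | grad a i => exact hwf i j a
  | aux b => exact hwy j b
  | lb hg hh h h' =>
    rw [d_lb]
    exact (h.lb_right (hh.locBdd hs)).add (LocLe.lb (hg.locBdd hs) h')
  | add _ _ h h' => rw [map_add]; exact h.add h'
  | smul a _ h => rw [map_smul]; exact h.smul a

theorem d_lap (j : Fin 6) (f : Sm (Cyl R) E3) :
    Sm.d (cdir j) (lap f) = lap (Sm.d (cdir j) f) := by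
  rw [lap, lap, map_sum]
  refine sum_congr rfl fun i _ => ?_
  rw [Sm.d_comm (cdir j) (cdir i), Sm.d_comm (cdir j) (cdir i)]

variable [Fintype α] [Fintype β]

theorem PolSystem.prolong (hR : R ≤ 1) (hs : PolSystem f y) :
    PolSystem (prolong f) (prolong y) := by
  obtain ⟨w, hw⟩ : ∃ w : ℝ × P3 → ℝ, w = fun x =>
    1 + gradSum 0 (fun k : Fin 6 × α => Sm.d (cdir k.1) (f k.2)) x
      + normSum (fun k : Fin 6 × β => Sm.d (cdir k.1) (y k.2)) x := ⟨_, rfl⟩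
  have hP := fun x => gradSum_nonneg 0 (fun k : Fin 6 × α => Sm.d (cdir k.1) (f k.2)) x
  have hY := fun x => normSum_nonneg (fun k : Fin 6 × β => Sm.d (cdir k.1) (y k.2)) x
  have hw1 : ∀ x, 1 ≤ w x := fun x => by rw [hw]; dsimp only; linarith [hP x, hY x]
  have hwf : ∀ i j a, LocLe w (Sm.d (cdir j) (Sm.d (cdir i) (f a))) := fun i j a => by
    refine LocLe.of_norm_le fun x => ?_
    have := norm_d_le_gradSum (fun k : Fin 6 × α => Sm.d (cdir k.1) (f k.2)) (i, a) j x
    dsimp only at this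
    rw [hw]; dsimp only; linarith [hY x]
  have hwy : ∀ j b, LocLe w (Sm.d (cdir j) (y b)) := fun j b => by
    refine LocLe.of_norm_le fun x => ?_
    have := norm_le_normSum (fun k : Fin 6 × β => Sm.d (cdir k.1) (y k.2)) (j, b) x
    dsimp only at this
    rw [hw]; dsimp only; linarith [hP x]
  have key := locBdd_of_locLe hR (f := fun k : Fin 6 × α => Sm.d (cdir k.1) (f k.2))
    (y := fun k : Fin 6 × β => Sm.d (cdir k.1) (y k.2)) (fun k => hs.locBdd_df k.2 k.1)
    (fun k => by
      rw [← hw, ← d_lap]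
      exact (hs.lap_f k.2).locLe_d hs k.1 hw1 hwf hwy)
    (fun k => by
      rw [← hw, Sm.d_comm]
      exact (hs.dr_y k.2).locLe_d hs k.1 hw1 hwf hwy)
  refine ⟨?_, ?_, ?_, ?_, ?_⟩
  · rintro ⟨_ | j, a⟩
    · exact (hs.lap_f a).prolong
    · change Pol _ _ (lap (Sm.d (cdir j) (f a)))
      rw [← d_lap]
      exact (hs.lap_f a).d j
  · rintro ⟨_ | j, b⟩
    · exact (hs.dr_y b).prolong
    · change Pol _ _ (Sm.dr (Sm.d (cdir j) (y b)))
      rw [Sm.d_comm]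
      exact (hs.dr_y b).d j
  · rintro ⟨_ | j, a⟩
    · exact hs.locBdd_f a
    · exact hs.locBdd_df a j
  · rintro ⟨_ | j, a⟩ i
    · exact hs.locBdd_df a i
    · exact key.1 (j, a) i
  · rintro ⟨_ | j, b⟩
    · exact hs.locBdd_y b
    · exact key.2 (j, b)

theorem PolSystem.locBddN (hR : R ≤ 1) (hs : PolSystem f y) (n : ℕ) :
    (∀ a, LocBddN cdir n (f a)) ∧ ∀ b, LocBddN cdir n (y b) := by
  induction n generalizing α β with
  | zero => exact ⟨hs.locBdd_f, hs.locBdd_y⟩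
  | succ n ih =>
    have := ih (hs.prolong hR)
    exact ⟨fun a => ⟨hs.locBdd_f a, fun i => this.1 (some i, a)⟩,
      fun b => ⟨hs.locBdd_y b, fun i => this.2 (some i, b)⟩⟩

end LocalBounds

namespace FlowSystem

variable {R : ℝ} (S : FlowSystem R)

theorem diff_zero (i : Fin 6) : S.diff 0 i = S.c i := by
  rw [diff, Pi.zero_apply, Sm.cst_zero, sub_zero]

theorem locBdd_vd (k : ℕ) : LocBdd (S.vd k) := by
  obtain ⟨C, _, hC, _⟩ := S.controlled k
  exact LocBdd.of_bound hC

theorem lap_vd (k : ℕ) : lap (S.vd k) = covL cdir S.c (S.vd k) - lb (S.divDiff 0) (S.vd k)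
    - (2 : ℝ) • (∑ i, lb (S.c i) (Sm.d (cdir i) (S.vd k)))
    - ∑ i, lb (S.c i) (lb (S.c i) (S.vd k)) := by
  rw [S.covL_eq_background 0, covL_cst_zero]
  simp only [covD_cst_zero, diff_zero]
  abel

theorem locBdd_initial : (∀ i, LocBdd (Sm.d (cdir i) S.v)) ∧ (∀ i, LocBdd (S.c i))
    ∧ LocBdd (S.divDiff 0) := by
  have key : ∀ q ∈ Hsp, ∃ C, 0 ≤ C ∧ ∀ᶠ x in 𝓝 q, ∀ r,
      (∀ (_ : Unit) (i : Fin 6), ‖(Sm.d (cdir i) S.v).1 (r, x)‖ ≤ C * 1)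
        ∧ (∀ i, ‖(S.diff 0 i).1 (r, x)‖ ≤ C * 1) ∧ ‖(S.divDiff 0).1 (r, x)‖ ≤ C * 1 := by
    intro q hq
    obtain ⟨C, hC0, hC, _⟩ := S.controlled 0
    have h₁ := Sm.eventually_norm_le S.X hq
    have h₂ := fun i => Sm.eventually_norm_le (Sm.slice 0 (S.diff 0 i)) hq
    have h₃ := Sm.eventually_norm_le (Sm.slice 0 (S.divDiff 0)) hq
    obtain ⟨A, hA⟩ : ∃ A, A = 1 + C + (‖S.X.1 q‖ + 1)
        + ∑ i, (‖(Sm.slice 0 (S.diff 0 i)).1 q‖ + 1)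
        + (‖(Sm.slice 0 (S.divDiff 0)).1 q‖ + 1) := ⟨_, rfl⟩
    have s₁ : 0 ≤ ‖S.X.1 q‖ := norm_nonneg _
    have s₂ : 0 ≤ ∑ i, (‖(Sm.slice 0 (S.diff 0 i)).1 q‖ + 1) :=
      sum_nonneg fun b _ => add_nonneg (norm_nonneg _) zero_le_one
    have s₃ : 0 ≤ ‖(Sm.slice 0 (S.divDiff 0)).1 q‖ := norm_nonneg _
    have a₂ : ∀ i, ‖(Sm.slice 0 (S.diff 0 i)).1 q‖ + 1 ≤ A := fun b => by
      have := single_le_sum (f := fun b => ‖(Sm.slice 0 (S.diff 0 b)).1 q‖ + 1)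
        (fun b _ => add_nonneg (norm_nonneg _) zero_le_one) (Finset.mem_univ b)
      linarith
    have hA1 : 1 ≤ A := by linarith
    have hA0 : 0 ≤ A := by linarith
    obtain ⟨ρ, hρ, hρ1, hsub, hall⟩ := exists_ball_of_eventually hq
      ((h₁.and (eventually_all.2 h₂)).and h₃)
    have e1 : A ≤ A / ρ := (le_div_iff₀ hρ).2 (mul_le_of_le_one_right hA0 hρ1)
    have e2 : A ≤ A / ρ ^ 2 :=
      (le_div_iff₀ (pow_pos hρ 2)).2 (mul_le_of_le_one_right hA0 (pow_le_one₀ hρ.le hρ1))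
    have hs := S.absorbSystem 0 hA1 hρ hsub
      (fun x _ i j => by rw [curv_zero, Sm.zero_apply, norm_zero]; positivity)
      (fun x => (hC x).trans (by linarith))
      (fun x hx => ((hall x hx).1.1.trans (by linarith)).trans e2)
      (fun i x hx => (((hall x hx).1.2 i).trans (a₂ i)).trans e1)
      (fun x hx => ((hall x hx).2.trans (by linarith)).trans e2)
    exact AbsorbSystem.locBdd_at (by nlinarith) hs
  refine ⟨fun i q hq => ?_, fun i q hq => ?_, fun q hq => ?_⟩
  · obtain ⟨C, hC, h⟩ := key q hq
    exact ⟨C, hC, h.mono fun x hx r => (hx r).1 () i⟩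
  · obtain ⟨C, hC, h⟩ := key q hq
    refine ⟨C, hC, h.mono fun x hx r => ?_⟩
    have := (hx r).2.1 i
    rwa [diff_zero] at this
  · obtain ⟨C, hC, h⟩ := key q hq
    exact ⟨C, hC, h.mono fun x hx r => (hx r).2.2⟩

theorem locBdd_Y : LocBdd S.Y := by
  intro q hq
  refine ⟨‖S.X.1 q‖ + 1, by positivity, ?_⟩
  filter_upwards [Sm.eventually_norm_le S.X hq] with x hx r
  rw [mul_one]
  exact (S.norm_Y_le r x).trans hx

variable {S}

theorem Term.locBdd {d k : ℕ} {f : Sm (Cyl R) E3} (h : S.Term d k f)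
    (hb : ∀ j < k, ∀ i, LocBdd (Sm.d (cdir i) (S.vd j))) : LocBdd f := by
  induction h with
  | @vd _ j _ => exact S.locBdd_vd j
  | @grad _ j h i =>
    rw [covD_eq]
    exact (hb j h i).add (LocLe.lb (S.locBdd_initial.2.1 i) (S.locBdd_vd j))
  | X => exact .cst _
  | Y => exact S.locBdd_Y
  | lb _ _ h h' => exact LocLe.lb (h hb) (h' hb)
  | add _ _ h h' => exact (h hb).add (h' hb)
  | smul a _ h => exact (h hb).smul a

variable (S)

theorem locBdd_d_vd (k : ℕ) (i : Fin 6) : LocBdd (Sm.d (cdir i) (S.vd k)) := by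
  induction k using Nat.strong_induction_on generalizing i with
  | _ k ih =>
    have hc := S.locBdd_initial.2.1
    refine (locBdd_of_locLe S.le_one (f := fun _ : Unit => S.vd k)
      (y := (Empty.elim : Empty → Sm (Cyl R) E3)) (fun _ => S.locBdd_vd k) (fun _ => ?_)
      (fun b => b.elim)).1 () i
    obtain ⟨w, hw⟩ : ∃ w : ℝ × P3 → ℝ, w = fun x => 1 + gradSum 0 (fun _ : Unit => S.vd k) x
      + normSum (Empty.elim : Empty → Sm (Cyl R) E3) x := ⟨_, rfl⟩
    rw [← hw, lap_vd]
    have hP := fun x => gradSum_nonneg 0 (fun _ : Unit => S.vd k) x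
    have hY := fun x => normSum_nonneg (Empty.elim : Empty → Sm (Cyl R) E3) x
    have hw1 : ∀ x, 1 ≤ w x := fun x => by rw [hw]; dsimp only; linarith [hP x, hY x]
    refine (((((Term.covL_vd k).locBdd fun j hj i => ih j hj i).mono hw1).sub
      ((LocLe.lb S.locBdd_initial.2.2 (S.locBdd_vd k)).mono hw1)).sub
      (LocLe.smul 2 (LocLe.sum _ fun i => LocLe.lb (hc i) ?_))).sub
      ((LocLe.sum _ fun i => LocLe.lb (hc i) (LocLe.lb (hc i) (S.locBdd_vd k))).mono hw1)
    refine LocLe.of_norm_le fun x => ?_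
    have := norm_d_le_gradSum (fun _ : Unit => S.vd k) () i x
    rw [hw]; dsimp only; linarith [hY x]

/-- The evolving quantities: the coefficients, their divergence, and the defect. -/
def aux : Option (Option (Fin 6)) → Sm (Cyl R) E3
  | none => S.Y
  | some none => S.divDiff 0
  | some (some i) => S.c i

variable {S}

theorem Term.pol {d k m : ℕ} {f : Sm (Cyl R) E3} (h : S.Term d k f) (hm : k ≤ m) :
    Pol (fun j : Fin m => S.vd j) S.aux f := by
  induction h with
  | @vd _ j h => exact Pol.base (f := fun j : Fin m => S.vd j) ⟨j, by omega⟩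
  | @grad _ j h i =>
    rw [covD_eq]
    exact (Pol.grad (f := fun j : Fin m => S.vd j) ⟨j, by omega⟩ i).add
      ((Pol.aux (y := S.aux) (some (some i))).lb
        (Pol.base (f := fun j : Fin m => S.vd j) ⟨j, by omega⟩))
  | X => exact .cst _
  | Y => exact Pol.aux (y := S.aux) none
  | lb _ _ h h' => exact (h hm).lb (h' hm)
  | add _ _ h h' => exact (h hm).add (h' hm)
  | smul a _ h => exact (h hm).smul a

variable (S)

theorem polSystem (m : ℕ) (hm : 0 < m) : PolSystem (fun j : Fin m => S.vd j) S.aux := by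
  have hc : ∀ i, Pol (fun j : Fin m => S.vd j) S.aux (S.c i) :=
    fun i => Pol.aux (y := S.aux) (some (some i))
  refine ⟨fun j => ?_, ?_, fun j => S.locBdd_vd j, fun j i => S.locBdd_d_vd j i, ?_⟩
  · have hj := Pol.base (f := fun j : Fin m => S.vd j) (y := S.aux) j
    rw [lap_vd]
    exact ((((Term.covL_vd (j : ℕ)).pol j.2.le).sub
      ((Pol.aux (y := S.aux) (some none)).lb hj)).sub
      (Pol.smul 2 (Pol.sum fun i => (hc i).lb
        (Pol.grad (f := fun j : Fin m => S.vd j) j i)))).sub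
      (Pol.sum fun i => (hc i).lb ((hc i).lb hj))
  · rintro (_ | _ | i)
    · change Pol _ _ (Sm.dr S.Y)
      rw [S.dr_Y]
      exact (Pol.cst _).neg
    · change Pol _ _ (Sm.dr (S.divDiff 0))
      rw [dr_divDiff]
      refine Pol.sub (Pol.neg ((Pol.aux (y := S.aux) none).lb
        (Pol.base (f := fun j : Fin m => S.vd j) ⟨0, hm⟩))) (Pol.sum fun i => ?_)
      rw [diff_zero]
      exact (hc i).lb ((Term.dr_c hm i).pol le_rfl)
    · exact (Term.dr_c hm i).pol le_rfl
  · rintro (_ | _ | i)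
    · exact S.locBdd_Y
    · exact S.locBdd_initial.2.2
    · exact S.locBdd_initial.2.1 i

theorem locBddN_vd (n k : ℕ) : LocBddN cdir n (S.vd k) :=
  ((S.polSystem (k + 1) k.succ_pos).locBddN S.le_one n).1 ⟨k, k.lt_succ_self⟩

end FlowSystem

section Transport

variable {R : ℝ}
variable {F : Type*} [NormedAddCommGroup F] [NormedSpace ℝ F]
variable {G : Type*} [NormedAddCommGroup G] [NormedSpace ℝ G]
variable {K : Type*} [NormedAddCommGroup K] [NormedSpace ℝ K]

theorem Sm.norm_le_gronwallBound (f : Sm (Cyl R) F) {σ δ k ε : ℝ} (hσ : σ ∈ Ico 0 R) (p : P3)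
    (h0 : ‖f.1 (0, p)‖ ≤ δ)
    (hb : ∀ τ ∈ Ico 0 σ, ‖(Sm.dr f).1 (τ, p)‖ ≤ k * ‖f.1 (τ, p)‖ + ε) :
    ‖f.1 (σ, p)‖ ≤ gronwallBound δ k ε σ := by
  have h := norm_le_gronwallBound_of_norm_deriv_right_le (f := fun τ => f.1 (τ, p))
    (f' := fun τ => (Sm.dr f).1 (τ, p)) (a := 0) (b := σ) (δ := δ) (K := k) (ε := ε)
    ((Sm.continuousOn_param f p).mono fun τ hτ => ⟨hτ.1, hτ.2.trans_lt hσ.2⟩)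
    (fun τ hτ => Sm.hasDerivWithinAt_dr_Ici f ⟨hτ.1, hτ.2.trans hσ.2⟩ p) h0 hb σ ⟨hσ.1, le_rfl⟩
  rwa [sub_zero] at h

theorem LocBdd.of_dr (hR : R ≤ 1) (B : G →L[ℝ] F →L[ℝ] F) {a : Sm (Cyl R) G} {f h : Sm (Cyl R) F}
    (ha : LocBdd a) (hh : LocBdd h) (hf : Sm.dr f = Sm.bil B a f + h) : LocBdd f := by
  intro q hq
  obtain ⟨C, hC, h1⟩ := ha q hq
  obtain ⟨C', hC', h2⟩ := hh q hq
  have hk : 0 ≤ ‖B‖ * C := mul_nonneg B.opNorm_nonneg hC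
  have hmono := gronwallBound_mono (δ := ‖f.1 (0, q)‖ + 1) (by positivity) hC' hk
  have hpos : 0 ≤ gronwallBound (‖f.1 (0, q)‖ + 1) (‖B‖ * C) C' 1 :=
    le_trans (by rw [gronwallBound_x0]; positivity) (hmono zero_le_one)
  refine ⟨_, hpos, ?_⟩
  filter_upwards [h1, h2, Sm.eventually_norm_le (Sm.slice 0 f) hq] with x hx1 hx2 hx3 r
  rw [mul_one]
  by_cases hr : r ∈ Ico 0 R
  · refine (Sm.norm_le_gronwallBound f hr x hx3 fun τ _ => ?_).trans
      (hmono (hr.2.le.trans hR))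
    have e1 := hx1 τ
    have e2 := hx2 τ
    rw [mul_one] at e1 e2
    rw [hf, Sm.add_apply, Sm.bil_apply]
    refine (norm_add_le _ _).trans (add_le_add ((B.le_opNorm₂ _ _).trans ?_) e2)
    exact mul_le_mul_of_nonneg_right (mul_le_mul_of_nonneg_left e1 B.opNorm_nonneg)
      (norm_nonneg _)
  · rw [f.2.2 _ fun h => hr h.1, norm_zero]
    exact hpos

theorem LocBddN.of_dr (hR : R ≤ 1) (B : G →L[ℝ] F →L[ℝ] F) {a : Sm (Cyl R) G} (n : ℕ)
    {f h : Sm (Cyl R) F} (ha : LocBddN cdir n a) (hh : LocBddN cdir n h)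
    (hf : Sm.dr f = Sm.bil B a f + h) : LocBddN cdir n f := by
  induction n generalizing f h with
  | zero => exact LocBdd.of_dr hR B ha.locBdd hh.locBdd hf
  | succ n ih =>
    have hfn := ih ha.of_succ hh.of_succ hf
    refine ⟨hfn.locBdd, fun i => ?_⟩
    refine ih (h := Sm.bil B (Sm.d (cdir i) a) f + Sm.d (cdir i) h) ha.of_succ
      (((ha.2 i).bil B hfn).add (hh.2 i)) ?_
    rw [Sm.dr, Sm.d_comm, ← Sm.dr, hf, map_add, Sm.d_bil]
    abel

/-- All spatial derivatives of the first `k` parameter derivatives are locally bounded. -/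
def LocBddR : ℕ → Sm (Cyl R) F → Prop
  | 0, f => ∀ n, LocBddN cdir n f
  | k + 1, f => (∀ n, LocBddN cdir n f) ∧ LocBddR k (Sm.dr f)

theorem LocBddR.locBddN {k : ℕ} {f : Sm (Cyl R) F} (h : LocBddR k f) (n : ℕ) :
    LocBddN cdir n f := by
  cases k with
  | zero => exact h n
  | succ k => exact h.1 n

theorem LocBddR.of_succ {k : ℕ} {f : Sm (Cyl R) F} (h : LocBddR (k + 1) f) : LocBddR k f := by
  induction k generalizing f with
  | zero => exact h.1
  | succ k ih => exact ⟨h.1, ih h.2⟩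

theorem LocBddR.add {k : ℕ} {f g : Sm (Cyl R) F} (hf : LocBddR k f) (hg : LocBddR k g) :
    LocBddR k (f + g) := by
  induction k generalizing f g with
  | zero => exact fun n => (hf n).add (hg n)
  | succ k ih =>
    refine ⟨fun n => (hf.1 n).add (hg.1 n), ?_⟩
    rw [map_add]
    exact ih hf.2 hg.2

theorem LocBddR.bil {k : ℕ} (B : F →L[ℝ] G →L[ℝ] K) {f : Sm (Cyl R) F} {g : Sm (Cyl R) G}
    (hf : LocBddR k f) (hg : LocBddR k g) : LocBddR k (Sm.bil B f g) := by
  induction k generalizing f g with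
  | zero => exact fun n => (hf n).bil B (hg n)
  | succ k ih =>
    refine ⟨fun n => (hf.1 n).bil B (hg.1 n), ?_⟩
    rw [Sm.d_bil]
    exact (ih hf.2 hg.of_succ).add (ih hf.of_succ hg.2)

theorem LocBddR.d {k : ℕ} {f : Sm (Cyl R) F} (hf : LocBddR k f) (i : Fin 6) :
    LocBddR k (Sm.d (cdir i) f) := by
  induction k generalizing f with
  | zero => exact fun n => (hf (n + 1)).2 i
  | succ k ih =>
    refine ⟨fun n => (hf.1 (n + 1)).2 i, ?_⟩
    rw [Sm.dr, Sm.d_comm]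
    exact ih hf.2

theorem LocBddR.of_dr (hR : R ≤ 1) (B : G →L[ℝ] F →L[ℝ] F) {a : Sm (Cyl R) G} {f : Sm (Cyl R) F}
    (k : ℕ) (ha : LocBddR k a) (hf : Sm.dr f = Sm.bil B a f) : LocBddR k f := by
  have h0 : ∀ n, LocBddN cdir n (0 : Sm (Cyl R) F) := fun n => by
    induction n with
    | zero => exact LocLe.zero (F := F) (w := fun _ => 1)
    | succ n ih => exact ⟨LocLe.zero, fun i => by rw [map_zero]; exact ih⟩
  have h1 : ∀ n, LocBddN cdir n f := fun n =>
    LocBddN.of_dr hR B n (ha.locBddN n) (h0 n) (by rw [hf, add_zero])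
  induction k with
  | zero => exact h1
  | succ k ih =>
    refine ⟨h1, ?_⟩
    rw [hf]
    exact ha.of_succ.bil B (ih ha.of_succ)

/-- The coordinate directions of the cylinder. -/
def fdir : Option (Fin 3) → ℝ × P3
  | none => (1, 0)
  | some i => (0, bvec i)

theorem LocBddR.locBddN_fdir {f : Sm (Cyl R) F} (h : ∀ k, LocBddR k f) (n : ℕ) :
    LocBddN fdir n f := by
  induction n generalizing f with
  | zero => exact ((h 0).locBddN 0).locBdd
  | succ n ih =>
    refine ⟨((h 0).locBddN 0).locBdd, ?_⟩
    rintro (_ | i)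
    · exact ih fun k => (h (k + 1)).2
    · have e : fdir (some i) = cdir (Fin.castLE (by norm_num) i) := by
        fin_cases i <;> simp [fdir, cdir, dir, bvec]
      rw [e]
      exact ih fun k => (h k).d _

/-- The coordinate functionals of the cylinder. -/
def fcoord : Option (Fin 3) → (ℝ × P3 →L[ℝ] ℝ)
  | none => ContinuousLinearMap.fst ℝ ℝ P3
  | some i => (coord i).comp (ContinuousLinearMap.snd ℝ ℝ P3)

theorem sum_fcoord_smul_fdir (x : ℝ × P3) : ∑ j, fcoord j x • fdir j = x := by
  have h := sum_coord_smul_bvec x.2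
  rw [Fintype.sum_option]
  refine Prod.ext ?_ ?_
  · simp [fcoord, fdir, Prod.fst_sum]
  · simpa [fcoord, fdir, Prod.snd_sum] using h

theorem eq_sum_fcoord (L : ℝ × P3 →L[ℝ] F) : L = ∑ j, (fcoord j).smulRight (L (fdir j)) := by
  refine ContinuousLinearMap.ext fun x => ?_
  conv_lhs => rw [← sum_fcoord_smul_fdir x]
  simp only [map_sum, map_smul, _root_.sum_apply,
    ContinuousLinearMap.smulRight_apply]

theorem Sm.fderivWithin_eq (f : Sm (Cyl R) F) {x : ℝ × P3} (hx : x ∈ Cyl R) :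
    fderivWithin ℝ f.1 (Cyl R) x = ∑ j, (fcoord j).smulRight ((Sm.d (fdir j) f).1 x) := by
  conv_lhs => rw [eq_sum_fcoord (fderivWithin ℝ f.1 (Cyl R) x)]
  exact sum_congr rfl fun j _ => by rw [Sm.d_apply _ f hx]

theorem Cyl_inter_mem_nhdsWithin {q : P3} {r ρ : ℝ} (hρ : 0 < ρ) :
    Ico 0 R ×ˢ ball q ρ ∈ 𝓝[Cyl R] (r, q) := by
  filter_upwards [self_mem_nhdsWithin, mem_nhdsWithin_of_mem_nhds
    (continuous_snd.continuousAt.preimage_mem_nhds (Metric.ball_mem_nhds q hρ))] with x hx hx'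
  exact ⟨hx.1, hx'⟩

theorem LocBddN.exists_tendsto [CompleteSpace F] (hR : 0 < R) {f : Sm (Cyl R) F}
    (h : LocBddN fdir 1 f) {x : ℝ × P3} (hx : x ∈ Icc 0 R ×ˢ Hsp) :
    ∃ y, Tendsto f.1 (𝓝[Cyl R] x) (𝓝 y) := by
  obtain ⟨r, q⟩ := x
  choose C hC hC' using fun j => (h.2 j).locBdd q hx.2
  obtain ⟨ρ, hρ, -, hsub, hall⟩ := exists_ball_of_eventually hx.2 (eventually_all.2 hC')
  have hU : Ico 0 R ×ˢ ball q ρ ⊆ Cyl R := fun y hy =>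
    ⟨hy.1, hsub (ball_subset_closedBall hy.2)⟩
  have hnn : 0 ≤ ∑ j, ‖fcoord j‖ * C j := sum_nonneg fun j _ =>
    mul_nonneg (norm_nonneg _) (hC j)
  have hL : LipschitzOnWith (∑ j, ‖fcoord j‖ * C j).toNNReal f.1
      (Ico 0 R ×ˢ ball q ρ) := by
    refine ((convex_Ico 0 R).prod (convex_ball q ρ)).lipschitzOnWith_of_nnnorm_hasFDerivWithin_le
      (fun y hy => (Sm.hasFDerivWithinAt f (hU hy)).mono hU) fun y hy => ?_
    rw [← NNReal.coe_le_coe, coe_nnnorm, Real.coe_toNNReal _ hnn, Sm.fderivWithin_eq f (hU hy)]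
    refine (norm_sum_le _ _).trans (sum_le_sum fun j _ => ?_)
    rw [ContinuousLinearMap.norm_smulRight_apply]
    have := hall y.2 hy.2 j y.1
    rw [mul_one] at this
    exact mul_le_mul_of_nonneg_left this (norm_nonneg _)
  have hne : (𝓝[Cyl R] (r, q)).NeBot := by
    rw [← mem_closure_iff_nhdsWithin_neBot, Cyl, closure_prod_eq, closure_Ico hR.ne]
    exact ⟨hx.1, subset_closure hx.2⟩
  have hc : Cauchy (𝓝[Cyl R] (r, q)) := cauchy_nhds.mono' hne nhdsWithin_le_nhds
  exact cauchy_map_iff_exists_tendsto.1 (hc.map_of_le hL.uniformContinuousOn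
    (le_principal_iff.2 (Cyl_inter_mem_nhdsWithin hρ)))

theorem Icc_subset_closure_Cyl (hR : 0 < R) : Icc 0 R ×ˢ Hsp ⊆ closure (Cyl R) := by
  rw [Cyl, closure_prod_eq, closure_Ico hR.ne]
  exact prod_mono le_rfl subset_closure

theorem Sm.extendFrom_eq (f : Sm (Cyl R) F) {x : ℝ × P3} (hx : x ∈ Cyl R) :
    extendFrom (Cyl R) f.1 x = f.1 x :=
  _root_.extendFrom_eq (subset_closure hx) (Sm.continuousOn f x hx)

theorem LocBddN.continuousOn_extendFrom [CompleteSpace F] (hR : 0 < R) {f : Sm (Cyl R) F}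
    (h : LocBddN fdir 1 f) : ContinuousOn (extendFrom (Cyl R) f.1) (Icc 0 R ×ˢ Hsp) :=
  _root_.continuousOn_extendFrom (Icc_subset_closure_Cyl hR) fun _ hx => h.exists_tendsto hR hx

theorem LocBddN.hasFDerivWithinAt_extendFrom [CompleteSpace F] (hR : 0 < R) {f : Sm (Cyl R) F}
    (h : LocBddN fdir 2 f) {x : ℝ × P3} (hx : x ∈ Icc 0 R ×ˢ Hsp) :
    HasFDerivWithinAt (extendFrom (Cyl R) f.1)
      (∑ j, (fcoord j).smulRight (extendFrom (Cyl R) (Sm.d (fdir j) f).1 x))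
      (Icc 0 R ×ˢ Hsp) x := by
  obtain ⟨r, q⟩ := x
  obtain ⟨ρ, hρ, -, hsub, -⟩ := exists_ball_of_eventually (P := fun _ => True) hx.2
    (.of_forall fun _ => trivial)
  set s : Set (ℝ × P3) := Ioo 0 R ×ˢ ball q ρ with hs
  have hsI : s ⊆ Cyl R := fun y hy =>
    ⟨Ioo_subset_Ico_self hy.1, hsub (ball_subset_closedBall hy.2)⟩
  have hso : IsOpen s := isOpen_Ioo.prod Metric.isOpen_ball
  have hcl : closure s = Icc 0 R ×ˢ closedBall q ρ := by
    rw [hs, closure_prod_eq, closure_Ioo hR.ne, closure_ball _ hρ.ne']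
  have hclI : closure s ⊆ Icc 0 R ×ˢ Hsp := by
    rw [hcl]
    exact prod_mono le_rfl hsub
  have heq : ∀ y ∈ s, extendFrom (Cyl R) f.1 =ᶠ[𝓝 y] f.1 := fun y hy => by
    filter_upwards [hso.mem_nhds hy] with z hz using Sm.extendFrom_eq f (hsI hz)
  have hder : ∀ y ∈ s, HasFDerivAt (extendFrom (Cyl R) f.1)
      (∑ j, (fcoord j).smulRight (extendFrom (Cyl R) (Sm.d (fdir j) f).1 y)) y := fun y hy => by
    have e := (Sm.hasFDerivWithinAt f (hsI hy)).hasFDerivAt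
      (mem_of_superset (hso.mem_nhds hy) hsI)
    rw [Sm.fderivWithin_eq f (hsI hy)] at e
    refine (e.congr_of_eventuallyEq (heq y hy)).congr_fderiv
      (sum_congr rfl fun j _ => by rw [Sm.extendFrom_eq _ (hsI hy)])
  have hmain := hasFDerivWithinAt_closure_of_tendsto_fderiv (s := s) (x := (r, q))
    (f := extendFrom (Cyl R) f.1)
    (f' := ∑ j, (fcoord j).smulRight (extendFrom (Cyl R) (Sm.d (fdir j) f).1 (r, q)))
    (fun y hy => (hder y hy).differentiableAt.differentiableWithinAt)
    ((convex_Ioo 0 R).prod (convex_ball q ρ)) hso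
    (fun y hy => (h.of_succ.continuousOn_extendFrom hR y (hclI hy)).mono
      (subset_closure.trans hclI)) ?_
  · refine hmain.mono_of_mem_nhdsWithin ?_
    rw [hcl]
    filter_upwards [self_mem_nhdsWithin, mem_nhdsWithin_of_mem_nhds
      (continuous_snd.continuousAt.preimage_mem_nhds (Metric.closedBall_mem_nhds q hρ))]
      with y hy hy' using ⟨hy.1, hy'⟩
  · refine Tendsto.congr' (f₁ := fun y =>
      ∑ j, (fcoord j).smulRight (extendFrom (Cyl R) (Sm.d (fdir j) f).1 y)) ?_ ?_
    · filter_upwards [self_mem_nhdsWithin] with y hy using (hder y hy).fderiv.symm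
    · refine tendsto_finsetSum _ fun j _ => ?_
      have h1 : Tendsto (extendFrom (Cyl R) (Sm.d (fdir j) f).1) (𝓝[s] (r, q)) (𝓝 _) :=
        ((h.2 j).continuousOn_extendFrom hR (r, q) hx).mono (subset_closure.trans hclI)
      exact ((ContinuousLinearMap.smulRightL ℝ (ℝ × P3) F (fcoord j)).continuous.tendsto _).comp
        h1

theorem LocBddN.contDiffOn_extendFrom [CompleteSpace F] (hR : 0 < R) {f : Sm (Cyl R) F}
    (h : ∀ n, LocBddN fdir n f) :
    ContDiffOn ℝ (⊤ : ℕ∞) (extendFrom (Cyl R) f.1) (Icc 0 R ×ˢ Hsp) := by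
  refine contDiffOn_infty.2 fun n => ?_
  have hu : UniqueDiffOn ℝ (Icc 0 R ×ˢ Hsp) :=
    (uniqueDiffOn_Icc hR).prod isOpen_Hsp.uniqueDiffOn
  induction n generalizing f with
  | zero => exact contDiffOn_zero.2 ((h 1).continuousOn_extendFrom hR)
  | succ n ih =>
    rw [Nat.cast_succ, contDiffOn_succ_iff_hasFDerivWithinAt_of_uniqueDiffOn hu]
    refine ⟨by simp, _, ?_, fun x hx => (h 2).hasFDerivWithinAt_extendFrom hR hx⟩
    refine ContDiffOn.sum fun j _ => ?_
    exact (ContinuousLinearMap.smulRightL ℝ (ℝ × P3) F (fcoord j)).contDiff.comp_contDiffOn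
      (ih fun n => (h (n + 1)).2 j)

end Transport

section SmallGradient

theorem AbsorbSystem.norm_covD_le {A C : ℝ} {R : ℝ} {c : Fin 6 → Sm Hsp E3}
    {f : Unit → Sm (Cyl R) E3} {y : Fin 6 → Sm (Cyl R) E3} {z : Sm (Cyl R) E3} {q : P3} {ρ : ℝ}
    (h : AbsorbSystem c f y z q ρ A)
    (hC : ∀ r ∈ Ico 0 R, ∀ x ∈ ball q ρ, depth q ρ x * gradSum c f (r, x) ≤ C)
    {r : ℝ} (hr : r ∈ Ico 0 R) (i : Fin 6) :
    ‖(covD cdir (fun j => Sm.cst R (c j)) i (f ())).1 (r, q)‖ ≤ C / ρ := by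
  have h1 := hC r hr q (Metric.mem_ball_self h.pos)
  rw [depth, sub_self, norm_zero, sub_zero] at h1
  rw [le_div_iff₀ h.pos, mul_comm]
  exact (mul_le_mul_of_nonneg_left (norm_le_gradSum c f () i _) h.pos.le).trans h1

theorem AbsorbSystem.exists_small {A : ℝ} (hA : 1 ≤ A) {ε : ℝ} (hε : 0 < ε) :
    ∃ η : ℝ, 0 < η ∧ ∀ {R : ℝ} (c : Fin 6 → Sm Hsp E3) (f : Unit → Sm (Cyl R) E3)
      (y : Fin 6 → Sm (Cyl R) E3) (z : Sm (Cyl R) E3) (q : P3) (ρ : ℝ),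
      AbsorbSystem c f y z q ρ A →
      (∀ r ∈ Ico 0 R, ∀ x ∈ ball q ρ, ‖(f ()).1 (r, x)‖ ≤ η) →
      ∀ r ∈ Ico 0 R, ∀ i,
        ‖(covD cdir (fun j => Sm.cst R (c j)) i (f ())).1 (r, q)‖ ≤ ε / ρ := by
  obtain ⟨K, hK, hgrad⟩ := gradient_estimate
  obtain ⟨C, hC, hbd⟩ := AbsorbSystem.exists_bound Unit (Fin 6) A hA
  obtain ⟨H, hH⟩ : ∃ H, H = A * ((2 + 2 * C) * (2 + 2 * C + 2 * C) + 4 * C) := ⟨_, rfl⟩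
  have hH0 : 0 ≤ H := by rw [hH]; positivity
  obtain ⟨M, hM⟩ : ∃ M, M = 1 + H + (H ^ 2 + A ^ 2 + 4 * A * C ^ 2) + 2 * C * (H + A) := ⟨_, rfl⟩
  have hM0 : 0 < M := by rw [hM]; positivity
  obtain ⟨δ, hδ, hδ8, hδM⟩ : ∃ δ : ℝ, 0 < δ ∧ δ ≤ 1 / 8 ∧ K * (δ * M) ≤ ε ^ 2 := by
    refine ⟨min (1 / 8) (ε ^ 2 / (K * M)), by positivity, min_le_left _ _, ?_⟩
    have := min_le_right (1 / 8) (ε ^ 2 / (K * M))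
    rw [le_div_iff₀ (by positivity)] at this
    linarith
  refine ⟨δ ^ 2, by positivity, fun {R} c f y z q ρ hS hsmall r hr i => ?_⟩
  have hρ := hS.pos
  have hhalf : ∀ x ∈ closedBall q (4 * (δ * ρ)), x ∈ ball q ρ ∧
      ρ / 2 ≤ depth q ρ x := fun x hx => by
    rw [mem_closedBall_iff_norm] at hx
    rw [mem_ball_iff_norm, depth]
    constructor <;> nlinarith
  have hnum : ∀ {d X n : ℝ} , ρ / 2 ≤ d → 0 ≤ X → d * X ≤ n → X ≤ 2 * n / ρ :=
    fun {d X n} hd hX h => by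
      rw [le_div_iff₀ hρ]
      nlinarith
  have hest := hgrad c (Sm.slice r (f ())) q (δ * ρ) (δ ^ 2) (H / ρ ^ 2) (2 * C / ρ) (A / ρ ^ 2)
    (by positivity) (by positivity) (by positivity)
    (fun x hx => hS.sub (ball_subset_closedBall (hhalf x hx).1)) fun x hx => by
      obtain ⟨hxb, hd⟩ := hhalf x hx
      obtain ⟨b1, b2, b3⟩ := hbd c f y z q ρ hS r hr x hxb
      have hd0 := depth_pos hxb
      have hP := hnum hd (gradSum_nonneg c f (r, x)) b1
      have hY := hnum hd (normSum_nonneg y (r, x)) b2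
      have hcs : (fun j => Sm.slice r (Sm.cst R (c j))) = c := funext fun j => Sm.slice_cst hr _
      have hsl : ∀ i, (covD dir c i (Sm.slice r (f ()))).1 x
          = (covD cdir (fun j => Sm.cst R (c j)) i (f ())).1 (r, x) := fun i => by
        rw [← Sm.slice_apply, slice_covD, hcs]
      have hsL : (covL dir c (Sm.slice r (f ()))).1 x
          = (covL cdir (fun j => Sm.cst R (c j)) (f ())).1 (r, x) := by
        rw [← Sm.slice_apply, slice_covL, hcs]
      refine ⟨hsmall r hr x hxb, ?_, fun i => ?_, hS.curv_le x hxb⟩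
      · rw [hsL]
        refine (hS.lap_le () r hr x hxb).trans ?_
        have e1 : 1 / depth q ρ x ≤ 2 / ρ := by
          rw [div_le_div_iff₀ hd0 hρ]; linarith
        have e2 : ‖z.1 (r, x)‖ ≤ 4 * C / ρ ^ 2 := by
          rw [le_div_iff₀ (by positivity)]
          have := pow_le_pow_left₀ (by positivity) hd 2
          nlinarith [norm_nonneg (z.1 (r, x))]
        have hz : H / ρ ^ 2 = A * ((2 / ρ + 2 * C / ρ) * (2 / ρ + 2 * C / ρ + 2 * C / ρ)
            + 4 * C / ρ ^ 2) := by
          rw [hH]; field_simp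
        rw [hz]
        refine mul_le_mul_of_nonneg_left (add_le_add (mul_le_mul (add_le_add e1 hY)
          (add_le_add (add_le_add e1 hP) hY) ?_ (by positivity)) e2) (by linarith)
        exact add_nonneg (add_nonneg (by positivity) (gradSum_nonneg c f _)) (normSum_nonneg y _)
      · rw [hsl]
        exact (norm_le_gradSum c f () i _).trans hP
  have hle : K * ((δ ^ 2) ^ 2 / (δ * ρ) ^ 2 + δ ^ 2 * (H / ρ ^ 2) + (δ * ρ) ^ 2 * ((H / ρ ^ 2) ^ 2
      + (A / ρ ^ 2) ^ 2 * (δ ^ 2) ^ 2 + A / ρ ^ 2 * (2 * C / ρ) ^ 2)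
      + δ * ρ * (2 * C / ρ * (H / ρ ^ 2 + A / ρ ^ 2 * δ ^ 2))) ≤ (ε / ρ) ^ 2 := by
    have hδ1 : δ ≤ 1 := by linarith
    have hδ2 : δ ^ 2 ≤ δ := by nlinarith
    have hδ21 : δ ^ 2 ≤ 1 := by nlinarith
    have hδ4 : (δ ^ 2) ^ 2 ≤ 1 := by nlinarith [sq_nonneg δ]
    have key : δ ^ 2 + δ ^ 2 * H + δ ^ 2 * (H ^ 2 + A ^ 2 * (δ ^ 2) ^ 2 + 4 * A * C ^ 2)
        + δ * (2 * C * (H + A * δ ^ 2)) ≤ δ * M := by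
      have t1 : A ^ 2 * (δ ^ 2) ^ 2 ≤ A ^ 2 := mul_le_of_le_one_right (sq_nonneg _) hδ4
      have t2 : A * δ ^ 2 ≤ A := mul_le_of_le_one_right (by linarith) hδ21
      have t3 : δ ^ 2 * H ≤ δ * H := mul_le_mul_of_nonneg_right hδ2 hH0
      have t4 : δ ^ 2 * (H ^ 2 + A ^ 2 * (δ ^ 2) ^ 2 + 4 * A * C ^ 2)
          ≤ δ * (H ^ 2 + A ^ 2 + 4 * A * C ^ 2) :=
        mul_le_mul hδ2 (by linarith) (by positivity) hδ.le
      have t5 : δ * (2 * C * (H + A * δ ^ 2)) ≤ δ * (2 * C * (H + A)) :=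
        mul_le_mul_of_nonneg_left (mul_le_mul_of_nonneg_left (by linarith) (by positivity)) hδ.le
      rw [hM]
      linarith
    have hid : K * ((δ ^ 2) ^ 2 / (δ * ρ) ^ 2 + δ ^ 2 * (H / ρ ^ 2)
      + (δ * ρ) ^ 2 * ((H / ρ ^ 2) ^ 2
      + (A / ρ ^ 2) ^ 2 * (δ ^ 2) ^ 2 + A / ρ ^ 2 * (2 * C / ρ) ^ 2)
      + δ * ρ * (2 * C / ρ * (H / ρ ^ 2 + A / ρ ^ 2 * δ ^ 2)))
      = K * (δ ^ 2 + δ ^ 2 * H + δ ^ 2 * (H ^ 2 + A ^ 2 * (δ ^ 2) ^ 2 + 4 * A * C ^ 2)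
        + δ * (2 * C * (H + A * δ ^ 2))) / ρ ^ 2 := by
      field_simp
      ring
    rw [hid, div_pow]
    exact div_le_div_of_nonneg_right ((mul_le_mul_of_nonneg_left key hK.le).trans hδM)
      (by positivity)
  have hg := hest.trans hle
  rw [gradSq_apply] at hg
  have hcs : (fun j => Sm.slice r (Sm.cst R (c j))) = c := funext fun j => Sm.slice_cst hr _
  have hsl : (covD dir c i (Sm.slice r (f ()))).1 q
      = (covD cdir (fun j => Sm.cst R (c j)) i (f ())).1 (r, q) := by
    rw [← Sm.slice_apply, slice_covD, hcs]
  rw [← hsl]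
  refine abs_le_of_sq_le_sq' (a := _) ?_ (by positivity) |>.2
  exact (single_le_sum (f := fun i => ‖(covD dir c i (Sm.slice r (f ()))).1 q‖ ^ 2)
    (fun _ _ => sq_nonneg _) (Finset.mem_univ i)).trans hg

end SmallGradient

section Ends

/-- The points near the ends of the half-space. -/
def AtEnd (k : ℝ) (p : P3) : Prop := p.1 < 1 / k ∨ k < p.1 ∨ k * p.1 < znorm p

theorem AtEnd.mono {k k' : ℝ} (hk : 0 < k) (hkk : k ≤ k') {p : P3} (hp : p ∈ Hsp)
    (h : AtEnd k' p) : AtEnd k p := by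
  have hp0 : 0 < p.1 := hp
  rcases h with h | h | h
  · exact Or.inl (h.trans_le (one_div_le_one_div_of_le hk hkk))
  · exact Or.inr (Or.inl (hkk.trans_lt h))
  · exact Or.inr (Or.inr ((mul_le_mul_of_nonneg_right hkk hp0.le).trans_lt h))

theorem znorm_le_add (p q : P3) : znorm p ≤ znorm q + znorm (p - q) := by
  have h : ∀ x : P3, znorm x = ‖(x.2.1 + x.2.2 * Complex.I : ℂ)‖ := fun x => by
    rw [Complex.norm_add_mul_I, znorm]
  rw [h, h, h]
  refine le_trans (le_of_eq ?_) (norm_add_le _ _)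
  congr 1
  push_cast [Prod.snd_sub, Prod.fst_sub]
  ring

theorem EndsLt.exists_atEnd {φ : P3 → ℝ} {ε : ℝ} (h : EndsLt φ ε) :
    ∃ k : ℝ, 1 < k ∧ ∀ q ∈ Hsp, AtEnd k q → ∀ x, ‖x - q‖ < q.1 / 8 → φ x < ε := by
  obtain ⟨⟨δ, hδ, h1⟩, ⟨M, h2⟩, η, hη, h3⟩ := h
  have hM := abs_nonneg M
  have hδ' : 0 < 2 / δ := by positivity
  have hη' : 0 < 2 / η := by positivity
  refine ⟨2 + 2 / δ + 2 * |M| + 2 / η, by linarith, fun q hq hqe x hx => ?_⟩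
  have hq0 : 0 < q.1 := hq
  have hx1 : |x.1 - q.1| ≤ ‖x - q‖ := norm_fst_le (x - q)
  obtain ⟨hlo, hhi⟩ := abs_le.1 hx1
  have hxH : x ∈ Hsp := by
    change 0 < x.1
    linarith
  rcases hqe with he | he | he
  · refine h1 x hxH ?_
    have hk : 1 / (2 + 2 / δ + 2 * |M| + 2 / η) ≤ δ / 2 := by
      rw [div_le_div_iff₀ (by linarith) two_pos]
      have : δ * (2 / δ) = 2 := by field_simp
      have h4 : 0 ≤ δ * (2 + 2 * |M| + 2 / η) := by positivity
      nlinarith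
    linarith
  · refine h2 x hxH ?_
    linarith [le_abs_self M]
  · refine h3 x hxH ?_
    have hz := znorm_le_add q x
    have hz' := znorm_le_norm (q - x)
    rw [norm_sub_rev] at hz'
    have h4 : (2 + 2 / η) * q.1 ≤ (2 + 2 / δ + 2 * |M| + 2 / η) * q.1 :=
      mul_le_mul_of_nonneg_right (by linarith) hq0.le
    have h5 : (1 + 2 / η) * q.1 ≤ znorm x := by linarith
    have h6 := mul_le_mul_of_nonneg_left h5 hη.le
    have h7 : η * ((1 + 2 / η) * q.1) = η * q.1 + 2 * q.1 := by field_simp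
    have h8 : 0 < η * q.1 := by positivity
    linarith

end Ends

namespace FlowSystem

variable {R : ℝ} (S : FlowSystem R)

theorem exists_norm_v_le : ∃ C : ℝ, 1 ≤ C ∧ ∀ x, ‖S.v.1 x‖ ≤ C := by
  obtain ⟨C, -, h, -⟩ := S.controlled 0
  exact ⟨max C 1, le_max_right _ _, fun x => (h x).trans (le_max_left _ _)⟩

theorem exists_atEnd_norm_v_le {η : ℝ} (hη : 0 < η) :
    ∃ k : ℝ, 1 < k ∧ ∀ q ∈ Hsp, AtEnd k q → ∀ x, ‖x - q‖ < q.1 / 8 →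
      ∀ r, ‖S.v.1 (r, x)‖ ≤ η := by
  obtain ⟨C, hC, -, h⟩ := S.controlled 0
  obtain ⟨k, hk, h1⟩ := (S.endsZero_W (η ^ 2 / (C + 1)) (by positivity)).exists_atEnd
  refine ⟨k, hk, fun q hq hqe x hx r => ?_⟩
  by_cases hrx : (r, x) ∈ Cyl R
  · have h2 := (h r hrx.1 x hrx.2).1
    have h3 := h1 q hq hqe x hx
    have h4 := S.W_nonneg x
    rw [lt_div_iff₀ (by positivity)] at h3
    refine abs_le_of_sq_le_sq' (h2.trans ?_) hη.le |>.2
    nlinarith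
  · rw [S.v.2.2 _ hrx, norm_zero]
    exact hη.le

/-- The connection at parameter zero. -/
def base (i : Fin 6) : Sm Hsp E3 := Sm.slice 0 (S.c i)

/-- `ρ` is a scale on which the curvature of the initial connection and the initial defect are
bounded. -/
structure Scale (ρ : P3 → ℝ) (A : ℝ) : Prop where
  pos : ∀ q ∈ Hsp, 0 < ρ q
  le : ∀ q ∈ Hsp, ρ q ≤ q.1 / 8
  curv_le : ∀ q ∈ Hsp, ∀ x ∈ ball q (ρ q), ∀ i j,
    ‖(curv dir S.base i j).1 x‖ ≤ A / ρ q ^ 2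
  X_le : ∀ q ∈ Hsp, ∀ x ∈ ball q (ρ q), ‖S.X.1 x‖ ≤ A / ρ q ^ 2

variable {S}

theorem Scale.absorbSystem {ρ : P3 → ℝ} {A B : ℝ} (h : S.Scale ρ A) (hB : 1 ≤ B) (hAB : A ≤ B)
    (hv : ∀ x, ‖S.v.1 x‖ ≤ B) {q : P3} (hq : q ∈ Hsp) :
    AbsorbSystem S.base (fun _ : Unit => S.v) (S.diff S.base) (S.divDiff S.base) q (ρ q)
      (10 * B ^ 2) := by
  have hρ := h.pos q hq
  have hq0 : 0 < q.1 := hq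
  have hAB' : A / ρ q ^ 2 ≤ B / ρ q ^ 2 := div_le_div_of_nonneg_right hAB (by positivity)
  have h0 : (0 : ℝ) ∈ Ico 0 R := ⟨le_rfl, S.pos⟩
  have hd : ∀ i, Sm.slice 0 (S.diff S.base i) = 0 := fun i => by
    rw [diff, map_sub, Sm.slice_cst h0, base, sub_self]
  have hdd : Sm.slice 0 (S.divDiff S.base) = 0 := by
    rw [divDiff, map_sum]
    exact Finset.sum_eq_zero fun i _ => by rw [slice_covD, hd, map_zero]
  refine S.absorbSystem S.base hB hρ (fun x hx => ?_)
    (fun x hx i j => (h.curv_le q hq x hx i j).trans hAB') hv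
    (fun x hx => (h.X_le q hq x hx).trans hAB') (fun i x _ => ?_) fun x _ => ?_
  · rw [mem_closedBall_iff_norm] at hx
    have := (abs_le.1 ((norm_fst_le (x - q)).trans hx)).1
    have hle := h.le q hq
    change 0 < x.1
    rw [Prod.fst_sub] at this
    linarith
  · rw [← Sm.slice_apply, hd, Sm.zero_apply, norm_zero]
    positivity
  · rw [← Sm.slice_apply, hdd, Sm.zero_apply, norm_zero]
    positivity

theorem Scale.exists_covD_le {ρ : P3 → ℝ} {A : ℝ} (h : S.Scale ρ A) :
    ∃ C : ℝ, 0 ≤ C ∧ ∀ r ∈ Ico 0 R, ∀ q ∈ Hsp, ∀ i,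
      ‖(covD cdir (fun j => Sm.cst R (S.base j)) i S.v).1 (r, q)‖ ≤ C / ρ q := by
  obtain ⟨V, hV, hv⟩ := S.exists_norm_v_le
  obtain ⟨C, hC, hbd⟩ := AbsorbSystem.exists_bound Unit (Fin 6) (10 * (max V A) ^ 2)
    (by nlinarith [le_max_left V A])
  refine ⟨C, hC, fun r hr q hq i => ?_⟩
  have hs := h.absorbSystem (hV.trans (le_max_left V A)) (le_max_right V A)
    (fun x => (hv x).trans (le_max_left V A)) hq
  exact hs.norm_covD_le (fun r hr x hx => (hbd _ _ _ _ _ _ hs r hr x hx).1) hr i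

theorem Scale.exists_atEnd_covD_le {ρ : P3 → ℝ} {A : ℝ} (h : S.Scale ρ A) {ε : ℝ} (hε : 0 < ε) :
    ∃ k : ℝ, 1 < k ∧ ∀ q ∈ Hsp, AtEnd k q → ∀ r ∈ Ico 0 R, ∀ i,
      ‖(covD cdir (fun j => Sm.cst R (S.base j)) i S.v).1 (r, q)‖ ≤ ε / ρ q := by
  obtain ⟨V, hV, hv⟩ := S.exists_norm_v_le
  obtain ⟨η, hη, hbd⟩ := AbsorbSystem.exists_small (A := 10 * (max V A) ^ 2)
    (by nlinarith [le_max_left V A]) hε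
  obtain ⟨k, hk, hke⟩ := S.exists_atEnd_norm_v_le hη
  refine ⟨k, hk, fun q hq hqe r hr i => ?_⟩
  have hs := h.absorbSystem (hV.trans (le_max_left V A)) (le_max_right V A)
    (fun x => (hv x).trans (le_max_left V A)) hq
  refine hbd _ _ _ _ _ _ hs (fun r _ x hx => hke q hq hqe x ?_ r) r hr i
  rw [mem_ball_iff_norm] at hx
  exact hx.trans_le (h.le q hq)

variable {F : Type*} [NormedAddCommGroup F] [NormedSpace ℝ F]

theorem locBddR_vd (k j : ℕ) : LocBddR k (S.vd j) := by
  induction k generalizing j with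
  | zero => exact fun n => S.locBddN_vd n j
  | succ k ih =>
    refine ⟨fun n => S.locBddN_vd n j, ?_⟩
    rw [dr_vd]
    exact ih _

theorem contDiffOn_extendFrom [CompleteSpace F] (B : E3 →L[ℝ] F →L[ℝ] F) {f : Sm (Cyl R) F}
    (hf : Sm.dr f = Sm.bil B S.v f) :
    ContDiffOn ℝ (⊤ : ℕ∞) (extendFrom (Cyl R) f.1) (Icc 0 R ×ˢ Hsp) :=
  LocBddN.contDiffOn_extendFrom S.pos (LocBddR.locBddN_fdir fun k =>
    LocBddR.of_dr S.le_one B k (locBddR_vd (S := S) k 0) hf)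

variable (S) in
/-- A frame transported by the flow, together with the infinitesimal action `ad` on frames. -/
structure Frame (f₀ : F) (B ad : E3 →L[ℝ] F →L[ℝ] F) (f : Sm (Cyl R) F) : Prop where
  dr_f : Sm.dr f = Sm.bil B S.v f
  zero : ∀ p ∈ Hsp, f.1 (0, p) = f₀
  ad_zero : ∀ a, ad a f₀ = 0
  ad_B : ∀ a v g, ad a (B v g) = B (br a v) g + B v (ad a g)

variable (S) in
/-- The covariant derivative of a frame with the initial connection. -/
def frameD (ad : E3 →L[ℝ] F →L[ℝ] F) (f : Sm (Cyl R) F) (i : Fin 6) : Sm (Cyl R) F :=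
  Sm.d (cdir i) f + Sm.bil ad (Sm.cst R (S.base i)) f

namespace Frame

variable {f₀ : F} {B ad : E3 →L[ℝ] F →L[ℝ] F} {f : Sm (Cyl R) F}

theorem exists_norm_le (h : S.Frame f₀ B ad f) :
    ∃ C : ℝ, 0 ≤ C ∧ ∀ r ∈ Ico 0 R, ∀ p ∈ Hsp, ‖f.1 (r, p)‖ ≤ C := by
  obtain ⟨V, hV, hv⟩ := S.exists_norm_v_le
  have hk : 0 ≤ ‖B‖ * V := mul_nonneg B.opNorm_nonneg (by linarith)
  have hmono := gronwallBound_mono (norm_nonneg f₀) (le_refl (0 : ℝ)) hk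
  refine ⟨gronwallBound ‖f₀‖ (‖B‖ * V) 0 1,
    le_trans (by rw [gronwallBound_x0]; positivity) (hmono zero_le_one), fun r hr p hp => ?_⟩
  refine (Sm.norm_le_gronwallBound f hr p (le_of_eq (by rw [h.zero p hp])) fun τ _ => ?_).trans
    (hmono (hr.2.le.trans S.le_one))
  rw [h.dr_f, Sm.bil_apply, add_zero]
  exact (B.le_opNorm₂ _ _).trans (mul_le_mul_of_nonneg_right
    (mul_le_mul_of_nonneg_left (hv _) B.opNorm_nonneg) (norm_nonneg _))

theorem norm_sub_le (h : S.Frame f₀ B ad f) {C η : ℝ} (hη : 0 ≤ η) {p : P3} (hp : p ∈ Hsp)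
    (hC : ∀ r ∈ Ico 0 R, ‖f.1 (r, p)‖ ≤ C) (hv : ∀ r, ‖S.v.1 (r, p)‖ ≤ η) {r : ℝ}
    (hr : r ∈ Ico 0 R) : ‖f.1 (r, p) - f₀‖ ≤ ‖B‖ * η * C := by
  have h0 : (0 : ℝ) ∈ Ico 0 R := ⟨le_rfl, S.pos⟩
  have hC0 : 0 ≤ C := (norm_nonneg _).trans (hC 0 h0)
  have hk : 0 ≤ ‖B‖ * η * C := by have := B.opNorm_nonneg; positivity
  have e := norm_image_sub_le_of_norm_deriv_right_le_segment (f := fun τ => f.1 (τ, p))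
    (f' := fun τ => (Sm.dr f).1 (τ, p)) (a := 0) (b := r) (C := ‖B‖ * η * C)
    ((Sm.continuousOn_param f p).mono fun τ hτ => ⟨hτ.1, hτ.2.trans_lt hr.2⟩)
    (fun τ hτ => Sm.hasDerivWithinAt_dr_Ici f ⟨hτ.1, hτ.2.trans hr.2⟩ p) (fun τ hτ => ?_)
    r ⟨hr.1, le_rfl⟩
  · rw [h.zero p hp, sub_zero] at e
    exact e.trans (mul_le_of_le_one_right hk (hr.2.le.trans S.le_one))
  · rw [h.dr_f, Sm.bil_apply]
    refine (B.le_opNorm₂ _ _).trans (mul_le_mul (mul_le_mul_of_nonneg_left (hv _)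
      B.opNorm_nonneg) (hC τ ⟨hτ.1, hτ.2.trans hr.2⟩) (norm_nonneg _) ?_)
    exact mul_nonneg B.opNorm_nonneg hη

theorem dr_frameD (h : S.Frame f₀ B ad f) (i : Fin 6) :
    Sm.dr (S.frameD ad f i) = Sm.bil B S.v (S.frameD ad f i)
      + Sm.bil B (covD cdir (fun j => Sm.cst R (S.base j)) i S.v) f := by
  rw [frameD, map_add, Sm.dr, Sm.d_comm, ← Sm.dr, Sm.d_bil, h.dr_f, Sm.d_bil,
    Sm.dr_cst, covD_eq]
  refine Sm.ext_on fun x _ => ?_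
  simp only [Sm.add_apply, Sm.bil_apply, Sm.zero_apply, lb_apply, map_zero,
    _root_.zero_apply, map_add, _root_.add_apply, h.ad_B]
  abel

theorem frameD_zero (h : S.Frame f₀ B ad f) (i : Fin 6) {p : P3} (hp : p ∈ Hsp) :
    (S.frameD ad f i).1 (0, p) = 0 := by
  have e : Sm.slice 0 (Sm.d (cdir i) f) = 0 := by
    rw [cdir, Sm.slice_d]
    refine Sm.ext_on fun x hx => ?_
    rw [Sm.d_apply_of_isOpen isOpen_Hsp _ _ hx]
    have : (Sm.slice 0 f).1 =ᶠ[𝓝 x] fun _ => f₀ := by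
      filter_upwards [isOpen_Hsp.mem_nhds hx] with y hy using h.zero y hy
    rw [this.fderiv_eq]
    simp
  rw [frameD, Sm.add_apply, ← Sm.slice_apply, e, Sm.bil_apply, h.zero p hp, h.ad_zero,
    Sm.zero_apply, add_zero]

theorem norm_frameD_le (h : S.Frame f₀ B ad f) {V C : ℝ} (hv : ∀ x, ‖S.v.1 x‖ ≤ V) {p : P3}
    (hp : p ∈ Hsp) (hC : ∀ r ∈ Ico 0 R, ‖f.1 (r, p)‖ ≤ C) {i : Fin 6} {η : ℝ}
    (hη : ∀ r ∈ Ico 0 R, ‖(covD cdir (fun j => Sm.cst R (S.base j)) i S.v).1 (r, p)‖ ≤ η) {r : ℝ}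
    (hr : r ∈ Ico 0 R) :
    ‖(S.frameD ad f i).1 (r, p)‖ ≤ ‖B‖ * η * C * gronwallBound 0 (‖B‖ * V) 1 1 := by
  have h0 : (0 : ℝ) ∈ Ico 0 R := ⟨le_rfl, S.pos⟩
  have hC0 : 0 ≤ C := (norm_nonneg _).trans (hC 0 h0)
  have hη0 : 0 ≤ η := (norm_nonneg _).trans (hη 0 h0)
  have hV0 : 0 ≤ V := (norm_nonneg _).trans (hv 0)
  have hB := B.opNorm_nonneg
  have hk : 0 ≤ ‖B‖ * V := by positivity
  have hlin : ∀ e x : ℝ, gronwallBound 0 (‖B‖ * V) e x = e * gronwallBound 0 (‖B‖ * V) 1 x :=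
    fun e x => by unfold gronwallBound; split_ifs <;> ring
  refine (Sm.norm_le_gronwallBound (S.frameD ad f i) (δ := 0) (k := ‖B‖ * V) (ε := ‖B‖ * η * C)
    hr p (by rw [h.frameD_zero i hp, norm_zero]) fun τ hτ => ?_).trans ?_
  · have hτ' : τ ∈ Ico 0 R := ⟨hτ.1, hτ.2.trans hr.2⟩
    rw [h.dr_frameD, Sm.add_apply, Sm.bil_apply, Sm.bil_apply]
    refine (norm_add_le _ _).trans (add_le_add ((B.le_opNorm₂ _ _).trans ?_)
      ((B.le_opNorm₂ _ _).trans ?_))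
    · exact mul_le_mul_of_nonneg_right (mul_le_mul_of_nonneg_left (hv _) hB) (norm_nonneg _)
    · exact mul_le_mul (mul_le_mul_of_nonneg_left (hη τ hτ') hB) (hC τ hτ') (norm_nonneg _)
        (by positivity)
  · rw [hlin]
    exact mul_le_mul_of_nonneg_left (gronwallBound_mono le_rfl zero_le_one hk
      (hr.2.le.trans S.le_one)) (by positivity)

theorem exists_bound (h : S.Frame f₀ B ad f) {ρ : P3 → ℝ} {A : ℝ} (hρ : S.Scale ρ A) :
    ∃ C : ℝ, 0 ≤ C ∧ (∀ r ∈ Ico 0 R, ∀ p ∈ Hsp, ‖f.1 (r, p)‖ ≤ C ∧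
      ∀ i, ‖(S.frameD ad f i).1 (r, p)‖ ≤ C / ρ p) ∧
    ∀ ε > 0, ∃ k : ℝ, 1 < k ∧ ∀ p ∈ Hsp, AtEnd k p → ∀ r ∈ Ico 0 R, ‖f.1 (r, p) - f₀‖ ≤ ε ∧
      ∀ i, ‖(S.frameD ad f i).1 (r, p)‖ ≤ ε / ρ p := by
  obtain ⟨V, hV, hv⟩ := S.exists_norm_v_le
  obtain ⟨C, hC0, hC⟩ := h.exists_norm_le
  obtain ⟨C', hC0', hC'⟩ := hρ.exists_covD_le
  have hB := B.opNorm_nonneg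
  obtain ⟨Γ, hΓ⟩ : ∃ Γ, Γ = gronwallBound 0 (‖B‖ * V) 1 1 := ⟨_, rfl⟩
  have hΓ0 : 0 ≤ Γ := by
    rw [hΓ]
    refine le_trans (le_of_eq ?_) (gronwallBound_mono le_rfl zero_le_one
      (mul_nonneg hB (by linarith)) (zero_le_one (α := ℝ)))
    rw [gronwallBound_x0]
  refine ⟨max C (‖B‖ * C' * C * Γ), le_max_of_le_left hC0, fun r hr p hp =>
    ⟨(hC r hr p hp).trans (le_max_left _ _), fun i => ?_⟩, fun ε hε => ?_⟩
  · refine (h.norm_frameD_le hv hp (fun r hr => hC r hr p hp) (fun r hr => hC' r hr p hp i)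
      hr).trans ?_
    have : ‖B‖ * (C' / ρ p) * C * Γ = ‖B‖ * C' * C * Γ / ρ p := by ring
    rw [← hΓ, this]
    exact div_le_div_of_nonneg_right (le_max_right _ _) (hρ.pos p hp).le
  · obtain ⟨η, hη, hη1, hη2⟩ : ∃ η : ℝ, 0 < η ∧ ‖B‖ * η * C ≤ ε ∧ ‖B‖ * η * C * Γ ≤ ε := by
      refine ⟨ε / (‖B‖ * C * (1 + Γ) + 1), by positivity, ?_, ?_⟩ <;>
      · rw [mul_div_assoc', div_mul_eq_mul_div]
        try rw [div_mul_eq_mul_div]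
        rw [div_le_iff₀ (by positivity)]
        have h1 : 0 ≤ ε * (‖B‖ * C) := by positivity
        have h2 : 0 ≤ ε * (‖B‖ * C) * Γ := by positivity
        nlinarith
    obtain ⟨k, hk, h1⟩ := S.exists_atEnd_norm_v_le hη
    obtain ⟨k', hk', h2⟩ := hρ.exists_atEnd_covD_le hη
    refine ⟨max k k', lt_max_of_lt_left hk, fun p hp he r hr => ⟨?_, fun i => ?_⟩⟩
    · have hp0 : 0 < p.1 := hp
      refine (h.norm_sub_le hη.le hp (fun r hr => hC r hr p hp) (fun r => h1 p hp
        (he.mono (by linarith) (le_max_left _ _) hp) p ?_ r) hr).trans hη1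
      rw [sub_self, norm_zero]
      positivity
    · refine (h.norm_frameD_le hv hp (fun r hr => hC r hr p hp) (fun r hr => h2 p hp
        (he.mono (by linarith) (le_max_right _ _) hp) r hr i) hr).trans ?_
      have : ‖B‖ * (η / ρ p) * C * Γ = ‖B‖ * η * C * Γ / ρ p := by ring
      rw [← hΓ, this]
      exact div_le_div_of_nonneg_right hη2 (hρ.pos p hp).le

end Frame

end FlowSystem

open Complex (I)

section MatrixCoordinates

/-- Continuous linear maps for the topologies of the given norms. -/
abbrev NLin (E F : Type*) [NormedAddCommGroup E] [NormedSpace ℝ E] [NormedAddCommGroup F]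
    [NormedSpace ℝ F] := E →L[ℝ] F

/-- The identification of `ℝ³` with `su(2)`. -/
def toM : NLin E3 M2 := LinearMap.toContinuousLinearMap
  { toFun := fun x => !![⟨0, x 2⟩, ⟨x 1, x 0⟩; ⟨-x 1, x 0⟩, ⟨0, -x 2⟩]
    map_add' := fun x y => by
      ext i j; fin_cases i <;> fin_cases j <;> simp [Complex.ext_iff] <;> ring
    map_smul' := fun c x => by
      ext i j; fin_cases i <;> fin_cases j <;> simp [Complex.ext_iff] }

/-- The coordinates of the anti-Hermitian trace-free part of a matrix. -/
def toE : NLin M2 E3 := LinearMap.toContinuousLinearMap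
  { toFun := fun X => !₂[((X 0 1).im + (X 1 0).im) / 2, ((X 0 1).re - (X 1 0).re) / 2,
      ((X 0 0).im - (X 1 1).im) / 2]
    map_add' := fun x y => by ext i; fin_cases i <;> simp <;> ring
    map_smul' := fun c x => by ext i; fin_cases i <;> simp <;> ring }

/-- Multiplication by a complex number. -/
def cmulL (c : ℂ) : NLin M2 M2 := LinearMap.toContinuousLinearMap
  { toFun := fun X => c • X
    map_add' := smul_add c
    map_smul' := fun r X => smul_comm c r X }

/-- Matrix multiplication as a continuous real bilinear map. -/
def mulL : NLin M2 (NLin M2 M2) :=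
  LinearMap.toContinuousBilinearMap (LinearMap.mk₂ ℝ (fun X Y : M2 => X * Y)
    add_mul (fun c X Y => smul_mul_assoc c X Y) mul_add (fun c X Y => mul_smul_comm c X Y))

/-- The adjugate of a two by two matrix, as a linear map. -/
def adjL : NLin M2 M2 := LinearMap.toContinuousLinearMap
  { toFun := fun X => !![X 1 1, -X 0 1; -X 1 0, X 0 0]
    map_add' := fun x y => by
      ext i j; fin_cases i <;> fin_cases j <;> simp <;> ring
    map_smul' := fun c x => by
      ext i j; fin_cases i <;> fin_cases j <;> simp }

theorem toM_apply (x : E3) : toM x = !![⟨0, x 2⟩, ⟨x 1, x 0⟩; ⟨-x 1, x 0⟩, ⟨0, -x 2⟩] := rfl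

theorem toE_apply (X : M2) : toE X = !₂[((X 0 1).im + (X 1 0).im) / 2,
    ((X 0 1).re - (X 1 0).re) / 2, ((X 0 0).im - (X 1 1).im) / 2] := rfl

@[simp] theorem cmulL_apply (c : ℂ) (X : M2) : cmulL c X = c • X := rfl

@[simp] theorem mulL_apply (X Y : M2) : mulL X Y = X * Y := rfl

theorem mul_adjL {X : M2} (h : X.det = 1) : X * adjL X = 1 := by
  have := X.mul_adjugate
  rw [h, one_smul, Matrix.adjugate_fin_two] at this
  exact this

theorem adjL_mul {X : M2} (h : X.det = 1) : adjL X * X = 1 := by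
  have := X.adjugate_mul
  rw [h, one_smul, Matrix.adjugate_fin_two] at this
  exact this

theorem inv_eq_adjL {X : M2} (h : X.det = 1) : X⁻¹ = adjL X :=
  Matrix.inv_eq_right_inv (mul_adjL h)

theorem toE_toM (x : E3) : toE (toM x) = x := by
  ext i; fin_cases i <;> simp [toE_apply, toM_apply]

theorem toE_I_smul_toM (x : E3) : toE (I • toM x) = 0 := by
  ext i; fin_cases i <;> simp [toE_apply, toM_apply]

theorem IsSU2.toM_toE {X : M2} (h : IsSU2 X) : toM (toE X) = X := by
  have h1 := h.1
  rw [Matrix.trace_fin_two, Complex.ext_iff] at h1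
  have h2 := fun i j => congrFun (congrFun h.2 i) j
  have h00 := h2 0 0
  have h01 := h2 0 1
  have h10 := h2 1 0
  have h11 := h2 1 1
  simp [Complex.ext_iff] at h1 h00 h01 h10 h11
  ext i j
  fin_cases i <;> fin_cases j <;> simp [toM_apply, toE_apply, Complex.ext_iff] <;>
    (try constructor) <;> linarith

theorem mcomm_toM (a b : E3) : mcomm (toM a) (toM b) = toM (br a b) := by
  ext i j
  fin_cases i <;> fin_cases j <;>
    simp [mcomm, toM_apply, br_apply, Complex.ext_iff] <;>
    (try constructor) <;> ring

theorem trace_mul_conjTranspose (X : M2) : (Matrix.trace (X * Xᴴ)).re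
    = ‖X 0 0‖ ^ 2 + ‖X 0 1‖ ^ 2 + ‖X 1 0‖ ^ 2 + ‖X 1 1‖ ^ 2 := by
  simp only [Complex.sq_norm, Complex.normSq_apply]
  simp [Matrix.trace_fin_two, Matrix.mul_apply, Fin.sum_univ_two]
  ring

theorem mnorm_toM (x : E3) : mnorm (toM x) = ‖x‖ := by
  rw [mnorm, trace_mul_conjTranspose, EuclideanSpace.norm_eq]
  congr 1
  simp only [Complex.sq_norm, Complex.normSq_apply, Fin.sum_univ_three, norm_eq_abs, sq_abs]
  simp [toM_apply]
  ring

theorem mnorm_le (X : M2) : mnorm X ≤ 2 * ‖X‖ := by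
  rw [mnorm, trace_mul_conjTranspose]
  refine Real.sqrt_le_iff.2 ⟨by positivity, ?_⟩
  have h : ∀ i j, ‖X i j‖ ^ 2 ≤ ‖X‖ ^ 2 := fun i j =>
    pow_le_pow_left₀ (norm_nonneg _) (Matrix.norm_entry_le_entrywise_sup_norm X) 2
  linarith [h 0 0, h 0 1, h 1 0, h 1 1, sq_nonneg ‖X‖]

/-- Infinitesimal action of `u ∈ su(2)` on frames by left multiplication with `i u`. -/
def frameB : NLin E3 (NLin M2 M2) :=
  LinearMap.toContinuousBilinearMap (LinearMap.mk₂ ℝ (fun (x : E3) (Y : M2) =>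
      I • (toM x * Y))
    (fun a b Y => by rw [map_add, add_mul, smul_add])
    (fun c a Y => by rw [map_smul, smul_mul_assoc, smul_comm])
    (fun a Y Z => by rw [mul_add, smul_add])
    (fun c a Y => by rw [mul_smul_comm, smul_comm]))

/-- The adjoint action of `su(2)` on matrices. -/
def frameAd : NLin E3 (NLin M2 M2) :=
  LinearMap.toContinuousBilinearMap (LinearMap.mk₂ ℝ (fun (x : E3) (Y : M2) => mcomm (toM x) Y)
    (fun a b Y => by simp only [mcomm, map_add]; noncomm_ring)
    (fun c a Y => by simp only [mcomm, map_smul, smul_mul_assoc, mul_smul_comm, smul_sub])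
    (fun a Y Z => by simp only [mcomm]; noncomm_ring)
    (fun c a Y => by simp only [mcomm, smul_mul_assoc, mul_smul_comm, smul_sub]))

theorem frameB_apply (x : E3) (Y : M2) : frameB x Y = I • (toM x * Y) := rfl

theorem frameAd_apply (x : E3) (Y : M2) : frameAd x Y = mcomm (toM x) Y := rfl

theorem frameAd_frameB (a v : E3) (Y : M2) :
    frameAd a (frameB v Y) = frameB (br a v) Y + frameB v (frameAd a Y) := by
  simp only [frameAd_apply, frameB_apply, ← mcomm_toM, mcomm, mul_smul_comm, smul_mul_assoc,
    ← smul_sub, ← smul_add]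
  congr 1
  noncomm_ring

end MatrixCoordinates

section Coefficients

theorem pd_eq {f : P3 → M2} {x : Sm Hsp M2} (hf : ∀ p ∈ Hsp, f p = x.1 p) (v : P3)
    {p : P3} (hp : p ∈ Hsp) : pd v f p = (Sm.d v x).1 p := by
  have h1 : f =ᶠ[𝓝 p] x.1 := by
    filter_upwards [isOpen_Hsp.mem_nhds hp] with q hq using hf q hq
  rw [pd, h1.fderiv_eq]
  exact (Sm.d_apply_of_isOpen isOpen_Hsp v _ hp).symm

theorem pd_eq_toM {f : P3 → M2} {x : Sm Hsp E3} (hf : ∀ p ∈ Hsp, f p = toM (x.1 p)) (v : P3)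
    {p : P3} (hp : p ∈ Hsp) : pd v f p = toM ((Sm.d v x).1 p) := by
  rw [pd_eq (x := Sm.map toM x) hf v hp, Sm.d_map, Sm.map_apply]

theorem cd_eq_toM {A f : P3 → M2} {a x : Sm Hsp E3} (hA : ∀ p ∈ Hsp, A p = toM (a.1 p))
    (hf : ∀ p ∈ Hsp, f p = toM (x.1 p)) (v : P3) :
    ∀ p ∈ Hsp, cd A v f p = toM ((Sm.d v x + lb a x).1 p) := fun p hp => by
  rw [cd, pd_eq_toM hf v hp, hA p hp, hf p hp, mcomm_toM, Sm.add_apply, lb_apply, map_add]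

namespace DataSet

variable (D : DataSet Hsp)

theorem a1_eq (p : P3) : D.a1 p = (2 : ℂ)⁻¹ • (D.phi p - (D.phi p)ᴴ) := by
  simp only [a1, a1Of, mstar, sub_eq_add_neg]

theorem a2_eq (p : P3) : D.a2 p = (I * (2 : ℂ)⁻¹) • (D.phi p + (D.phi p)ᴴ) := by
  simp only [a2, a2Of, mstar, sub_neg_eq_add]

theorem su2_a1 {p : P3} (hp : p ∈ Hsp) : IsSU2 (D.a1 p) := by
  have h := D.sl2_phi p hp
  refine ⟨?_, ?_⟩ <;> rw [a1_eq]
  · simp [Matrix.trace_sub, h]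
  · rw [Matrix.conjTranspose_smul, Matrix.conjTranspose_sub, Matrix.conjTranspose_conjTranspose,
      ← smul_neg, neg_sub]
    simp

theorem su2_a2 {p : P3} (hp : p ∈ Hsp) : IsSU2 (D.a2 p) := by
  have h := D.sl2_phi p hp
  refine ⟨?_, ?_⟩ <;> rw [a2_eq]
  · simp [Matrix.trace_add, h]
  · rw [Matrix.conjTranspose_smul, Matrix.conjTranspose_add, Matrix.conjTranspose_conjTranspose,
      ← neg_smul, add_comm]
    simp

theorem phi_eq (p : P3) : D.phi p = D.a1 p - I • D.a2 p := by
  rw [a1_eq, a2_eq, smul_smul, ← mul_assoc, Complex.I_mul_I]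
  module

/-- The fields `A_t, A₁, A₂, a₁, a₂, a₃` in coordinates. -/
def coef (i : Fin 6) : Sm Hsp E3 :=
  ![Sm.map toE (Sm.ofContDiffOn D.At D.smooth_At), Sm.map toE (Sm.ofContDiffOn D.A1 D.smooth_A1),
    Sm.map toE (Sm.ofContDiffOn D.A2 D.smooth_A2),
    Sm.map toE (Sm.ofContDiffOn D.phi D.smooth_phi),
    Sm.map toE (Sm.map (cmulL I) (Sm.ofContDiffOn D.phi D.smooth_phi)),
    Sm.map toE (Sm.ofContDiffOn D.a3 D.smooth_a3)] i

theorem toM_coef {p : P3} (hp : p ∈ Hsp) : D.At p = toM ((D.coef 0).1 p) ∧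
    D.A1 p = toM ((D.coef 1).1 p) ∧ D.A2 p = toM ((D.coef 2).1 p) ∧
    D.a1 p = toM ((D.coef 3).1 p) ∧ D.a2 p = toM ((D.coef 4).1 p) ∧
    D.a3 p = toM ((D.coef 5).1 p) := by
  have h1 := (D.su2_a1 hp).toM_toE
  have h2 := (D.su2_a2 hp).toM_toE
  have e1 : toE (D.phi p) = toE (D.a1 p) := by
    rw [phi_eq, ← h1, ← h2, map_sub, toE_I_smul_toM, sub_zero]
  have e2 : toE (I • D.phi p) = toE (D.a2 p) := by
    rw [phi_eq, ← h1, ← h2, smul_sub, smul_smul, Complex.I_mul_I, map_sub, toE_I_smul_toM, neg_smul,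
      one_smul, map_neg, zero_sub, neg_neg]
  refine ⟨?_, ?_, ?_, ?_, ?_, ?_⟩ <;> simp only [coef] <;> symm
  · simpa [Sm.ofContDiffOn_apply _ hp] using (D.su2_At p hp).toM_toE
  · simpa [Sm.ofContDiffOn_apply _ hp] using (D.su2_A1 p hp).toM_toE
  · simpa [Sm.ofContDiffOn_apply _ hp] using (D.su2_A2 p hp).toM_toE
  · simpa [Sm.ofContDiffOn_apply _ hp, e1] using h1
  · simpa [Sm.ofContDiffOn_apply _ hp, e2] using h2
  · simpa [Sm.ofContDiffOn_apply _ hp] using (D.su2_a3 p hp).toM_toE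

theorem X_eq {p : P3} (hp : p ∈ Hsp) : D.X p = toM ((curv dir D.coef 0 5
    - curv dir D.coef 1 2 + curv dir D.coef 3 4).1 p) := by
  have h := fun q (hq : q ∈ Hsp) => D.toM_coef hq
  have h1 : (I * (2 : ℂ)⁻¹) • mcomm (D.phi p) (mstar (D.phi p))
      = -mcomm (D.a1 p) (D.a2 p) := by
    have h2 : mstar (D.phi p) = D.a1 p + I • D.a2 p := by
      rw [a1_eq, a2_eq, smul_smul, ← mul_assoc, Complex.I_mul_I, mstar]
      module
    have h3 : mcomm (D.phi p) (mstar (D.phi p))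
        = (2 * I) • mcomm (D.a1 p) (D.a2 p) := by
      rw [h2, phi_eq]
      simp only [mcomm, sub_mul, mul_add, mul_sub, add_mul, smul_mul_assoc, mul_smul_comm]
      module
    rw [h3, smul_smul, show I * (2 : ℂ)⁻¹ * (2 * I) = I * I by ring,
      Complex.I_mul_I, neg_one_smul]
  simp only [X, XOf]
  rw [h1, cd_eq_toM (fun q hq => (h q hq).1) (fun q hq => (h q hq).2.2.2.2.2) et p hp, B3Of,
    pd_eq_toM (fun q hq => (h q hq).2.2.1) ez1 hp, pd_eq_toM (fun q hq => (h q hq).2.1) ez2 hp,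
    (h p hp).2.1, (h p hp).2.2.1, (h p hp).2.2.2.1, (h p hp).2.2.2.2.1, mcomm_toM, mcomm_toM]
  simp [curv, dir, Sm.d_zero_dir]

theorem lap_eq_toM {u : P3 → M2} {x : Sm Hsp E3} (hu : ∀ p ∈ Hsp, u p = toM (x.1 p)) {p : P3}
    (hp : p ∈ Hsp) : D.lap u p = -toM ((covL dir D.coef x).1 p) := by
  have h := fun q (hq : q ∈ Hsp) => D.toM_coef hq
  have h0 := fun q hq => (h q hq).1
  have h1 := fun q hq => (h q hq).2.1
  have h2 := fun q hq => (h q hq).2.2.1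
  have e3 : a1Of D.phi p = toM ((D.coef 3).1 p) := (h p hp).2.2.2.1
  have e4 : a2Of D.phi p = toM ((D.coef 4).1 p) := (h p hp).2.2.2.2.1
  have hb : ∀ a b : E3, mcomm (toM a) (mcomm (toM b) (toM a)) = -toM (br a (br a b)) :=
    fun a b => by rw [mcomm_toM, mcomm_toM, br_skew b a, map_neg, map_neg]
  simp only [lap, lapOf]
  rw [cd_eq_toM h0 (cd_eq_toM h0 hu et) et p hp, cd_eq_toM h1 (cd_eq_toM h1 hu ez1) ez1 p hp,
    cd_eq_toM h2 (cd_eq_toM h2 hu ez2) ez2 p hp, e3, e4, (h p hp).2.2.2.2.2, hu p hp, hb, hb, hb]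
  simp only [covL_eq, Fin.sum_univ_six, covD_eq, Sm.add_apply, map_add]
  simp [dir, Sm.d_zero_dir]
  abel

end DataSet

end Coefficients

section ComplexGauge

theorem toM_add_I_smul_inj {a b a' b' : E3}
    (h : toM a + I • toM b = toM a' + I • toM b') : a = a' ∧ b = b' := by
  have h1 := congrArg toE h
  simp only [map_add, toE_toM, toE_I_smul_toM, add_zero] at h1
  refine ⟨h1, ?_⟩
  rw [h1, add_right_inj] at h
  have h2 := congrArg (fun X => toE ((-I) • X)) h
  simpa only [smul_smul, neg_mul, Complex.I_mul_I, neg_neg, one_smul, toE_toM] using h2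

variable {R : ℝ}

/-- The complex gauge transform by `G`, with inverse `Gi`, of the coefficient `α` of the operator
`∂_e + τ ∂_{e'}`. -/
def gaugeZ (G Gi : Sm (Cyl R) M2) (α : Sm Hsp M2) (e e' : P3) (τ : ℂ) : Sm (Cyl R) M2 :=
  Sm.bil mulL (Sm.bil mulL G (Sm.cst R α)) Gi
    - Sm.bil mulL (Sm.d ((0 : ℝ), e) G + Sm.map (cmulL τ) (Sm.d ((0 : ℝ), e') G)) Gi

variable {G Gi : Sm (Cyl R) M2}

theorem dr_inverse (h : ∀ q ∈ Cyl R, G.1 q * Gi.1 q = 1) (h' : ∀ q ∈ Cyl R, Gi.1 q * G.1 q = 1) :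
    Sm.dr Gi = -Sm.bil mulL Gi (Sm.bil mulL (Sm.dr G) Gi) := by
  have h1 : Sm.bil mulL G Gi
      = Sm.cst R (Sm.ofContDiffOn (fun _ : P3 => (1 : M2)) contDiffOn_const) :=
    Sm.ext_on fun q hq => by
      rw [← Prod.mk.eta (p := q), Sm.cst_apply _ hq.1, Sm.ofContDiffOn_apply _ hq.2]
      exact h q hq
  have h2 := congrArg Sm.dr h1
  rw [Sm.dr_cst, Sm.d_bil] at h2
  refine Sm.ext_on fun q hq => ?_
  have h3 := congrArg (fun f : Sm (Cyl R) M2 => Gi.1 q * f.1 q) h2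
  simp only [Sm.add_apply, Sm.bil_apply, mulL_apply, mul_add, Sm.zero_apply, mul_zero] at h3
  rw [← mul_assoc (Gi.1 q) (G.1 q), h' q hq, one_mul] at h3
  simp only [Sm.neg_apply, Sm.bil_apply, mulL_apply]
  exact eq_neg_of_add_eq_zero_right h3

theorem dr_gaugeZ (h : ∀ q ∈ Cyl R, G.1 q * Gi.1 q = 1) (h' : ∀ q ∈ Cyl R, Gi.1 q * G.1 q = 1)
    {W : Sm (Cyl R) M2} (hW : Sm.dr G = Sm.bil mulL W G) (α : Sm Hsp M2) (e e' : P3) (τ : ℂ)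
    {q : ℝ × P3} (hq : q ∈ Cyl R) : (Sm.dr (gaugeZ G Gi α e e' τ)).1 q
      = -((Sm.d ((0 : ℝ), e) W).1 q + τ • (Sm.d ((0 : ℝ), e') W).1 q
        + mcomm ((gaugeZ G Gi α e e' τ).1 q) (W.1 q)) := by
  have hi : (Sm.dr Gi).1 q = -(Gi.1 q * W.1 q) := by
    have h1 : Sm.bil mulL (Sm.dr G) Gi = W := Sm.ext_on fun x hx => by
      rw [hW]
      simp only [Sm.bil_apply, mulL_apply]
      rw [mul_assoc, h x hx, mul_one]
    rw [dr_inverse h h', h1]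
    rfl
  have hd : ∀ w : P3, (Sm.dr (Sm.d ((0 : ℝ), w) G)).1 q
      = (Sm.d ((0 : ℝ), w) W).1 q * G.1 q + W.1 q * (Sm.d ((0 : ℝ), w) G).1 q := fun w => by
    rw [Sm.d_comm, hW, Sm.d_bil]
    rfl
  have hg : (Sm.dr G).1 q = W.1 q * G.1 q := by rw [hW]; rfl
  simp only [gaugeZ, LinearMap.map_sub, LinearMap.map_add, Sm.d_bil, Sm.dr_cst, Sm.d_map, Sm.sub_apply, Sm.add_apply,
    Sm.bil_apply, Sm.map_apply, mulL_apply, cmulL_apply, Sm.zero_apply, hi, hd, hg, mul_zero,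
    add_zero]
  obtain ⟨dw, hdw⟩ : ∃ x, x = (Sm.d ((0 : ℝ), e) W).1 q + τ • (Sm.d ((0 : ℝ), e') W).1 q :=
    ⟨_, rfl⟩
  obtain ⟨y, hy⟩ : ∃ x, x = (Sm.d ((0 : ℝ), e) G).1 q + τ • (Sm.d ((0 : ℝ), e') G).1 q :=
    ⟨_, rfl⟩
  have h1 : (Sm.d ((0 : ℝ), e) W).1 q * G.1 q + W.1 q * (Sm.d ((0 : ℝ), e) G).1 q
      + τ • ((Sm.d ((0 : ℝ), e') W).1 q * G.1 q + W.1 q * (Sm.d ((0 : ℝ), e') G).1 q)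
      = dw * G.1 q + W.1 q * y := by
    rw [hdw, hy, add_mul, mul_add, smul_mul_assoc, mul_smul_comm, smul_add]
    abel
  rw [h1, ← hdw, ← hy, mcomm, add_mul, mul_assoc dw, h q hq, mul_one]
  noncomm_ring

theorem dr_gauge_coef (h : ∀ q ∈ Cyl R, G.1 q * Gi.1 q = 1)
    (h' : ∀ q ∈ Cyl R, Gi.1 q * G.1 q = 1) {v : Sm (Cyl R) E3} (hv : Sm.dr G = Sm.bil frameB v G)
    {α : Sm Hsp M2} {e e' : P3} {σ : ℝ} (hσ : σ * σ = 1) {c c' : Sm (Cyl R) E3}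
    (hc : ∀ q ∈ Cyl R, (gaugeZ G Gi α e e' (σ • I)).1 q
      = toM (c.1 q) + (σ • I) • toM (c'.1 q)) :
    Sm.dr c = σ • (Sm.d ((0 : ℝ), e') v + lb c' v) ∧
      Sm.dr c' = -σ • (Sm.d ((0 : ℝ), e) v + lb c v) := by
  obtain ⟨W, hW⟩ : ∃ W, W = Sm.map (cmulL I) (Sm.map toM v) := ⟨_, rfl⟩
  have hWG : Sm.dr G = Sm.bil mulL W G := by
    rw [hv, hW]
    exact Sm.ext_on fun q _ => by simp [frameB_apply]
  have hZ : gaugeZ G Gi α e e' (σ • I)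
      = Sm.map toM c + Sm.map (cmulL (σ • I)) (Sm.map toM c') := Sm.ext_on hc
  have key : ∀ q ∈ Cyl R, (Sm.dr c).1 q = (σ • (Sm.d ((0 : ℝ), e') v + lb c' v)).1 q ∧
      σ • (Sm.dr c').1 q = -(Sm.d ((0 : ℝ), e) v + lb c v).1 q := fun q hq => by
    have h1 := dr_gaugeZ h h' hWG α e e' (σ • I) hq
    rw [hc q hq, hZ, hW] at h1
    simp only [map_add, Sm.d_map, Sm.add_apply, Sm.map_apply, cmulL_apply] at h1
    refine toM_add_I_smul_inj ?_
    have h2 : mcomm (toM (c.1 q) + (σ • I) • toM (c'.1 q)) (I • toM (v.1 q))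
        = I • toM (br (c.1 q) (v.1 q)) - σ • toM (br (c'.1 q) (v.1 q)) := by
      have h3 : I • I • toM (br (c'.1 q) (v.1 q)) = -toM (br (c'.1 q) (v.1 q)) := by
        rw [smul_smul, Complex.I_mul_I, neg_one_smul]
      rw [← neg_eq_iff_eq_neg] at h3
      rw [sub_eq_add_neg, ← smul_neg, ← h3, neg_neg, ← mcomm_toM, ← mcomm_toM]
      simp only [mcomm, add_mul, mul_add, smul_mul_assoc, mul_smul_comm, smul_assoc, smul_sub,
        smul_add, smul_comm I σ]
      abel
    have h4 : (σ • I) • I • toM ((Sm.d ((0 : ℝ), e') v).1 q)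
        = -(σ • toM ((Sm.d ((0 : ℝ), e') v).1 q)) := by
      rw [smul_assoc, smul_smul, Complex.I_mul_I, neg_one_smul, smul_neg]
    rw [h2, h4] at h1
    have h5 : I • toM (σ • (Sm.dr c').1 q) = (σ • I) • toM ((Sm.dr c').1 q) := by
      rw [map_smul, smul_assoc, smul_comm]
    rw [h5, h1]
    simp only [Sm.smul_apply, Sm.add_apply, lb_apply, map_add, map_neg, map_smul, smul_add,
      smul_neg]
    abel
  refine ⟨Sm.ext_on fun q hq => (key q hq).1, Sm.ext_on fun q hq => ?_⟩
  have h1 := congrArg (fun x => σ • x) (key q hq).2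
  simp only [smul_smul, hσ, one_smul, smul_neg] at h1
  rw [h1, Sm.smul_apply, neg_smul]

end ComplexGauge

section CoefficientSystem

variable {R : ℝ}

theorem slice_curv (r : ℝ) (c : Fin 6 → Sm (Cyl R) E3) (i j : Fin 6) :
    Sm.slice r (curv cdir c i j) = curv dir (fun i => Sm.slice r (c i)) i j := by
  rw [curv, curv, map_add, map_sub, slice_lb, cdir, cdir, Sm.slice_d, Sm.slice_d]

theorem dr_curv (c : Fin 6 → Sm (Cyl R) E3) (i j : Fin 6) : Sm.dr (curv cdir c i j)
    = covD cdir c i (Sm.dr (c j)) - covD cdir c j (Sm.dr (c i)) := by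
  simp only [curv, map_add, map_sub, d_lb, covD_eq, Sm.d_comm ((1 : ℝ), (0 : P3)) (cdir _)]
  rw [lb_skew (Sm.dr (c i)) (c j)]
  abel

/-- The moment map `𝔛` of a family of coefficients. -/
def momentY (c : Fin 6 → Sm (Cyl R) E3) : Sm (Cyl R) E3 :=
  curv cdir c 0 5 - curv cdir c 1 2 + curv cdir c 3 4

/-- The evolution equations `ċ = J D v` of the coefficients. -/
structure Evolves (c : Fin 6 → Sm (Cyl R) E3) (v : Sm (Cyl R) E3) : Prop where
  h0 : Sm.dr (c 0) = -covD cdir c 5 v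
  h1 : Sm.dr (c 1) = covD cdir c 2 v
  h2 : Sm.dr (c 2) = -covD cdir c 1 v
  h3 : Sm.dr (c 3) = -covD cdir c 4 v
  h4 : Sm.dr (c 4) = covD cdir c 3 v
  h5 : Sm.dr (c 5) = covD cdir c 0 v

/-- The complex structure relating `ċ` to `D v`. -/
def coefJ : Fin 6 → Fin 6 → ℝ :=
  ![![0, 0, 0, 0, 0, -1], ![0, 0, 1, 0, 0, 0], ![0, -1, 0, 0, 0, 0], ![0, 0, 0, 0, -1, 0],
    ![0, 0, 0, 1, 0, 0], ![1, 0, 0, 0, 0, 0]]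

theorem abs_coefJ_le (i j : Fin 6) : |coefJ i j| ≤ 1 := by
  fin_cases i <;> fin_cases j <;> simp [coefJ]

namespace Evolves

variable {c : Fin 6 → Sm (Cyl R) E3} {v : Sm (Cyl R) E3} (h : Evolves c v)

include h

theorem dr_c (i : Fin 6) : Sm.dr (c i) = ∑ j, coefJ i j • covD cdir c j v := by
  have e : ∀ f : Sm (Cyl R) E3, (-1 : ℝ) • f = -f := fun f => by module
  have e1 : ∀ f : Sm (Cyl R) E3, (1 : ℝ) • f = f := fun f => by module
  have e0 : ∀ f : Sm (Cyl R) E3, (0 : ℝ) • f = 0 := fun f => by module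
  rw [Fin.sum_univ_six]
  fin_cases i
  · simpa [coefJ, e, e1, e0] using h.h0
  · simpa [coefJ, e, e1, e0] using h.h1
  · simpa [coefJ, e, e1, e0] using h.h2
  · simpa [coefJ, e, e1, e0] using h.h3
  · simpa [coefJ, e, e1, e0] using h.h4
  · simpa [coefJ, e, e1, e0] using h.h5

theorem dr_momentY : Sm.dr (momentY c) = covL cdir c v := by
  simp only [momentY, map_add, map_sub, dr_curv, h.h0, h.h1, h.h2, h.h3, h.h4, h.h5, map_neg,
    covL_eq, Fin.sum_univ_six]
  abel

theorem div_dr_c : ∑ i, covD cdir c i (Sm.dr (c i)) = -lb (momentY c) v := by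
  have h50 := covD_comm cdir c 5 0 v
  have h21 := covD_comm cdir c 2 1 v
  have h43 := covD_comm cdir c 4 3 v
  simp only [Fin.sum_univ_six, h.h0, h.h1, h.h2, h.h3, h.h4, h.h5, map_neg, momentY, map_add,
    map_sub, LinearMap.add_apply, LinearMap.sub_apply, h50, h21, h43]
  abel

end Evolves

end CoefficientSystem

section FlowTranslation

/-- The substitution `s = -log (1 - r)` carries `[0, R)` onto the parameter domain `[0, T)`. -/
structure Reparam (T : ℝ≥0∞) (R : ℝ) : Prop where
  pos : 0 < R
  le_one : R ≤ 1
  mem_flowDom : ∀ r ∈ Ico 0 R, -log (1 - r) ∈ flowDom T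
  mem_Ico : ∀ s ∈ flowDom T, 1 - exp (-s) ∈ Ico 0 R

theorem IsSU2.of_smul {c : ℝ} (hc : c ≠ 0) {X : M2} (h : IsSU2 (c • X)) : IsSU2 X := by
  obtain ⟨h1, h2⟩ := h
  rw [Matrix.trace_smul] at h1
  rw [Matrix.conjTranspose_smul, star_trivial, ← smul_neg] at h2
  exact ⟨(smul_eq_zero.1 h1).resolve_left hc, smul_right_injective _ hc h2⟩

theorem toM_add_smul_I_inj {σ : ℝ} (hσ : σ ≠ 0) {a b a' b' : E3}
    (h : toM a + (σ • I) • toM b = toM a' + (σ • I) • toM b') :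
    a = a' ∧ b = b' := by
  have e : ∀ x, (σ • I) • toM x = I • toM (σ • x) := fun x => by
    rw [map_smul, smul_assoc, smul_comm]
  rw [e, e] at h
  obtain ⟨h1, h2⟩ := toM_add_I_smul_inj h
  exact ⟨h1, smul_right_injective _ hσ h2⟩

namespace KWFlow

variable {D : DataSet Hsp} {T : ℝ≥0∞} (F : KWFlow D T) {R : ℝ} (h : Reparam T R)

/-- The family `g` as a function of `r = 1 - e^{-s}`. -/
def frame : Sm (Cyl R) M2 :=
  Sm.ofContDiffOn (fun q => F.g (-log (1 - q.1)) q.2) <| by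
    have h1 : ContDiffOn ℝ (⊤ : ℕ∞) (fun q : ℝ × P3 => (-log (1 - q.1), q.2)) (Cyl R) :=
      ((ContDiffOn.log (by fun_prop) fun q hq => by
        have := hq.1.2.trans_le h.le_one
        linarith).neg).prodMk contDiffOn_snd
    exact F.smooth_g.comp h1 fun q hq => ⟨h.mem_flowDom _ hq.1, hq.2⟩

theorem frame_apply {r : ℝ} (hr : r ∈ Ico 0 R) {p : P3} (hp : p ∈ Hsp) :
    (F.frame h).1 (r, p) = F.g (-log (1 - r)) p :=
  Sm.ofContDiffOn_apply _ (show (r, p) ∈ Cyl R from ⟨hr, hp⟩)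

theorem det_frame {q : ℝ × P3} (hq : q ∈ Cyl R) : ((F.frame h).1 q).det = 1 := by
  rw [← Prod.mk.eta (p := q), F.frame_apply h hq.1 hq.2]
  exact F.det_g _ (h.mem_flowDom _ hq.1) _ hq.2

/-- The inverse of `frame`. -/
def frameInv : Sm (Cyl R) M2 := Sm.map adjL (F.frame h)

theorem frame_mul_frameInv : ∀ q ∈ Cyl R, (F.frame h).1 q * (F.frameInv h).1 q = 1 :=
  fun _ hq => mul_adjL (F.det_frame h hq)

theorem frameInv_mul_frame : ∀ q ∈ Cyl R, (F.frameInv h).1 q * (F.frame h).1 q = 1 :=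
  fun _ hq => adjL_mul (F.det_frame h hq)

theorem frameInv_apply {r : ℝ} (hr : r ∈ Ico 0 R) {p : P3} (hp : p ∈ Hsp) :
    (F.frameInv h).1 (r, p) = (F.g (-log (1 - r)) p)⁻¹ := by
  rw [inv_eq_adjL (F.det_g _ (h.mem_flowDom _ hr) _ hp), ← F.frame_apply h hr hp]
  rfl

theorem pd_g {r : ℝ} (hr : r ∈ Ico 0 R) {p : P3} (hp : p ∈ Hsp) (e : P3) :
    pd e (F.g (-log (1 - r))) p = (Sm.d ((0 : ℝ), e) (F.frame h)).1 (r, p) := by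
  rw [pd_eq (x := Sm.slice r (F.frame h)) (fun q hq => (F.frame_apply h hr hq).symm) e hp,
    ← Sm.slice_d, Sm.slice_apply]

/-- The velocity `u` of the flow, relative to the parameter `r`. -/
def velocity : Sm (Cyl R) E3 :=
  Sm.map toE (Sm.map (cmulL (-I)) (Sm.bil mulL (Sm.dr (F.frame h)) (F.frameInv h)))

theorem u_eq {r : ℝ} (hr : r ∈ Ioo 0 R) {p : P3} (hp : p ∈ Hsp) :
    F.u (-log (1 - r)) p = (1 - r) • (Sm.map (cmulL (-I))
      (Sm.bil mulL (Sm.dr (F.frame h)) (F.frameInv h))).1 (r, p) := by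
  have hr' : r ∈ Ico 0 R := ⟨hr.1.le, hr.2⟩
  have h1r : 0 < 1 - r := by linarith [hr.2, h.le_one]
  have he : exp (-(-log (1 - r))) = 1 - r := by rw [neg_neg, Real.exp_log h1r]
  have h1 : HasDerivAt (fun r => (F.frame h).1 (r, p)) ((Sm.dr (F.frame h)).1 (r, p)) r :=
    (Sm.hasDerivWithinAt_dr _ hr' p).hasDerivAt (Ico_mem_nhds hr.1 hr.2)
  have h2 : HasDerivAt (fun s : ℝ => 1 - exp (-s)) (1 - r) (-log (1 - r)) :=
    (((hasDerivAt_neg _).exp).const_sub 1).congr_deriv (by rw [he]; ring)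
  have h3 : HasDerivAt (fun s => F.g s p) ((1 - r) • (Sm.dr (F.frame h)).1 (r, p))
      (-log (1 - r)) := by
    have h4 : 1 - exp (-(-log (1 - r))) = r := by rw [he]; ring
    have h5 := HasDerivAt.scomp (-log (1 - r)) (by rw [h4]; exact h1) h2
    refine h5.congr_of_eventuallyEq ?_
    have h6 : ∀ᶠ s in 𝓝 (-log (1 - r)), 1 - exp (-s) ∈ Ioo 0 R :=
      h2.continuousAt.eventually (by
        show ∀ᶠ y in 𝓝 (1 - exp (-(-log (1 - r)))), y ∈ Ioo 0 R
        rw [h4]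
        exact Ioo_mem_nhds hr.1 hr.2)
    filter_upwards [h6] with s hs
    have h7 : -log (1 - (1 - exp (-s))) = s := by
      rw [sub_sub_cancel, Real.log_exp, neg_neg]
    rw [Function.comp_apply, F.frame_apply h ⟨hs.1.le, hs.2⟩ hp, h7]
  have h8 : deriv (fun s' => F.g s' p) (-log (1 - r))
      = (1 - r) • (Sm.dr (F.frame h)).1 (r, p) := h3.deriv
  rw [F.u_def _ (h.mem_flowDom r hr') p hp, h8, ← F.frameInv_apply h hr' hp,
    smul_mul_assoc, smul_comm]
  rfl

theorem toM_velocity : Sm.map toM (F.velocity h) = Sm.map (cmulL (-I))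
    (Sm.bil mulL (Sm.dr (F.frame h)) (F.frameInv h)) :=
  Sm.ext_Ioo fun r hr p hp => by
    have h1 := F.su2_u _ (h.mem_flowDom r ⟨hr.1.le, hr.2⟩) p hp
    rw [F.u_eq h hr hp] at h1
    exact (h1.of_smul (by linarith [hr.2, h.le_one])).toM_toE

theorem u_eq_toM {r : ℝ} (hr : r ∈ Ioo 0 R) {p : P3} (hp : p ∈ Hsp) :
    F.u (-log (1 - r)) p = toM (((1 - r) • Sm.slice r (F.velocity h)).1 p) := by
  rw [F.u_eq h hr hp, ← toM_velocity]
  simp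

theorem dr_frame : Sm.dr (F.frame h) = Sm.bil frameB (F.velocity h) (F.frame h) :=
  Sm.ext_on fun q hq => by
    have h1 := congrArg (fun f : Sm (Cyl R) M2 => f.1 q) (F.toM_velocity h)
    simp only [Sm.map_apply, cmulL_apply, Sm.bil_apply, mulL_apply] at h1
    rw [Sm.bil_apply, frameB_apply, h1, smul_mul_assoc, smul_smul, mul_assoc,
      F.frameInv_mul_frame h q hq]
    simp

/-- Complex combinations of the coefficients of the base data set. -/
def baseZ (D : DataSet Hsp) (i j : Fin 6) (σ : ℝ) : Sm Hsp M2 :=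
  Sm.map toM (D.coef i) + Sm.map (cmulL (σ • I)) (Sm.map toM (D.coef j))

/-- The complex gauge transforms of the complex combinations of the coefficients. -/
def flowZ (i j : Fin 6) (σ : ℝ) : Sm (Cyl R) M2 :=
  gaugeZ (F.frame h) (F.frameInv h) (baseZ D i j σ) (dir i) (dir j) (σ • I)

theorem flowZ_apply (i j : Fin 6) (σ : ℝ) {r : ℝ} (hr : r ∈ Ico 0 R) {p : P3} (hp : p ∈ Hsp) :
    (F.flowZ h i j σ).1 (r, p) = F.g (-log (1 - r)) p
        * (toM ((D.coef i).1 p) + (σ • I) • toM ((D.coef j).1 p))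
        * (F.g (-log (1 - r)) p)⁻¹
      - (pd (dir i) (F.g (-log (1 - r))) p
        + (σ • I) • pd (dir j) (F.g (-log (1 - r))) p)
        * (F.g (-log (1 - r)) p)⁻¹ := by
  simp only [flowZ, gaugeZ, Sm.sub_apply, Sm.bil_apply, Sm.add_apply, Sm.map_apply, cmulL_apply,
    Sm.cst_apply _ hr, F.pd_g h hr hp, F.frame_apply h hr hp, F.frameInv_apply h hr hp, baseZ]
  rfl

/-- The pairs of indices that combine into one complex component of the connection. -/
def IsPair (i j : Fin 6) (σ : ℝ) : Prop :=
  i = 0 ∧ j = 5 ∧ σ = -1 ∨ i = 1 ∧ j = 2 ∧ σ = 1 ∨ i = 3 ∧ j = 4 ∧ σ = -1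

theorem IsPair.mul_self {i j : Fin 6} {σ : ℝ} (h : IsPair i j σ) : σ * σ = 1 := by
  rcases h with e | e | e <;> rw [e.2.2] <;> norm_num

theorem IsPair.all {Q : Fin 6 → Prop} (h : ∀ i j σ, IsPair i j σ → Q i ∧ Q j) (i : Fin 6) :
    Q i := by
  have h05 := h 0 5 (-1) (by simp [IsPair])
  have h12 := h 1 2 1 (by simp [IsPair])
  have h34 := h 3 4 (-1) (by simp [IsPair])
  fin_cases i
  exacts [h05.1, h12.1, h12.2, h34.1, h34.2, h05.2]

theorem flowZ_eq {r : ℝ} (hr : r ∈ Ico 0 R) {p : P3} (hp : p ∈ Hsp) {i j : Fin 6} {σ : ℝ}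
    (hij : IsPair i j σ) :
    (F.flowZ h i j σ).1 (r, p) = toM (((F.Ds (-log (1 - r))).coef i).1 p)
      + (σ • I) • toM (((F.Ds (-log (1 - r))).coef j).1 p) := by
  have hs := h.mem_flowDom r hr
  rw [F.flowZ_apply h i j σ hr hp]
  obtain ⟨s, hs'⟩ : ∃ s, s = -log (1 - r) := ⟨_, rfl⟩
  rw [← hs'] at hs ⊢
  have hg : F.g s p * (F.g s p)⁻¹ = 1 := by
    rw [inv_eq_adjL (F.det_g s hs p hp), mul_adjL (F.det_g s hs p hp)]
  have h0 : pd 0 (F.g s) p = 0 := by simp [pd]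
  obtain ⟨c0, c1, c2, c3, c4, c5⟩ := D.toM_coef hp
  obtain ⟨b0, b1, b2, b3, b4, b5⟩ := (F.Ds s).toM_coef hp
  have hJ : ((-1 : ℝ) • I) = -I := by simp
  rcases hij with ⟨rfl, rfl, rfl⟩ | ⟨rfl, rfl, rfl⟩ | ⟨rfl, rfl, rfl⟩
  · have h1 := F.eq_t s hs p hp
    rw [← c0, ← c5, ← b0, ← b5, hJ]
    simp only [cd, mcomm, dir, Matrix.cons_val, h0, smul_zero, add_zero, add_mul, mul_add,
      sub_mul, smul_mul_assoc, mul_smul_comm, mul_assoc, hg, mul_one] at h1 ⊢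
    linear_combination (norm := module) -h1
  · have h1 := F.eq_z s hs p hp
    rw [← c1, ← c2, ← b1, ← b2, one_smul]
    simp only [cd, mcomm, dir, Matrix.cons_val, add_mul, mul_add, smul_add, smul_sub,
      sub_mul, smul_mul_assoc, mul_smul_comm, mul_assoc, hg, mul_one] at h1 ⊢
    linear_combination (norm := module) -h1
  · have h1 := F.eq_phi s hs p hp
    have e : ∀ D : DataSet Hsp, D.a1 p + -I • D.a2 p = D.phi p := fun D => by
      rw [D.phi_eq, neg_smul, sub_eq_add_neg]
    rw [← c3, ← c4, ← b3, ← b4, hJ, e, e, h1]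
    simp [dir, h0]

include h in
theorem exists_coef : ∃ c : Fin 6 → Sm (Cyl R) E3, ∀ i, ∀ r ∈ Ico 0 R, ∀ p ∈ Hsp,
    (c i).1 (r, p) = ((F.Ds (-log (1 - r))).coef i).1 p := by
  rw [← Classical.skolem (p := fun i (c : Sm (Cyl R) E3) => ∀ r ∈ Ico 0 R, ∀ p ∈ Hsp,
    c.1 (r, p) = ((F.Ds (-log (1 - r))).coef i).1 p)]
  refine IsPair.all fun i j σ hij => ?_
  refine ⟨⟨Sm.map toE (F.flowZ h i j σ), fun r hr p hp => ?_⟩,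
    ⟨σ • Sm.map toE (Sm.map (cmulL (-I)) (F.flowZ h i j σ)), fun r hr p hp => ?_⟩⟩
  · rw [Sm.map_apply, F.flowZ_eq h hr hp hij, smul_assoc, map_add, map_smul, toE_toM,
      toE_I_smul_toM, smul_zero, add_zero]
  · rw [Sm.smul_apply, Sm.map_apply, Sm.map_apply, F.flowZ_eq h hr hp hij, cmulL_apply, smul_add,
      neg_smul, neg_smul, smul_assoc, smul_comm I σ, smul_smul I,
      Complex.I_mul_I, neg_one_smul, smul_neg, neg_neg, map_add, map_neg, toE_I_smul_toM,
      map_smul, toE_toM, neg_zero, zero_add, smul_smul, hij.mul_self, one_smul]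

include h in
theorem coef_zero {p : P3} (hp : p ∈ Hsp) (i : Fin 6) :
    ((F.Ds 0).coef i).1 p = (D.coef i).1 p := by
  refine IsPair.all (Q := fun i => ((F.Ds 0).coef i).1 p = (D.coef i).1 p)
    (fun i j σ hij => ?_) i
  have hσ : σ ≠ 0 := fun h => by simpa [h] using hij.mul_self
  have h0 : (0 : ℝ) ∈ Ico 0 R := ⟨le_rfl, h.pos⟩
  have h1 := F.flowZ_eq h h0 hp hij
  have hpd : ∀ e, pd e (F.g 0) p = 0 := fun e => by
    have h2 : F.g 0 =ᶠ[𝓝 p] fun _ => 1 := by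
      filter_upwards [isOpen_Hsp.mem_nhds hp] with q hq using F.g_zero q hq
    rw [pd, h2.fderiv_eq]
    simp
  rw [F.flowZ_apply h i j σ h0 hp, sub_zero, Real.log_one, neg_zero, F.g_zero p hp, hpd, hpd]
    at h1
  refine toM_add_smul_I_inj hσ ?_
  rw [← h1]
  simp

end KWFlow

end FlowTranslation

section FlowSystemOfFlow

theorem Sm.dr_eq_of_eq_neg_smul_dr {R : ℝ} (hR1 : R ≤ 1) {Y : Sm (Cyl R) E3}
    (h : ∀ r ∈ Ioo 0 R, ∀ p ∈ Hsp, Y.1 (r, p) = -((1 - r) • (Sm.dr Y).1 (r, p))) :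
    Sm.dr Y = -Sm.cst R (Sm.slice 0 Y) ∧ ∀ r p, ‖Y.1 (r, p)‖ ≤ ‖(Sm.slice 0 Y).1 p‖ := by
  obtain ⟨w, hw⟩ : ∃ w : Sm (Cyl R) ℝ, ∀ q ∈ Cyl R, w.1 q = 1 - q.1 :=
    ⟨Sm.ofContDiffOn (fun q => 1 - q.1) (by fun_prop), fun q hq => Sm.ofContDiffOn_apply _ hq⟩
  have h1 : Y = -Sm.bil (ContinuousLinearMap.lsmul ℝ ℝ) w (Sm.dr Y) :=
    Sm.ext_Ioo fun r hr p hp => by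
      rw [h r hr p hp, Sm.neg_apply, Sm.bil_apply, hw _ ⟨⟨hr.1.le, hr.2⟩, hp⟩]
      rfl
  have h2 : ∀ r ∈ Ico 0 R, ∀ p ∈ Hsp, Y.1 (r, p) = -((1 - r) • (Sm.dr Y).1 (r, p)) :=
    fun r hr p hp => by
      conv_lhs => rw [h1]
      rw [Sm.neg_apply, Sm.bil_apply, hw _ ⟨hr, hp⟩]
      rfl
  have h3 : ∀ r ∈ Ico 0 R, ∀ p ∈ Hsp, Y.1 (r, p) = (1 - r) • Y.1 (0, p) := fun r hr p hp => by
    have hne : ∀ x ∈ Icc 0 r, 1 - x ≠ 0 := fun x hx => by linarith [hx.2, hr.2]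
    have h4 := constant_of_has_deriv_right_zero (f := fun x => (1 - x)⁻¹ • Y.1 (x, p))
      (a := 0) (b := r) ?_ ?_ r ⟨hr.1, le_rfl⟩
    · simp only [sub_zero, inv_one, one_smul] at h4
      rw [← h4, smul_inv_smul₀ (hne r ⟨hr.1, le_rfl⟩)]
    · refine ContinuousOn.smul (ContinuousOn.inv₀ (by fun_prop) hne) ?_
      exact (Sm.continuousOn_param Y p).mono fun x hx => ⟨hx.1, hx.2.trans_lt hr.2⟩
    · intro x hx
      have hx' : x ∈ Ico 0 R := ⟨hx.1, hx.2.trans hr.2⟩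
      have hx1 := hne x ⟨hx.1, hx.2.le⟩
      have h5 : HasDerivAt (fun x : ℝ => (1 - x)⁻¹) (((1 - x) ^ 2)⁻¹) x :=
        (((hasDerivAt_id x).const_sub 1).inv hx1).congr_deriv (by simp)
      refine (h5.hasDerivWithinAt.smul (Sm.hasDerivWithinAt_dr_Ici Y hx' p)).congr_deriv ?_
      rw [h2 x hx' p hp, smul_neg, smul_smul, sq, mul_inv, mul_assoc, inv_mul_cancel₀ hx1, mul_one,
        add_neg_cancel]
  refine ⟨Sm.ext_on fun q hq => ?_, fun r p => ?_⟩
  · obtain ⟨r, p⟩ := q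
    rw [Sm.neg_apply, Sm.cst_apply _ hq.1, Sm.slice_apply]
    have h4 := h2 r hq.1 p hq.2
    have hne : 1 - r ≠ 0 := by linarith [hq.1.2]
    rw [h3 r hq.1 p hq.2, ← smul_neg] at h4
    rw [smul_right_injective _ hne h4, neg_neg]
  · by_cases hq : (r, p) ∈ Cyl R
    · rw [h3 r hq.1 p hq.2, norm_smul, Sm.slice_apply, norm_of_nonneg (by linarith [hq.1.2])]
      exact mul_le_of_le_one_left (norm_nonneg _) (by linarith [hq.1.1])
    · rw [Y.2.2 _ hq, norm_zero]
      exact norm_nonneg _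

variable {D : DataSet Hsp} {T : ℝ≥0∞} {R : ℝ}

/-- The moment map of the base data set in coordinates. -/
def DataSet.moment (D : DataSet Hsp) : Sm Hsp E3 :=
  curv dir D.coef 0 5 - curv dir D.coef 1 2 + curv dir D.coef 3 4

theorem KWFlow.evolves (F : KWFlow D T) (h : Reparam T R) {c : Fin 6 → Sm (Cyl R) E3}
    (hc : ∀ i, ∀ r ∈ Ico 0 R, ∀ p ∈ Hsp,
      (c i).1 (r, p) = ((F.Ds (-log (1 - r))).coef i).1 p) :
    Evolves c (F.velocity h) := by
  have key : ∀ (i j : Fin 6) (σ : ℝ), KWFlow.IsPair i j σ →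
      Sm.dr (c i) = σ • covD cdir c j (F.velocity h) ∧
        Sm.dr (c j) = -σ • covD cdir c i (F.velocity h) := fun i j σ hij => by
    refine dr_gauge_coef (F.frame_mul_frameInv h) (F.frameInv_mul_frame h) (F.dr_frame h)
      hij.mul_self (α := KWFlow.baseZ D i j σ) (e := dir i) (e' := dir j) fun q hq => ?_
    obtain ⟨r, p⟩ := q
    rw [hc i r hq.1 p hq.2, hc j r hq.1 p hq.2]
    exact F.flowZ_eq h hq.1 hq.2 hij
  have e : ∀ f : Sm (Cyl R) E3, (-1 : ℝ) • f = -f := fun f => by module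
  have e1 : ∀ f : Sm (Cyl R) E3, (1 : ℝ) • f = f := fun f => by module
  obtain ⟨h0, h5⟩ := key 0 5 (-1) (by simp [KWFlow.IsPair])
  obtain ⟨h1, h2⟩ := key 1 2 1 (by simp [KWFlow.IsPair])
  obtain ⟨h3, h4⟩ := key 3 4 (-1) (by simp [KWFlow.IsPair])
  rw [neg_neg] at h4 h5
  rw [e] at h0 h2 h3
  rw [e1] at h1 h4 h5
  exact ⟨h0, h1, h2, h3, h4, h5⟩

set_option maxHeartbeats 1000000 in
theorem KWFlow.exists_flowSystem (F : KWFlow D T) (h : Reparam T R) (hX : XnormSqInt D < ⊤) :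
    ∃ S : FlowSystem R, S.Frame (1 : M2) frameB frameAd (F.frame h) ∧
      (∀ i, S.base i = D.coef i) ∧ S.X = D.moment := by
  obtain ⟨c, hc⟩ := F.exists_coef h
  have hev := F.evolves h hc
  have h0R : (0 : ℝ) ∈ Ico 0 R := ⟨le_rfl, h.pos⟩
  have hsl : ∀ r ∈ Ico 0 R, ∀ i, Sm.slice r (c i) = (F.Ds (-log (1 - r))).coef i :=
    fun r hr i => Sm.ext_on fun p hp => by rw [Sm.slice_apply, hc i r hr p hp]
  have hbase : ∀ i, Sm.slice 0 (c i) = D.coef i := fun i => Sm.ext_on fun p hp => by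
    rw [hsl 0 h0R, sub_zero, Real.log_one, neg_zero, F.coef_zero h hp]
  have hslY : ∀ r, Sm.slice r (momentY c) = curv dir (fun i => Sm.slice r (c i)) 0 5
      - curv dir (fun i => Sm.slice r (c i)) 1 2 + curv dir (fun i => Sm.slice r (c i)) 3 4 :=
    fun r => by rw [momentY, map_add, map_sub, slice_curv, slice_curv, slice_curv]
  have hY0 : Sm.slice 0 (momentY c) = D.moment := by
    rw [hslY, funext hbase, DataSet.moment]
  have hYdr : ∀ r ∈ Ioo 0 R, ∀ p ∈ Hsp,
      (momentY c).1 (r, p) = -((1 - r) • (Sm.dr (momentY c)).1 (r, p)) := fun r hr p hp => by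
    have hr' : r ∈ Ico 0 R := ⟨hr.1.le, hr.2⟩
    have h1 := F.lap_eq _ (h.mem_flowDom r hr') p hp
    rw [DataSet.lap_eq_toM _ (fun q hq => F.u_eq_toM h hr hq) hp, DataSet.X_eq _ hp,
      ← funext (hsl r hr'), ← hslY, map_smul, ← slice_covL, ← hev.dr_momentY] at h1
    rw [← map_neg] at h1
    have h2 := congrArg toE h1
    rw [toE_toM, toE_toM] at h2
    exact h2.symm
  obtain ⟨hdr, hle⟩ := Sm.dr_eq_of_eq_neg_smul_dr h.le_one hYdr
  rw [hY0] at hdr hle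
  refine ⟨{ pos := h.pos, le_one := h.le_one, c := c, v := F.velocity h, X := D.moment
            Y := momentY c, J := coefJ, abs_J_le := abs_coefJ_le, dr_c := hev.dr_c
            covL_v := by rw [← hev.dr_momentY, hdr]
            dr_Y := hdr, norm_Y_le := hle, div_dr_c := hev.div_dr_c
            ends_v := fun r hr ε hε => ?_, energy := ?_ }, ⟨F.dr_frame h, fun p hp => ?_, fun a => ?_,
            frameAd_frameB⟩, hbase, rfl⟩
  · have h1r : 0 < 1 - r := by linarith [hr.2, h.le_one]
    have hu : ∀ p ∈ Hsp, mnorm (F.u (-log (1 - r)) p) < (1 - r) * ε →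
        ‖(F.velocity h).1 (r, p)‖ < ε := fun p hp hlt => by
      rw [F.u_eq_toM h hr hp, mnorm_toM, Sm.smul_apply, Sm.slice_apply, norm_smul,
        norm_of_nonneg h1r.le] at hlt
      exact lt_of_mul_lt_mul_left hlt h1r.le
    obtain ⟨ha, hb, hd⟩ := F.asymp_u _ (h.mem_flowDom r ⟨hr.1.le, hr.2⟩)
    obtain ⟨δ, hδ, ha⟩ := ha _ (mul_pos h1r hε)
    obtain ⟨K, hb⟩ := hb _ (mul_pos h1r hε)
    obtain ⟨η, hη, hd⟩ := hd _ (mul_pos h1r hε)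
    exact ⟨⟨δ, hδ, fun p hp hlt => hu p hp (ha p hp hlt)⟩,
      ⟨K, fun p hp hlt => hu p hp (hb p hp hlt)⟩, η, hη, fun p hp hlt => hu p hp (hd p hp hlt)⟩
  · refine lt_of_eq_of_lt ?_ hX
    refine setLIntegral_congr_fun isOpen_Hsp.measurableSet fun p hp => ?_
    simp only [D.X_eq hp, mnorm_toM, DataSet.moment]
  · rw [F.frame_apply h h0R hp, sub_zero, Real.log_one, neg_zero, F.g_zero p hp]
  · rw [frameAd_apply, mcomm, mul_one, one_mul, sub_self]

end FlowSystemOfFlow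

section ScaleOfData

namespace DataSet

variable (D : DataSet Hsp)

/-- The quantity `|B| + |E₁| + |E₂| + |∇_A a| + |a|²` controlling the scale `mu`. -/
def size (p : P3) : ℝ :=
  mnorm (B3Of D.A1 D.A2 p) + mnorm (EA1Of D.At D.A1 p) + mnorm (EA2Of D.At D.A2 p)
    + Real.sqrt (covaNormSq D p) + anormSq D p

theorem size_eq {p : P3} (hp : p ∈ Hsp) : D.size p = ‖(curv dir D.coef 1 2).1 p‖
    + ‖(curv dir D.coef 0 1).1 p‖ + ‖(curv dir D.coef 0 2).1 p‖
    + Real.sqrt (‖(curv dir D.coef 0 3).1 p‖ ^ 2 + ‖(curv dir D.coef 1 3).1 p‖ ^ 2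
      + ‖(curv dir D.coef 2 3).1 p‖ ^ 2
      + (‖(curv dir D.coef 0 4).1 p‖ ^ 2 + ‖(curv dir D.coef 1 4).1 p‖ ^ 2
      + ‖(curv dir D.coef 2 4).1 p‖ ^ 2)
      + (‖(curv dir D.coef 0 5).1 p‖ ^ 2 + ‖(curv dir D.coef 1 5).1 p‖ ^ 2
      + ‖(curv dir D.coef 2 5).1 p‖ ^ 2))
    + (‖(D.coef 3).1 p‖ ^ 2 + ‖(D.coef 4).1 p‖ ^ 2 + ‖(D.coef 5).1 p‖ ^ 2) := by
  have h := fun q (hq : q ∈ Hsp) => D.toM_coef hq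
  have h0 := fun q hq => (h q hq).1
  have h1 := fun q hq => (h q hq).2.1
  have h2 := fun q hq => (h q hq).2.2.1
  have h3 := fun q hq => (h q hq).2.2.2.1
  have h4 := fun q hq => (h q hq).2.2.2.2.1
  have h5 := fun q hq => (h q hq).2.2.2.2.2
  have hc : ∀ {A A' : P3 → M2} {i j : Fin 6}, (∀ q ∈ Hsp, A q = toM ((D.coef i).1 q)) →
      (∀ q ∈ Hsp, A' q = toM ((D.coef j).1 q)) →
      mnorm (pd (dir i) A' p - pd (dir j) A p + mcomm (A p) (A' p))
        = ‖(curv dir D.coef i j).1 p‖ := fun hi hj => by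
    rw [pd_eq_toM hi _ hp, pd_eq_toM hj _ hp, hi p hp, hj p hp, mcomm_toM, ← map_sub, ← map_add,
      mnorm_toM]
    rfl
  have hd : ∀ {A A' : P3 → M2} {i j : Fin 6}, dir j = 0 →
      (∀ q ∈ Hsp, A q = toM ((D.coef i).1 q)) → (∀ q ∈ Hsp, A' q = toM ((D.coef j).1 q)) →
      mnorm (cd A (dir i) A' p) = ‖(curv dir D.coef i j).1 p‖ := fun hj0 hi hj => by
    rw [← hc hi hj, hj0, pd_eq_toM hi 0 hp, Sm.d_zero_dir, Sm.zero_apply, map_zero, sub_zero, cd]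
  have e1 := hc h1 h2
  have e2 := hc h0 h1
  have e3 := hc h0 h2
  have d03 := hd rfl h0 h3
  have d13 := hd rfl h1 h3
  have d23 := hd rfl h2 h3
  have d04 := hd rfl h0 h4
  have d14 := hd rfl h1 h4
  have d24 := hd rfl h2 h4
  have d05 := hd rfl h0 h5
  have d15 := hd rfl h1 h5
  have d25 := hd rfl h2 h5
  rw [← e1, ← e2, ← e3, ← d03, ← d13, ← d23, ← d04, ← d14, ← d24, ← d05, ← d15, ← d25,
    ← mnorm_toM, ← mnorm_toM, ← mnorm_toM, ← h3 p hp, ← h4 p hp, ← h5 p hp]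
  rfl

theorem norm_curv_le {p : P3} (hp : p ∈ Hsp) (i j : Fin 6) :
    ‖(curv dir D.coef i j).1 p‖ ≤ D.size p := by
  have hskew : ∀ i j, curv dir D.coef i j = -curv dir D.coef j i := fun i j => by
    rw [curv, curv, lb_skew (D.coef i)]
    abel
  have hbr : ∀ i j, dir i = 0 → dir j = 0 →
      ‖(curv dir D.coef i j).1 p‖ ≤ ‖(D.coef i).1 p‖ ^ 2 + ‖(D.coef j).1 p‖ ^ 2 :=
    fun i j hi hj => by
      rw [curv, hi, hj, Sm.d_zero_dir, Sm.d_zero_dir, sub_zero, zero_add, lb_apply]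
      linarith [norm_br_le ((D.coef i).1 p) ((D.coef j).1 p),
        two_mul_le_add_sq ‖(D.coef i).1 p‖ ‖(D.coef j).1 p‖]
  have b34 := hbr 3 4 rfl rfl
  have b35 := hbr 3 5 rfl rfl
  have b45 := hbr 4 5 rfl rfl
  have hsz := D.size_eq hp
  obtain ⟨N, hN⟩ : ∃ N : Fin 6 → Fin 6 → ℝ, ∀ i j, ‖(curv dir D.coef i j).1 p‖ = N i j :=
    ⟨_, fun _ _ => rfl⟩
  have hn : ∀ i j, 0 ≤ N i j := fun i j => hN i j ▸ norm_nonneg _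
  simp only [hN] at hsz b34 b35 b45
  have hs : ∀ x, x ^ 2 ≤ _ → x ≤ _ := fun x => le_sqrt_of_sq_le (x := x)
    (y := N 0 3 ^ 2 + N 1 3 ^ 2 + N 2 3 ^ 2 + (N 0 4 ^ 2 + N 1 4 ^ 2 + N 2 4 ^ 2)
      + (N 0 5 ^ 2 + N 1 5 ^ 2 + N 2 5 ^ 2))
  have key : ∀ i j, i < j → N i j ≤ D.size p := fun i j hij => by
    have q := fun i j => sq_nonneg (N i j)
    have h0 := (hn 0 3).trans (hs (N 0 3)
      (by linarith [q 1 3, q 2 3, q 0 4, q 1 4, q 2 4, q 0 5, q 1 5, q 2 5]))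
    have h1 := sq_nonneg ‖(D.coef 3).1 p‖
    have h2 := sq_nonneg ‖(D.coef 4).1 p‖
    have h3 := sq_nonneg ‖(D.coef 5).1 p‖
    have h4 := hn 0 1
    have h5 := hn 0 2
    have h6 := hn 1 2
    have hS : ∀ x, x ^ 2 ≤ _ → x ≤ D.size p := fun x hx => by
      rw [hsz]
      linarith [hs x hx]
    fin_cases i <;> fin_cases j <;> first
      | exact absurd hij (by decide)
      | exact hS _ (by
          simp only [Fin.mk_one, Fin.zero_eta, Fin.reduceFinMk]
          linarith [q 0 3, q 1 3, q 2 3, q 0 4, q 1 4, q 2 4, q 0 5, q 1 5, q 2 5])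
      | (simp only [hsz, Fin.mk_one, Fin.zero_eta, Fin.reduceFinMk]; linarith)
  rcases lt_trichotomy i j with h | rfl | h
  · exact hN i j ▸ key i j h
  · have h : curv dir D.coef i i = 0 := by
      rw [curv, sub_self, zero_add]
      exact Sm.ext_on fun q _ => by
        rw [lb_apply, ← toE_toM (br _ _), ← mcomm_toM, mcomm, sub_self, map_zero, Sm.zero_apply]
    rw [h, Sm.zero_apply, norm_zero]
    exact (hn 0 1).trans (key 0 1 (by decide))
  · rw [hskew, Sm.neg_apply, norm_neg]
    exact hN j i ▸ key j i h

theorem norm_moment_le {p : P3} (hp : p ∈ Hsp) : ‖D.moment.1 p‖ ≤ 3 * D.size p := by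
  rw [moment, Sm.add_apply, Sm.sub_apply]
  linarith [norm_add_le ((curv dir D.coef 0 5).1 p - (curv dir D.coef 1 2).1 p)
    ((curv dir D.coef 3 4).1 p), norm_sub_le ((curv dir D.coef 0 5).1 p)
    ((curv dir D.coef 1 2).1 p), D.norm_curv_le hp 0 5, D.norm_curv_le hp 1 2,
    D.norm_curv_le hp 3 4]

theorem continuousOn_size : ContinuousOn D.size Hsp := by
  have hc : ∀ i j, ContinuousOn (fun p => ‖(curv dir D.coef i j).1 p‖) Hsp :=
    fun i j => (Sm.continuousOn _).norm
  have ha : ∀ i, ContinuousOn (fun p => ‖(D.coef i).1 p‖) Hsp := fun i => (Sm.continuousOn _).norm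
  refine ContinuousOn.congr ?_ fun p hp => D.size_eq hp
  exact ((((hc 1 2).add (hc 0 1)).add (hc 0 2)).add
    (((((hc 0 3).pow 2).add ((hc 1 3).pow 2)).add ((hc 2 3).pow 2)).add
      ((((hc 0 4).pow 2).add ((hc 1 4).pow 2)).add ((hc 2 4).pow 2)) |>.add
      ((((hc 0 5).pow 2).add ((hc 1 5).pow 2)).add ((hc 2 5).pow 2))).sqrt).add
    ((((ha 3).pow 2).add ((ha 4).pow 2)).add ((ha 5).pow 2))

end DataSet

theorem norm_sub_le_dist3 (p q : P3) : ‖p - q‖ ≤ dist3 p q :=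
  le_sqrt_of_sq_le (norm_sq_le_nsq (p - q))

theorem dist3_le (p q : P3) : dist3 p q ≤ 2 * ‖p - q‖ := by
  refine Real.sqrt_le_iff.2 ⟨by positivity, ?_⟩
  have h : (p.1 - q.1) ^ 2 + (p.2.1 - q.2.1) ^ 2 + (p.2.2 - q.2.2) ^ 2 ≤ 3 * ‖p - q‖ ^ 2 :=
    nsq_le (p - q)
  nlinarith [sq_nonneg ‖p - q‖]

theorem mem_Hsp_of_dist3_lt {p q : P3} (hq : q ∈ Hsp) (h : ‖p - q‖ ≤ q.1 / 4) : p ∈ Hsp := by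
  have h1 : |p.1 - q.1| ≤ ‖p - q‖ := norm_fst_le (p - q)
  have h2 : 0 < q.1 := hq
  show 0 < p.1
  linarith [neg_abs_le (p.1 - q.1)]

/-- The set of admissible scales whose supremum is `mu`. -/
def muSet (D : DataSet Hsp) (q : P3) : Set ℝ :=
  {μ : ℝ | 0 < μ ∧ μ ≤ min (1 / q.1) (1 / 100) ∧
    ∀ p, dist3 p q < q.1 / 4 → μ ^ 2 * q.1 ^ 2 * D.size p ≤ 1}

theorem muSet_nonempty (D : DataSet Hsp) {q : P3} (hq : q ∈ Hsp) : (muSet D q).Nonempty := by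
  have hq0 : 0 < q.1 := hq
  obtain ⟨C, hC⟩ := (isCompact_closedBall q (q.1 / 4)).bddAbove_image (f := D.size)
    (D.continuousOn_size.mono fun p hp => mem_Hsp_of_dist3_lt hq (by
      rw [← dist_eq_norm]; exact hp))
  have hC' : ∀ p, dist3 p q < q.1 / 4 → D.size p ≤ max C 0 := fun p hp =>
    (hC ⟨p, by rw [Metric.mem_closedBall, dist_eq_norm]; exact (norm_sub_le_dist3 p q).trans hp.le,
      rfl⟩).trans (le_max_left _ _)
  have hK0 : 0 < 1 + q.1 ^ 2 * max C 0 := by positivity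
  refine ⟨min (min (1 / q.1) (1 / 100)) (1 / (1 + q.1 ^ 2 * max C 0)), by positivity,
    min_le_left _ _, fun p hp => ?_⟩
  obtain ⟨m, hm⟩ : ∃ m, m = min (min (1 / q.1) (1 / 100)) (1 / (1 + q.1 ^ 2 * max C 0)) :=
    ⟨_, rfl⟩
  rw [← hm]
  have hm0 : 0 < m := by rw [hm]; positivity
  have hm1 : m ≤ 1 := by
    have : m ≤ 1 / 100 := hm ▸ (min_le_left _ _).trans (min_le_right _ _)
    linarith
  have hm2 : m * (1 + q.1 ^ 2 * max C 0) ≤ 1 := by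
    rw [← le_div_iff₀ hK0, hm]
    exact min_le_right _ _
  have h1 : m ^ 2 * q.1 ^ 2 * D.size p ≤ m ^ 2 * q.1 ^ 2 * max C 0 :=
    mul_le_mul_of_nonneg_left (hC' p hp) (by positivity)
  have h2 : 0 ≤ q.1 ^ 2 * max C 0 := by positivity
  nlinarith [mul_nonneg hm0.le h2, mul_le_mul_of_nonneg_right hm1 (mul_nonneg hm0.le h2)]

theorem mu_bounds (D : DataSet Hsp) {q : P3} (hq : q ∈ Hsp) : 0 < mu D q ∧ mu D q ≤ 1 / 100 ∧
    ∀ p, dist3 p q < q.1 / 4 → mu D q ^ 2 * q.1 ^ 2 * D.size p ≤ 4 := by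
  obtain ⟨m, hm⟩ := muSet_nonempty D hq
  have hb : BddAbove (muSet D q) := ⟨1 / 100, fun x hx => hx.2.1.trans (min_le_right _ _)⟩
  have hpos : 0 < mu D q := hm.1.trans_le (le_csSup hb hm)
  refine ⟨hpos, csSup_le ⟨m, hm⟩ fun x hx => hx.2.1.trans (min_le_right _ _), fun p hp => ?_⟩
  obtain ⟨x, hx, hlt⟩ := exists_lt_of_lt_csSup ⟨m, hm⟩ (show mu D q / 2 < sSup (muSet D q) from
    half_lt_self hpos)
  have hp' : p ∈ Hsp := mem_Hsp_of_dist3_lt hq ((norm_sub_le_dist3 p q).trans hp.le)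
  have h0 : 0 ≤ D.size p := (norm_nonneg _).trans (D.norm_curv_le hp' 0 1)
  have h1 := hx.2.2 p hp
  have h2 : mu D q ^ 2 ≤ 4 * x ^ 2 := by nlinarith [hx.1]
  nlinarith [mul_le_mul_of_nonneg_right h2 (mul_nonneg (sq_nonneg q.1) h0)]

theorem FlowSystem.scale_mu {R : ℝ} (S : FlowSystem R) (D : DataSet Hsp)
    (hb : ∀ i, S.base i = D.coef i) (hX : S.X = D.moment) :
    S.Scale (fun q => mu D q * q.1 / 16) 1 := by
  have key : ∀ q ∈ Hsp, ∀ x ∈ ball q (mu D q * q.1 / 16),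
      x ∈ Hsp ∧ 3 * D.size x ≤ 1 / (mu D q * q.1 / 16) ^ 2 := fun q hq x hx => by
    obtain ⟨h0, h1, h2⟩ := mu_bounds D hq
    have hq0 : 0 < q.1 := hq
    have h3 : ‖x - q‖ < mu D q * q.1 / 16 := by rwa [← dist_eq_norm]
    have h4 : mu D q * q.1 ≤ 1 / 100 * q.1 := mul_le_mul_of_nonneg_right h1 hq0.le
    refine ⟨mem_Hsp_of_dist3_lt hq (by linarith), ?_⟩
    have h5 := h2 x (by linarith [dist3_le x q])
    rw [le_div_iff₀ (by positivity)]
    linarith [show 3 * D.size x * (mu D q * q.1 / 16) ^ 2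
      = 3 / 256 * (mu D q ^ 2 * q.1 ^ 2 * D.size x) by ring]
  refine ⟨fun q hq => ?_, fun q hq => ?_, fun q hq x hx i j => ?_, fun q hq x hx => ?_⟩
  · exact div_pos (mul_pos (mu_bounds D hq).1 hq) (by norm_num)
  · have hq0 : 0 < q.1 := hq
    nlinarith [(mu_bounds D hq).2.1]
  · obtain ⟨h1, h2⟩ := key q hq x hx
    rw [funext hb]
    linarith [D.norm_curv_le h1 i j, (norm_nonneg _).trans (D.norm_curv_le h1 0 1)]
  · obtain ⟨h1, h2⟩ := key q hq x hx
    rw [hX]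
    exact (D.norm_moment_le h1).trans h2

end ScaleOfData

section Assembly

theorem exists_reparam {T : ℝ≥0∞} (hT : 0 < T) :
    ∃ R, Reparam T R ∧ (T = ⊤ → R = 1) ∧ (T ≠ ⊤ → R = 1 - exp (-T.toReal)) := by
  have hexp : ∀ s : ℝ, 0 ≤ s → 0 ≤ 1 - exp (-s) := fun s hs => by
    linarith [Real.exp_le_one_iff.2 (neg_nonpos.2 hs)]
  have hlog : ∀ r : ℝ, 0 ≤ r → r < 1 → 0 ≤ -log (1 - r) := fun r h0 h1 =>
    neg_nonneg.2 (Real.log_nonpos (by linarith) (by linarith))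
  by_cases h : T = ⊤
  · refine ⟨1, ⟨one_pos, le_rfl, fun r hr => ⟨hlog r hr.1 hr.2, ?_⟩, fun s hs =>
      ⟨hexp s hs.1, ?_⟩⟩, fun _ => rfl, fun h' => absurd h h'⟩
    · rw [h]
      exact ENNReal.ofReal_lt_top
    · linarith [exp_pos (-s)]
  · have hT' : 0 < T.toReal := ENNReal.toReal_pos hT.ne' h
    refine ⟨1 - exp (-T.toReal), ⟨?_, ?_, fun r hr => ?_, fun s hs => ⟨hexp s hs.1, ?_⟩⟩,
      fun h' => absurd h' h, fun _ => rfl⟩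
    · linarith [Real.exp_lt_one_iff.2 (neg_neg_iff_pos.2 hT')]
    · linarith [exp_pos (-T.toReal)]
    · have h1 : exp (-T.toReal) < 1 - r := by linarith [hr.2]
      have h2 : 0 < 1 - r := (exp_pos _).trans h1
      refine ⟨hlog r hr.1 (by linarith), ?_⟩
      rw [ENNReal.ofReal_lt_iff_lt_toReal (hlog r hr.1 (by linarith)) h]
      linarith [(Real.lt_log_iff_exp_lt h2).2 h1]
    · have h1 := (ENNReal.ofReal_lt_iff_lt_toReal hs.1 h).1 hs.2
      linarith [Real.exp_lt_exp.2 (neg_lt_neg h1)]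

variable {D : DataSet Hsp} {T : ℝ≥0∞} {R : ℝ}

theorem KWFlow.extendsToClosed (F : KWFlow D T) (h : Reparam T R) (h1 : T = ⊤ → R = 1)
    (h2 : T ≠ ⊤ → R = 1 - exp (-T.toReal))
    (hG : ContDiffOn ℝ (⊤ : ℕ∞) (extendFrom (Cyl R) (F.frame h).1) (Icc 0 R ×ˢ Hsp)) :
    ExtendsToClosed T F.g := by
  have hval : ∀ r ∈ Ico 0 R, ∀ p ∈ Hsp,
      extendFrom (Cyl R) (F.frame h).1 (r, p) = F.g (-log (1 - r)) p := fun r hr p hp =>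
    (Sm.extendFrom_eq (F.frame h) (show (r, p) ∈ Cyl R from ⟨hr, hp⟩)).trans
      (F.frame_apply h hr hp)
  refine ⟨fun hT => ⟨fun s p => extendFrom (Cyl R) (F.frame h).1 (1 - exp (-s), p), ?_, ?_⟩,
    fun hT => ⟨fun r p => extendFrom (Cyl R) (F.frame h).1 (r, p), ?_, ?_⟩⟩
  · refine hG.comp (f := fun q : ℝ × P3 => (1 - exp (-q.1), q.2)) (by fun_prop)
      fun q hq => ⟨⟨?_, ?_⟩, hq.2⟩
    · show 0 ≤ 1 - exp (-q.1)
      linarith [Real.exp_le_one_iff.2 (neg_nonpos.2 hq.1.1)]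
    · rw [h2 hT]
      show 1 - exp (-q.1) ≤ _
      linarith [Real.exp_le_exp.2 (neg_le_neg hq.1.2)]
  · intro s hs p hp
    have hs' : s ∈ flowDom T := ⟨hs.1, (ENNReal.ofReal_lt_iff_lt_toReal hs.1 hT).2 hs.2⟩
    show extendFrom (Cyl R) (F.frame h).1 (1 - exp (-s), p) = _
    rw [hval _ (h.mem_Ico s hs') p hp, sub_sub_cancel, Real.log_exp, neg_neg]
  · have := h1 hT
    subst this
    exact hG
  · have := h1 hT
    subst this
    exact hval

theorem KWFlow.sqrt_covGradSq_le (F : KWFlow D T) (h : Reparam T R) {S : FlowSystem R}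
    (hb : ∀ i, S.base i = D.coef i) {r : ℝ} (hr : r ∈ Ico 0 R) {p : P3} (hp : p ∈ Hsp) {b : ℝ}
    (hle : ∀ i, ‖(S.frameD frameAd (F.frame h) i).1 (r, p)‖ ≤ b) :
    Real.sqrt (covGradSqOf D.At D.A1 D.A2 (F.g (-log (1 - r))) p) ≤ 4 * b := by
  have hb0 : 0 ≤ b := (norm_nonneg _).trans (hle 0)
  have key : ∀ {A : P3 → M2} (i : Fin 6), A p = toM ((D.coef i).1 p) →
      mnorm (cd A (dir i) (F.g (-log (1 - r))) p) ^ 2 ≤ (2 * b) ^ 2 := fun {A} i hA => by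
    have h1 : cd A (dir i) (F.g (-log (1 - r))) p
        = (S.frameD frameAd (F.frame h) i).1 (r, p) := by
      rw [cd, F.pd_g h hr hp, hA, ← F.frame_apply h hr hp, FlowSystem.frameD, hb, Sm.add_apply,
        Sm.bil_apply, Sm.cst_apply _ hr, frameAd_apply]
      rfl
    rw [h1]
    refine pow_le_pow_left₀ (Real.sqrt_nonneg _) ((mnorm_le _).trans ?_) 2
    linarith [hle i]
  obtain ⟨c0, c1, c2, -⟩ := D.toM_coef hp
  refine Real.sqrt_le_iff.2 ⟨by positivity, ?_⟩
  have h0 := key 0 c0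
  have h1 := key 1 c1
  have h2 := key 2 c2
  have h3 : covGradSqOf D.At D.A1 D.A2 (F.g (-log (1 - r))) p
      ≤ (2 * b) ^ 2 + (2 * b) ^ 2 + (2 * b) ^ 2 := add_le_add (add_le_add h0 h1) h2
  nlinarith [sq_nonneg b]

theorem div_mu_lt (D : DataSet Hsp) {p : P3} (hp : p ∈ Hsp) {κ a b : ℝ} (hκ : 1 < κ) (ha : 0 ≤ a)
    (hab : 64 * a < b) : 4 * (a / (mu D p * p.1 / 16)) < b / (mu D p ^ κ * p.1) := by
  obtain ⟨h0, h1, -⟩ := mu_bounds D hp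
  have hp0 : 0 < p.1 := hp
  have h2 : mu D p ^ κ ≤ mu D p := by
    simpa using Real.rpow_le_rpow_of_exponent_ge h0 (by linarith) hκ.le
  have h3 : 0 < mu D p ^ κ := Real.rpow_pos_of_pos h0 κ
  calc 4 * (a / (mu D p * p.1 / 16)) = 64 * a / (mu D p * p.1) := by field_simp; ring
    _ < b / (mu D p * p.1) := by gcongr
    _ ≤ b / (mu D p ^ κ * p.1) := by gcongr; linarith

end Assembly

/-- Proposition 5.1 of the paper: the flow family `{g|_s}` extends smoothly to the
closed interval `[0,T]`, with uniform bounds and asymptotics for `g|_s` and its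
covariant derivative. -/
theorem statement2 (D : DataSet Hsp) (hKW : KW123 Hsp D) (hX : XnormSqInt D < ⊤)
    (T : ℝ≥0∞) (hT : 0 < T) (F : KWFlow D T) :
    ExtendsToClosed T F.g ∧
    ∃ κ : ℝ, 1 < κ ∧
      (∀ s ∈ flowDom T, ∀ p ∈ Hsp,
        mnorm (F.g s p) < κ ∧
        Real.sqrt (covGradSqOf D.At D.A1 D.A2 (F.g s) p) < κ / (mu D p ^ κ * p.1)) ∧
      ∀ ε > (0:ℝ), ∃ κe : ℝ, 1 < κe ∧ ∀ s ∈ flowDom T, ∀ p ∈ Hsp,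
        (p.1 < 1/κe ∨ κe < p.1 ∨ κe * p.1 < znorm p) →
        mnorm (F.g s p - 1) < ε ∧
        Real.sqrt (covGradSqOf D.At D.A1 D.A2 (F.g s) p) < ε / (mu D p ^ κ * p.1) := by
  obtain ⟨R, h, h1, h2⟩ := exists_reparam hT
  obtain ⟨S, hS, hb, hSX⟩ := F.exists_flowSystem h hX
  refine ⟨F.extendsToClosed h h1 h2 (S.contDiffOn_extendFrom frameB hS.dr_f), ?_⟩
  obtain ⟨C, hC0, hC, hε⟩ := hS.exists_bound (S.scale_mu D hb hSX)
  have hs : ∀ s : ℝ, -log (1 - (1 - exp (-s))) = s := fun s => by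
    rw [sub_sub_cancel, Real.log_exp, neg_neg]
  have hκ : 1 < 64 * C + 2 := by linarith
  refine ⟨64 * C + 2, hκ, fun s hsT p hp => ?_, fun ε hε0 => ?_⟩
  · have hr := h.mem_Ico s hsT
    obtain ⟨h3, h4⟩ := hC _ hr p hp
    have h5 := F.sqrt_covGradSq_le h hb hr hp h4
    rw [F.frame_apply h hr hp, hs] at h3
    rw [hs] at h5
    exact ⟨by linarith [mnorm_le (F.g s p)], h5.trans_lt (div_mu_lt D hp hκ hC0 (by linarith))⟩
  · obtain ⟨k, hk, hend⟩ := hε (ε / 128) (by positivity)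
    refine ⟨k, hk, fun s hsT p hp hpk => ?_⟩
    have hr := h.mem_Ico s hsT
    obtain ⟨h3, h4⟩ := hend p hp hpk _ hr
    have h5 := F.sqrt_covGradSq_le h hb hr hp h4
    rw [F.frame_apply h hr hp, hs] at h3
    rw [hs] at h5
    exact ⟨by linarith [mnorm_le (F.g s p - 1)],
      h5.trans_lt (div_mu_lt D hp hκ (by positivity) (by linarith))⟩

end
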